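/- Let k be a field, let n be a positive integer not divisible by the characteristic of k, and let D be a central division algebra of degree n over k. Let K = k(x₁,…,x_{n−1}) be the field of rational functions in n−1 variables over k. If Δ is a central division algebra of degree n over K that has the same maximal subfields as D ⊗_k K, then Δ is isomorphic as a K-algebra to D' ⊗_k K for some central division algebra D' of degree n over k whose Brauer class generates the same subgroup of the Brauer group Br(k) as the class of D; concretely, there exist integers r, s ≥ 1 such that D' is Brauer-equivalent to the r-fold tensor power D^{⊗r} and D is Brauer-equivalent to D'^{⊗s}. -/

import Mathlib

set_option maxHeartbeats 1000000
set_option synthInstance.maxHeartbeats 400000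

open scoped TensorProduct

/-- `D` is a central division algebra of degree `n` over `k`: a division ring which is a
`k`-algebra whose center is exactly `k` and whose dimension over `k` is `n ^ 2`. -/
def IsCentralDivisionAlgebraOfDegree (k : Type) [Field k] (n : ℕ) (D : Type)
    [DivisionRing D] [Algebra k D] : Prop :=
  Subalgebra.center k D = ⊥ ∧ Module.finrank k D = n ^ 2

/-- Two `k`-algebras have the same maximal subfields (relative to the degree `n`):
a field extension `P/k` of degree `n` embeds into one if and only if it embeds
into the other. -/
def HaveSameMaximalSubfields (k : Type) [Field k] (n : ℕ)
    (D₁ : Type) [Ring D₁] [Algebra k D₁] (D₂ : Type) [Ring D₂] [Algebra k D₂] : Prop :=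
  ∀ (P : Type) [Field P] [Algebra k P], Module.finrank k P = n →
    (Nonempty (P →ₐ[k] D₁) ↔ Nonempty (P →ₐ[k] D₂))

/-- Two central simple `k`-algebras are Brauer-equivalent if suitable matrix algebras over
them are isomorphic as `k`-algebras. -/
def BrauerEquivalent (k : Type) [Field k] (A : Type) [Ring A] [Algebra k A]
    (B : Type) [Ring B] [Algebra k B] : Prop :=
  ∃ a b : ℕ, 0 < a ∧ 0 < b ∧
    Nonempty (Matrix (Fin a) (Fin a) A ≃ₐ[k] Matrix (Fin b) (Fin b) B)

/-- The `r`-fold tensor power `D ⊗_k ⋯ ⊗_k D` of a `k`-algebra `D`. -/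
noncomputable abbrev tensorPow (k : Type) [Field k] (D : Type) [Ring D] [Algebra k D]
    (r : ℕ) : Type :=
  ⨂[k] (_ : Fin r), D

namespace GenusTranscendental

open Polynomial Module

/-- The base change of a central division algebra to a field extension is simple. -/
theorem isSimpleRing_tensorProduct {K : Type*} [Field K] {A : Type*} [Ring A] [Nontrivial A]
    [Algebra K A]
    (hunit : ∀ x : A, x ≠ 0 → IsUnit x) (hcenter : Subalgebra.center K A = ⊥)
    (L : Type*) [Field L] [Algebra K L] : IsSimpleRing (A ⊗[K] L) := by
  classical
  let B := Algebra.TensorProduct.basis A (Module.Free.chooseBasis K L)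
  have hleft : ∀ (a : A) (x : A ⊗[K] L) i, B.repr ((a ⊗ₜ 1) * x) i = a * B.repr x i := by
    intro a x i
    induction x using TensorProduct.induction_on with
    | zero => simp
    | tmul a' l => simp [B, Algebra.TensorProduct.basis_repr_tmul, mul_assoc]
    | add x y hx hy => rw [mul_add, map_add, map_add, Finsupp.add_apply, Finsupp.add_apply,
        hx, hy, mul_add]
  have hright : ∀ (a : A) (x : A ⊗[K] L) i, B.repr (x * (a ⊗ₜ 1)) i = B.repr x i * a := by
    intro a x i
    induction x using TensorProduct.induction_on with
    | zero => simp
    | tmul a' l =>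
      simp only [B, Algebra.TensorProduct.basis_repr_tmul, Algebra.TensorProduct.tmul_mul_tmul,
        mul_one, Finsupp.smul_apply, Finsupp.mapRange_apply, smul_eq_mul, mul_assoc]
      rw [Algebra.commutes]
    | add x y hx hy => rw [add_mul, map_add, map_add, Finsupp.add_apply, Finsupp.add_apply,
        hx, hy, add_mul]
  have key : ∀ (n : ℕ) (I : TwoSidedIdeal (A ⊗[K] L)) (x : A ⊗[K] L), x ∈ I → x ≠ 0 →
      (B.repr x).support.card = n → (1 : A ⊗[K] L) ∈ I := by
    intro n
    induction n using Nat.strong_induction_on with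
    | _ n ih =>
      intro I x hxI hx hn
      have hne : B.repr x ≠ 0 := by simpa using hx
      obtain ⟨i, hi⟩ := Finsupp.ne_iff.mp hne
      simp only [Finsupp.coe_zero, Pi.zero_apply] at hi
      obtain ⟨u, hu⟩ := hunit _ hi
      set y : A ⊗[K] L := ((↑u⁻¹ : A) ⊗ₜ 1) * x with hy
      have hyI : y ∈ I := I.mul_mem_left _ _ hxI
      have hyr : ∀ j, B.repr y j = ↑u⁻¹ * B.repr x j := fun j => hleft _ _ j
      have hyi : B.repr y i = 1 := by rw [hyr, ← hu]; simp
      have hsupp : ∀ j, B.repr x j = 0 → B.repr y j = 0 := fun j hj => by rw [hyr, hj, mul_zero]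
      by_cases hall : ∀ a : A, (a ⊗ₜ 1) * y = y * (a ⊗ₜ 1)
      · have hcen : ∀ j, ∃ c : K, algebraMap K A c = B.repr y j := by
          intro j
          have : B.repr y j ∈ Subalgebra.center K A := by
            rw [Subalgebra.mem_center_iff]
            intro a
            rw [← hleft, hall, hright]
          rw [hcenter] at this
          simpa [Algebra.mem_bot] using this
        choose c hc using hcen
        have hyl : ∃ l : L, y = 1 ⊗ₜ l := by
          refine ⟨∑ j ∈ (B.repr y).support, c j • Module.Free.chooseBasis K L j, ?_⟩
          conv_lhs => rw [← B.linearCombination_repr y, Finsupp.linearCombination_apply,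
            Finsupp.sum]
          rw [TensorProduct.tmul_sum]
          refine Finset.sum_congr rfl fun j _ => ?_
          rw [← hc, TensorProduct.tmul_smul, Algebra.TensorProduct.basis_apply,
            algebraMap_smul]
        obtain ⟨l, hl⟩ := hyl
        have hl0 : l ≠ 0 := by
          rintro rfl
          rw [hl, TensorProduct.tmul_zero, map_zero] at hyi
          simp at hyi
        have := I.mul_mem_left ((1 : A) ⊗ₜ[K] l⁻¹) _ hyI
        rw [hl] at this
        simpa [Algebra.TensorProduct.tmul_mul_tmul, inv_mul_cancel₀ hl0,
          Algebra.TensorProduct.one_def] using this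
      · push Not at hall
        obtain ⟨a, ha⟩ := hall
        refine ih _ ?_ I ((a ⊗ₜ 1) * y - y * (a ⊗ₜ 1))
          (I.sub_mem (I.mul_mem_left _ _ hyI) (I.mul_mem_right _ _ hyI))
          (sub_ne_zero.mpr ha) rfl
        rw [← hn]
        refine Finset.card_lt_card (Finset.ssubset_iff_of_subset ?_ |>.mpr ⟨i, ?_, ?_⟩)
        · intro j hj
          rw [Finsupp.mem_support_iff] at hj ⊢
          intro hj0
          apply hj
          rw [map_sub, Finsupp.sub_apply, hleft, hright, hsupp j hj0]
          simp
        · rwa [Finsupp.mem_support_iff]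
        · rw [Finsupp.notMem_support_iff, map_sub, Finsupp.sub_apply, hleft, hright, hyi]
          simp
  have : Nontrivial (A ⊗[K] L) := by
    have hB : Function.Injective B.repr := B.repr.injective
    refine ⟨⟨(1 : A) ⊗ₜ 1, 0, ?_⟩⟩
    intro h
    have hinj : Function.Injective (Algebra.TensorProduct.includeRight : L →ₐ[K] A ⊗[K] L) :=
      Algebra.TensorProduct.includeRight_injective (algebraMap K A).injective
    have h1 : (Algebra.TensorProduct.includeRight : L →ₐ[K] A ⊗[K] L) 1 =
      (Algebra.TensorProduct.includeRight : L →ₐ[K] A ⊗[K] L) 0 := by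
      rw [map_zero]; exact h
    exact one_ne_zero (hinj h1)
  rw [isSimpleRing_iff_isTwoSided_imp]
  refine ⟨inferInstance, fun I hI => ?_⟩
  by_cases hbot : I = ⊥
  · exact Or.inl hbot
  right
  obtain ⟨x, hxI, hx⟩ := Submodule.exists_mem_ne_zero_of_ne_bot hbot
  rw [Ideal.eq_top_iff_one]
  have := key _ I.toTwoSided x (by simpa using hxI) hx rfl
  simpa using this

/-- Wedderburn uniqueness, one direction. -/
theorem nonempty_algHom_of_matrix_algEquiv {K : Type*} [Field K] {E F : Type*}
    [Ring E] [Nontrivial E] [Ring F] [Nontrivial F] [Algebra K E] [Algebra K F]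
    (hE : ∀ x : E, x ≠ 0 → IsUnit x) (hF : ∀ x : F, x ≠ 0 → IsUnit x)
    {ι κ : Type*} [Fintype ι] [DecidableEq ι] [Fintype κ] [DecidableEq κ] [Nonempty ι]
    [Nonempty κ]
    (Ψ : Matrix ι ι E ≃ₐ[K] Matrix κ κ F) : Nonempty (E →ₐ[K] F) := by
  classical
  obtain ⟨i₀⟩ := ‹Nonempty ι›
  obtain ⟨j₀⟩ := ‹Nonempty κ›
  set e : Matrix κ κ F := Ψ (Matrix.single i₀ i₀ 1) with he
  have hee : e * e = e := by rw [he, ← map_mul]; simp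
  have he0 : e ≠ 0 := by
    rw [he, Ne, EmbeddingLike.map_eq_zero_iff]
    intro h
    have := congrFun (congrFun h i₀) i₀
    simp at this
  obtain ⟨p, q, hpq⟩ : ∃ p q, e p q ≠ 0 := by
    by_contra! h
    exact he0 (by ext; simp [h])
  obtain ⟨u, hu⟩ := hF _ hpq
  set x : Matrix κ κ F := Matrix.single j₀ p 1 * e with hx
  set y : Matrix κ κ F := e * Matrix.single q j₀ (↑u⁻¹ : F) with hy
  set f : Matrix κ κ F := Matrix.single j₀ j₀ 1 with hf
  have hxy : x * y = f := by
    rw [hx, hy, mul_assoc, ← mul_assoc e e, hee, ← mul_assoc]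
    rw [Matrix.single_mul_mul_single, ← hu]
    simp [hf]
  have hxe : x * e = x := by rw [hx, mul_assoc, hee]
  have hey : e * y = y := by rw [hy, ← mul_assoc, hee]
  have hfx : f * x = x := by rw [hx, hf, ← mul_assoc]; simp
  have hyf : y * f = y := by rw [hy, hf, mul_assoc]; simp
  have hyx : y * x = e := by
    obtain ⟨W, hW⟩ := Ψ.surjective (y * x)
    have hid : (y * x) * (y * x) = y * x := by
      rw [mul_assoc, ← mul_assoc x, hxy, hfx]
    have hWe : Matrix.single i₀ i₀ 1 * W * Matrix.single i₀ i₀ 1 = W := by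
      apply Ψ.injective
      rw [map_mul, map_mul, hW, ← he, ← mul_assoc, hey, mul_assoc, hxe]
    have hWW : W * W = W := by
      apply Ψ.injective; rw [map_mul, hW, hid]
    rw [Matrix.single_mul_mul_single, one_mul, mul_one] at hWe
    have hw : W i₀ i₀ * W i₀ i₀ = W i₀ i₀ := by
      have := congrFun (congrFun hWW i₀) i₀
      rw [← hWe] at this
      simpa using this
    have hw0 : W i₀ i₀ ≠ 0 := by
      intro h0
      rw [h0, Matrix.single_zero] at hWe
      rw [← hWe, map_zero] at hW
      have : f = 0 := by
        have h2 : f * f = x * (y * x) * y := by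
          rw [← hxy]; simp only [mul_assoc]
        rw [← hW] at h2
        simpa [hf] using h2
      have := congrFun (congrFun this j₀) j₀
      simp [hf] at this
    have hw1 : W i₀ i₀ = 1 := (hE _ hw0).mul_left_cancel (by rw [hw, mul_one])
    rw [← hW, ← hWe, hw1]
  have hcorner : ∀ M, f * M * f = Matrix.single j₀ j₀ (M j₀ j₀) := by
    intro M; rw [hf, Matrix.single_mul_mul_single]; simp
  let Φ : E →ₐ[K] F :=
    AlgHom.ofLinearMap
      (Matrix.entryLinearMap K F j₀ j₀ ∘ₗ LinearMap.mulLeft K x ∘ₗ LinearMap.mulRight K y ∘ₗ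
        Ψ.toLinearMap ∘ₗ Matrix.singleLinearMap K i₀ i₀)
      (by
        change (x * (Ψ (Matrix.single i₀ i₀ 1) * y)) j₀ j₀ = 1
        rw [← he, hey, hxy]; simp [hf])
      (by
        intro a b
        change (x * (Ψ (Matrix.single i₀ i₀ (a * b)) * y)) j₀ j₀ =
          (x * (Ψ (Matrix.single i₀ i₀ a) * y)) j₀ j₀ * (x * (Ψ (Matrix.single i₀ i₀ b) * y)) j₀ j₀
        have h1 : ∀ a, f * (x * (Ψ (Matrix.single i₀ i₀ a) * y)) * f =
            x * (Ψ (Matrix.single i₀ i₀ a) * y) := by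
          intro a
          rw [← mul_assoc f, hfx, mul_assoc x, mul_assoc (Ψ _) y, hyf]
        have h2 : x * (Ψ (Matrix.single i₀ i₀ (a * b)) * y) =
            (x * (Ψ (Matrix.single i₀ i₀ a) * y)) * (x * (Ψ (Matrix.single i₀ i₀ b) * y)) := by
          have : (Matrix.single i₀ i₀ (a * b) : Matrix ι ι E) =
            Matrix.single i₀ i₀ a * Matrix.single i₀ i₀ 1 * Matrix.single i₀ i₀ b := by simp
          rw [this, map_mul, map_mul, ← he, ← hyx]
          simp only [mul_assoc]
        rw [h2, ← h1 a, ← h1 b, hcorner, hcorner]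
        simp)
  exact ⟨Φ⟩

theorem ringHom_injective_of_forall_isUnit {E F : Type*} [Ring E] [Ring F] [Nontrivial F]
    (hE : ∀ x : E, x ≠ 0 → IsUnit x) (φ : E →+* F) : Function.Injective φ := by
  rw [injective_iff_map_eq_zero]
  intro x hx
  by_contra h
  have := (hE x h).map φ
  rw [hx] at this
  exact not_isUnit_zero this

theorem nonempty_algEquiv_of_matrix_algEquiv {K : Type*} [Field K] {E F : Type*}
    [Ring E] [Nontrivial E] [Ring F] [Nontrivial F] [Algebra K E] [Algebra K F]
    [Module.Finite K E] [Module.Finite K F]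
    (hE : ∀ x : E, x ≠ 0 → IsUnit x) (hF : ∀ x : F, x ≠ 0 → IsUnit x)
    {ι κ : Type*} [Fintype ι] [DecidableEq ι] [Fintype κ] [DecidableEq κ] [Nonempty ι]
    [Nonempty κ]
    (Ψ : Matrix ι ι E ≃ₐ[K] Matrix κ κ F) : Nonempty (E ≃ₐ[K] F) := by
  obtain ⟨φ⟩ := nonempty_algHom_of_matrix_algEquiv hE hF Ψ
  obtain ⟨ψ⟩ := nonempty_algHom_of_matrix_algEquiv hF hE Ψ.symm
  have h1 := ringHom_injective_of_forall_isUnit hE φ.toRingHom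
  have h2 := ringHom_injective_of_forall_isUnit hF ψ.toRingHom
  have hdim : Module.finrank K E = Module.finrank K F :=
    le_antisymm (LinearMap.finrank_le_finrank_of_injective (f := φ.toLinearMap) h1)
      (LinearMap.finrank_le_finrank_of_injective (f := ψ.toLinearMap) h2)
  exact ⟨AlgEquiv.ofBijective φ ⟨h1, (LinearMap.injective_iff_surjective_of_finrank_eq_finrank
    (f := φ.toLinearMap) hdim).mp h1⟩⟩

section Split

variable {K L A ι : Type*} [Field K] [Field L] [Algebra K L] [Ring A] [Algebra K A]
  [Fintype ι] [DecidableEq ι]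

/-- A representation of a `K`-algebra by matrices over `L` which becomes an isomorphism after
extending scalars to `L`. -/
structure IsSplit (ρ : A →ₐ[K] Matrix ι ι L) : Prop where
  span : Submodule.span L (Set.range ρ) = ⊤
  finrank_eq : finrank K A = Fintype.card ι ^ 2

namespace IsSplit

variable {ρ : A →ₐ[K] Matrix ι ι L}

theorem finite [Nonempty ι] (h : IsSplit ρ) : Module.Finite K A :=
  Module.finite_of_finrank_pos (by rw [h.finrank_eq]; have := Fintype.card_pos (α := ι); positivity)

theorem exists_basis [Nonempty ι] (h : IsSplit ρ) {κ : Type*} [Fintype κ] (b : Basis κ K A) :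
    ∃ B : Basis κ L (Matrix ι ι L), ∀ i, B i = ρ (b i) := by
  have hspan : ⊤ ≤ Submodule.span L (Set.range fun i => ρ (b i)) := by
    rw [← h.span, Submodule.span_le]
    rintro _ ⟨a, rfl⟩
    rw [← b.sum_repr a, map_sum]
    refine Submodule.sum_mem _ fun i _ => ?_
    rw [map_smul, ← algebraMap_smul L]
    exact Submodule.smul_mem _ _ (Submodule.subset_span ⟨i, rfl⟩)
  refine ⟨basisOfTopLeSpanOfCardEqFinrank _ hspan ?_,
    fun i => congrFun (coe_basisOfTopLeSpanOfCardEqFinrank _ _ _) i⟩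
  rw [← Module.finrank_eq_card_basis b, h.finrank_eq, Module.finrank_matrix, Module.finrank_self,
    sq, mul_one]

theorem linearIndependent [Nonempty ι] (h : IsSplit ρ) {κ : Type*} {v : κ → A}
    (hv : LinearIndependent K v) : LinearIndependent L (fun i => ρ (v i)) := by
  have := h.finite
  have hv' := hv.linearIndepOn_id
  let b := Basis.extend hv'
  have hfin : Finite ↑(hv'.extend (Set.subset_univ (Set.range v))) :=
    Module.Finite.finite_basis b
  have := Fintype.ofFinite ↑(hv'.extend (Set.subset_univ (Set.range v)))
  obtain ⟨B, hB⟩ := h.exists_basis b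
  have hli := B.linearIndependent
  have hinj := hv.injective
  let f : κ → ↑(hv'.extend (Set.subset_univ (Set.range v))) := fun i =>
    ⟨v i, hv'.subset_extend _ ⟨i, rfl⟩⟩
  have hf : Function.Injective f := fun i j hij => hinj (congrArg Subtype.val hij)
  have := hli.comp f hf
  convert this using 1
  ext1 i
  rw [Function.comp_apply, hB]
  exact congrArg ρ (Basis.extend_apply_self hv' (f i)).symm

theorem injective [Nonempty ι] (h : IsSplit ρ) : Function.Injective ρ := by
  have := h.finite
  obtain ⟨B, hB⟩ := h.exists_basis (Module.finBasis K A)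
  rw [injective_iff_map_eq_zero]
  intro a ha
  have ha' : ∑ i, algebraMap K L ((Module.finBasis K A).repr a i) • B i = 0 := by
    rw [← ha]
    conv_rhs => rw [← (Module.finBasis K A).sum_repr a, map_sum]
    exact Finset.sum_congr rfl fun i _ => by rw [map_smul, hB, algebraMap_smul]
  have := Fintype.linearIndependent_iff.mp B.linearIndependent _ ha'
  rw [← (Module.finBasis K A).repr.map_eq_zero_iff]
  ext i
  exact (map_eq_zero (algebraMap K L)).mp (this i)

theorem ext_of_comm [Nonempty ι] (h : IsSplit ρ) {M : Matrix ι ι L}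
    (hM : ∀ a, M * ρ a = ρ a * M) : ∃ l : L, M = l • 1 := by
  have hall : ∀ N, M * N = N * M := by
    intro N
    have : N ∈ Submodule.span L (Set.range ρ) := by rw [h.span]; trivial
    induction this using Submodule.span_induction with
    | mem x hx => obtain ⟨a, rfl⟩ := hx; exact hM a
    | zero => simp
    | add x y _ _ hx hy => rw [mul_add, add_mul, hx, hy]
    | smul l x _ hx => simp [hx]
  have hc : M ∈ Subalgebra.center L (Matrix ι ι L) :=
    Subalgebra.mem_center_iff.mpr fun N => (hall N).symm
  rw [Algebra.IsCentral.center_eq_bot, Algebra.mem_bot] at hc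
  obtain ⟨l, hl⟩ := hc
  exact ⟨l, by rw [← hl, Algebra.algebraMap_eq_smul_one]⟩

theorem isSimpleRing [Nonempty ι] (h : IsSplit ρ) : IsSimpleRing A := by
  have := h.finite
  have hinj := h.injective
  have hnt : Nontrivial A := by
    refine ⟨⟨1, 0, fun h10 => ?_⟩⟩
    have := congrArg ρ h10
    rw [map_one, map_zero] at this
    exact one_ne_zero this
  rw [isSimpleRing_iff_isTwoSided_imp]
  refine ⟨hnt, fun I hI => ?_⟩
  let J : Submodule L (Matrix ι ι L) := Submodule.span L (ρ '' I)
  have hmul : ∀ N x, x ∈ J → N * x ∈ J ∧ x * N ∈ J := by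
    intro N x hx
    have hN : N ∈ Submodule.span L (Set.range ρ) := by rw [h.span]; trivial
    induction hx using Submodule.span_induction with
    | zero => simp
    | add x y _ _ hx hy => exact ⟨by rw [mul_add]; exact J.add_mem hx.1 hy.1,
        by rw [add_mul]; exact J.add_mem hx.2 hy.2⟩
    | smul l x _ hx => exact ⟨by rw [mul_smul_comm]; exact J.smul_mem _ hx.1,
        by rw [smul_mul_assoc]; exact J.smul_mem _ hx.2⟩
    | mem x hx =>
      obtain ⟨i, hi, rfl⟩ := hx
      induction hN using Submodule.span_induction with
      | zero => simp
      | add x y _ _ hx hy => exact ⟨by rw [add_mul]; exact J.add_mem hx.1 hy.1,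
          by rw [mul_add]; exact J.add_mem hx.2 hy.2⟩
      | smul l x _ hx => exact ⟨by rw [smul_mul_assoc]; exact J.smul_mem _ hx.1,
          by rw [mul_smul_comm]; exact J.smul_mem _ hx.2⟩
      | mem x hx =>
        obtain ⟨a, rfl⟩ := hx
        exact ⟨by rw [← map_mul]; exact Submodule.subset_span ⟨_, I.mul_mem_left a hi, rfl⟩,
          by rw [← map_mul]; exact Submodule.subset_span ⟨_, I.mul_mem_right a hi, rfl⟩⟩
  let J' : Ideal (Matrix ι ι L) :=
    { carrier := J
      add_mem' := J.add_mem
      zero_mem' := J.zero_mem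
      smul_mem' := fun N x hx => (hmul N x hx).1 }
  have hJ' : J'.IsTwoSided := ⟨fun N hx => (hmul N _ hx).2⟩
  have hs : IsSimpleRing (Matrix ι ι L) := inferInstance
  rcases (isSimpleRing_iff_isTwoSided_imp.mp hs).2 J' hJ' with h0 | h1
  · left
    rw [eq_bot_iff]
    intro x hx
    have : ρ x ∈ J' := Submodule.subset_span ⟨x, hx, rfl⟩
    rw [h0] at this
    exact hinj (by simpa using this)
  · right
    have hJ : J = ⊤ := by
      rw [eq_top_iff]; intro x _
      have : x ∈ J' := by rw [h1]; trivial
      exact this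
    let I' : Submodule K A := I.restrictScalars K
    have hI' : I' = ⊤ := by
      apply Submodule.eq_top_of_finrank_eq
      refine le_antisymm (Submodule.finrank_le _) ?_
      let b := Module.finBasis K I'
      have hspan : ⊤ ≤ Submodule.span L (Set.range fun i => ρ (b i)) := by
        rw [← hJ, Submodule.span_le]
        rintro _ ⟨a, ha, rfl⟩
        have : ρ a = ∑ i, b.repr ⟨a, ha⟩ i • ρ (b i) := by
          simp_rw [← map_smul, ← map_sum]
          congr 1
          have h1 := congrArg I'.subtype (b.sum_repr ⟨a, ha⟩)
          rw [map_sum] at h1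
          exact h1.symm
        rw [this]
        refine Submodule.sum_mem _ fun i _ => ?_
        rw [← algebraMap_smul L]
        exact Submodule.smul_mem _ _ (Submodule.subset_span ⟨i, rfl⟩)
      have hle := finrank_range_le_card (R := L) (fun i => ρ (b i))
      rw [Set.finrank, top_le_iff.mp hspan, finrank_top, Module.finrank_matrix,
        Module.finrank_self, Fintype.card_fin, mul_one, ← sq, ← h.finrank_eq] at hle
      exact hle
    rw [eq_top_iff]
    intro x _
    have : x ∈ I' := by rw [hI']; trivial
    exact this

end IsSplit

/-- Skolem-Noether for full matrix algebras. -/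
theorem exists_conj_of_algEquiv_matrix (f : Matrix ι ι L ≃ₐ[L] Matrix ι ι L) :
    ∃ U : Matrix ι ι L, IsUnit U ∧ ∀ M, U * M = f M * U := by
  let e : Matrix ι ι L ≃ₐ[L] Module.End L (ι → L) := Matrix.toLinAlgEquiv'
  obtain ⟨T, hT⟩ := ((e.symm.trans f).trans e).eq_linearEquivConjAlgEquiv
  refine ⟨e.symm T.toLinearMap, ?_, fun M => ?_⟩
  · have : IsUnit (T.toLinearMap : Module.End L (ι → L)) := by
      refine IsUnit.of_mul_eq_one T.symm.toLinearMap ?_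
      exact LinearMap.ext fun x => T.apply_symm_apply x
    exact this.map e.symm
  · apply e.injective
    rw [map_mul, map_mul, AlgEquiv.apply_symm_apply]
    have h1 : e (f M) = T.conjAlgEquiv L (e M) := by
      rw [← hT]; simp
    rw [h1, LinearEquiv.conjAlgEquiv_apply]
    exact LinearMap.ext fun x => by simp

theorem IsSplit.exists_conj [Nonempty ι] {ρ ρ' : A →ₐ[K] Matrix ι ι L} (h : IsSplit ρ)
    (h' : IsSplit ρ') : ∃ U : Matrix ι ι L, IsUnit U ∧ ∀ a, U * ρ' a = ρ a * U := by
  have := h.finite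
  have key : ∀ ρ : A →ₐ[K] Matrix ι ι L, IsSplit ρ →
      ∃ f : L ⊗[K] A ≃ₐ[L] Matrix ι ι L, ∀ a, f (1 ⊗ₜ a) = ρ a := by
    intro ρ h
    let φ : L ⊗[K] A →ₐ[L] Matrix ι ι L := Algebra.TensorProduct.lift (Algebra.ofId L _) ρ
      (fun l a => Algebra.commutes l (ρ a))
    have hφ : ∀ a, φ (1 ⊗ₜ a) = ρ a := fun a =>
      (Algebra.TensorProduct.lift_tmul _ _ _ _ _).trans (by simp)
    have hsurj : Function.Surjective φ.toLinearMap := by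
      rw [← LinearMap.range_eq_top, eq_top_iff, ← h.span, Submodule.span_le]
      rintro _ ⟨a, rfl⟩
      exact ⟨1 ⊗ₜ a, hφ a⟩
    have hdim : finrank L (L ⊗[K] A) = finrank L (Matrix ι ι L) := by
      rw [Module.finrank_baseChange, h.finrank_eq, Module.finrank_matrix, Module.finrank_self, sq,
        mul_one]
    have hinj := (LinearMap.injective_iff_surjective_of_finrank_eq_finrank hdim).mpr hsurj
    exact ⟨AlgEquiv.ofBijective φ ⟨hinj, hsurj⟩, hφ⟩
  obtain ⟨f, hf⟩ := key ρ h
  obtain ⟨f', hf'⟩ := key ρ' h'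
  obtain ⟨U, hU, hc⟩ := exists_conj_of_algEquiv_matrix (f'.symm.trans f)
  refine ⟨U, hU, fun a => ?_⟩
  rw [hc, ← hf', ← hf]
  simp

end Split

section Form

variable {K L A G ι : Type*} [Field K] [Field L] [Algebra K L] [Ring A] [Algebra K A]
  [Group G] [Fintype ι] [DecidableEq ι]

theorem mapMatrix_smul' (s : L ≃ₐ[K] L) (l : L) (M : Matrix ι ι L) :
    s.mapMatrix (l • M) = s l • s.mapMatrix M := by
  ext; simp

theorem mapMatrix_det (s : L ≃ₐ[K] L) (M : Matrix ι ι L) :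
    (s.mapMatrix M).det = s M.det := (AlgEquiv.map_det s M).symm

/-- Galois descent datum for a split form. -/
structure IsForm (act : G →* (L ≃ₐ[K] L)) (ρ : A →ₐ[K] Matrix ι ι L)
    (U : G → Matrix ι ι L) (c : G → G → L) : Prop where
  split : IsSplit ρ
  isUnit : ∀ σ, IsUnit (U σ)
  comm : ∀ σ a, U σ * (act σ).mapMatrix (ρ a) = ρ a * U σ
  coc : ∀ σ τ, U σ * (act σ).mapMatrix (U τ) = c σ τ • U (σ * τ)

variable {act : G →* (L ≃ₐ[K] L)} {ρ : A →ₐ[K] Matrix ι ι L}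
    {U : G → Matrix ι ι L} {c : G → G → L}

theorem IsSplit.exists_isForm [Nonempty ι] (h : IsSplit ρ) (act : G →* (L ≃ₐ[K] L)) :
    ∃ U c, IsForm act ρ U c := by
  have key : ∀ σ : G, IsSplit (((act σ).mapMatrix (m := ι)).toAlgHom.comp ρ) := by
    intro σ
    refine ⟨?_, h.finrank_eq⟩
    rw [eq_top_iff]
    intro M _
    have hM : (act σ).mapMatrix.symm M ∈ Submodule.span L (Set.range ρ) := by
      rw [h.span]; trivial
    have : ∀ N ∈ Submodule.span L (Set.range ρ), (act σ).mapMatrix N ∈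
        Submodule.span L (Set.range (((act σ).mapMatrix (m := ι)).toAlgHom.comp ρ)) := by
      intro N hN
      induction hN using Submodule.span_induction with
      | zero => simp
      | add x y _ _ hx hy => rw [map_add]; exact Submodule.add_mem _ hx hy
      | smul l x _ hx => rw [mapMatrix_smul']; exact Submodule.smul_mem _ _ hx
      | mem x hx => obtain ⟨a, rfl⟩ := hx; exact Submodule.subset_span ⟨a, rfl⟩
    have h2 := this _ hM
    rwa [AlgEquiv.apply_symm_apply] at h2
  choose U hU hc using fun σ => h.exists_conj (key σ)
  have hc : ∀ σ a, U σ * (act σ).mapMatrix (ρ a) = ρ a * U σ := hc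
  have hcoc : ∀ σ τ, ∃ l : L, U σ * (act σ).mapMatrix (U τ) = l • U (σ * τ) := by
    intro σ τ
    obtain ⟨V, hV⟩ := (hU (σ * τ)).exists_right_inv
    have hV' : V * U (σ * τ) = 1 := mul_eq_one_comm.mp hV
    have hUa : ∀ a, (U σ * (act σ).mapMatrix (U τ)) * (act (σ * τ)).mapMatrix (ρ a) =
        ρ a * (U σ * (act σ).mapMatrix (U τ)) := by
      intro a
      have : (act (σ * τ)).mapMatrix (ρ a) = (act σ).mapMatrix ((act τ).mapMatrix (ρ a)) := by
        rw [map_mul]; ext; simp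
      rw [this, mul_assoc, ← map_mul, hc, map_mul, ← mul_assoc, hc, mul_assoc]
    obtain ⟨l, hl⟩ := h.ext_of_comm (M := U σ * (act σ).mapMatrix (U τ) * V) (by
      intro a
      have : V * ρ a = (act (σ * τ)).mapMatrix (ρ a) * V := by
        calc V * ρ a = V * (ρ a * U (σ * τ)) * V := by rw [mul_assoc, mul_assoc, hV, mul_one]
          _ = V * (U (σ * τ) * (act (σ * τ)).mapMatrix (ρ a)) * V := by rw [hc]
          _ = _ := by rw [← mul_assoc, hV', one_mul]
      rw [mul_assoc, this, ← mul_assoc, hUa, mul_assoc])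
    refine ⟨l, ?_⟩
    calc _ = U σ * (act σ).mapMatrix (U τ) * V * U (σ * τ) := by
          rw [mul_assoc _ V, hV', mul_one]
      _ = _ := by rw [hl]; simp
  choose c hc' using hcoc
  exact ⟨U, c, h, hU, hc, hc'⟩

namespace IsForm

theorem det_ne_zero (h : IsForm act ρ U c) (σ : G) : (U σ).det ≠ 0 :=
  ((Matrix.isUnit_iff_isUnit_det _).mp (h.isUnit σ)).ne_zero

theorem det_coc (h : IsForm act ρ U c) (σ τ : G) :
    (U σ).det * act σ (U τ).det = c σ τ ^ Fintype.card ι * (U (σ * τ)).det := by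
  rw [← mapMatrix_det, ← Matrix.det_mul, h.coc, Matrix.det_smul]

theorem coc_ne_zero [Nonempty ι] (h : IsForm act ρ U c) (σ τ : G) : c σ τ ≠ 0 := by
  intro h0
  have := h.det_coc σ τ
  rw [h0, zero_pow Fintype.card_ne_zero, zero_mul] at this
  rcases mul_eq_zero.mp this with h1 | h1
  · exact h.det_ne_zero σ h1
  · exact h.det_ne_zero τ (by simpa using h1)

theorem mem_range [Nonempty ι] (h : IsForm act ρ U c)
    (hfix : ∀ l : L, (∀ σ, act σ l = l) → ∃ x : K, algebraMap K L x = l)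
    {M : Matrix ι ι L} (hM : ∀ σ, U σ * (act σ).mapMatrix M = M * U σ) : ∃ a, ρ a = M := by
  have := h.split.finite
  obtain ⟨B, hB⟩ := h.split.exists_basis (Module.finBasis K A)
  have hfixed : ∀ σ i, act σ (B.repr M i) = B.repr M i := by
    intro σ
    have h1 : M * U σ = ∑ i, B.repr M i • (B i * U σ) := by
      conv_lhs => rw [← B.sum_repr M]
      rw [Finset.sum_mul]; simp
    have h2 : U σ * (act σ).mapMatrix M = ∑ i, act σ (B.repr M i) • (B i * U σ) := by
      conv_lhs => rw [← B.sum_repr M]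
      rw [map_sum, Finset.mul_sum]
      refine Finset.sum_congr rfl fun i _ => ?_
      rw [mapMatrix_smul', mul_smul_comm, hB, h.comm]
    have h3 := (h1.symm.trans (hM σ).symm).trans h2
    have hU := h.isUnit σ
    have h4 : ∑ i, B.repr M i • B i = ∑ i, act σ (B.repr M i) • B i := by
      apply hU.mul_right_cancel
      simpa only [Finset.sum_mul, smul_mul_assoc] using h3
    have h5 : ∑ i, (B.repr M i - act σ (B.repr M i)) • B i = 0 := by
      simp_rw [sub_smul, Finset.sum_sub_distrib, h4, sub_self]
    intro i
    exact (sub_eq_zero.mp (Fintype.linearIndependent_iff.mp B.linearIndependent _ h5 i)).symm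
  choose x hx using fun i => hfix _ (fun σ => hfixed σ i)
  refine ⟨∑ i, x i • Module.finBasis K A i, ?_⟩
  rw [map_sum]
  conv_rhs => rw [← B.sum_repr M]
  refine Finset.sum_congr rfl fun i _ => ?_
  rw [map_smul, ← hB, ← hx, algebraMap_smul]

theorem center_eq_bot [Nonempty ι] (h : IsForm act ρ U c)
    (hfix : ∀ l : L, (∀ σ, act σ l = l) → ∃ x : K, algebraMap K L x = l) :
    Subalgebra.center K A = ⊥ := by
  rw [eq_bot_iff]
  intro z hz
  rw [Subalgebra.mem_center_iff] at hz
  obtain ⟨l, hl⟩ := h.split.ext_of_comm (M := ρ z) (fun a => by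
    rw [← map_mul, ← map_mul, hz])
  obtain ⟨x, hx⟩ := hfix l (by
    intro σ
    have h1 := h.comm σ z
    rw [hl, mapMatrix_smul', map_one, mul_smul_comm, mul_one, smul_mul_assoc, one_mul] at h1
    have h2 : (act σ l - l) • U σ = 0 := by rw [sub_smul, h1, sub_self]
    rcases smul_eq_zero.mp h2 with h3 | h3
    · exact sub_eq_zero.mp h3
    · have := h.det_ne_zero σ
      rw [h3, Matrix.det_zero] at this
      exact absurd rfl this)
  rw [Algebra.mem_bot]
  refine ⟨x, h.split.injective ?_⟩
  rw [AlgHom.commutes, hl, ← hx, Algebra.algebraMap_eq_smul_one, algebraMap_smul]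

/-- Rescaling the descent datum. -/
theorem rescale (h : IsForm act ρ U c) (r : G → L) (hr : ∀ σ, r σ ≠ 0) :
    IsForm act ρ (fun σ => r σ • U σ)
      (fun σ τ => r σ * act σ (r τ) * (r (σ * τ))⁻¹ * c σ τ) where
  split := h.split
  isUnit σ := by
    rw [Matrix.isUnit_iff_isUnit_det, Matrix.det_smul]
    exact (((hr σ).isUnit.pow _).mul (h.det_ne_zero σ).isUnit)
  comm σ a := by rw [smul_mul_assoc, h.comm, mul_smul_comm]
  coc σ τ := by
    rw [mapMatrix_smul', smul_mul_smul_comm, h.coc, smul_smul, smul_smul]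
    congr 1
    field_simp [hr (σ * τ)]

/-- The reduced characteristic polynomial has coefficients in the base field. -/
theorem exists_charpoly (h : IsForm act ρ U c)
    (hfix : ∀ l : L, (∀ σ, act σ l = l) → ∃ x : K, algebraMap K L x = l) (a : A) :
    ∃ f : K[X], f.map (algebraMap K L) = (ρ a).charpoly := by
  have hinv : ∀ σ, (ρ a).charpoly.map (act σ : L →+* L) = (ρ a).charpoly := by
    intro σ
    rw [← Matrix.charpoly_map]
    have h1 : (ρ a).map (act σ : L →+* L) = (act σ).mapMatrix (ρ a) := rfl
    obtain ⟨u, hu⟩ := h.isUnit σ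
    have h2 := h.comm σ a
    rw [← hu] at h2
    rw [h1, show (act σ).mapMatrix (ρ a) = u⁻¹.val * ρ a * u.val by
      rw [mul_assoc, ← h2, ← mul_assoc]; simp]
    have h3 := Matrix.charpoly_units_conj u⁻¹ (ρ a)
    simp
  have : (ρ a).charpoly ∈ Polynomial.lifts (algebraMap K L) := by
    rw [Polynomial.lifts_iff_coeff_lifts]
    intro i
    obtain ⟨x, hx⟩ := hfix ((ρ a).charpoly.coeff i) (fun σ => by
      conv_rhs => rw [← hinv σ]
      simp)
    exact ⟨x, hx⟩
  exact (Polynomial.mem_lifts _).mp this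

end IsForm

end Form

theorem exists_eval_det_ne_zero {F σ ι : Type*} [Field F] [Fintype ι] [DecidableEq ι]
    (S : Set F) (hS : S.Infinite) (N : Matrix ι ι (MvPolynomial σ F)) (pt : σ → F)
    (hpt : (N.map (MvPolynomial.eval pt)).det ≠ 0) :
    ∃ t : σ → F, (∀ i, t i ∈ S) ∧ (N.map (MvPolynomial.eval t)).det ≠ 0 := by
  by_contra! h
  apply hpt
  have h0 : N.det = 0 := by
    apply MvPolynomial.funext_set (fun _ => S) (fun _ => hS)
    intro x hx
    rw [map_zero, RingHom.map_det]
    exact h x (fun i => hx i (Set.mem_univ i))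
  have := RingHom.map_det (MvPolynomial.eval pt) N
  rw [h0, map_zero] at this
  exact this.symm

theorem exists_det_sum_galois_ne_zero {k P F ι : Type*} [Field k] [Infinite k] [Field P]
    [Algebra k P] [FiniteDimensional k P] [Field F] [Algebra P F] [Fintype ι]
    [DecidableEq ι] [Fintype (P ≃ₐ[k] P)]
    (z : (P ≃ₐ[k] P) → Matrix ι ι F) (hz : (z 1).det ≠ 0) :
    ∃ l : P, (∑ s, algebraMap P F (s l) • z s).det ≠ 0 := by
  classical
  let ω := Module.finBasis k P
  let W : Matrix (P ≃ₐ[k] P) (Fin (finrank k P)) P := fun s j => s (ω j)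
  have hW : LinearIndependent P W.row := by
    rw [Fintype.linearIndependent_iff]
    intro g hg
    have hli : LinearIndependent P fun s : P ≃ₐ[k] P => (s : P →ₐ[k] P).toLinearMap :=
      (linearIndependent_algHom_toLinearMap k P P).comp (fun s : P ≃ₐ[k] P => (s : P →ₐ[k] P))
        AlgEquiv.coe_toAlgHom_injective
    refine Fintype.linearIndependent_iff.mp hli g ?_
    apply ω.ext
    intro j
    have := congrFun hg j
    simpa [W, Matrix.row] using this
  have hrank := hW.rank_matrix
  have hsurj : Function.Surjective W.mulVecLin := by
    rw [← LinearMap.range_eq_top]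
    apply Submodule.eq_top_of_finrank_eq
    rw [← Matrix.rank, hrank, Module.finrank_fintype_fun_eq_card]
  obtain ⟨t0, ht0⟩ := hsurj (Pi.single 1 1)
  let N : Matrix ι ι (MvPolynomial (Fin (finrank k P)) F) :=
    ∑ s, (∑ j, MvPolynomial.C (algebraMap P F (s (ω j))) * MvPolynomial.X j) •
      (z s).map MvPolynomial.C
  have hN : ∀ t, N.map (MvPolynomial.eval t) =
      ∑ s, (∑ j, algebraMap P F (s (ω j)) * t j) • z s := by
    intro t
    ext a b
    simp [N, Matrix.sum_apply]
  obtain ⟨t, ht, hdet⟩ := exists_eval_det_ne_zero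
    (Set.range ((algebraMap P F).comp (algebraMap k P)))
    (Set.infinite_range_of_injective (RingHom.injective _)) N
    (fun j => algebraMap P F (t0 j)) (by
      rw [hN]
      have : ∑ s, (∑ j, algebraMap P F (s (ω j)) * algebraMap P F (t0 j)) • z s = z 1 := by
        rw [Finset.sum_eq_single 1]
        · have h1 : ∑ j, (1 : P ≃ₐ[k] P) (ω j) * t0 j = 1 :=
            (congrFun ht0 1).trans (Pi.single_eq_same _ _)
          have h2 := congrArg (algebraMap P F) h1
          rw [map_sum, map_one] at h2
          simp only [map_mul] at h2
          rw [h2, one_smul]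
        · intro s _ hs
          have h1 : ∑ j, s (ω j) * t0 j = 0 :=
            (congrFun ht0 s).trans (Pi.single_eq_of_ne hs _)
          have h2 := congrArg (algebraMap P F) h1
          rw [map_sum, map_zero] at h2
          simp only [map_mul] at h2
          rw [h2, zero_smul]
        · simp
      rwa [this])
  choose u hu using ht
  refine ⟨∑ j, u j • ω j, ?_⟩
  rw [hN] at hdet
  convert hdet using 5 with s
  rw [map_sum, map_sum]
  refine Finset.sum_congr rfl fun j _ => ?_
  rw [← hu, map_smul, Algebra.smul_def, map_mul, mul_comm]
  rfl

section Descent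

variable {k P K L ι : Type*} [Field k] [Field P] [Field K] [Field L] [Algebra k P]
  [Algebra K L] [Algebra P L] [Fintype ι] [DecidableEq ι]
  {act : (P ≃ₐ[k] P) →* (L ≃ₐ[K] L)}

/-- Two forms with the same cocycle are isomorphic. -/
theorem IsForm.nonempty_algEquiv [Infinite k] [FiniteDimensional k P] [Nonempty ι]
    (hact : ∀ s x, act s (algebraMap P L x) = algebraMap P L (s x))
    (hfix : ∀ l : L, (∀ s, act s l = l) → ∃ x : K, algebraMap K L x = l)
    {A A' : Type*} [Ring A] [Algebra K A] [Ring A'] [Algebra K A']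
    {ρ : A →ₐ[K] Matrix ι ι L} {ρ' : A' →ₐ[K] Matrix ι ι L}
    {U U' : (P ≃ₐ[k] P) → Matrix ι ι L} {c : (P ≃ₐ[k] P) → (P ≃ₐ[k] P) → L}
    (h : IsForm act ρ U c) (h' : IsForm act ρ' U' c) : Nonempty (A ≃ₐ[K] A') := by
  classical
  have := Fintype.ofFinite (P ≃ₐ[k] P)
  choose V hV using fun s => (h'.isUnit s).exists_right_inv
  have hV' : ∀ s, V s * U' s = 1 := fun s => mul_eq_one_comm.mp (hV s)
  obtain ⟨l, hl⟩ := exists_det_sum_galois_ne_zero (fun s => U s * V s) (by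
    rw [Matrix.det_mul]
    refine mul_ne_zero (h.det_ne_zero 1) fun h0 => ?_
    have := congrArg Matrix.det (hV 1)
    rw [Matrix.det_mul, h0, mul_zero, Matrix.det_one] at this
    exact zero_ne_one this)
  set S := ∑ s, algebraMap P L (s l) • (U s * V s) with hS
  have hSu : IsUnit S := (Matrix.isUnit_iff_isUnit_det S).mpr hl.isUnit
  have hUS : ∀ s, U s * (act s).mapMatrix S = S * U' s := by
    intro s
    rw [hS, map_sum, Finset.mul_sum, Finset.sum_mul]
    refine Fintype.sum_equiv (Equiv.mulLeft s) _ _ fun t => ?_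
    rw [mapMatrix_smul', mul_smul_comm, hact, map_mul, ← mul_assoc, h.coc]
    have h1 : c s t • (act s).mapMatrix (V t) = V (s * t) * U' s := by
      have h2 : (V (s * t) * U' s) * (act s).mapMatrix (U' t) = c s t • 1 := by
        rw [mul_assoc, h'.coc, mul_smul_comm, hV']
      have h3 : (act s).mapMatrix (U' t) * (act s).mapMatrix (V t) = 1 := by
        rw [← map_mul, hV, map_one]
      calc _ = (c s t • 1) * (act s).mapMatrix (V t) := by rw [smul_mul_assoc, one_mul]
        _ = _ := by rw [← h2, mul_assoc, h3, mul_one]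
    rw [smul_mul_assoc, smul_mul_assoc, ← mul_smul_comm, h1]
    simp [mul_assoc]
  obtain ⟨u, hu⟩ := hSu
  let cj : Matrix ι ι L →ₐ[K] Matrix ι ι L :=
    { toFun := fun M => u.val * M * u⁻¹.val
      map_one' := by simp
      map_mul' := fun M N => by simp [mul_assoc]
      map_zero' := by simp
      map_add' := fun M N => by rw [mul_add, add_mul]
      commutes' := fun x => by
        rw [← Algebra.commutes, mul_assoc, Units.mul_inv, mul_one] }
  let φ : A' →ₐ[K] Matrix ι ι L := cj.comp ρ'
  have hφ : ∀ a, φ a = u.val * ρ' a * u⁻¹.val := fun a => rfl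
  have hφi : Function.Injective φ := by
    intro a b hab
    rw [hφ, hφ] at hab
    exact h'.split.injective (u.isUnit.mul_left_cancel (u⁻¹.isUnit.mul_right_cancel hab))
  have hle : φ.range ≤ ρ.range := by
    rintro _ ⟨a, rfl⟩
    refine h.mem_range hfix fun s => ?_
    change _ = φ a * _
    change U s * (act s).mapMatrix (φ a) = _
    have h1 := hUS s
    rw [← hu] at h1
    have h2 : (act s).mapMatrix u.val * (act s).mapMatrix u⁻¹.val = 1 := by
      rw [← map_mul, Units.mul_inv, map_one]
    have h3 : U' s * (act s).mapMatrix u⁻¹.val = u⁻¹.val * U s := by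
      calc _ = u⁻¹.val * (u.val * U' s) * (act s).mapMatrix u⁻¹.val := by simp [← mul_assoc]
        _ = _ := by rw [← h1, mul_assoc, mul_assoc (U s), h2, mul_one]
    rw [hφ, map_mul, map_mul, ← mul_assoc, ← mul_assoc, h1, mul_assoc u.val, h'.comm,
      mul_assoc, mul_assoc, h3]
    simp only [mul_assoc]
  have := h.split.finite
  have := h'.split.finite
  have hdim : finrank K A = finrank K A' := h.split.finrank_eq.trans h'.split.finrank_eq.symm
  let e1 := AlgEquiv.ofInjective ρ h.split.injective
  let e2 := AlgEquiv.ofInjective φ hφi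
  have heq : φ.range = ρ.range := by
    have := Module.Finite.equiv e1.toLinearEquiv
    apply Subalgebra.toSubmodule_injective
    have hf : Module.Finite K (Subalgebra.toSubmodule ρ.range) := this
    apply Submodule.eq_of_le_of_finrank_eq hle
    have h1 := e1.toLinearEquiv.finrank_eq
    have h2 := e2.toLinearEquiv.finrank_eq
    exact h2.symm.trans (hdim.symm.trans h1)
  exact ⟨e1.trans ((Subalgebra.equivOfEq _ _ heq.symm).trans e2.symm)⟩

end Descent

section Constructions

variable {K L A G ι κ : Type*} [Field K] [Field L] [Algebra K L] [Ring A] [Algebra K A]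
  [Group G] [Fintype ι] [DecidableEq ι] [Fintype κ] [DecidableEq κ]
  {act : G →* (L ≃ₐ[K] L)} {ρ : A →ₐ[K] Matrix ι ι L}
  {U : G → Matrix ι ι L} {c : G → G → L}

theorem IsForm.reindex (h : IsForm act ρ U c) (e : ι ≃ κ) :
    IsForm act ((Matrix.reindexAlgEquiv K L e).toAlgHom.comp ρ)
      (fun s => Matrix.reindex e e (U s)) c where
  split :=
    { span := by
        rw [eq_top_iff]
        intro M _
        have hM : Matrix.reindex e.symm e.symm M ∈ Submodule.span L (Set.range ρ) := by
          rw [h.split.span]; trivial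
        have : ∀ N ∈ Submodule.span L (Set.range ρ), Matrix.reindex e e N ∈
            Submodule.span L
              (Set.range ((Matrix.reindexAlgEquiv K L e).toAlgHom.comp ρ)) := by
          intro N hN
          induction hN using Submodule.span_induction with
          | zero => exact Submodule.zero_mem _
          | add x y _ _ hx hy => exact Submodule.add_mem _ hx hy
          | smul l x _ hx => exact Submodule.smul_mem _ l hx
          | mem x hx => obtain ⟨a, rfl⟩ := hx; exact Submodule.subset_span ⟨a, rfl⟩
        have h2 := this _ hM
        simpa using h2
      finrank_eq := by rw [h.split.finrank_eq, Fintype.card_congr e] }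
  isUnit s := (h.isUnit s).map (Matrix.reindexAlgEquiv K L e)
  comm s a := by
    have := congrArg (Matrix.reindexAlgEquiv K L e) (h.comm s a)
    rw [map_mul, map_mul] at this
    exact this
  coc s t := by
    have := congrArg (Matrix.reindexAlgEquiv K L e) (h.coc s t)
    rw [map_mul] at this
    exact this

theorem IsForm.matrix (h : IsForm act ρ U c) (κ : Type*) [Fintype κ] [DecidableEq κ] :
    IsForm act ((Matrix.compAlgEquiv κ ι L K).toAlgHom.comp (ρ.mapMatrix (m := κ)))
      (fun s => Matrix.comp κ κ ι ι L (Matrix.diagonal fun _ => U s)) c where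
  split :=
    { span := by
        rw [eq_top_iff]
        intro M _
        obtain ⟨M, rfl⟩ := (Matrix.comp κ κ ι ι L).surjective M
        have key : ∀ i j, ∀ N ∈ Submodule.span L (Set.range ρ),
            Matrix.comp κ κ ι ι L (Matrix.single i j N) ∈ Submodule.span L
            (Set.range ((Matrix.compAlgEquiv κ ι L K).toAlgHom.comp (ρ.mapMatrix (m := κ)))) := by
          intro i j N hN
          induction hN using Submodule.span_induction with
          | zero =>
            rw [Matrix.single_zero]; exact Submodule.zero_mem _
          | add x y _ _ hx hy =>
            rw [Matrix.single_add]; exact Submodule.add_mem _ hx hy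
          | smul l x _ hx =>
            have h1 := Submodule.smul_mem _ l hx
            convert h1 using 1
            ext p q
            simp only [Matrix.comp_apply, Matrix.single_apply, Matrix.smul_apply]
            split_ifs <;> simp
          | mem x hx =>
            obtain ⟨a, rfl⟩ := hx
            refine Submodule.subset_span ⟨Matrix.single i j a, ?_⟩
            change Matrix.comp κ κ ι ι L ((Matrix.single i j a).map ρ) = _
            congr 1
            ext p q : 2
            simp only [Matrix.map_apply, Matrix.single_apply]
            split_ifs <;> simp
        have hM : Matrix.comp κ κ ι ι L M =
            ∑ i, ∑ j, Matrix.comp κ κ ι ι L (Matrix.single i j (M i j)) := by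
          conv_lhs => rw [Matrix.matrix_eq_sum_single M]
          exact (map_sum (Matrix.compAddEquiv κ κ ι ι L) _ _).trans
            (Finset.sum_congr rfl fun i _ => map_sum (Matrix.compAddEquiv κ κ ι ι L) _ _)
        rw [hM]
        exact Submodule.sum_mem _ fun i _ => Submodule.sum_mem _ fun j _ =>
          key i j _ (by rw [h.split.span]; trivial)
      finrank_eq := by
        rw [Module.finrank_matrix, h.split.finrank_eq, Fintype.card_prod]; ring }
  isUnit s := by
    obtain ⟨V, hV⟩ := (h.isUnit s).exists_right_inv
    have h1 : IsUnit (Matrix.diagonal fun _ : κ => U s) :=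
      IsUnit.of_mul_eq_one (Matrix.diagonal fun _ : κ => V) (by
        rw [Matrix.diagonal_mul_diagonal]; simp [hV])
    exact h1.map (Matrix.compAlgEquiv κ ι L K)
  comm s a := by
    have h1 : (Matrix.diagonal fun _ : κ => U s) * (a.map ρ).map (act s).mapMatrix =
        a.map ρ * Matrix.diagonal fun _ : κ => U s := by
      refine Matrix.ext fun i j => ?_
      rw [Matrix.diagonal_mul, Matrix.mul_diagonal]
      exact h.comm s (a i j)
    have := congrArg (Matrix.compAlgEquiv κ ι L K) h1
    rw [map_mul, map_mul] at this
    exact this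
  coc s t := by
    have h1 : (Matrix.diagonal fun _ : κ => U s) *
        (Matrix.diagonal fun _ : κ => U t).map (act s).mapMatrix =
        Matrix.diagonal fun _ : κ => c s t • U (s * t) := by
      rw [Matrix.diagonal_map (map_zero _), Matrix.diagonal_mul_diagonal]
      simp only [h.coc]
    have := congrArg (Matrix.compAlgEquiv κ ι L K) h1
    rw [map_mul] at this
    refine this.trans ?_
    ext ⟨i, i'⟩ ⟨j, j'⟩
    simp only [Matrix.compAlgEquiv_apply, Matrix.comp_apply, Matrix.diagonal_apply,
      Matrix.smul_apply]
    split_ifs <;> simp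

end Constructions

section TensorPower

variable {ι : Type*} [Fintype ι] [DecidableEq ι]

/-- The Kronecker product of a finite family of matrices. -/
def kronecker (L ι : Type*) [Field L] (r : ℕ) : MultilinearMap L (fun _ : Fin r => Matrix ι ι L)
    (Matrix (Fin r → ι) (Fin r → ι) L) :=
  MultilinearMap.pi fun f => MultilinearMap.pi fun g =>
    (MultilinearMap.mkPiAlgebra L (Fin r) L).compLinearMap fun i =>
      Matrix.entryLinearMap L L (f i) (g i)

variable {L : Type*} [Field L] {r : ℕ}

omit [Fintype ι] [DecidableEq ι] in
theorem kronecker_apply (M : Fin r → Matrix ι ι L) (f g : Fin r → ι) :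
    kronecker L ι r M f g = ∏ i, M i (f i) (g i) := rfl

omit [DecidableEq ι] in
theorem kronecker_mul (M N : Fin r → Matrix ι ι L) :
    kronecker L ι r (M * N) = kronecker L ι r M * kronecker L ι r N := by
  ext f g
  simp only [kronecker_apply, Matrix.mul_apply, Pi.mul_apply, Finset.prod_univ_sum,
    Fintype.piFinset_univ, Finset.prod_mul_distrib]

omit [Fintype ι] in
theorem kronecker_one : kronecker L ι r 1 = 1 := by
  ext f g
  simp only [kronecker_apply, Pi.one_apply, Matrix.one_apply, Fintype.prod_ite_zero,
    Finset.prod_const_one, funext_iff]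

omit [Fintype ι] in
theorem kronecker_single (f g : Fin r → ι) :
    kronecker L ι r (fun i => Matrix.single (f i) (g i) 1) = Matrix.single f g 1 := by
  ext p q
  simp only [kronecker_apply, Matrix.single_apply, Fintype.prod_ite_zero,
    Finset.prod_const_one, funext_iff, forall_and]

theorem span_kronecker_eq_top {s : Set (Matrix ι ι L)} (hs : Submodule.span L s = ⊤) :
    Submodule.span L (kronecker L ι r '' {M | ∀ i, M i ∈ s}) = ⊤ := by
  have key : ∀ (t : Finset (Fin r)) (M : Fin r → Matrix ι ι L), (∀ i ∉ t, M i ∈ s) →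
      kronecker L ι r M ∈ Submodule.span L (kronecker L ι r '' {M | ∀ i, M i ∈ s}) := by
    intro t
    induction t using Finset.induction_on with
    | empty => exact fun M hM => Submodule.subset_span ⟨M, fun i => hM i (by simp), rfl⟩
    | insert j t hj ih =>
      intro M hM
      have hMj : M j ∈ Submodule.span L s := by rw [hs]; trivial
      have : ∀ x ∈ Submodule.span L s, kronecker L ι r (Function.update M j x) ∈
          Submodule.span L (kronecker L ι r '' {M | ∀ i, M i ∈ s}) := by
        intro x hx
        induction hx using Submodule.span_induction with
        | zero => rw [MultilinearMap.map_update_zero]; exact Submodule.zero_mem _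
        | add x y _ _ hx hy => rw [MultilinearMap.map_update_add]; exact Submodule.add_mem _ hx hy
        | smul l x _ hx => rw [MultilinearMap.map_update_smul]; exact Submodule.smul_mem _ l hx
        | mem x hx =>
          refine ih _ fun i hi => ?_
          by_cases hij : i = j
          · subst hij; simpa using hx
          · rw [Function.update_of_ne hij]; exact hM i (by simp [hij, hi])
      simpa using this _ hMj
  rw [eq_top_iff]
  intro M _
  rw [Matrix.matrix_eq_sum_single M]
  refine Submodule.sum_mem _ fun f _ => Submodule.sum_mem _ fun g _ => ?_
  have := Submodule.smul_mem _ (M f g) (key Finset.univ (fun i => Matrix.single (f i) (g i) 1)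
    (by simp))
  rwa [kronecker_single, Matrix.smul_single, smul_eq_mul, mul_one] at this

variable {K A : Type*} [Field K] [Ring A] [Algebra K A] [Algebra K L]

/-- The tensor power of a matrix representation. -/
noncomputable def tensorPowRep (r : ℕ) (ρ : A →ₐ[K] Matrix ι ι L) :
    (⨂[K] (_ : Fin r), A) →ₐ[K] Matrix (Fin r → ι) (Fin r → ι) L :=
  PiTensorProduct.liftAlgHom
    (((kronecker L ι r).restrictScalars K).compLinearMap fun _ => ρ.toLinearMap)
    (by
      rw [MultilinearMap.compLinearMap_apply]
      refine Eq.trans ?_ (kronecker_one (L := L) (ι := ι) (r := r))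
      simp [Pi.one_def])
    (fun x y => by
      simp only [MultilinearMap.compLinearMap_apply, MultilinearMap.coe_restrictScalars]
      rw [← kronecker_mul]
      congr 1
      ext1 i
      exact map_mul ρ _ _)

theorem tensorPowRep_tprod (ρ : A →ₐ[K] Matrix ι ι L) (x : Fin r → A) :
    tensorPowRep r ρ (PiTensorProduct.tprod K x) = kronecker L ι r fun i => ρ (x i) := by
  simp [tensorPowRep, PiTensorProduct.liftAlgHom]

variable {G : Type*} [Group G] {act : G →* (L ≃ₐ[K] L)} {ρ : A →ₐ[K] Matrix ι ι L}
    {U : G → Matrix ι ι L} {c : G → G → L}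

theorem kronecker_mapMatrix (s : L ≃ₐ[K] L) (M : Fin r → Matrix ι ι L) :
    s.mapMatrix (kronecker L ι r M) = kronecker L ι r fun i => s.mapMatrix (M i) := by
  ext f g
  simp [kronecker_apply]

theorem IsForm.tensorPow [Nonempty ι] (h : IsForm act ρ U c) (r : ℕ) :
    IsForm act (tensorPowRep r ρ) (fun s => kronecker L ι r fun _ => U s)
      (fun s t => c s t ^ r) where
  split :=
    { span := by
        rw [eq_top_iff, ← span_kronecker_eq_top (L := L) h.split.span, Submodule.span_le]
        rintro _ ⟨M, hM, rfl⟩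
        choose a ha using hM
        refine Submodule.subset_span ⟨PiTensorProduct.tprod K a, ?_⟩
        rw [tensorPowRep_tprod]
        simp only [ha]
      finrank_eq := by
        have := h.split.finite
        rw [Module.finrank_eq_card_basis (Basis.piTensorProduct fun _ : Fin r => finBasis K A),
          Fintype.card_fun, Fintype.card_fun, Fintype.card_fin, h.split.finrank_eq,
          Fintype.card_fin, ← pow_mul, ← pow_mul, mul_comm] }
  isUnit s := by
    obtain ⟨V, hV⟩ := (h.isUnit s).exists_right_inv
    refine IsUnit.of_mul_eq_one (kronecker L ι r fun _ => V) ?_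
    rw [← kronecker_mul, ← kronecker_one]
    congr 1
    ext1 i
    exact hV
  comm s a := by
    induction a using PiTensorProduct.induction_on with
    | smul_tprod x a =>
      rw [map_smul, map_smul, mul_smul_comm, smul_mul_assoc, tensorPowRep_tprod,
        kronecker_mapMatrix, ← kronecker_mul, ← kronecker_mul]
      congr 2
      ext1 i
      exact h.comm s (a i)
    | add x y hx hy => rw [map_add, map_add, mul_add, add_mul, hx, hy]
  coc s t := by
    rw [kronecker_mapMatrix, ← kronecker_mul]
    have := (kronecker L ι r).map_smul_univ (fun _ => c s t) (fun _ => U (s * t))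
    rw [Finset.prod_const, Finset.card_univ, Fintype.card_fin] at this
    rw [← this]
    congr 1
    ext1 i
    exact h.coc s t

end TensorPower

section BaseChange

variable {k P K L D G ι : Type*} [Field k] [Field P] [Algebra k P] [Field K] [Field L]
  [Algebra K L] [Algebra k K] [Algebra P L] [Algebra k L] [IsScalarTower k K L]
  [IsScalarTower k P L] [Ring D] [Algebra k D] [Group G] [Fintype ι] [DecidableEq ι]

/-- Extension of scalars of a matrix representation. -/
noncomputable def baseChangeRep (K : Type*) {L : Type*} [Field K] [Field L]
    [Algebra K L] [Algebra k K] [Algebra P L] [Algebra k L] [IsScalarTower k K L]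
    [IsScalarTower k P L] (ρ : D →ₐ[k] Matrix ι ι P) : K ⊗[k] D →ₐ[K] Matrix ι ι L :=
  Algebra.TensorProduct.lift (Algebra.ofId K _)
    ((((IsScalarTower.toAlgHom k P L).mapMatrix (m := ι))).comp ρ)
    (fun x _ => Algebra.commutes x _)

theorem baseChangeRep_tmul (ρ : D →ₐ[k] Matrix ι ι P) (x : K) (d : D) :
    baseChangeRep K (L := L) ρ (x ⊗ₜ d) = x • (ρ d).map (algebraMap P L) :=
  (Algebra.TensorProduct.lift_tmul _ _ _ _ _).trans (by
    rw [Algebra.ofId_apply, ← Algebra.smul_def]; rfl)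

variable {actP : G →* (P ≃ₐ[k] P)} {act : G →* (L ≃ₐ[K] L)} {ρ : D →ₐ[k] Matrix ι ι P}
  {U : G → Matrix ι ι P} {c : G → G → P}

theorem IsSplit.baseChange [Nonempty ι] (h : IsSplit ρ) :
    IsSplit (baseChangeRep K (L := L) ρ) where
  span := by
    rw [eq_top_iff]
    intro M _
    have h1 : ∀ N : Matrix ι ι P, N.map (algebraMap P L) ∈
        Submodule.span L (Set.range (baseChangeRep K (L := L) ρ)) := by
      intro N
      have hN : N ∈ Submodule.span P (Set.range ρ) := by rw [h.span]; trivial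
      induction hN using Submodule.span_induction with
      | zero => rw [Matrix.map_zero _ (map_zero _)]; exact Submodule.zero_mem _
      | add x y _ _ hx hy =>
        rw [Matrix.map_add _ (map_add _)]; exact Submodule.add_mem _ hx hy
      | smul l x _ hx =>
        rw [Matrix.map_smul' _ _ _ (map_mul _)]; exact Submodule.smul_mem _ _ hx
      | mem x hx =>
        obtain ⟨d, rfl⟩ := hx
        refine Submodule.subset_span ⟨1 ⊗ₜ d, ?_⟩
        rw [baseChangeRep_tmul, one_smul]
    rw [Matrix.matrix_eq_sum_single M]
    refine Submodule.sum_mem _ fun f _ => Submodule.sum_mem _ fun g _ => ?_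
    have := Submodule.smul_mem _ (M f g) (h1 (Matrix.single f g 1))
    rwa [Matrix.map_single, map_one, Matrix.smul_single, smul_eq_mul, mul_one] at this
  finrank_eq := by rw [Module.finrank_baseChange, h.finrank_eq]

theorem IsForm.baseChange [Nonempty ι]
    (hact : ∀ s x, act s (algebraMap P L x) = algebraMap P L (actP s x))
    (h : IsForm actP ρ U c) :
    IsForm act (baseChangeRep K (L := L) ρ) (fun s => (U s).map (algebraMap P L))
      (fun s t => algebraMap P L (c s t)) := by
  have hm : ∀ s (M : Matrix ι ι P), (act s).mapMatrix (M.map (algebraMap P L)) =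
      ((actP s).mapMatrix M).map (algebraMap P L) := by
    intro s M; ext i j; exact hact s _
  refine ⟨h.split.baseChange, fun s => ?_, fun s a => ?_, fun s t => ?_⟩
  · exact (h.isUnit s).map (algebraMap P L).mapMatrix
  · induction a using TensorProduct.induction_on with
    | zero => simp
    | add x y hx hy => rw [map_add, map_add, mul_add, add_mul, hx, hy]
    | tmul x d =>
      rw [baseChangeRep_tmul, map_smul, mul_smul_comm, smul_mul_assoc, hm,
        ← Matrix.map_mul, ← Matrix.map_mul, h.comm]
  · rw [hm, ← Matrix.map_mul, h.coc, Matrix.map_smul' _ _ _ (map_mul _)]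

end BaseChange

section Splitting

theorem linearIndependent_one_tmul {K L A κ : Type*} [Field K] [Field L] [Algebra K L] [Ring A]
    [Algebra K A] {v : κ → A} (hv : LinearIndependent K v) :
    LinearIndependent L (fun i => (1 : L) ⊗ₜ[K] v i) := by
  have hv' := hv.linearIndepOn_id
  let b := Basis.extend hv'
  have hli := (Algebra.TensorProduct.basis L b).linearIndependent
  let f : κ → ↑(hv'.extend (Set.subset_univ (Set.range v))) := fun i =>
    ⟨v i, hv'.subset_extend _ ⟨i, rfl⟩⟩
  have hf : Function.Injective f := fun i j hij => hv.injective (congrArg Subtype.val hij)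
  have := hli.comp f hf
  convert this using 1
  ext1 i
  rw [Function.comp_apply, Algebra.TensorProduct.basis_apply]
  exact congrArg _ (Basis.extend_apply_self hv' (f i)).symm

theorem sum_finrank_le_of_iSupIndep {L V ι : Type*} [Field L] [AddCommGroup V] [Module L V]
    [FiniteDimensional L V] [Fintype ι] [DecidableEq ι] (W : ι → Submodule L V)
    (hW : iSupIndep W) : ∑ i, finrank L (W i) ≤ finrank L V := by
  rw [← Module.finrank_directSum]
  exact LinearMap.finrank_le_finrank_of_injective hW.dfinsupp_lsum_injective

theorem aeval_one_tmul_ne_zero {K L A : Type*} [Field K] [Field L] [Algebra K L] [Ring A]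
    [Algebra K A] (β : A) (p : L[X]) (hp : p ≠ 0) (hdeg : p.natDegree < (minpoly K β).natDegree) :
    aeval ((1 : L) ⊗ₜ[K] β) p ≠ 0 := by
  intro h0
  have hli := linearIndependent_one_tmul (L := L) (linearIndependent_pow (K := K) β)
  rw [aeval_eq_sum_range' hdeg, Finset.sum_range] at h0
  have h1 := Fintype.linearIndependent_iff.mp hli (fun i => p.coeff i) (by
    rw [← h0]
    exact Finset.sum_congr rfl fun i _ => by rw [Algebra.TensorProduct.tmul_pow, one_pow])
  apply hp
  ext i
  by_cases hi : i < (minpoly K β).natDegree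
  · exact h1 ⟨i, hi⟩
  · exact coeff_eq_zero_of_natDegree_lt (by omega)

theorem exists_monic_mul_X_sub_C {L : Type*} [Field L] {n : ℕ} (θ : Fin n → L) (i : Fin n) :
    ∃ g : L[X], g.Monic ∧ g.natDegree < n ∧ g * (X - C (θ i)) = ∏ i, (X - C (θ i)) := by
  classical
  refine ⟨∏ j ∈ Finset.univ.erase i, (X - C (θ j)),
    monic_prod_of_monic _ _ fun j _ => monic_X_sub_C _, ?_, ?_⟩
  · have h1 := natDegree_finsetProd_X_sub_C_eq_card (Finset.univ.erase i) θ
    rw [h1, Finset.card_erase_of_mem (Finset.mem_univ i), Finset.card_univ, Fintype.card_fin]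
    have := i.pos
    omega
  · rw [Finset.prod_erase_mul (f := fun j => X - C (θ j)) _ (Finset.mem_univ i)]

/-- A simple algebra of dimension `n ^ 2` containing an element with `n` distinct eigenvalues is
split. -/
theorem exists_algHom_surjective {L B : Type*} [Field L] [Ring B] [Algebra L B] [IsSimpleRing B]
    {n : ℕ} (hn : 0 < n) (hdim : finrank L B = n ^ 2) (β : B) (θ : Fin n → L)
    (hθ : Function.Injective θ) (hβ : aeval β (∏ i, (X - C (θ i))) = 0)
    (hne : ∀ p : L[X], p ≠ 0 → p.natDegree < n → aeval β p ≠ 0) :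
    ∃ Φ : B →ₐ[L] Matrix (Fin n) (Fin n) L, Function.Surjective Φ := by
  classical
  have : Module.Finite L B := Module.finite_of_finrank_pos (by rw [hdim]; positivity)
  let T : Module.End L B := LinearMap.mulRight L β
  let W : Fin n → Submodule L B := fun i => T.eigenspace (θ i)
  have hW : ∀ i x, x ∈ W i ↔ x * β = θ i • x := fun i x => Module.End.mem_eigenspace_iff
  have hind : iSupIndep W := T.eigenspaces_iSupIndep.comp hθ
  have hWne : ∀ i, W i ≠ ⊥ := by
    intro i
    rw [Submodule.ne_bot_iff]
    obtain ⟨g, hgm, hgdeg, hg⟩ := exists_monic_mul_X_sub_C θ i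
    refine ⟨aeval β g, ?_, hne g hgm.ne_zero hgdeg⟩
    rw [hW]
    rw [← hg, map_mul, map_sub, aeval_X, aeval_C, mul_sub, sub_eq_zero] at hβ
    rw [hβ, ← Algebra.commutes, ← Algebra.smul_def]
  have hsum := sum_finrank_le_of_iSupIndep W hind
  obtain ⟨i, hi⟩ : ∃ i, finrank L (W i) ≤ n := by
    by_contra! h
    have h1 : ∑ i : Fin n, (n + 1) ≤ ∑ i, finrank L (W i) := Finset.sum_le_sum fun i _ => h i
    rw [Finset.sum_const, Finset.card_univ, Fintype.card_fin, smul_eq_mul] at h1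
    have h2 : finrank L B = n * n := by rw [hdim, sq]
    have h3 : n * (n + 1) = n * n + n := by ring
    omega
  have hstab : ∀ b : B, ∀ x ∈ W i, b * x ∈ W i := by
    intro b x hx
    rw [hW] at hx ⊢
    rw [mul_assoc, hx, mul_smul_comm]
  let φ : B →ₐ[L] Module.End L (W i) :=
    { toFun := fun b => (LinearMap.mulLeft L b).restrict (hstab b)
      map_one' := LinearMap.ext fun x => Subtype.ext (one_mul (x : B))
      map_mul' := fun a b => LinearMap.ext fun x => Subtype.ext (mul_assoc a b (x : B))
      map_zero' := LinearMap.ext fun x => Subtype.ext (zero_mul (x : B))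
      map_add' := fun a b => LinearMap.ext fun x => Subtype.ext (add_mul a b (x : B))
      commutes' := fun l => LinearMap.ext fun x =>
        Subtype.ext (Algebra.smul_def l (x : B)).symm }
  have hnt : Nontrivial (W i) := Submodule.nontrivial_iff_ne_bot.mpr (hWne i)
  have hφ : Function.Injective φ := RingHom.injective φ.toRingHom
  have hge : n ^ 2 ≤ finrank L (W i) ^ 2 := by
    have := LinearMap.finrank_le_finrank_of_injective (f := φ.toLinearMap) hφ
    rw [hdim] at this
    rw [sq (finrank L (W i))]
    exact this.trans_eq (Module.finrank_linearMap (R := L) (S := L) (M := W i) (N := W i))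
  have hWn : finrank L (W i) = n :=
    le_antisymm hi ((Nat.pow_le_pow_iff_left (by norm_num)).mp hge)
  have hfr : finrank L B = finrank L (Module.End L (W i)) := by
    rw [hdim, Module.finrank_linearMap (R := L) (S := L) (M := W i) (N := W i), hWn, sq]
  have hsurj : Function.Surjective φ.toLinearMap :=
    (LinearMap.injective_iff_surjective_of_finrank_eq_finrank (K := L) (V := B)
      (V₂ := Module.End L (W i)) hfr (f := φ.toLinearMap)).mp hφ
  let bas : Basis (Fin n) L (W i) := (finBasis L (W i)).reindex (finCongr hWn)
  exact ⟨(LinearMap.toMatrixAlgEquiv bas).toAlgHom.comp φ,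
    (LinearMap.toMatrixAlgEquiv bas).surjective.comp hsurj⟩

theorem isSplit_of_surjective {K L A : Type*} [Field K] [Field L] [Algebra K L] [Ring A]
    [Algebra K A] {n : ℕ} (hdim : finrank K A = n ^ 2)
    (Φ : L ⊗[K] A →ₐ[L] Matrix (Fin n) (Fin n) L) (hΦ : Function.Surjective Φ) :
    IsSplit ((Φ.restrictScalars K).comp Algebra.TensorProduct.includeRight) := by
  refine ⟨?_, by rw [hdim, Fintype.card_fin]⟩
  rw [eq_top_iff]
  intro M _
  obtain ⟨b, rfl⟩ := hΦ M
  induction b using TensorProduct.induction_on with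
  | zero => rw [map_zero]; exact Submodule.zero_mem _
  | add x y hx hy => rw [map_add]; exact Submodule.add_mem _ (hx trivial) (hy trivial)
  | tmul l a =>
    have : l ⊗ₜ[K] a = l • ((1 : L) ⊗ₜ[K] a) := by
      rw [TensorProduct.smul_tmul', smul_eq_mul, mul_one]
    rw [this, map_smul]
    exact Submodule.smul_mem _ _ (Submodule.subset_span ⟨a, rfl⟩)

/-- A central division algebra is split by any field over which the minimal polynomial of an
element of maximal degree splits with distinct roots. -/
theorem exists_isSplit {K L A : Type*} [Field K] [Field L] [Algebra K L] [Ring A] [Nontrivial A]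
    [Algebra K A] {n : ℕ} (hn : 0 < n) (hunit : ∀ x : A, x ≠ 0 → IsUnit x)
    (hcenter : Subalgebra.center K A = ⊥) (hdim : finrank K A = n ^ 2) (β : A)
    (hβ : (minpoly K β).natDegree = n) (θ : Fin n → L) (hθ : Function.Injective θ)
    (hroots : (minpoly K β).map (algebraMap K L) = ∏ i, (X - C (θ i))) :
    ∃ ρ : A →ₐ[K] Matrix (Fin n) (Fin n) L, IsSplit ρ := by
  have : IsSimpleRing (L ⊗[K] A) := by
    have := isSimpleRing_tensorProduct hunit hcenter L
    exact IsSimpleRing.of_ringEquiv (Algebra.TensorProduct.comm K A L).toRingEquiv this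
  obtain ⟨Φ, hΦ⟩ := exists_algHom_surjective (B := L ⊗[K] A) hn
    (by rw [Module.finrank_baseChange, hdim]) ((1 : L) ⊗ₜ[K] β) θ hθ (by
      rw [← hroots, aeval_map_algebraMap]
      have := aeval_algHom_apply
        (Algebra.TensorProduct.includeRight : A →ₐ[K] L ⊗[K] A) β (minpoly K β)
      rw [minpoly.aeval, map_zero] at this
      exact this) (fun p hp hdeg => aeval_one_tmul_ne_zero β p hp (by rwa [hβ]))
  exact ⟨_, isSplit_of_surjective hdim Φ hΦ⟩

theorem exists_isSplit_algebraicClosure {K A : Type*} [Field K] [Ring A] [Nontrivial A]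
    [Algebra K A] {n : ℕ} (hn : 0 < n) (hunit : ∀ x : A, x ≠ 0 → IsUnit x)
    (hcenter : Subalgebra.center K A = ⊥) (hdim : finrank K A = n ^ 2) :
    ∃ ρ : A →ₐ[K] Matrix (Fin n) (Fin n) (AlgebraicClosure K), IsSplit ρ := by
  have : Module.Finite K A := Module.finite_of_finrank_pos (by rw [hdim]; positivity)
  have : IsSimpleRing (AlgebraicClosure K ⊗[K] A) := by
    have := isSimpleRing_tensorProduct hunit hcenter (AlgebraicClosure K)
    exact IsSimpleRing.of_ringEquiv
      (Algebra.TensorProduct.comm K A (AlgebraicClosure K)).toRingEquiv this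
  obtain ⟨m, hm, ⟨e⟩⟩ := IsSimpleRing.exists_algEquiv_matrix_of_isAlgClosed
    (AlgebraicClosure K) (AlgebraicClosure K ⊗[K] A)
  have hmn : m = n := by
    have := e.toLinearEquiv.finrank_eq
    rw [Module.finrank_baseChange, hdim, Module.finrank_matrix, Module.finrank_self,
      Fintype.card_fin, mul_one, ← sq] at this
    exact ((Nat.pow_left_injective (n := 2) (by norm_num)) this).symm
  subst hmn
  exact ⟨_, isSplit_of_surjective hdim e.toAlgHom e.surjective⟩

end Splitting

section Density

variable {K L A : Type*} [Field K] [Field L] [Algebra K L] [Ring A] [Algebra K A]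

/-- Elements of a split form are Zariski dense in the matrix algebra. -/
theorem IsSplit.exists_eval_ne_zero {ι : Type*} [Fintype ι] [DecidableEq ι] [Nonempty ι]
    [Infinite K] {ρ : A →ₐ[K] Matrix ι ι L} (h : IsSplit ρ) (p : MvPolynomial (ι × ι) L)
    (hp : p ≠ 0) : ∃ a, MvPolynomial.eval (fun q => ρ a q.1 q.2) p ≠ 0 := by
  have := h.finite
  obtain ⟨B, hB⟩ := h.exists_basis (finBasis K A)
  have : Infinite L := Infinite.of_injective _ (algebraMap K L).injective
  obtain ⟨m, hm⟩ : ∃ m, MvPolynomial.eval m p ≠ 0 := by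
    by_contra! h0
    exact hp (MvPolynomial.funext fun x => by rw [h0, map_zero])
  let g : ι × ι → MvPolynomial (Fin (finrank K A)) L := fun q =>
    ∑ i, MvPolynomial.C (B i q.1 q.2) * MvPolynomial.X i
  have hg : ∀ t, MvPolynomial.eval t (MvPolynomial.bind₁ g p) =
      MvPolynomial.eval (fun q => (∑ i, t i • B i) q.1 q.2) p := by
    intro t
    refine (MvPolynomial.eval₂Hom_bind₁ _ _ _ _).trans ?_
    change MvPolynomial.eval _ p = _
    congr 2
    ext q
    change MvPolynomial.eval t (g q) = _
    simp [g, Matrix.sum_apply, mul_comm]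
  have hne : MvPolynomial.bind₁ g p ≠ 0 := by
    intro h0
    have h1 := hg (B.repr (Matrix.of fun i j => m (i, j)))
    rw [h0, map_zero, B.sum_repr] at h1
    exact hm h1.symm
  obtain ⟨t, ht, hne⟩ : ∃ t : Fin (finrank K A) → L, (∀ i, t i ∈ Set.range (algebraMap K L)) ∧
      MvPolynomial.eval t (MvPolynomial.bind₁ g p) ≠ 0 := by
    by_contra! h0
    refine hne (MvPolynomial.funext_set (fun _ => Set.range (algebraMap K L))
      (fun _ => Set.infinite_range_of_injective (algebraMap K L).injective) ?_)
    intro x hx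
    rw [map_zero]
    exact h0 x fun i => hx i (Set.mem_univ i)
  choose u hu using ht
  refine ⟨∑ i, u i • finBasis K A i, ?_⟩
  rw [hg] at hne
  have hsum : ρ (∑ i, u i • finBasis K A i) = ∑ i, t i • B i := by
    rw [map_sum]
    refine Finset.sum_congr rfl fun i _ => ?_
    rw [map_smul, hB, ← hu, algebraMap_smul]
  rwa [hsum]

/-- The matrix whose columns are the images of the all-ones vector under the powers of `M`. -/
def krylov {n : ℕ} {R : Type*} [CommRing R] (M : Matrix (Fin n) (Fin n) R) :
    Matrix (Fin n) (Fin n) R :=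
  Matrix.of fun i j => ((M ^ (j : ℕ)).mulVec fun _ => 1) i

theorem krylov_map {n : ℕ} {R S : Type*} [CommRing R] [CommRing S] (f : R →+* S)
    (M : Matrix (Fin n) (Fin n) R) : krylov (M.map f) = (krylov M).map f := by
  ext i j
  have : (M.map f) ^ (j : ℕ) = (M ^ (j : ℕ)).map f := (map_pow f.mapMatrix M j).symm
  simp [krylov, this, Matrix.mulVec, dotProduct]

theorem krylov_diagonal {n : ℕ} {R : Type*} [CommRing R] (d : Fin n → R) :
    krylov (Matrix.diagonal d) = Matrix.vandermonde d := by
  ext i j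
  simp [krylov, Matrix.diagonal_pow, Matrix.mulVec_diagonal, Matrix.vandermonde]

theorem det_krylov_mvPolynomialX_ne_zero {n : ℕ} [Infinite L] :
    (krylov (Matrix.mvPolynomialX (Fin n) (Fin n) L)).det ≠ 0 := by
  intro h0
  let d : Fin n ↪ L := Fin.valEmbedding.trans (Infinite.natEmbedding L)
  have h1 := congrArg (MvPolynomial.eval fun p : Fin n × Fin n => Matrix.diagonal d p.1 p.2) h0
  rw [map_zero, RingHom.map_det, RingHom.mapMatrix_apply, ← krylov_map] at h1
  have h2 := Matrix.mvPolynomialX_mapMatrix_eval (Matrix.diagonal d)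
  rw [RingHom.mapMatrix_apply] at h2
  rw [h2, krylov_diagonal] at h1
  exact Matrix.det_vandermonde_ne_zero_iff.mpr d.injective h1

theorem eval_det_krylov {n : ℕ} (M : Matrix (Fin n) (Fin n) L) :
    MvPolynomial.eval (fun p : Fin n × Fin n => M p.1 p.2)
      (krylov (Matrix.mvPolynomialX (Fin n) (Fin n) L)).det = (krylov M).det := by
  have h2 := Matrix.mvPolynomialX_mapMatrix_eval M
  rw [RingHom.mapMatrix_apply] at h2
  rw [RingHom.map_det, RingHom.mapMatrix_apply, ← krylov_map, h2]

variable {n : ℕ} {ρ : A →ₐ[K] Matrix (Fin n) (Fin n) L}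

theorem linearIndependent_pow_of_det_krylov {a : A} (ha : (krylov (ρ a)).det ≠ 0) :
    LinearIndependent K (fun i : Fin n => a ^ (i : ℕ)) := by
  rw [Fintype.linearIndependent_iff]
  intro g hg
  have h1 : (krylov (ρ a)).mulVec (fun i => algebraMap K L (g i)) = 0 := by
    have h2 := congrArg ρ hg
    rw [map_sum, map_zero] at h2
    ext i
    have h3 := congrFun (congrArg (fun M => Matrix.mulVec M fun _ => 1) h2) i
    simp only [map_smul, map_pow, Matrix.zero_mulVec, Matrix.sum_mulVec, Finset.sum_apply] at h3
    rw [← h3]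
    simp only [Matrix.mulVec, krylov, dotProduct, Matrix.of_apply, Matrix.smul_apply, mul_one,
      Finset.sum_mul]
    refine Finset.sum_congr rfl fun j _ => Finset.sum_congr rfl fun l _ => ?_
    rw [Algebra.smul_def, mul_comm]
  have h2 := Matrix.eq_zero_of_mulVec_eq_zero ha h1
  intro i
  exact (map_eq_zero (algebraMap K L)).mp (congrFun h2 i)

theorem natDegree_minpoly_of_linearIndependent (h : IsSplit ρ) (hn : 0 < n) {a : A}
    (ha : LinearIndependent K (fun i : Fin n => a ^ (i : ℕ))) :
    (minpoly K a).natDegree = n := by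
  have : Nonempty (Fin n) := ⟨⟨0, hn⟩⟩
  have := h.finite
  have hInt : IsIntegral K a := IsIntegral.of_finite K a
  refine le_antisymm ?_ ?_
  · by_contra! hlt
    have h1 := h.linearIndependent (linearIndependent_pow (K := K) a)
    have h2 := aeval_eq_sum_range' (p := (ρ a).charpoly) (n := (minpoly K a).natDegree) (by
      rw [Matrix.charpoly_natDegree_eq_dim, Fintype.card_fin]; exact hlt) (ρ a)
    rw [Matrix.aeval_self_charpoly, Finset.sum_range] at h2
    have h3 := Fintype.linearIndependent_iff.mp h1 (fun i => (ρ a).charpoly.coeff i) (by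
      rw [h2]; simp)
    have h4 := h3 ⟨n, hlt⟩
    have h5 := (Matrix.charpoly_monic (ρ a)).coeff_natDegree
    rw [Matrix.charpoly_natDegree_eq_dim, Fintype.card_fin] at h5
    exact one_ne_zero (h5.symm.trans h4)
  · by_contra! hlt
    have h2 := minpoly.aeval K a
    rw [aeval_eq_sum_range' hlt, Finset.sum_range] at h2
    have h3 := Fintype.linearIndependent_iff.mp ha _ h2 ⟨_, hlt⟩
    exact (minpoly.ne_zero hInt) (leadingCoeff_eq_zero.mp h3)

theorem IsSplit.exists_natDegree_minpoly [Infinite K] (h : IsSplit ρ) (hn : 0 < n) :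
    ∃ a : A, (minpoly K a).natDegree = n := by
  have : Nonempty (Fin n) := ⟨⟨0, hn⟩⟩
  have : Infinite L := Infinite.of_injective _ (algebraMap K L).injective
  obtain ⟨a, ha⟩ := h.exists_eval_ne_zero _ (det_krylov_mvPolynomialX_ne_zero (n := n))
  rw [eval_det_krylov] at ha
  exact ⟨a, natDegree_minpoly_of_linearIndependent h hn (linearIndependent_pow_of_det_krylov ha)⟩

/-- Every element has perturbations of maximal degree. -/
theorem IsSplit.exists_natDegree_minpoly_add [Infinite K] (h : IsSplit ρ) (hn : 0 < n) (y : A) :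
    ∃ b : A, ∀ S : Set K, S.Infinite → ∃ s ∈ S, (minpoly K (y + s • b)).natDegree = n := by
  have : Nonempty (Fin n) := ⟨⟨0, hn⟩⟩
  have : Infinite L := Infinite.of_injective _ (algebraMap K L).injective
  obtain ⟨a, ha⟩ := h.exists_eval_ne_zero _ (det_krylov_mvPolynomialX_ne_zero (n := n))
  rw [eval_det_krylov] at ha
  refine ⟨a - y, fun S hS => ?_⟩
  classical
  let N : Matrix (Fin n) (Fin n) L[X] := (ρ y).map C + (X : L[X]) • (ρ (a - y)).map C
  have hN : ∀ s : L, N.map (evalRingHom s) = ρ y + s • ρ (a - y) := by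
    intro s; ext i j; simp [N]
  let q : L[X] := (krylov N).det
  have hq : ∀ s : L, q.eval s = (krylov (ρ y + s • ρ (a - y))).det := by
    intro s
    rw [← hN, krylov_map, ← RingHom.mapMatrix_apply, ← RingHom.map_det]; rfl
  have hq0 : q ≠ 0 := by
    intro h0
    have := hq 1
    rw [h0, eval_zero, one_smul, map_sub, add_sub_cancel] at this
    exact ha this.symm
  have hinf : (algebraMap K L '' S).Infinite := hS.image (algebraMap K L).injective.injOn
  obtain ⟨_, ⟨s, hs, rfl⟩, hsr⟩ := hinf.exists_notMem_finset q.roots.toFinset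
  refine ⟨s, hs, natDegree_minpoly_of_linearIndependent h hn
    (linearIndependent_pow_of_det_krylov (ρ := ρ) ?_)⟩
  rw [map_add, map_smul, ← algebraMap_smul L s, ← hq]
  intro h0
  exact hsr (by rw [Multiset.mem_toFinset, mem_roots hq0]; exact h0)

end Density

section Degree

theorem IsForm.map_minpoly {K L A G ι : Type*} [Field K] [Field L] [Algebra K L] [Ring A]
    [Algebra K A] [Group G] [Fintype ι] [DecidableEq ι] [Nonempty ι] {act : G →* (L ≃ₐ[K] L)}
    {ρ : A →ₐ[K] Matrix ι ι L} {U : G → Matrix ι ι L} {c : G → G → L} (h : IsForm act ρ U c)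
    (hfix : ∀ l, (∀ σ, act σ l = l) → ∃ x : K, algebraMap K L x = l) {a : A}
    (ha : (minpoly K a).natDegree = Fintype.card ι) :
    (minpoly K a).map (algebraMap K L) = (ρ a).charpoly := by
  obtain ⟨f, hf⟩ := h.exists_charpoly hfix a
  have hfin := h.split.finite
  have hInt : IsIntegral K a := Algebra.IsIntegral.isIntegral a
  have hmon : f.Monic := by
    have : ((ρ a).charpoly).Monic := Matrix.charpoly_monic _
    rw [← hf] at this
    exact monic_of_injective (algebraMap K L).injective this
  have hdeg : f.natDegree = Fintype.card ι := by
    rw [← natDegree_map_eq_of_injective (algebraMap K L).injective f, hf,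
      Matrix.charpoly_natDegree_eq_dim]
  have h0 : aeval a f = 0 := by
    apply h.split.injective
    rw [map_zero, ← aeval_algHom_apply, ← aeval_map_algebraMap L, hf]
    exact Matrix.aeval_self_charpoly _
  rw [← hf, eq_of_monic_of_dvd_of_natDegree_le (minpoly.monic hInt) hmon (minpoly.dvd K a h0)
    (by rw [hdeg, ha])]

theorem separable_of_natDegree {K : Type*} [Field K] {f : K[X]} (hf : Irreducible f)
    (hn : (f.natDegree : K) ≠ 0) : f.Separable := by
  rw [separable_iff_derivative_ne_zero hf]
  intro h0
  have hpos : 0 < f.natDegree := hf.natDegree_pos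
  have h1 := congrArg (fun p => p.coeff (f.natDegree - 1)) h0
  simp only [coeff_derivative, coeff_zero] at h1
  rw [Nat.sub_add_cancel hpos, coeff_natDegree] at h1
  rcases mul_eq_zero.mp h1 with h1 | h1
  · exact hf.ne_zero (leadingCoeff_eq_zero.mp h1)
  · apply hn
    rw [← h1, ← Nat.cast_succ, Nat.succ_eq_add_one, Nat.sub_add_cancel hpos]

theorem exists_roots_of_splits {L : Type*} [Field L] {n : ℕ} {f : L[X]} (hm : f.Monic)
    (hdeg : f.natDegree = n) (hsep : f.Separable) (hs : f.Splits) :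
    ∃ θ : Fin n → L, Function.Injective θ ∧ f = ∏ i, (X - C (θ i)) := by
  have hcard : f.roots.toList.length = n := by
    rw [Multiset.length_toList, ← hdeg]; exact hs.natDegree_eq_card_roots.symm
  have hnd : f.roots.toList.Nodup := by
    rw [← Multiset.coe_nodup, Multiset.coe_toList]; exact nodup_roots hsep
  refine ⟨fun i => f.roots.toList.get (i.cast hcard.symm), fun i j hij => ?_, ?_⟩
  · have := List.nodup_iff_injective_get.mp hnd hij
    simpa using this
  · refine (hs.eq_prod_roots_of_monic hm).trans ?_
    have h1 : (f.roots.map fun x => X - C x).prod =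
        (f.roots.toList.map fun x => X - C x).prod := by
      conv_lhs => rw [← Multiset.coe_toList f.roots, Multiset.map_coe, Multiset.prod_coe]
    rw [h1, ← List.prod_ofFn]
    subst hcard
    congr 1
    apply List.ext_get
    · simp
    · intro i h1 h2
      simp

/-- A finite Galois extension splitting two given separable irreducible polynomials. -/
theorem exists_isGalois_splits {k : Type} [Field k] {f g : k[X]} (hf : Irreducible f)
    (hg : Irreducible g) (hfs : f.Separable) (hgs : g.Separable) :
    ∃ (P : Type) (_ : Field P) (_ : Algebra k P), FiniteDimensional k P ∧ IsGalois k P ∧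
      (f.map (algebraMap k P)).Splits ∧ (g.map (algebraMap k P)).Splits := by
  by_cases hc : IsCoprime f g
  · refine ⟨(f * g).SplittingField, inferInstance, inferInstance, inferInstance,
      IsGalois.of_separable_splitting_field (hfs.mul hgs hc), ?_⟩
    have h := SplittingField.splits (f * g)
    rw [Polynomial.map_mul] at h
    have h0 : f.map (algebraMap k (f * g).SplittingField) *
      g.map (algebraMap k (f * g).SplittingField) ≠ 0 :=
      mul_ne_zero (map_ne_zero hf.ne_zero) (map_ne_zero hg.ne_zero)
    exact ⟨h.of_dvd h0 (dvd_mul_right _ _), h.of_dvd h0 (dvd_mul_left _ _)⟩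
  · have hfg : f ∣ g := by
      by_contra h
      exact hc (hf.coprime_iff_not_dvd.mpr h)
    have hgf : g ∣ f := (hf.associated_of_dvd hg hfg).symm.dvd
    refine ⟨f.SplittingField, inferInstance, inferInstance, inferInstance,
      IsGalois.of_separable_splitting_field hfs, SplittingField.splits f, ?_⟩
    exact (SplittingField.splits f).of_dvd (map_ne_zero hf.ne_zero) (Polynomial.map_dvd _ hgf)

/-- A field generated by a root of `f` embeds into an algebra if and only if `f` has a root
there. -/
theorem nonempty_adjoinRoot_algHom_iff {K : Type*} [Field K] (f : K[X]) (B : Type*) [Ring B]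
    [Algebra K B] : Nonempty (AdjoinRoot f →ₐ[K] B) ↔ ∃ x : B, aeval x f = 0 := by
  constructor
  · rintro ⟨φ⟩
    refine ⟨φ (AdjoinRoot.root f), ?_⟩
    rw [aeval_algHom_apply, AdjoinRoot.aeval_eq, AdjoinRoot.mk_self, map_zero]
  · rintro ⟨x, hx⟩
    refine ⟨Ideal.Quotient.liftₐ (Ideal.span {f}) (aeval x) fun a ha => ?_⟩
    obtain ⟨g, rfl⟩ := Ideal.mem_span_singleton.mp ha
    rw [map_mul, hx, zero_mul]

end Degree

section Specialization

variable {k : Type*} [Field k] {D : Type*} [Ring D] [Algebra k D]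

/-- Specialization of the coefficients of `R ⊗ D` along a point of `R`. -/
noncomputable def specialize {R : Type*} [CommRing R] [Algebra k R] (t : R →ₐ[k] k) :
    R ⊗[k] D →ₐ[k] D :=
  Algebra.TensorProduct.lift ((Algebra.ofId k D).comp t) (AlgHom.id k D) fun x y =>
    (Algebra.commutes (t x) y : Commute (((Algebra.ofId k D).comp t) x) ((AlgHom.id k D) y))

theorem specialize_tmul {R : Type*} [CommRing R] [Algebra k R] (t : R →ₐ[k] k) (x : R) (d : D) :
    specialize t (x ⊗ₜ[k] d) = t x • d :=
  (Algebra.TensorProduct.lift_tmul _ _ _ x d).trans (Algebra.smul_def _ _).symm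

theorem exists_specialize_ne_zero {R : Type*} [CommRing R] [Algebra k R] {y : R ⊗[k] D}
    (hy : y ≠ 0) : ∃ p : R, p ≠ 0 ∧ ∀ t : R →ₐ[k] k, t p ≠ 0 → specialize t y ≠ 0 := by
  let b := Basis.ofVectorSpace k D
  let b' := Algebra.TensorProduct.basis R b
  have key : ∀ (t : R →ₐ[k] k) (z : R ⊗[k] D) j, b.repr (specialize t z) j = t (b'.repr z j) := by
    intro t z j
    induction z using TensorProduct.induction_on with
    | zero => simp only [map_zero, Finsupp.zero_apply]
    | add x y hx hy => simp only [map_add, Finsupp.add_apply, hx, hy]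
    | tmul r d =>
      rw [specialize_tmul, Algebra.TensorProduct.basis_repr_tmul, map_smul, Finsupp.smul_apply,
        Finsupp.smul_apply, Finsupp.mapRange_apply, smul_eq_mul, smul_eq_mul, map_mul,
        AlgHom.commutes]
      rfl
  obtain ⟨j, hj⟩ : ∃ j, b'.repr y j ≠ 0 := by
    by_contra! h
    exact hy (b'.repr.map_eq_zero_iff.mp (Finsupp.ext h))
  refine ⟨b'.repr y j, hj, fun t ht h0 => ht ?_⟩
  rw [← key, h0, map_zero, Finsupp.zero_apply]

theorem exists_smul_mem_range {R K : Type*} [CommRing R] [IsDomain R] [Field K] [Algebra R K]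
    [IsFractionRing R K] [Algebra k R] [Algebra k K] [IsScalarTower k R K] (x : K ⊗[k] D) :
    ∃ s : R, s ≠ 0 ∧ ∃ y : R ⊗[k] D,
      Algebra.TensorProduct.map (IsScalarTower.toAlgHom k R K) (AlgHom.id k D) y =
        algebraMap R K s • x := by
  have hsm : ∀ (r : R) (y : R ⊗[k] D),
      Algebra.TensorProduct.map (IsScalarTower.toAlgHom k R K) (AlgHom.id k D)
        ((r ⊗ₜ[k] (1 : D)) * y) = algebraMap R K r •
      Algebra.TensorProduct.map (IsScalarTower.toAlgHom k R K) (AlgHom.id k D) y := by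
    intro r y
    rw [map_mul, Algebra.TensorProduct.map_tmul, Algebra.smul_def]
    rfl
  induction x using TensorProduct.induction_on with
  | zero => exact ⟨1, one_ne_zero, 0, by rw [map_zero, smul_zero]⟩
  | add x y hx hy =>
    obtain ⟨s, hs, x', hx'⟩ := hx
    obtain ⟨t, ht, y', hy'⟩ := hy
    refine ⟨s * t, mul_ne_zero hs ht, (t ⊗ₜ[k] (1 : D)) * x' + (s ⊗ₜ[k] (1 : D)) * y', ?_⟩
    rw [map_add, hsm, hsm, hx', hy', smul_smul, smul_smul, smul_add, map_mul,
      mul_comm (algebraMap R K t)]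
  | tmul l d =>
    obtain ⟨r, s, hs, rfl⟩ := IsFractionRing.div_surjective (A := R) l
    have hs0 := nonZeroDivisors.ne_zero hs
    refine ⟨s, hs0, r ⊗ₜ[k] d, ?_⟩
    have hs1 : algebraMap R K s ≠ 0 := by
      rwa [Ne, FaithfulSMul.algebraMap_eq_zero_iff]
    rw [Algebra.TensorProduct.map_tmul, TensorProduct.smul_tmul', smul_eq_mul,
      mul_div_cancel₀ _ hs1]
    rfl

theorem isDomain_tensorProduct {K : Type*} [Infinite k] (σ : Type*) [Field K]
    [Algebra (MvPolynomial σ k) K] [IsFractionRing (MvPolynomial σ k) K] [Algebra k K]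
    [IsScalarTower k (MvPolynomial σ k) K] [IsDomain D] : IsDomain (K ⊗[k] D) := by
  have hnt : Nontrivial (K ⊗[k] D) := by
    have : Function.Injective (Algebra.TensorProduct.includeRight : D →ₐ[k] K ⊗[k] D) :=
      Algebra.TensorProduct.includeRight_injective (algebraMap k K).injective
    exact this.nontrivial
  have hinj : Function.Injective (Algebra.TensorProduct.map
      (IsScalarTower.toAlgHom k (MvPolynomial σ k) K) (AlgHom.id k D)) :=
    Module.Flat.rTensor_preserves_injective_linearMap (M := D)
      (IsScalarTower.toAlgHom k (MvPolynomial σ k) K).toLinearMap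
      (IsFractionRing.injective (MvPolynomial σ k) K)
  have hnz : NoZeroDivisors (K ⊗[k] D) := by
    refine ⟨fun {x y} hxy => ?_⟩
    by_contra! hne
    obtain ⟨s, hs, x', hx'⟩ := exists_smul_mem_range (R := MvPolynomial σ k) x
    obtain ⟨t, ht, y', hy'⟩ := exists_smul_mem_range (R := MvPolynomial σ k) y
    have hs1 : algebraMap (MvPolynomial σ k) K s ≠ 0 := by
      rwa [Ne, FaithfulSMul.algebraMap_eq_zero_iff]
    have ht1 : algebraMap (MvPolynomial σ k) K t ≠ 0 := by
      rwa [Ne, FaithfulSMul.algebraMap_eq_zero_iff]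
    have hx0 : x' ≠ 0 := by
      rintro rfl
      rw [map_zero] at hx'
      exact smul_ne_zero hs1 hne.1 hx'.symm
    have hy0 : y' ≠ 0 := by
      rintro rfl
      rw [map_zero] at hy'
      exact smul_ne_zero ht1 hne.2 hy'.symm
    have h0 : x' * y' = 0 := by
      apply hinj
      rw [map_mul, hx', hy', map_zero, smul_mul_smul_comm, hxy, smul_zero]
    obtain ⟨p, hp, hp'⟩ := exists_specialize_ne_zero hx0
    obtain ⟨q, hq, hq'⟩ := exists_specialize_ne_zero hy0
    obtain ⟨v, hv⟩ : ∃ v : σ → k, MvPolynomial.eval v (p * q) ≠ 0 := by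
      by_contra! h
      exact mul_ne_zero hp hq (MvPolynomial.funext fun v => by rw [h v, map_zero])
    rw [map_mul] at hv
    have h1 := hp' (MvPolynomial.aeval v) (by
      rw [MvPolynomial.aeval_eq_eval]; exact left_ne_zero_of_mul hv)
    have h2 := hq' (MvPolynomial.aeval v) (by
      rw [MvPolynomial.aeval_eq_eval]; exact right_ne_zero_of_mul hv)
    refine mul_ne_zero h1 h2 ?_
    rw [← map_mul, h0, map_zero]
  exact NoZeroDivisors.to_isDomain _

theorem isUnit_of_isDomain_of_finite {K A : Type*} [Field K] [Ring A] [IsDomain A] [Algebra K A]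
    [FiniteDimensional K A] {x : A} (hx : x ≠ 0) : IsUnit x := by
  let := divisionRingOfFiniteDimensional K A
  exact hx.isUnit

end Specialization

section Twist

variable {P ι : Type*} [Field P]

theorem homogeneousComponent_addMonoidHom (T : MvPolynomial ι P →+ MvPolynomial ι P) (d : ℕ)
    (hT : ∀ i g, g.IsHomogeneous i → (T g).IsHomogeneous (d + i)) (e : ℕ) (g : MvPolynomial ι P) :
    MvPolynomial.homogeneousComponent (d + e) (T g) =
      T (MvPolynomial.homogeneousComponent e g) := by
  conv_lhs => rw [← MvPolynomial.sum_homogeneousComponent g, map_sum, map_sum]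
  have h1 : ∀ i, MvPolynomial.homogeneousComponent (d + e)
      (T (MvPolynomial.homogeneousComponent i g)) =
      if e = i then T (MvPolynomial.homogeneousComponent i g) else 0 := by
    intro i
    rw [MvPolynomial.homogeneousComponent_of_mem (n := d + i)
      (hT i _ (MvPolynomial.homogeneousComponent_isHomogeneous i g))]
    simp only [add_right_inj]
  rw [Finset.sum_congr rfl fun i _ => h1 i, Finset.sum_ite_eq]
  split_ifs with h
  · rfl
  · rw [MvPolynomial.homogeneousComponent_eq_zero _ _ (by simpa using h), map_zero]

variable [Fintype ι]

/-- The semilinear substitution `X ↦ W X` composed with `s` on the coefficients. -/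
noncomputable def twist (s : P →+* P) (W : Matrix ι ι P) : MvPolynomial ι P →+* MvPolynomial ι P :=
  MvPolynomial.eval₂Hom (MvPolynomial.C.comp s) fun j =>
    ∑ l, MvPolynomial.C (W j l) * MvPolynomial.X l

theorem twist_C (s : P →+* P) (W : Matrix ι ι P) (x : P) :
    twist s W (MvPolynomial.C x) = MvPolynomial.C (s x) := MvPolynomial.eval₂Hom_C _ _ _

theorem twist_X (s : P →+* P) (W : Matrix ι ι P) (j : ι) :
    twist s W (MvPolynomial.X j) = ∑ l, MvPolynomial.C (W j l) * MvPolynomial.X l :=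
  MvPolynomial.eval₂Hom_X' _ _ _

theorem twist_isHomogeneous (s : P →+* P) (W : Matrix ι ι P) {A : MvPolynomial ι P} {d : ℕ}
    (hA : A.IsHomogeneous d) : (twist s W A).IsHomogeneous d := by
  have := hA.eval₂ (n := 1) (MvPolynomial.C.comp s)
    (fun j => ∑ l, MvPolynomial.C (W j l) * MvPolynomial.X l)
    (fun r => MvPolynomial.isHomogeneous_C _ _)
    (fun i => MvPolynomial.IsHomogeneous.sum _ _ _ fun l _ =>
      MvPolynomial.isHomogeneous_C_mul_X _ _)
  rwa [one_mul] at this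

theorem twist_comp [DecidableEq ι] (s t : P →+* P) (W W' : Matrix ι ι P) :
    (twist s W).comp (twist t W') = twist (s.comp t) (s.mapMatrix W' * W) := by
  apply MvPolynomial.ringHom_ext
  · intro r
    rw [RingHom.comp_apply, twist_C, twist_C, twist_C]; rfl
  · intro j
    rw [RingHom.comp_apply, twist_X, twist_X, map_sum]
    simp_rw [map_mul, twist_C, twist_X, Matrix.mul_apply, map_sum, Finset.sum_mul, Finset.mul_sum]
    rw [Finset.sum_comm]
    refine Finset.sum_congr rfl fun m _ => Finset.sum_congr rfl fun l _ => ?_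
    rw [← mul_assoc, MvPolynomial.C_mul]
    rfl

theorem twist_smul (s : P →+* P) (W : Matrix ι ι P) (a : P) {A : MvPolynomial ι P} {d : ℕ}
    (hA : A.IsHomogeneous d) : twist s (a • W) A = MvPolynomial.C (a ^ d) * twist s W A := by
  have key : ∀ m : ι →₀ ℕ, m.degree = d → ∀ r, twist s (a • W) (MvPolynomial.monomial m r) =
      MvPolynomial.C (a ^ d) * twist s W (MvPolynomial.monomial m r) := by
    intro m hm r
    rw [MvPolynomial.monomial_eq, map_mul, map_mul, twist_C, twist_C, Finsupp.prod_fintype _ _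
      fun i => pow_zero _, map_prod, map_prod]
    have : ∀ i, twist s (a • W) (MvPolynomial.X i ^ m i) =
        MvPolynomial.C (a ^ m i) * twist s W (MvPolynomial.X i ^ m i) := by
      intro i
      rw [map_pow, map_pow, map_pow, ← mul_pow, twist_X, twist_X, Finset.mul_sum]
      congr 1
      refine Finset.sum_congr rfl fun l _ => ?_
      rw [Matrix.smul_apply, smul_eq_mul, map_mul, mul_assoc]
    rw [Finset.prod_congr rfl fun i _ => this i, Finset.prod_mul_distrib, ← map_prod,
      Finset.prod_pow_eq_pow_sum, ← hm, Finsupp.degree_eq_sum]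
    ring
  conv_lhs => rw [A.as_sum, map_sum]
  conv_rhs => rw [A.as_sum, map_sum, Finset.mul_sum]
  refine Finset.sum_congr rfl fun m hm => key m ?_ _
  by_contra h
  exact (MvPolynomial.mem_support_iff.mp hm) (hA.coeff_eq_zero h)

variable [DecidableEq ι]

theorem twist_id_one : twist (RingHom.id P) (1 : Matrix ι ι P) = RingHom.id _ := by
  apply MvPolynomial.ringHom_ext
  · intro r
    rw [twist_C]; rfl
  · intro j
    rw [twist_X, Finset.sum_eq_single j]
    · rw [Matrix.one_apply_eq, map_one, one_mul]; rfl
    · intro l _ hl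
      rw [Matrix.one_apply_ne hl.symm, map_zero, zero_mul]
    · intro h; exact absurd (Finset.mem_univ j) h

theorem exists_twist_inverse (s : P ≃+* P) (W : Matrix ι ι P) (hW : IsUnit W) :
    ∃ Ψ : MvPolynomial ι P →+* MvPolynomial ι P, (∀ x, Ψ (twist (s : P →+* P) W x) = x) ∧
      ∀ x, twist (s : P →+* P) W (Ψ x) = x := by
  obtain ⟨u, rfl⟩ := hW
  have hs1 : (s : P →+* P).comp (s.symm : P →+* P) = RingHom.id P := by ext x; simp
  have hs2 : (s.symm : P →+* P).comp (s : P →+* P) = RingHom.id P := by ext x; simp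
  have h3 : (s : P →+* P).mapMatrix ((s.symm : P →+* P).mapMatrix (↑u⁻¹ : Matrix ι ι P)) =
      (↑u⁻¹ : Matrix ι ι P) := by
    refine Matrix.ext fun i j => ?_
    simp only [RingHom.mapMatrix_apply, Matrix.map_apply, RingHom.coe_coe,
      RingEquiv.apply_symm_apply]
  refine ⟨twist (s.symm : P →+* P) ((s.symm : P →+* P).mapMatrix (↑u⁻¹ : Matrix ι ι P)),
    fun x => ?_, fun x => ?_⟩
  · rw [← RingHom.comp_apply, twist_comp, hs2]
    have h4 : (s.symm : P →+* P).mapMatrix (u : Matrix ι ι P) *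
        (s.symm : P →+* P).mapMatrix (↑u⁻¹ : Matrix ι ι P) = 1 :=
      ((s.symm : P →+* P).mapMatrix.map_mul (u : Matrix ι ι P) (↑u⁻¹ : Matrix ι ι P)).symm.trans
        ((congrArg (s.symm : P →+* P).mapMatrix u.mul_inv).trans (map_one _))
    rw [h4, twist_id_one]
    rfl
  · rw [← RingHom.comp_apply, twist_comp, hs1, h3, Units.inv_mul, twist_id_one]
    rfl

end Twist

section Gcd

theorem exists_gcd {Q G : Type*} [CommRing Q] [IsDomain Q] [UniqueFactorizationMonoid Q]
    [Fintype G] (A : G → Q) : ∃ g, (∀ τ, g ∣ A τ) ∧ ∀ d, (∀ τ, d ∣ A τ) → d ∣ g := by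
  classical
  let := UniqueFactorizationMonoid.toGCDMonoid Q
  have key : ∀ s : Finset G, ∃ g, (∀ τ ∈ s, g ∣ A τ) ∧ ∀ d, (∀ τ ∈ s, d ∣ A τ) → d ∣ g := by
    intro s
    induction s using Finset.induction_on with
    | empty => exact ⟨0, by simp, by simp⟩
    | insert a s _ ih =>
      obtain ⟨g, h1, h2⟩ := ih
      refine ⟨gcd (A a) g, fun τ hτ => ?_, fun d hd => ?_⟩
      · rcases Finset.mem_insert.mp hτ with rfl | hτ
        · exact gcd_dvd_left _ _
        · exact (gcd_dvd_right _ _).trans (h1 τ hτ)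
      · exact dvd_gcd (hd a (Finset.mem_insert_self _ _))
          (h2 d fun τ hτ => hd τ (Finset.mem_insert_of_mem hτ))
  obtain ⟨g, h1, h2⟩ := key Finset.univ
  exact ⟨g, fun τ => h1 τ (Finset.mem_univ τ), fun d hd => h2 d fun τ _ => hd τ⟩

theorem gcd_mul_left_dvd {Q G : Type*} [CommRing Q] [IsDomain Q] [UniqueFactorizationMonoid Q]
    [Fintype G] {B : G → Q} {g a x : Q} (ha : a ≠ 0) (hg : ∀ d, (∀ τ, d ∣ B τ) → d ∣ g)
    (hx : ∀ τ, x ∣ a * B τ) : x ∣ a * g := by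
  obtain ⟨y, h1, h2⟩ := exists_gcd fun τ => a * B τ
  obtain ⟨e, rfl⟩ := h2 a fun τ => dvd_mul_right _ _
  refine (h2 x hx).trans (mul_dvd_mul_left a (hg e fun τ => ?_))
  exact (mul_dvd_mul_iff_left ha).mp (h1 τ)

end Gcd

theorem exists_coboundary_of_homogeneous {P G ι : Type*} [Field P] [Group G]
    [Fintype G] (act : G →  P → P) (Φ : G → MvPolynomial ι P →+* MvPolynomial ι P)
    (hΦC : ∀ σ x, Φ σ (MvPolynomial.C x) = MvPolynomial.C (act σ x))
    (hinv : ∀ σ, ∃ Ψ : MvPolynomial ι P →+* MvPolynomial ι P, (∀ x, Ψ (Φ σ x) = x) ∧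
      ∀ x, Φ σ (Ψ x) = x)
    (hΦh : ∀ σ x i, x.IsHomogeneous i → (Φ σ x).IsHomogeneous i)
    (c c' : G → G → P) (hc : ∀ σ τ, c σ τ ≠ 0)
    (hcomp : ∀ σ τ (x : MvPolynomial ι P) (i : ℕ), x.IsHomogeneous i →
      Φ σ (Φ τ x) = MvPolynomial.C ((c σ τ)⁻¹ ^ i) * Φ (σ * τ) x)
    (A : G → MvPolynomial ι P) (h : MvPolynomial ι P) (d : ℕ) (hA : ∀ σ, (A σ).IsHomogeneous d)
    (hh : h.IsHomogeneous d) (hA0 : ∀ σ, A σ ≠ 0) (hh0 : h ≠ 0)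
    (hrel : ∀ σ τ, A σ * Φ σ (A τ) = MvPolynomial.C (c' σ τ) * A (σ * τ) * Φ σ h) :
    ∃ (κ : G → P) (e : ℕ), (∀ σ, κ σ ≠ 0) ∧ ∀ σ τ,
      c' σ τ * κ (σ * τ) * c σ τ ^ d = κ σ * act σ (κ τ) * c σ τ ^ e := by
  have hinj : ∀ σ, Function.Injective (Φ σ) := fun σ => by
    obtain ⟨Ψ, h1, _⟩ := hinv σ
    exact Function.LeftInverse.injective h1
  have hne : ∀ σ x, x ≠ 0 → Φ σ x ≠ 0 := fun σ x hx => by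
    rwa [Ne, map_eq_zero_iff _ (hinj σ)]
  have hC0 : ∀ σ τ, c' σ τ ≠ 0 := by
    intro σ τ h0
    have := hrel σ τ
    rw [h0, map_zero, zero_mul, zero_mul] at this
    exact mul_ne_zero (hA0 σ) (hne σ _ (hA0 τ)) this
  obtain ⟨g, hg1, hg2⟩ := exists_gcd A
  have hg0 : g ≠ 0 := by
    rintro rfl
    exact hA0 1 (zero_dvd_iff.mp (hg1 1))
  have hΦg1 : ∀ σ τ, Φ σ g ∣ Φ σ (A τ) := fun σ τ => map_dvd (Φ σ) (hg1 τ)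
  have hΦg2 : ∀ σ y, (∀ τ, y ∣ Φ σ (A τ)) → y ∣ Φ σ g := by
    intro σ y hy
    obtain ⟨Ψ, h1, h2⟩ := hinv σ
    rw [← h2 y]
    refine map_dvd (Φ σ) (hg2 _ fun τ => ?_)
    rw [← h1 (A τ)]
    exact map_dvd Ψ (hy τ)
  have hassoc : ∀ σ, ∃ x : P, x ≠ 0 ∧ A σ * Φ σ g = MvPolynomial.C x * (g * Φ σ h) := by
    intro σ
    have hd1 : Φ σ h * g ∣ A σ * Φ σ g := by
      refine gcd_mul_left_dvd (hA0 σ) (hΦg2 σ) fun τ => ?_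
      rw [hrel, mul_comm (Φ σ h)]
      exact mul_dvd_mul_right ((hg1 _).mul_left _) _
    have hd2 : A σ * Φ σ g ∣ Φ σ h * g := by
      refine gcd_mul_left_dvd (B := A) (hne σ h hh0) hg2 fun τ => ?_
      have h1 : A σ * Φ σ (A (σ⁻¹ * τ)) = MvPolynomial.C (c' σ (σ⁻¹ * τ)) * (Φ σ h * A τ) := by
        rw [hrel, mul_inv_cancel_left]; ring
      have h2 : Φ σ h * A τ = MvPolynomial.C (c' σ (σ⁻¹ * τ))⁻¹ * (A σ * Φ σ (A (σ⁻¹ * τ))) := by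
        rw [h1, ← mul_assoc, ← MvPolynomial.C_mul, inv_mul_cancel₀ (hC0 _ _), MvPolynomial.C_1,
          one_mul]
      rw [h2]
      exact (mul_dvd_mul_left _ (hΦg1 _ _)).mul_left _
    obtain ⟨u, hu⟩ := associated_of_dvd_dvd hd1 hd2
    obtain ⟨x, hx, hxu⟩ := MvPolynomial.isUnit_iff_eq_C_of_isReduced.mp u.isUnit
    refine ⟨x, hx.ne_zero, ?_⟩
    rw [← hu, hxu]
    ring
  choose κ hκ0 hκ using hassoc
  obtain ⟨e, he⟩ : ∃ e, MvPolynomial.homogeneousComponent e g ≠ 0 := by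
    by_contra! h0
    apply hg0
    rw [← MvPolynomial.sum_homogeneousComponent g]
    exact Finset.sum_eq_zero fun i _ => h0 i
  set y := MvPolynomial.homogeneousComponent e g with hy
  have hyh : y.IsHomogeneous e := MvPolynomial.homogeneousComponent_isHomogeneous e g
  have hκ' : ∀ σ, A σ * Φ σ y = MvPolynomial.C (κ σ) * (y * Φ σ h) := by
    intro σ
    have h1 := homogeneousComponent_addMonoidHom
      ((AddMonoidHom.mulLeft (A σ)).comp (Φ σ).toAddMonoidHom) d
      (fun i x hx => (hA σ).mul (hΦh _ _ _ hx)) e g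
    have h2 := homogeneousComponent_addMonoidHom
      (AddMonoidHom.mulLeft (MvPolynomial.C (κ σ) * Φ σ h)) d
      (fun i x hx => by
        have := ((MvPolynomial.isHomogeneous_C ι (κ σ)).mul
          (hΦh σ h d hh)).mul hx
        rwa [zero_add] at this) e g
    have h3 : (AddMonoidHom.mulLeft (A σ)).comp (Φ σ).toAddMonoidHom g =
        AddMonoidHom.mulLeft (MvPolynomial.C (κ σ) * Φ σ h) g := by
      refine (hκ σ).trans ?_
      rw [AddMonoidHom.coe_mulLeft]; ring
    rw [h3, h2] at h1
    refine h1.symm.trans ?_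
    rw [AddMonoidHom.coe_mulLeft]; ring
  refine ⟨κ, e, hκ0, fun σ τ => ?_⟩
  have h1 := congrArg (Φ σ) (hκ' τ)
  rw [map_mul, map_mul, map_mul, hcomp σ τ y e hyh, hcomp σ τ h d hh] at h1
  rw [hΦC] at h1
  have hc0 := hc σ τ
  have h3 : MvPolynomial.C (c' σ τ * κ (σ * τ) * (c σ τ)⁻¹ ^ e) * (y * Φ (σ * τ) h * Φ σ h) =
      MvPolynomial.C (κ σ * act σ (κ τ) * (c σ τ)⁻¹ ^ d) * (y * Φ (σ * τ) h * Φ σ h) := by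
    have h4 := hrel σ τ
    have h5 := hκ' σ
    have h6 := hκ' (σ * τ)
    simp only [map_mul]
    linear_combination (-(MvPolynomial.C (c' σ τ) * MvPolynomial.C ((c σ τ)⁻¹ ^ e) * Φ σ h)) * h6
      + A σ * h1 - (MvPolynomial.C ((c σ τ)⁻¹ ^ e) * Φ (σ * τ) y) * h4 +
      MvPolynomial.C (act σ (κ τ)) * MvPolynomial.C ((c σ τ)⁻¹ ^ d) * Φ (σ * τ) h * h5
  have h4 := mul_right_cancel₀ (mul_ne_zero (mul_ne_zero he (hne _ _ hh0)) (hne _ _ hh0)) h3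
  have h5 := MvPolynomial.C_injective _ _ h4
  have h6 : c σ τ ^ d * (c σ τ)⁻¹ ^ d = 1 := by rw [← mul_pow, mul_inv_cancel₀ hc0, one_pow]
  have h7 : c σ τ ^ e * (c σ τ)⁻¹ ^ e = 1 := by rw [← mul_pow, mul_inv_cancel₀ hc0, one_pow]
  linear_combination (c σ τ ^ d * c σ τ ^ e) * h5 + (κ σ * act σ (κ τ) * c σ τ ^ e) * h6 -
    (c' σ τ * κ (σ * τ) * c σ τ ^ d) * h7

/-- A cocycle that becomes a coboundary of homogeneous fractions for the twisted action is a power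
of the twisting cocycle. -/
theorem exists_coboundary_of_twist {k P G ι : Type*} [Field k] [Field P] [Algebra k P] [Group G]
    [Fintype G] [Fintype ι] [DecidableEq ι] (act : G →* (P ≃ₐ[k] P)) (W : G → Matrix ι ι P)
    (hWu : ∀ σ, IsUnit (W σ)) (c c' : G → G → P) (hc : ∀ σ τ, c σ τ ≠ 0)
    (hW : ∀ σ τ, (act σ).mapMatrix (W τ) * W σ = (c σ τ)⁻¹ • W (σ * τ))
    (A : G → MvPolynomial ι P) (h : MvPolynomial ι P) (d : ℕ) (hA : ∀ σ, (A σ).IsHomogeneous d)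
    (hh : h.IsHomogeneous d) (hA0 : ∀ σ, A σ ≠ 0) (hh0 : h ≠ 0)
    (hrel : ∀ σ τ, A σ * twist (act σ : P →+* P) (W σ) (A τ) =
      MvPolynomial.C (c' σ τ) * A (σ * τ) * twist (act σ : P →+* P) (W σ) h) :
    ∃ (κ : G → P) (e : ℕ), (∀ σ, κ σ ≠ 0) ∧ ∀ σ τ,
      c' σ τ * κ (σ * τ) * c σ τ ^ d = κ σ * act σ (κ τ) * c σ τ ^ e := by
  refine exists_coboundary_of_homogeneous (fun σ x => act σ x)
    (fun σ => twist (act σ : P →+* P) (W σ)) (fun σ x => twist_C _ _ _)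
    (fun σ => exists_twist_inverse (act σ).toRingEquiv (W σ) (hWu σ))
    (fun σ x i hx => twist_isHomogeneous _ _ hx) c c' hc (fun σ τ x i hx => ?_)
    A h d hA hh hA0 hh0 hrel
  have h1 : (twist (act σ : P →+* P) (W σ)).comp (twist (act τ : P →+* P) (W τ)) =
      twist (act (σ * τ) : P →+* P) ((c σ τ)⁻¹ • W (σ * τ)) := by
    rw [twist_comp, ← hW, map_mul act]
    rfl
  rw [← RingHom.comp_apply, h1, twist_smul _ _ _ hx]

section Eigenvector

variable {ι : Type*} [Fintype ι] [DecidableEq ι]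

theorem exists_eigenvector {E : Type*} [Field E] (N : Matrix ι ι E) (t : E)
    (ht : N.charpoly.IsRoot t) : ∃ z ≠ 0, N.mulVec z = t • z := by
  have h1 : (Matrix.scalar ι t - N).det = 0 := by
    rw [← Matrix.eval_charpoly]; exact ht
  obtain ⟨z, hz, hz0⟩ := Matrix.exists_mulVec_eq_zero_iff.mpr h1
  refine ⟨z, hz, ?_⟩
  rw [Matrix.sub_mulVec, sub_eq_zero] at hz0
  rw [← hz0, Matrix.scalar_apply, ← Matrix.smul_one_eq_diagonal, Matrix.smul_mulVec,
    Matrix.one_mulVec]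

theorem exists_smul_of_separable {E : Type*} [Field E] (N : Matrix ι ι E) (t : E)
    (hsep : N.charpoly.Separable) {z y : ι → E} (hz0 : z ≠ 0) (hz : N.mulVec z = t • z)
    (hy : N.mulVec y = t • y) : ∃ b : E, y = b • z := by
  have h1 := LinearMap.finrank_eigenspace_le (Matrix.toLin' N) t
  rw [Matrix.charpoly_toLin'] at h1
  have h2 : N.charpoly.rootMultiplicity t ≤ 1 := rootMultiplicity_le_one_of_separable hsep t
  have hz' : z ∈ Module.End.eigenspace (Matrix.toLin' N) t := by
    rw [Module.End.mem_eigenspace_iff, Matrix.toLin'_apply, hz]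
  have hy' : y ∈ Module.End.eigenspace (Matrix.toLin' N) t := by
    rw [Module.End.mem_eigenspace_iff, Matrix.toLin'_apply, hy]
  obtain ⟨b, hb⟩ := (finrank_le_one_iff.mp (h1.trans h2))
  obtain ⟨p, hp⟩ := hb ⟨z, hz'⟩
  obtain ⟨q, hq⟩ := hb ⟨y, hy'⟩
  have hp' : p • (b : ι → E) = z := congrArg Subtype.val hp
  have hq' : q • (b : ι → E) = y := congrArg Subtype.val hq
  have hp0 : p ≠ 0 := by
    rintro rfl
    exact hz0 (by rw [← hp', zero_smul])
  exact ⟨q * p⁻¹, by rw [← hp', smul_smul, mul_assoc, inv_mul_cancel₀ hp0, mul_one, hq']⟩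

omit [DecidableEq ι] in
theorem map_mulVec' {R S : Type*} [CommRing R] [CommRing S] (f : R →+* S) (M : Matrix ι ι R)
    (v : ι → R) : (fun i => f (M.mulVec v i)) = (M.map f).mulVec fun i => f (v i) :=
  funext fun i => RingHom.map_mulVec f M v i

theorem exists_cochain_of_eigenvector {G L E : Type*} [Group G] [Field L] [Field E]
    (act : G → L →+* L) (Φ : G → E →+* E) (hΦ : ∀ σ τ x, Φ σ (Φ τ x) = Φ (σ * τ) x)
    (j : L →+* E) (hj : ∀ σ x, Φ σ (j x) = j (act σ x)) (U : G → Matrix ι ι L)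
    (hU : ∀ σ, IsUnit (U σ)) (c : G → G → L)
    (hcoc : ∀ σ τ, U σ * (U τ).map (act σ) = c σ τ • U (σ * τ)) (N : Matrix ι ι L)
    (hN : ∀ σ, U σ * N.map (act σ) = N * U σ) (t : E) (ht : ∀ σ, Φ σ t = t)
    (hroot : (N.charpoly.map j).IsRoot t) (hsep : N.charpoly.Separable) :
    ∃ b : G → E, (∀ σ, b σ ≠ 0) ∧ ∀ σ τ, b σ * Φ σ (b τ) = j (c σ τ) * b (σ * τ) := by
  rw [← Matrix.charpoly_map] at hroot
  have hsep' : (N.map j).charpoly.Separable := by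
    rw [Matrix.charpoly_map]; exact hsep.map
  obtain ⟨z, hz0, hz⟩ := exists_eigenvector (N.map j) t hroot
  have hmap : ∀ σ (M : Matrix ι ι L), (M.map j).map (Φ σ) = (M.map (act σ)).map j := by
    intro σ M
    refine Matrix.ext fun i l => ?_
    exact hj σ _
  have hmul : ∀ M M' : Matrix ι ι L, (M * M').map j = M.map j * M'.map j := fun M M' =>
    Matrix.map_mul
  have hΦz : ∀ σ, ((N.map (act σ)).map j).mulVec (fun i => Φ σ (z i)) =
      t • fun i => Φ σ (z i) := by
    intro σ
    rw [← hmap, ← map_mulVec', hz]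
    funext i
    simp [ht]
  have h1 : ∀ σ, ∃ b : E, ((U σ).map j).mulVec (fun i => Φ σ (z i)) = b • z := by
    intro σ
    refine exists_smul_of_separable (N.map j) t hsep' hz0 hz ?_
    rw [Matrix.mulVec_mulVec, ← hmul, ← hN, hmul, ← Matrix.mulVec_mulVec, hΦz, Matrix.mulVec_smul]
  choose b hb using h1
  have hUj : ∀ σ, IsUnit ((U σ).map j) := fun σ => (hU σ).map j.mapMatrix
  have hcancel : ∀ x y : E, x • z = y • z → x = y := fun x y h => smul_left_injective E hz0 h
  refine ⟨b, fun σ h0 => ?_, fun σ τ => ?_⟩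
  · have h2 := hb σ
    rw [h0, zero_smul] at h2
    have h3 := (Matrix.mulVec_injective_iff_isUnit.mpr (hUj σ))
      (h2.trans (Matrix.mulVec_zero _).symm)
    apply hz0
    funext i
    have := congrFun h3 i
    exact (map_eq_zero (Φ σ)).mp this
  · apply hcancel
    have h2 := congrArg (fun v : ι → E => ((U σ).map j).mulVec fun i => Φ σ (v i)) (hb τ)
    beta_reduce at h2
    rw [map_mulVec', hmap, Matrix.mulVec_mulVec, ← hmul, hcoc] at h2
    have h3 : (fun i => Φ σ ((b τ • z) i)) = Φ σ (b τ) • fun i => Φ σ (z i) := by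
      funext i; simp
    have h4 : (c σ τ • U (σ * τ)).map j = j (c σ τ) • (U (σ * τ)).map j := by
      refine Matrix.ext fun i l => ?_
      simp
    rw [h3, Matrix.mulVec_smul, hb, h4, Matrix.smul_mulVec, funext fun i => hΦ σ τ (z i), hb,
      smul_smul, smul_smul] at h2
    rw [mul_comm, ← h2]

end Eigenvector

section GenericPoint

theorem exists_specialization_subalgebra {P R E F : Type*} [Field P] [CommRing R]
    [Algebra P R] [Field E] [Algebra R E] [FaithfulSMul R E] [Algebra P E] [IsScalarTower P R E]
    [Field F] [Algebra P F] (ψ : R →ₐ[P] F) :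
    ∃ T : Subalgebra P (E × F),
      (∀ a b : R, ψ b ≠ 0 → (algebraMap R E a / algebraMap R E b, ψ a / ψ b) ∈ T) ∧
      ∀ z ∈ T, z.1 = 0 → z.2 = 0 := by
  have hb0 : ∀ b : R, ψ b ≠ 0 → algebraMap R E b ≠ 0 := by
    intro b hb h0
    rw [FaithfulSMul.algebraMap_eq_zero_iff] at h0
    exact hb (by rw [h0, map_zero])
  refine ⟨{ carrier := {z | ∃ a b : R, ψ b ≠ 0 ∧
              z = (algebraMap R E a / algebraMap R E b, ψ a / ψ b)},
            mul_mem' := ?_, add_mem' := ?_, algebraMap_mem' := ?_ }, ?_, ?_⟩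
  · rintro _ _ ⟨a, b, hb, rfl⟩ ⟨a', b', hb', rfl⟩
    refine ⟨a * a', b * b', by rw [map_mul]; exact mul_ne_zero hb hb', ?_⟩
    have h1 := hb0 b hb
    have h2 := hb0 b' hb'
    refine Prod.ext ?_ ?_
    · simp only [map_mul, Prod.mk_mul_mk]; field_simp
    · simp only [map_mul, Prod.mk_mul_mk]; field_simp
  · rintro _ _ ⟨a, b, hb, rfl⟩ ⟨a', b', hb', rfl⟩
    refine ⟨a * b' + a' * b, b * b', by rw [map_mul]; exact mul_ne_zero hb hb', ?_⟩
    have h1 := hb0 b hb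
    have h2 := hb0 b' hb'
    refine Prod.ext ?_ ?_
    · simp only [map_mul, map_add, Prod.mk_add_mk]; field_simp
    · simp only [map_mul, map_add, Prod.mk_add_mk]; field_simp
  · intro r
    refine ⟨algebraMap P R r, 1, by rw [map_one]; exact one_ne_zero, ?_⟩
    rw [map_one, map_one, div_one, div_one, ← IsScalarTower.algebraMap_apply, AlgHom.commutes]
    rfl
  · intro a b hb
    exact ⟨a, b, hb, rfl⟩
  · rintro _ ⟨a, b, hb, rfl⟩ h0
    have h1 : algebraMap R E a = 0 := (div_eq_zero_iff.mp h0).resolve_right (hb0 b hb)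
    rw [FaithfulSMul.algebraMap_eq_zero_iff] at h1
    change ψ a / ψ b = 0
    rw [h1, map_zero, zero_div]

theorem aeval_smul_of_isHomogeneous {P A κ : Type*} [CommRing P] [CommRing A] [Algebra P A]
    {p : MvPolynomial κ P} {e : ℕ} (hp : p.IsHomogeneous e) (s : A) (x : κ → A) :
    MvPolynomial.aeval (fun i => s * x i) p = s ^ e * MvPolynomial.aeval x p := by
  rw [MvPolynomial.aeval_def, MvPolynomial.aeval_def, MvPolynomial.eval₂_eq,
    MvPolynomial.eval₂_eq, Finset.mul_sum]
  refine Finset.sum_congr rfl fun m hm => ?_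
  have : m.degree = e := by
    by_contra h
    exact (MvPolynomial.mem_support_iff.mp hm) (hp.coeff_eq_zero h)
  simp_rw [mul_pow]
  rw [Finset.prod_mul_distrib, Finset.prod_pow_eq_pow_sum, ← this]
  rw [Finsupp.degree_apply]
  ring

theorem aeval_ne_zero_of_pole {P F₀ F κ : Type*} [Field P] [Field F₀] [Algebra P F₀] [Field F]
    [Algebra F₀[X] F] [FaithfulSMul F₀[X] F] [Algebra P F] [IsScalarTower P F₀[X] F]
    {w : κ → F₀} (hw : AlgebraicIndependent P w) (g : κ → F₀[X]) (hg : ∀ i, (g i).eval 0 = w i)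
    (a : κ → F) (ha : ∀ i, algebraMap F₀[X] F X * a i = algebraMap F₀[X] F (g i))
    {p : MvPolynomial κ P} (hp : p ≠ 0) : MvPolynomial.aeval a p ≠ 0 := by
  intro h0
  set d := p.totalDegree with hd
  have h1 : ∀ e ∈ Finset.range (d + 1), algebraMap F₀[X] F (X ^ (d - e) *
      MvPolynomial.aeval g (MvPolynomial.homogeneousComponent e p)) =
      algebraMap F₀[X] F X ^ d * MvPolynomial.aeval a (MvPolynomial.homogeneousComponent e p) := by
    intro e he
    have he' : e ≤ d := Nat.lt_succ_iff.mp (Finset.mem_range.mp he)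
    have h2 := aeval_smul_of_isHomogeneous
      (MvPolynomial.homogeneousComponent_isHomogeneous e p) (algebraMap F₀[X] F X) a
    rw [funext ha] at h2
    have h3 : MvPolynomial.aeval (fun i => algebraMap F₀[X] F (g i))
        (MvPolynomial.homogeneousComponent e p) = algebraMap F₀[X] F
          (MvPolynomial.aeval g (MvPolynomial.homogeneousComponent e p)) :=
      MvPolynomial.aeval_algebraMap_apply _ _ _
    rw [map_mul, ← h3, h2, map_pow, ← mul_assoc, ← pow_add, Nat.sub_add_cancel he']
  have h2 : ∑ e ∈ Finset.range (d + 1), X ^ (d - e) *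
      MvPolynomial.aeval g (MvPolynomial.homogeneousComponent e p) = 0 := by
    rw [← FaithfulSMul.algebraMap_eq_zero_iff F₀[X] F, map_sum, Finset.sum_congr rfl h1,
      ← Finset.mul_sum, ← map_sum, MvPolynomial.sum_homogeneousComponent, h0, mul_zero]
  have h3 := congrArg (eval 0) h2
  rw [eval_finsetSum, Finset.sum_range_succ, Finset.sum_eq_zero, zero_add, Nat.sub_self,
    pow_zero, one_mul, eval_zero] at h3
  · have h4 : eval 0 (MvPolynomial.aeval g (MvPolynomial.homogeneousComponent d p)) =
        MvPolynomial.aeval w (MvPolynomial.homogeneousComponent d p) := by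
      have h5 := MvPolynomial.map_aeval g (evalRingHom (0 : F₀))
        (MvPolynomial.homogeneousComponent d p)
      rw [coe_evalRingHom] at h5
      rw [h5, MvPolynomial.aeval_def, funext hg, MvPolynomial.coe_eval₂Hom]
      congr 1
      refine RingHom.ext fun x => ?_
      rw [RingHom.comp_apply, Polynomial.algebraMap_apply, coe_evalRingHom, eval_C]
    rw [h4] at h3
    have h6 : MvPolynomial.homogeneousComponent d p = 0 := by
      have := hw
      rw [algebraicIndependent_iff] at this
      exact this _ h3
    obtain ⟨m, hm, hm'⟩ := p.support.exists_mem_eq_sup (MvPolynomial.support_nonempty.mpr hp)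
      (fun m => m.sum fun _ e => e)
    have h7 := MvPolynomial.coeff_homogeneousComponent d p m
    rw [h6, if_pos, MvPolynomial.coeff_zero] at h7
    · exact MvPolynomial.mem_support_iff.mp hm h7.symm
    · exact hm'.symm
  · intro e he
    rw [eval_mul, eval_pow, eval_X, zero_pow (by have := Finset.mem_range.mp he; lia), zero_mul]

/-- The coefficients of the diagonal perturbation of `M` having `y` as an eigenvector. -/
noncomputable def pointCoord {P : Type*} [Field P] {m : ℕ} (θ : Fin (m + 1) → P)
    (M : Matrix (Fin (m + 1)) (Fin (m + 1)) P) {A : Type*} [Field A] [Algebra P A]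
    (y : Fin (m + 1) → A) (i : Fin (m + 1)) : A :=
  ∑ j, algebraMap P A ((Matrix.vandermonde θ)⁻¹ i j) *
    (-∑ l, algebraMap P A (M j l) * (y l / y j))

section Coord

variable {P : Type*} [Field P] {m : ℕ} {θ : Fin (m + 1) → P} (hθ : Function.Injective θ)
  (M : Matrix (Fin (m + 1)) (Fin (m + 1)) P) {A : Type*} [Field A] [Algebra P A]

include hθ

theorem sum_vandermonde_mul_inv (j j' : Fin (m + 1)) :
    ∑ i : Fin (m + 1), θ j ^ (i : ℕ) * (Matrix.vandermonde θ)⁻¹ i j' = if j = j' then 1 else 0 := by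
  have h : IsUnit (Matrix.vandermonde θ).det :=
    (Matrix.det_vandermonde_ne_zero_iff.mpr hθ).isUnit
  have := congrFun (congrFun (Matrix.mul_nonsing_inv _ h) j) j'
  rw [Matrix.mul_apply, Matrix.one_apply] at this
  exact this

theorem sum_inv_mul_vandermonde (i i' : Fin (m + 1)) :
    ∑ j, (Matrix.vandermonde θ)⁻¹ i j * θ j ^ (i' : ℕ) = if i = i' then 1 else 0 := by
  have h : IsUnit (Matrix.vandermonde θ).det :=
    (Matrix.det_vandermonde_ne_zero_iff.mpr hθ).isUnit
  have := congrFun (congrFun (Matrix.nonsing_inv_mul _ h) i) i'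
  rw [Matrix.mul_apply, Matrix.one_apply] at this
  exact this

theorem sum_inv_mul_sum (ζ : Fin (m + 1) → A) (i : Fin (m + 1)) :
    ∑ j, algebraMap P A ((Matrix.vandermonde θ)⁻¹ i j) *
      (∑ i', ζ i' * algebraMap P A (θ j ^ (i' : ℕ))) = ζ i := by
  simp_rw [Finset.mul_sum]
  rw [Finset.sum_comm]
  have h1 : ∀ i', ∑ j, algebraMap P A ((Matrix.vandermonde θ)⁻¹ i j) *
      (ζ i' * algebraMap P A (θ j ^ (i' : ℕ))) = if i = i' then ζ i' else 0 := by
    intro i'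
    have := congrArg (algebraMap P A) (sum_inv_mul_vandermonde hθ i i')
    rw [map_sum] at this
    simp_rw [map_mul] at this
    simp_rw [mul_left_comm _ (ζ i')]
    rw [← Finset.mul_sum, this]
    split_ifs <;> simp
  rw [Finset.sum_congr rfl fun i' _ => h1 i', Finset.sum_ite_eq, if_pos (Finset.mem_univ _)]

theorem sum_pointCoord (y : Fin (m + 1) → A) (j : Fin (m + 1)) :
    ∑ i, pointCoord θ M y i * algebraMap P A (θ j ^ (i : ℕ)) =
      -∑ l, algebraMap P A (M j l) * (y l / y j) := by
  unfold pointCoord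
  simp_rw [Finset.sum_mul]
  rw [Finset.sum_comm]
  have h1 : ∀ j', ∑ i : Fin (m + 1), algebraMap P A ((Matrix.vandermonde θ)⁻¹ i j') *
      (-∑ l, algebraMap P A (M j' l) * (y l / y j')) * algebraMap P A (θ j ^ (i : ℕ)) =
      if j = j' then -∑ l, algebraMap P A (M j' l) * (y l / y j') else 0 := by
    intro j'
    have := congrArg (algebraMap P A) (sum_vandermonde_mul_inv hθ j j')
    rw [map_sum] at this
    simp_rw [map_mul] at this
    simp_rw [mul_right_comm]
    rw [← Finset.sum_mul]
    simp_rw [mul_comm (algebraMap P A ((Matrix.vandermonde θ)⁻¹ _ _))]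
    rw [this]
    split_ifs <;> simp
  rw [Finset.sum_congr rfl fun i' _ => h1 i', Finset.sum_ite_eq, if_pos (Finset.mem_univ _)]

theorem eq_of_sum_eq {ζ ζ' : Fin (m + 1) → A}
    (h : ∀ j, ∑ i, ζ i * algebraMap P A (θ j ^ (i : ℕ)) =
      ∑ i, ζ' i * algebraMap P A (θ j ^ (i : ℕ))) : ζ = ζ' := by
  funext i
  rw [← sum_inv_mul_sum hθ ζ i, ← sum_inv_mul_sum hθ ζ' i]
  exact Finset.sum_congr rfl fun j _ => by rw [h]

end Coord

theorem exists_polynomial_pointCoord {P F₀ F : Type*} [Field P] [Field F₀] [Algebra P F₀] [Field F]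
    [Algebra F₀[X] F] [FaithfulSMul F₀[X] F] [Algebra P F] [IsScalarTower P F₀[X] F] {m : ℕ}
    {w : Fin m → F₀} (hw : LinearIndependent P w) {θ : Fin (m + 1) → P}
    (hθ : Function.Injective θ) (M : Matrix (Fin (m + 1)) (Fin (m + 1)) P)
    (hM : ∀ j : Fin m, M j.castSucc (Fin.last m) ≠ 0) :
    ∃ (y : Fin (m + 1) → F) (g : Fin m → F₀[X]), (∀ j, y j ≠ 0) ∧ (∀ i, (g i).eval 0 = w i) ∧
      ∀ i, algebraMap F₀[X] F X * pointCoord θ M y i.succ = algebraMap F₀[X] F (g i) := by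
  obtain ⟨ζ, hζ0, hζ⟩ : ∃ ζ : Fin (m + 1) → F₀,
      ζ 0 = -∑ i : Fin m, algebraMap P F₀ (θ (Fin.last m) ^ ((i : ℕ) + 1)) * w i ∧
      ∀ i : Fin m, ζ i.succ = w i := ⟨Fin.cons _ w, Fin.cons_zero _ _, fun i => Fin.cons_succ _ _ _⟩
  obtain ⟨μ, hμ⟩ : ∃ μ : Fin (m + 1) → F₀,
      ∀ j, μ j = ∑ i', ζ i' * algebraMap P F₀ (θ j ^ (i' : ℕ)) := ⟨_, fun j => rfl⟩
  have hμ' : ∀ j, μ j = ∑ i : Fin m,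
      (θ j ^ ((i : ℕ) + 1) - θ (Fin.last m) ^ ((i : ℕ) + 1)) • w i := by
    intro j
    rw [hμ, Fin.sum_univ_succ, hζ0, Fin.val_zero, pow_zero, map_one, mul_one, neg_add_eq_sub,
      ← Finset.sum_sub_distrib]
    refine Finset.sum_congr rfl fun i _ => ?_
    rw [hζ, Fin.val_succ, Algebra.smul_def, map_sub]
    ring
  have hμl : μ (Fin.last m) = 0 := by
    rw [hμ']
    exact Finset.sum_eq_zero fun i _ => by rw [sub_self, zero_smul]
  have hμ0 : ∀ j : Fin m, μ j.castSucc ≠ 0 := by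
    intro j h0
    rw [hμ'] at h0
    have h1 := Fintype.linearIndependent_iff.mp hw _ h0 ⟨0, j.pos⟩
    rw [zero_add, pow_one, pow_one, sub_eq_zero] at h1
    exact (Fin.castSucc_lt_last j).ne (hθ h1)
  obtain ⟨u, hu⟩ : ∃ u : Fin m → F₀,
      ∀ j, u j = -algebraMap P F₀ (M j.castSucc (Fin.last m)) / μ j.castSucc := ⟨_, fun j => rfl⟩
  have hM' : ∀ j : Fin m, algebraMap P F₀ (M j.castSucc (Fin.last m)) ≠ 0 := fun j => by
    rw [Ne, FaithfulSMul.algebraMap_eq_zero_iff]; exact hM j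
  have hu0 : ∀ j, u j ≠ 0 := fun j => by
    rw [hu]; exact div_ne_zero (neg_ne_zero.mpr (hM' j)) (hμ0 j)
  obtain ⟨y, hyl, hy⟩ : ∃ y : Fin (m + 1) → F, y (Fin.last m) = 1 ∧
      ∀ j : Fin m, y j.castSucc = algebraMap F₀[X] F X * algebraMap F₀[X] F (C (u j)) :=
    ⟨Fin.lastCases 1 fun j => algebraMap F₀[X] F X * algebraMap F₀[X] F (C (u j)), by simp,
      fun j => by simp⟩
  have hlast : ∀ (a : F₀[X]) (b : Fin m → F₀[X]), ∃ ν : Fin (m + 1) → F₀[X],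
      ν (Fin.last m) = a ∧ ∀ j : Fin m, ν j.castSucc = b j := fun a b =>
    ⟨fun j => Fin.lastCases a b j, Fin.lastCases_last, fun j => Fin.lastCases_castSucc j⟩
  obtain ⟨ν, hνl, hν⟩ : ∃ ν : Fin (m + 1) → F₀[X],
      ν (Fin.last m) = -(X * (C (algebraMap P F₀ (M (Fin.last m) (Fin.last m))) +
        X * ∑ l : Fin m, C (algebraMap P F₀ (M (Fin.last m) l.castSucc)) * C (u l))) ∧
      ∀ j : Fin m, ν j.castSucc = -((C (algebraMap P F₀ (M j.castSucc (Fin.last m))) +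
        X * ∑ l : Fin m, C (algebraMap P F₀ (M j.castSucc l.castSucc)) * C (u l)) * C (u j)⁻¹) :=
    hlast _ _
  have hX : algebraMap F₀[X] F X ≠ 0 := by
    rw [Ne, FaithfulSMul.algebraMap_eq_zero_iff]; exact X_ne_zero
  have hC : ∀ x : F₀, x ≠ 0 → algebraMap F₀[X] F (C x) ≠ 0 := fun x hx => by
    rw [Ne, FaithfulSMul.algebraMap_eq_zero_iff]; exact C_ne_zero.mpr hx
  have hPF : ∀ x : P, algebraMap P F x = algebraMap F₀[X] F (C (algebraMap P F₀ x)) := fun x => by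
    rw [IsScalarTower.algebraMap_apply P F₀[X] F, Polynomial.algebraMap_apply]
  have hy0 : ∀ j, y j ≠ 0 := by
    intro j
    refine Fin.lastCases ?_ (fun j => ?_) j
    · rw [hyl]; exact one_ne_zero
    · rw [hy]; exact mul_ne_zero hX (hC _ (hu0 j))
  have hsum : ∀ j, ∑ l, algebraMap P F (M j l) * y l = algebraMap F₀[X] F
      (C (algebraMap P F₀ (M j (Fin.last m))) +
        X * ∑ l : Fin m, C (algebraMap P F₀ (M j l.castSucc)) * C (u l)) := by
    intro j
    rw [Fin.sum_univ_castSucc, hyl, map_add, map_mul, map_sum, Finset.mul_sum, mul_one, hPF,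
      add_comm]
    congr 1
    refine Finset.sum_congr rfl fun l _ => ?_
    rw [hy, hPF, map_mul]
    ring
  have hν1 : ∀ j, algebraMap F₀[X] F X * (-∑ l, algebraMap P F (M j l) * (y l / y j)) =
      algebraMap F₀[X] F (ν j) := by
    intro j
    simp_rw [← mul_div_assoc]
    rw [← Finset.sum_div, hsum]
    refine Fin.lastCases ?_ (fun j => ?_) j
    · rw [hyl, hνl, div_one, map_neg, map_mul]; ring
    · have h1 := hC _ (hu0 j)
      have h2 : algebraMap F₀[X] F (C (u j)) * algebraMap F₀[X] F (C (u j)⁻¹) = 1 := by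
        rw [← map_mul, ← C_mul, mul_inv_cancel₀ (hu0 j), C_1, map_one]
      rw [hy, hν, map_neg, map_mul, eq_comm, mul_neg, neg_inj, ← mul_div_assoc,
        mul_div_mul_left _ _ hX, eq_div_iff h1, mul_assoc,
          mul_comm _ (algebraMap F₀[X] F (C (u j))),
        h2, mul_one]
  have hν0 : ∀ j, (ν j).eval 0 = μ j := by
    intro j
    refine Fin.lastCases ?_ (fun j => ?_) j
    · rw [hνl, hμl]; simp
    · rw [hν]
      have := hμ0 j
      have := hM' j
      simp only [eval_neg, eval_mul, eval_add, eval_C, eval_X, zero_mul, add_zero]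
      rw [hu]
      field_simp
  refine ⟨y, fun i => ∑ j, C (algebraMap P F₀ ((Matrix.vandermonde θ)⁻¹ i.succ j)) * ν j, hy0,
    fun i => ?_, fun i => ?_⟩
  · rw [eval_finsetSum]
    simp_rw [eval_mul, eval_C, hν0, hμ]
    rw [sum_inv_mul_sum hθ, hζ]
  · rw [pointCoord, Finset.mul_sum, map_sum]
    refine Finset.sum_congr rfl fun j _ => ?_
    rw [map_mul, ← hν1, hPF]
    ring

theorem algebraicIndependent_pointCoord {P : Type*} [Field P] {m : ℕ} {θ : Fin (m + 1) → P}
    (hθ : Function.Injective θ) (M : Matrix (Fin (m + 1)) (Fin (m + 1)) P)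
    (hM : ∀ j : Fin m, M j.castSucc (Fin.last m) ≠ 0) {E : Type*} [Field E]
    [Algebra (MvPolynomial (Fin (m + 1)) P) E] [FaithfulSMul (MvPolynomial (Fin (m + 1)) P) E]
    [Algebra P E] [IsScalarTower P (MvPolynomial (Fin (m + 1)) P) E] :
    AlgebraicIndependent P fun i : Fin m => pointCoord θ M
      (fun j => algebraMap (MvPolynomial (Fin (m + 1)) P) E (MvPolynomial.X j)) i.succ := by
  have hw : AlgebraicIndependent P fun i : Fin m =>
      algebraMap (MvPolynomial (Fin m) P) (FractionRing (MvPolynomial (Fin m) P))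
        (MvPolynomial.X i) :=
    (MvPolynomial.algebraicIndependent_X (Fin m) P).map' (f := IsScalarTower.toAlgHom P
      (MvPolynomial (Fin m) P) (FractionRing (MvPolynomial (Fin m) P)))
      (IsFractionRing.injective _ _)
  obtain ⟨y, g, hy0, hg, hyg⟩ := exists_polynomial_pointCoord
    (F := FractionRing (FractionRing (MvPolynomial (Fin m) P))[X]) hw.linearIndependent hθ M hM
  obtain ⟨T, hT1, hT2⟩ := exists_specialization_subalgebra (E := E) (MvPolynomial.aeval (R := P) y)
  have hT3 : ∀ i, (pointCoord θ M (fun j => algebraMap (MvPolynomial (Fin (m + 1)) P) E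
      (MvPolynomial.X j)) i, pointCoord θ M y i) ∈ T := by
    intro i
    have h1 : ∀ j l, ((algebraMap (MvPolynomial (Fin (m + 1)) P) E (MvPolynomial.X l) /
        algebraMap (MvPolynomial (Fin (m + 1)) P) E (MvPolynomial.X j), y l / y j)) ∈ T := by
      intro j l
      have := hT1 (MvPolynomial.X l) (MvPolynomial.X j) (by rw [MvPolynomial.aeval_X]; exact hy0 j)
      rwa [MvPolynomial.aeval_X, MvPolynomial.aeval_X] at this
    have h2 := T.sum_mem fun j (_ : j ∈ Finset.univ) =>
      T.mul_mem (T.algebraMap_mem ((Matrix.vandermonde θ)⁻¹ i j))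
        (T.neg_mem (T.sum_mem fun l (_ : l ∈ Finset.univ) =>
          T.mul_mem (T.algebraMap_mem (M j l)) (h1 j l)))
    convert h2 using 1
    refine Prod.ext ?_ ?_
    · simp [pointCoord, Prod.fst_sum]
    · simp [pointCoord, Prod.snd_sum]
  rw [algebraicIndependent_iff]
  intro p hp
  by_contra hp0
  refine aeval_ne_zero_of_pole hw g hg _ hyg hp0 ?_
  have h3 : MvPolynomial.aeval (fun i : Fin m => ((pointCoord θ M (fun j =>
      algebraMap (MvPolynomial (Fin (m + 1)) P) E (MvPolynomial.X j)) i.succ,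
        pointCoord θ M y i.succ))) p ∈ T := by
    rw [MvPolynomial.aeval_def]
    exact MvPolynomial.eval₂_mem (fun i _ => T.algebraMap_mem _) fun i => hT3 _
  have h4 := MvPolynomial.comp_aeval_apply (R := P) (fun i : Fin m => ((pointCoord θ M (fun j =>
      algebraMap (MvPolynomial (Fin (m + 1)) P) E (MvPolynomial.X j)) i.succ,
        pointCoord θ M y i.succ))) (AlgHom.fst P E _) p
  have h5 := MvPolynomial.comp_aeval_apply (R := P) (fun i : Fin m => ((pointCoord θ M (fun j =>
      algebraMap (MvPolynomial (Fin (m + 1)) P) E (MvPolynomial.X j)) i.succ,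
        pointCoord θ M y i.succ))) (AlgHom.snd P E _) p
  exact h5.symm.trans (hT2 _ h3 (h4.trans hp))

end GenericPoint

section HomogeneousFractions

variable (P ι E : Type*) [Field P] [Field E] [Algebra (MvPolynomial ι P) E]
  [FaithfulSMul (MvPolynomial ι P) E]

/-- The fractions of homogeneous polynomials of equal degrees. -/
def homogeneousFractions : Subfield E where
  carrier := {x | ∃ (d : ℕ) (A B : MvPolynomial ι P), A.IsHomogeneous d ∧ B.IsHomogeneous d ∧
    B ≠ 0 ∧ x = algebraMap (MvPolynomial ι P) E A / algebraMap (MvPolynomial ι P) E B}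
  mul_mem' := by
    rintro _ _ ⟨d, A, B, hA, hB, hB0, rfl⟩ ⟨d', A', B', hA', hB', hB0', rfl⟩
    exact ⟨d + d', A * A', B * B', hA.mul hA', hB.mul hB', mul_ne_zero hB0 hB0', by
      rw [map_mul, map_mul, div_mul_div_comm]⟩
  one_mem' := ⟨0, 1, 1, MvPolynomial.isHomogeneous_one _ _, MvPolynomial.isHomogeneous_one _ _,
    one_ne_zero, by rw [map_one, div_one]⟩
  add_mem' := by
    rintro _ _ ⟨d, A, B, hA, hB, hB0, rfl⟩ ⟨d', A', B', hA', hB', hB0', rfl⟩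
    refine ⟨d + d', A * B' + B * A', B * B', (hA.mul hB').add (hB.mul hA'), hB.mul hB',
      mul_ne_zero hB0 hB0', ?_⟩
    rw [map_mul, map_add, map_mul, map_mul, div_add_div]
    · rwa [Ne, FaithfulSMul.algebraMap_eq_zero_iff]
    · rwa [Ne, FaithfulSMul.algebraMap_eq_zero_iff]
  zero_mem' := ⟨0, 0, 1, MvPolynomial.isHomogeneous_zero _ _ _,
    MvPolynomial.isHomogeneous_one _ _, one_ne_zero, by rw [map_zero, zero_div]⟩
  neg_mem' := by
    rintro _ ⟨d, A, B, hA, hB, hB0, rfl⟩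
    exact ⟨d, -A, B, hA.neg, hB, hB0, by rw [map_neg, neg_div]⟩
  inv_mem' := by
    rintro _ ⟨d, A, B, hA, hB, hB0, rfl⟩
    by_cases hA0 : A = 0
    · exact ⟨d, A, B, hA, hB, hB0, by rw [hA0, map_zero, zero_div, inv_zero]⟩
    · exact ⟨d, B, A, hB, hA, hA0, by rw [inv_div]⟩

variable {P ι E}

theorem div_mem_homogeneousFractions {d : ℕ} {A B : MvPolynomial ι P} (hA : A.IsHomogeneous d)
    (hB : B.IsHomogeneous d) (hB0 : B ≠ 0) : algebraMap (MvPolynomial ι P) E A /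
      algebraMap (MvPolynomial ι P) E B ∈ homogeneousFractions P ι E :=
  ⟨d, A, B, hA, hB, hB0, rfl⟩

theorem algebraMap_mem_homogeneousFractions [Algebra P E]
    [IsScalarTower P (MvPolynomial ι P) E] (x : P) :
    algebraMap P E x ∈ homogeneousFractions P ι E := by
  have := div_mem_homogeneousFractions (E := E) (MvPolynomial.isHomogeneous_C ι x)
    (MvPolynomial.isHomogeneous_one ι P) one_ne_zero
  rwa [map_one, div_one, ← MvPolynomial.algebraMap_eq, ← IsScalarTower.algebraMap_apply] at this

theorem pointCoord_mem_homogeneousFractions {m : ℕ} {E : Type*} [Field E]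
    [Algebra (MvPolynomial (Fin (m + 1)) P) E] [FaithfulSMul (MvPolynomial (Fin (m + 1)) P) E]
    [Algebra P E] [IsScalarTower P (MvPolynomial (Fin (m + 1)) P) E] (θ : Fin (m + 1) → P)
    (M : Matrix (Fin (m + 1)) (Fin (m + 1)) P) (i : Fin (m + 1)) :
    pointCoord θ M (fun j => algebraMap (MvPolynomial (Fin (m + 1)) P) E (MvPolynomial.X j)) i ∈
      homogeneousFractions P (Fin (m + 1)) E :=
  sum_mem fun _ _ => mul_mem (algebraMap_mem_homogeneousFractions _) (neg_mem (sum_mem fun _ _ =>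
    mul_mem (algebraMap_mem_homogeneousFractions _) (div_mem_homogeneousFractions
      (MvPolynomial.isHomogeneous_X _ _) (MvPolynomial.isHomogeneous_X _ _)
      (MvPolynomial.X_ne_zero _))))

theorem exists_common_denominator {G : Type*} [Fintype G] {b : G → E}
    (hb : ∀ σ, b σ ∈ homogeneousFractions P ι E) : ∃ (A : G → MvPolynomial ι P)
      (h : MvPolynomial ι P) (d : ℕ), (∀ σ, (A σ).IsHomogeneous d) ∧ h.IsHomogeneous d ∧ h ≠ 0 ∧
      ∀ σ, b σ * algebraMap (MvPolynomial ι P) E h = algebraMap (MvPolynomial ι P) E (A σ) := by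
  classical
  choose d A B hA hB hB0 hb' using hb
  refine ⟨fun σ => A σ * ∏ τ ∈ Finset.univ.erase σ, B τ, ∏ τ, B τ, ∑ τ, d τ, fun σ => ?_,
    MvPolynomial.IsHomogeneous.prod _ _ _ fun τ _ => hB τ,
    Finset.prod_ne_zero_iff.mpr fun τ _ => hB0 τ, fun σ => ?_⟩
  · rw [← Finset.add_sum_erase _ _ (Finset.mem_univ σ)]
    exact (hA σ).mul (MvPolynomial.IsHomogeneous.prod _ _ _ fun τ _ => hB τ)
  · rw [hb', ← Finset.mul_prod_erase _ _ (Finset.mem_univ σ), map_mul, map_mul, ← mul_assoc,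
      div_mul_cancel₀]
    rw [Ne, FaithfulSMul.algebraMap_eq_zero_iff]
    exact hB0 σ

end HomogeneousFractions

section TwistField

variable {P ι E : Type*} [Field P] [Field E] [Algebra (MvPolynomial ι P) E]
  [IsFractionRing (MvPolynomial ι P) E] [Fintype ι] [DecidableEq ι]

theorem exists_twist_field (s : P ≃+* P) (W : Matrix ι ι P) (hW : IsUnit W) :
    ∃ Φ : E →+* E, ∀ q, Φ (algebraMap (MvPolynomial ι P) E q) =
      algebraMap (MvPolynomial ι P) E (twist (s : P →+* P) W q) := by
  obtain ⟨Ψ, hΨ, _⟩ := exists_twist_inverse s W hW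
  have hinj : Function.Injective ((algebraMap (MvPolynomial ι P) E).comp
      (twist (s : P →+* P) W)) := by
    rw [RingHom.coe_comp]
    exact (IsFractionRing.injective _ _).comp (Function.LeftInverse.injective hΨ)
  exact ⟨IsFractionRing.lift hinj, fun q => IsFractionRing.lift_algebraMap hinj q⟩

omit [DecidableEq ι] in
theorem mem_homogeneousFractions_of_twist {s : P →+* P} {W : Matrix ι ι P} {Φ : E →+* E}
    (hΦ : ∀ q, Φ (algebraMap (MvPolynomial ι P) E q) =
      algebraMap (MvPolynomial ι P) E (twist s W q)) {x : E}
    (hx : x ∈ homogeneousFractions P ι E) : Φ x ∈ homogeneousFractions P ι E := by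
  obtain ⟨d, A, B, hA, hB, hB0, rfl⟩ := hx
  rw [map_div₀, hΦ, hΦ]
  refine div_mem_homogeneousFractions (twist_isHomogeneous _ _ hA) (twist_isHomogeneous _ _ hB) ?_
  intro h0
  have := hΦ B
  rw [h0, map_zero, map_eq_zero, FaithfulSMul.algebraMap_eq_zero_iff] at this
  exact hB0 this

theorem twist_field_comp {k G : Type*} [Field k] [Algebra k P] [Group G] (act : G →* (P ≃ₐ[k] P))
    (W : G → Matrix ι ι P) (c : G → G → P) (hc : ∀ σ τ, c σ τ ≠ 0)
    (hW : ∀ σ τ, (act σ).mapMatrix (W τ) * W σ = (c σ τ)⁻¹ • W (σ * τ)) (Φ : G → E →+* E)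
    (hΦ : ∀ σ q, Φ σ (algebraMap (MvPolynomial ι P) E q) =
      algebraMap (MvPolynomial ι P) E (twist (act σ : P →+* P) (W σ) q)) (σ τ : G) {x : E}
    (hx : x ∈ homogeneousFractions P ι E) : Φ σ (Φ τ x) = Φ (σ * τ) x := by
  have h1 : ∀ d (A : MvPolynomial ι P), A.IsHomogeneous d →
      Φ σ (Φ τ (algebraMap (MvPolynomial ι P) E A)) = algebraMap (MvPolynomial ι P) E
        (MvPolynomial.C ((c σ τ)⁻¹ ^ d)) * Φ (σ * τ) (algebraMap (MvPolynomial ι P) E A) := by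
    intro d A hA
    have h2 : (twist (act σ : P →+* P) (W σ)).comp (twist (act τ : P →+* P) (W τ)) =
        twist (act (σ * τ) : P →+* P) ((c σ τ)⁻¹ • W (σ * τ)) := by
      rw [twist_comp, ← hW, map_mul act]
      rfl
    rw [hΦ, hΦ, hΦ, ← map_mul, ← RingHom.comp_apply (twist _ _), h2, twist_smul _ _ _ hA]
  obtain ⟨d, A, B, hA, hB, hB0, rfl⟩ := hx
  rw [map_div₀, map_div₀, map_div₀, h1 d A hA, h1 d B hB, mul_div_mul_left]
  rw [Ne, FaithfulSMul.algebraMap_eq_zero_iff]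
  exact MvPolynomial.C_ne_zero.mpr (pow_ne_zero _ (inv_ne_zero (hc σ τ)))

end TwistField

section Core

variable {k P G : Type*} [Field k] [Field P] [Algebra k P] [Group G] {m : ℕ}

theorem pointCoord_eigenvector {E : Type*} [Field E] [Algebra P E] {θ : Fin (m + 1) → P}
    (hθ : Function.Injective θ) (M : Matrix (Fin (m + 1)) (Fin (m + 1)) P)
    (y : Fin (m + 1) → E) (hy : ∀ j, y j ≠ 0) (t : E) (x : Fin m → E) :
    (M.map (algebraMap P E) + ∑ i : Fin m, x i •
      (Matrix.diagonal (fun j => θ j ^ ((i : ℕ) + 1))).map (algebraMap P E)).mulVec y = t • y ↔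
      t = -pointCoord θ M y 0 ∧ ∀ i, x i = pointCoord θ M y i.succ := by
  have h1 : ∀ j, ((M.map (algebraMap P E) + ∑ i : Fin m, x i •
      (Matrix.diagonal (fun j => θ j ^ ((i : ℕ) + 1))).map (algebraMap P E)).mulVec y) j =
      (∑ l, algebraMap P E (M j l) * (y l / y j) +
        ∑ i, x i * algebraMap P E (θ j ^ ((i : ℕ) + 1))) * y j := by
    intro j
    rw [Matrix.add_mulVec, Pi.add_apply, Matrix.sum_mulVec, Finset.sum_apply, add_mul,
      Finset.sum_mul, Finset.sum_mul]
    refine congrArg₂ (· + ·) ?_ (Finset.sum_congr rfl fun i _ => ?_)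
    · refine Finset.sum_congr (s₁ := (Finset.univ : Finset (Fin (m + 1)))) rfl fun l _ => ?_
      rw [mul_assoc, div_mul_cancel₀ _ (hy j)]
      rfl
    · rw [Matrix.diagonal_map (map_zero _), Matrix.smul_mulVec, Pi.smul_apply,
        Matrix.mulVec_diagonal, smul_eq_mul, mul_assoc]
  have h2 : ∀ j, ∑ i, (Fin.cons (-t) x : Fin (m + 1) → E) i * algebraMap P E (θ j ^ (i : ℕ)) =
      -t + ∑ i, x i * algebraMap P E (θ j ^ ((i : ℕ) + 1)) := by
    intro j
    rw [Fin.sum_univ_succ]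
    simp
  constructor
  · intro h
    have h3 : (Fin.cons (-t) x : Fin (m + 1) → E) = pointCoord θ M y := by
      refine eq_of_sum_eq hθ fun j => ?_
      rw [h2, sum_pointCoord hθ]
      have h4 := congrFun h j
      rw [h1, Pi.smul_apply, smul_eq_mul] at h4
      linear_combination mul_right_cancel₀ (hy j) h4
    refine ⟨?_, fun i => ?_⟩
    · rw [← h3, Fin.cons_zero, neg_neg]
    · rw [← h3, Fin.cons_succ]
  · rintro ⟨ht, hx⟩
    funext j
    have h3 := sum_pointCoord hθ M y j
    have h4 : (Fin.cons (-t) x : Fin (m + 1) → E) = pointCoord θ M y := by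
      funext i
      refine Fin.cases ?_ (fun i => ?_) i
      · rw [Fin.cons_zero, ht, neg_neg]
      · rw [Fin.cons_succ, hx]
    rw [← h4, h2] at h3
    rw [h1, Pi.smul_apply, smul_eq_mul]
    linear_combination y j * h3

theorem isRoot_charpoly_of_mulVec {ι E : Type*} [Fintype ι] [DecidableEq ι] [Field E]
    {N : Matrix ι ι E} {t : E} {z : ι → E} (hz0 : z ≠ 0) (hz : N.mulVec z = t • z) :
    N.charpoly.IsRoot t := by
  rw [IsRoot, Matrix.eval_charpoly]
  refine Matrix.exists_mulVec_eq_zero_iff.mp ⟨z, hz0, ?_⟩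
  rw [Matrix.sub_mulVec, hz, Matrix.scalar_apply, ← Matrix.smul_one_eq_diagonal,
    Matrix.smul_mulVec, Matrix.one_mulVec, sub_self]

theorem map_generic_comm {ι E : Type*} [Fintype ι] [DecidableEq ι] [Field E] [Algebra P E]
    (s : P ≃ₐ[k] P) (Φ : E →+* E) (hΦ : ∀ x, Φ (algebraMap P E x) = algebraMap P E (s x))
    (U M : Matrix ι ι P) (hM : U * s.mapMatrix M = M * U) (D : Fin m → Matrix ι ι P)
    (hD : ∀ i, U * s.mapMatrix (D i) = D i * U) (x : Fin m → E) :
    U.map (algebraMap P E) *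
        (M.map (algebraMap P E) + ∑ i, x i • (D i).map (algebraMap P E)).map Φ =
      (M.map (algebraMap P E) + ∑ i, Φ (x i) • (D i).map (algebraMap P E)) *
        U.map (algebraMap P E) := by
  have h1 : ∀ X : Matrix ι ι P, U * s.mapMatrix X = X * U →
      U.map (algebraMap P E) * (s.mapMatrix X).map (algebraMap P E) =
      X.map (algebraMap P E) * U.map (algebraMap P E) := by
    intro X hX
    rw [← Matrix.map_mul, hX, Matrix.map_mul]
  have h2 : (M.map (algebraMap P E) + ∑ i, x i • (D i).map (algebraMap P E)).map Φ =
      (s.mapMatrix M).map (algebraMap P E) +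
        ∑ i, Φ (x i) • (s.mapMatrix (D i)).map (algebraMap P E) := by
    refine Matrix.ext fun p q => ?_
    simp only [Matrix.map_apply, Matrix.add_apply, Matrix.sum_apply, Matrix.smul_apply,
      smul_eq_mul, map_add, map_sum, map_mul, hΦ, AlgEquiv.mapMatrix_apply]
  rw [h2, mul_add, add_mul, h1 M hM, Finset.mul_sum, Finset.sum_mul]
  congr 1
  refine Finset.sum_congr rfl fun i _ => ?_
  rw [Matrix.mul_smul, h1 _ (hD i), Matrix.smul_mul]

theorem exists_cohomologous_of_generic [Fintype G] {θ : Fin (m + 1) → P}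
    (hθ : Function.Injective θ) (M : Matrix (Fin (m + 1)) (Fin (m + 1)) P)
    (hM : ∀ j : Fin m, M j.castSucc (Fin.last m) ≠ 0) (act : G →* (P ≃ₐ[k] P))
    (U : G → Matrix (Fin (m + 1)) (Fin (m + 1)) P) (hU : ∀ σ, IsUnit (U σ)) (c : G → G → P)
    (hc : ∀ σ τ, c σ τ ≠ 0)
    (hcoc : ∀ σ τ, U σ * (act σ).mapMatrix (U τ) = c σ τ • U (σ * τ))
    (hUM : ∀ σ, U σ * (act σ).mapMatrix M = M * U σ)
    (hUθ : ∀ σ, U σ * (act σ).mapMatrix (Matrix.diagonal θ) = Matrix.diagonal θ * U σ)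
    {L : Type*} [Field L] [Algebra P L] [Algebra (MvPolynomial (Fin m) P) L]
    [IsFractionRing (MvPolynomial (Fin m) P) L] [IsScalarTower P (MvPolynomial (Fin m) P) L]
    (actL : G → L →+* L)
    (hactL : ∀ σ p, actL σ (algebraMap (MvPolynomial (Fin m) P) L p) =
      algebraMap (MvPolynomial (Fin m) P) L (p.map (act σ : P →+* P)))
    (U' : G → Matrix (Fin (m + 1)) (Fin (m + 1)) L) (hU' : ∀ σ, IsUnit (U' σ)) (c' : G → G → P)
    (hcoc' : ∀ σ τ, U' σ * (U' τ).map (actL σ) = algebraMap P L (c' σ τ) • U' (σ * τ))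
    (N : Matrix (Fin (m + 1)) (Fin (m + 1)) L) (hN : ∀ σ, U' σ * N.map (actL σ) = N * U' σ)
    (hsep : N.charpoly.Separable)
    (hchar : N.charpoly = (M.map (algebraMap P L) + ∑ i : Fin m,
      algebraMap (MvPolynomial (Fin m) P) L (MvPolynomial.X i) •
        (Matrix.diagonal fun j => θ j ^ ((i : ℕ) + 1)).map (algebraMap P L)).charpoly) :
    ∃ (κ : G → P) (d e : ℕ), (∀ σ, κ σ ≠ 0) ∧ ∀ σ τ,
      c' σ τ * κ (σ * τ) * c σ τ ^ d = κ σ * act σ (κ τ) * c σ τ ^ e := by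
  obtain ⟨W, hW1, hW2⟩ : ∃ W : G → Matrix (Fin (m + 1)) (Fin (m + 1)) P,
      (∀ σ, W σ * U σ = 1) ∧ ∀ σ, U σ * W σ = 1 := by
    choose u hu using hU
    exact ⟨fun σ => ↑(u σ)⁻¹, fun σ => by rw [← hu]; exact (u σ).inv_mul,
      fun σ => by rw [← hu]; exact (u σ).mul_inv⟩
  have hWu : ∀ σ, IsUnit (W σ) := fun σ => ⟨⟨W σ, U σ, hW1 σ, hW2 σ⟩, rfl⟩
  have hW : ∀ σ τ, (act σ).mapMatrix (W τ) * W σ = (c σ τ)⁻¹ • W (σ * τ) := by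
    intro σ τ
    have h1 : (act σ).mapMatrix (U τ) * (act σ).mapMatrix (W τ) = 1 := by
      rw [← map_mul, hW2, map_one]
    have h2 : (U σ * (act σ).mapMatrix (U τ)) * ((act σ).mapMatrix (W τ) * W σ) = 1 := by
      rw [mul_assoc, ← mul_assoc _ _ (W σ), h1, one_mul, hW2]
    have h3 := congrArg (fun X => (c σ τ)⁻¹ • (W (σ * τ) * X)) h2
    beta_reduce at h3
    rw [hcoc, mul_one, Matrix.smul_mul, Matrix.mul_smul, ← mul_assoc, hW1, one_mul, smul_smul,
      inv_mul_cancel₀ (hc σ τ), one_smul] at h3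
    exact h3
  set E := FractionRing (MvPolynomial (Fin (m + 1)) P) with hE
  set R := MvPolynomial (Fin (m + 1)) P with hR
  have hΦ := fun σ => exists_twist_field (E := E) (act σ).toRingEquiv (W σ) (hWu σ)
  choose Φ hΦ using hΦ
  have hΦC : ∀ σ x, Φ σ (algebraMap P E x) = algebraMap P E (act σ x) := by
    intro σ x
    rw [IsScalarTower.algebraMap_apply P R E, IsScalarTower.algebraMap_apply P R E, hΦ,
      MvPolynomial.algebraMap_eq, twist_C]
    rfl
  have hΦ0 := fun σ (x : E) (hx : x ∈ homogeneousFractions P (Fin (m + 1)) E) =>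
    mem_homogeneousFractions_of_twist (hΦ σ) hx
  have hΦcomp := fun σ τ (x : E) (hx : x ∈ homogeneousFractions P (Fin (m + 1)) E) =>
    twist_field_comp act W c hc hW Φ hΦ σ τ hx
  obtain ⟨y, hy⟩ : ∃ y : Fin (m + 1) → E, y = fun j => algebraMap R E (MvPolynomial.X j) :=
    ⟨_, rfl⟩
  have hy0 : ∀ j, y j ≠ 0 := fun j => by
    rw [hy, Ne, FaithfulSMul.algebraMap_eq_zero_iff]; exact MvPolynomial.X_ne_zero j
  have hx0 : ∀ i, pointCoord θ M y i ∈ homogeneousFractions P (Fin (m + 1)) E := fun i => by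
    rw [hy]; exact pointCoord_mem_homogeneousFractions θ M i
  have halg : AlgebraicIndependent P fun i : Fin m => pointCoord θ M y i.succ := by
    rw [hy]; exact algebraicIndependent_pointCoord hθ M hM
  have hyΦ : ∀ σ, (fun i => Φ σ (y i)) = ((W σ).map (algebraMap P E)).mulVec y := by
    intro σ
    funext i
    rw [hy]
    beta_reduce
    rw [hΦ, twist_X, map_sum]
    refine Finset.sum_congr rfl fun l _ => ?_
    rw [map_mul, ← MvPolynomial.algebraMap_eq, ← IsScalarTower.algebraMap_apply]
    rfl
  have hUD : ∀ σ (i : Fin m), U σ * (act σ).mapMatrix (Matrix.diagonal fun j =>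
      θ j ^ ((i : ℕ) + 1)) = (Matrix.diagonal fun j => θ j ^ ((i : ℕ) + 1)) * U σ := by
    intro σ i
    have h1 : (Matrix.diagonal fun j => θ j ^ ((i : ℕ) + 1)) =
        Matrix.diagonal θ ^ ((i : ℕ) + 1) := by
      rw [Matrix.diagonal_pow]; rfl
    have h2 : SemiconjBy (U σ) ((act σ).mapMatrix (Matrix.diagonal θ)) (Matrix.diagonal θ) := hUθ σ
    rw [h1, map_pow]
    exact h2.pow_right _
  have hfix : ∀ σ, (-Φ σ (pointCoord θ M y 0) = -pointCoord θ M y 0) ∧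
      ∀ i : Fin m, Φ σ (pointCoord θ M y i.succ) = pointCoord θ M y i.succ := by
    intro σ
    have h1 := (pointCoord_eigenvector hθ M y hy0 _ _).mpr ⟨rfl, fun i => rfl⟩
    have h2 := congrArg (fun v : Fin (m + 1) → E => ((U σ).map (algebraMap P E)).mulVec
      fun i => Φ σ (v i)) h1
    beta_reduce at h2
    rw [map_mulVec', Matrix.mulVec_mulVec, map_generic_comm (act σ) (Φ σ) (hΦC σ) (U σ) M (hUM σ) _
      (fun i => hUD σ i), ← Matrix.mulVec_mulVec] at h2
    have h3 : (fun i => Φ σ ((-pointCoord θ M y 0 • y) i)) =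
        (-Φ σ (pointCoord θ M y 0)) • fun i => Φ σ (y i) := by
      funext i; simp
    have h4 : ((U σ).map (algebraMap P E)).mulVec (fun i => Φ σ (y i)) = y := by
      rw [hyΦ, Matrix.mulVec_mulVec, ← Matrix.map_mul, hW2,
        Matrix.map_one _ (map_zero _) (map_one _), Matrix.one_mulVec]
    rw [h3, Matrix.mulVec_smul, h4] at h2
    exact (pointCoord_eigenvector hθ M y hy0 _ _).mp h2
  obtain ⟨j, hj1, hj2⟩ : ∃ j : L →+* E, (∀ x, j (algebraMap P L x) = algebraMap P E x) ∧
      ∀ i, j (algebraMap (MvPolynomial (Fin m) P) L (MvPolynomial.X i)) =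
        pointCoord θ M y i.succ := by
    have hinj : Function.Injective (MvPolynomial.aeval (R := P)
      fun i : Fin m => pointCoord θ M y i.succ).toRingHom := halg
    refine ⟨IsFractionRing.lift hinj, fun x => ?_, fun i => ?_⟩
    · rw [IsScalarTower.algebraMap_apply P (MvPolynomial (Fin m) P) L,
        IsFractionRing.lift_algebraMap hinj]
      exact AlgHom.commutes _ x
    · rw [IsFractionRing.lift_algebraMap hinj]
      exact MvPolynomial.aeval_X _ _
  have hj0 : ∀ x, j x ∈ homogeneousFractions P (Fin (m + 1)) E := by
    have h1 : ∀ p, j (algebraMap (MvPolynomial (Fin m) P) L p) ∈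
        homogeneousFractions P (Fin (m + 1)) E := by
      intro p
      induction p using MvPolynomial.induction_on with
      | C a =>
        rw [← MvPolynomial.algebraMap_eq, ← IsScalarTower.algebraMap_apply, hj1]
        exact algebraMap_mem_homogeneousFractions a
      | add p q hp hq => rw [map_add, map_add]; exact add_mem hp hq
      | mul_X p i hp => rw [map_mul, map_mul, hj2]; exact mul_mem hp (hx0 _)
    intro x
    obtain ⟨a, b, _, rfl⟩ := IsFractionRing.div_surjective (A := MvPolynomial (Fin m) P) x
    rw [map_div₀]
    exact div_mem (h1 a) (h1 b)
  have hjΦ : ∀ σ x, Φ σ (j x) = j (actL σ x) := by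
    intro σ x
    have h1 : ∀ p, Φ σ (j (algebraMap (MvPolynomial (Fin m) P) L p)) =
        j (actL σ (algebraMap (MvPolynomial (Fin m) P) L p)) := by
      intro p
      induction p using MvPolynomial.induction_on with
      | C a =>
        rw [hactL, MvPolynomial.map_C, ← MvPolynomial.algebraMap_eq,
          ← IsScalarTower.algebraMap_apply, ← IsScalarTower.algebraMap_apply, hj1, hj1, hΦC]
        rfl
      | add p q hp hq => simp only [map_add] at hp hq ⊢; rw [hp, hq]
      | mul_X p i hp =>
        have h2 : Φ σ (j (algebraMap (MvPolynomial (Fin m) P) L (MvPolynomial.X i))) =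
            j (actL σ (algebraMap (MvPolynomial (Fin m) P) L (MvPolynomial.X i))) := by
          rw [hactL, MvPolynomial.map_X, hj2, (hfix σ).2]
        simp only [map_mul] at hp ⊢
        rw [hp, h2]
    obtain ⟨a, b, _, rfl⟩ := IsFractionRing.div_surjective (A := MvPolynomial (Fin m) P) x
    simp only [map_div₀]
    rw [h1, h1]
  have hroot : (N.charpoly.map j).IsRoot (-pointCoord θ M y 0) := by
    have h1 := (pointCoord_eigenvector hθ M y hy0 _ _).mpr ⟨rfl, fun i => rfl⟩
    have h2 : (M.map (algebraMap P L) + ∑ i : Fin m,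
        algebraMap (MvPolynomial (Fin m) P) L (MvPolynomial.X i) •
          (Matrix.diagonal fun j => θ j ^ ((i : ℕ) + 1)).map (algebraMap P L)).map j =
        M.map (algebraMap P E) + ∑ i : Fin m, pointCoord θ M y i.succ •
          (Matrix.diagonal fun j => θ j ^ ((i : ℕ) + 1)).map (algebraMap P E) := by
      refine Matrix.ext fun p q => ?_
      simp only [Matrix.map_apply, Matrix.add_apply, Matrix.sum_apply, Matrix.smul_apply,
        smul_eq_mul, map_add, map_sum, map_mul, hj1, hj2]
    rw [hchar, ← Matrix.charpoly_map, h2]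
    exact isRoot_charpoly_of_mulVec (fun h0 => hy0 0 (congrFun h0 0)) h1
  have hroot' : (N.charpoly.map (j.codRestrict (homogeneousFractions P (Fin (m + 1)) E) hj0)).IsRoot
      ⟨_, neg_mem (hx0 0)⟩ := by
    refine IsRoot.of_map (f := (homogeneousFractions P (Fin (m + 1)) E).subtype) ?_
      Subtype.val_injective
    rw [Polynomial.map_map]
    exact hroot
  obtain ⟨b, hb0, hb⟩ := exists_cochain_of_eigenvector (E := homogeneousFractions P (Fin (m + 1)) E)
    actL (fun σ => ((Φ σ).comp (homogeneousFractions P (Fin (m + 1)) E).subtype).codRestrict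
      (homogeneousFractions P (Fin (m + 1)) E) fun x => hΦ0 σ x x.2)
    (fun σ τ x => Subtype.ext (hΦcomp σ τ x x.2))
    (j.codRestrict (homogeneousFractions P (Fin (m + 1)) E) hj0)
    (fun σ x => Subtype.ext (hjΦ σ x)) U' hU' (fun σ τ => algebraMap P L (c' σ τ)) hcoc' N hN
    ⟨_, neg_mem (hx0 0)⟩ (fun σ => Subtype.ext ((map_neg _ _).trans (hfix σ).1)) hroot' hsep
  obtain ⟨A, h, d, hA, hh, hh0, hAb⟩ := exists_common_denominator fun σ => (b σ).2
  have hb' : ∀ σ τ, (b σ : E) * Φ σ (b τ) = algebraMap P E (c' σ τ) * b (σ * τ) := by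
    intro σ τ
    rw [← hj1]
    exact congrArg Subtype.val (hb σ τ)
  have hA0 : ∀ σ, A σ ≠ 0 := by
    intro σ h0
    have h1 := hAb σ
    rw [h0, map_zero, mul_eq_zero, FaithfulSMul.algebraMap_eq_zero_iff] at h1
    exact h1.elim (fun h => hb0 σ (Subtype.ext h)) hh0
  obtain ⟨κ, e, hκ0, hκ⟩ := exists_coboundary_of_twist act W hWu c c' hc hW A h d hA hh hA0 hh0 (by
    intro σ τ
    apply IsFractionRing.injective R E
    have h1 := congrArg (Φ σ) (hAb τ)
    rw [map_mul, hΦ, hΦ] at h1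
    have h2 := hb' σ τ
    rw [map_mul, map_mul, map_mul, ← MvPolynomial.algebraMap_eq,
      ← IsScalarTower.algebraMap_apply]
    have h3 := hAb σ
    have h4 := hAb (σ * τ)
    have h5 : algebraMap R E h * (algebraMap R E (twist (act σ).toRingEquiv (W σ) h)) *
      (b σ * Φ σ (b τ)) = algebraMap R E h * (algebraMap R E (twist (act σ).toRingEquiv (W σ) h)) *
      (algebraMap P E (c' σ τ) * b (σ * τ)) := by rw [h2]
    change _ * algebraMap R E (twist (act σ).toRingEquiv (W σ) (A τ)) =
      _ * algebraMap R E (twist (act σ).toRingEquiv (W σ) h)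
    rw [← h3, ← h4, ← h1]
    linear_combination h5)
  exact ⟨κ, d, e, hκ0, hκ⟩

end Core

theorem exists_unit_mul_diagonal {L : Type*} [Field L] {n : ℕ} (N : Matrix (Fin n) (Fin n) L)
    (θ : Fin n → L) (hθ : Function.Injective θ) (hN : N.charpoly = ∏ i, (X - C (θ i))) :
    ∃ V : (Matrix (Fin n) (Fin n) L)ˣ, N * (V : Matrix (Fin n) (Fin n) L) =
      (V : Matrix (Fin n) (Fin n) L) * Matrix.diagonal θ := by
  have h1 : ∀ i, ∃ v : Fin n → L, v ≠ 0 ∧ N.mulVec v = θ i • v := fun i =>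
    exists_eigenvector N (θ i) (by
      rw [hN, IsRoot, eval_prod]
      exact Finset.prod_eq_zero (Finset.mem_univ i) (by simp))
  choose v hv0 hv using h1
  have hli : LinearIndependent L v := by
    refine Module.End.eigenvectors_linearIndependent' (Matrix.toLin' N) θ hθ v fun i => ?_
    rw [Module.End.hasEigenvector_iff, Module.End.mem_eigenspace_iff, Matrix.toLin'_apply]
    exact ⟨hv i, hv0 i⟩
  have hu : IsUnit (Matrix.of v).transpose :=
    Matrix.linearIndependent_cols_iff_isUnit.mp hli
  refine ⟨hu.unit, Matrix.ext fun i j => ?_⟩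
  rw [IsUnit.unit_spec, Matrix.mul_diagonal]
  exact (congrFun (hv j) i).trans (mul_comm _ _)

theorem IsSplit.exists_conj_unit {K L A ι : Type*} [Field K] [Field L] [Algebra K L] [Ring A]
    [Algebra K A] [Fintype ι] [DecidableEq ι] {ρ : A →ₐ[K] Matrix ι ι L} (h : IsSplit ρ)
    (V : (Matrix ι ι L)ˣ) : ∃ ρ' : A →ₐ[K] Matrix ι ι L, IsSplit ρ' ∧
      ∀ a, ρ' a = (↑V⁻¹ : Matrix ι ι L) * ρ a * (V : Matrix ι ι L) := by
  let ρ' : A →ₐ[K] Matrix ι ι L := AlgHom.ofLinearMap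
    ((LinearMap.mulLeftRight K ((↑V⁻¹ : Matrix ι ι L), (V : Matrix ι ι L))).comp ρ.toLinearMap)
    (by simp [LinearMap.mulLeftRight_apply]) (by
      intro x y
      simp only [LinearMap.comp_apply, LinearMap.mulLeftRight_apply, AlgHom.toLinearMap_apply,
        map_mul]
      rw [mul_assoc _ (V : Matrix ι ι L), ← mul_assoc (V : Matrix ι ι L),
        ← mul_assoc (V : Matrix ι ι L), Units.mul_inv, one_mul]
      simp only [mul_assoc])
  have hρ' : ∀ a, ρ' a = (↑V⁻¹ : Matrix ι ι L) * ρ a * (V : Matrix ι ι L) := fun a => rfl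
  refine ⟨ρ', ⟨?_, h.finrank_eq⟩, hρ'⟩
  let e : Matrix ι ι L →ₗ[L] Matrix ι ι L :=
    LinearMap.mulLeftRight L ((↑V⁻¹ : Matrix ι ι L), (V : Matrix ι ι L))
  have he : Function.Surjective e := fun M => ⟨(V : Matrix ι ι L) * M * (↑V⁻¹ : Matrix ι ι L), by
    rw [LinearMap.mulLeftRight_apply]
    simp only [mul_assoc, Units.inv_mul, mul_one]
    rw [← mul_assoc, Units.inv_mul, one_mul]⟩
  have h1 : Set.range ρ' = e '' Set.range ρ := by
    rw [← Set.range_comp]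
    rfl
  rw [h1, ← Submodule.map_span, h.span, Submodule.map_top, LinearMap.range_eq_top.mpr he]

/-- A split representation can be chosen so that a generator of a maximal subfield is diagonal. -/
theorem IsSplit.exists_diagonal {K L A : Type*} [Field K] [Field L] [Algebra K L] [Ring A]
    [Algebra K A] {n : ℕ} [NeZero n] {ρ : A →ₐ[K] Matrix (Fin n) (Fin n) L} (h : IsSplit ρ)
    (hfix : ∀ l : L, (∀ σ : L ≃ₐ[K] L, σ l = l) → ∃ x : K, algebraMap K L x = l) {b : A}
    (hb : (minpoly K b).natDegree = n) (θ : Fin n → L) (hθ : Function.Injective θ)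
    (hroots : (minpoly K b).map (algebraMap K L) = ∏ i, (X - C (θ i))) :
    ∃ ρ' : A →ₐ[K] Matrix (Fin n) (Fin n) L, IsSplit ρ' ∧ ρ' b = Matrix.diagonal θ := by
  obtain ⟨U, c, hU⟩ := h.exists_isForm (MonoidHom.id (L ≃ₐ[K] L))
  have h1 := hU.map_minpoly hfix (a := b) (by rw [hb, Fintype.card_fin])
  obtain ⟨V, hV⟩ := exists_unit_mul_diagonal (ρ b) θ hθ (h1.symm.trans hroots)
  obtain ⟨ρ', hρ', h2⟩ := h.exists_conj_unit V
  exact ⟨ρ', hρ', by rw [h2, mul_assoc, hV, ← mul_assoc, Units.inv_mul, one_mul]⟩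

section Generic

variable {k P K L D A : Type*} [Field k] [Infinite k] [Field P] [Algebra k P]
  [FiniteDimensional k P] {m : ℕ} [Ring D] [Nontrivial D] [Algebra k D]
  [Field K] [Algebra (MvPolynomial (Fin m) k) K] [IsFractionRing (MvPolynomial (Fin m) k) K]
  [Algebra k K] [IsScalarTower k (MvPolynomial (Fin m) k) K]
  [Field L] [Algebra (MvPolynomial (Fin m) P) L] [IsFractionRing (MvPolynomial (Fin m) P) L]
  [Algebra P L] [IsScalarTower P (MvPolynomial (Fin m) P) L]
  [Algebra K L] [Algebra k L] [IsScalarTower k K L] [IsScalarTower k P L]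
  [Ring A] [Nontrivial A] [Algebra K A]

/-- If all generic maximal subfields of a division algebra embed into a second algebra with
constant cocycle, then this cocycle is cohomologous to a power of that of the division algebra. -/
theorem exists_cohomologous_pow (hchar : ((m + 1 : ℕ) : k) ≠ 0)
    (hKL : ∀ p : MvPolynomial (Fin m) k, algebraMap K L (algebraMap (MvPolynomial (Fin m) k) K p) =
      algebraMap (MvPolynomial (Fin m) P) L (MvPolynomial.map (algebraMap k P) p))
    {act : (P ≃ₐ[k] P) →* (L ≃ₐ[K] L)}
    (hact : ∀ σ p, act σ (algebraMap (MvPolynomial (Fin m) P) L p) =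
      algebraMap (MvPolynomial (Fin m) P) L (MvPolynomial.map (σ : P →+* P) p))
    (hfix : ∀ l : L, (∀ σ, act σ l = l) → ∃ x : K, algebraMap K L x = l)
    (hD : ∀ x : D, x ≠ 0 → IsUnit x)
    {ρ : D →ₐ[k] Matrix (Fin (m + 1)) (Fin (m + 1)) P}
    {U : (P ≃ₐ[k] P) → Matrix (Fin (m + 1)) (Fin (m + 1)) P} {c : (P ≃ₐ[k] P) → (P ≃ₐ[k] P) → P}
    (h : IsForm (MonoidHom.id (P ≃ₐ[k] P)) ρ U c)
    {b : D} {θ : Fin (m + 1) → P} (hθ : Function.Injective θ) (hb : ρ b = Matrix.diagonal θ)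
    {ρ' : A →ₐ[K] Matrix (Fin (m + 1)) (Fin (m + 1)) L}
    {U' : (P ≃ₐ[k] P) → Matrix (Fin (m + 1)) (Fin (m + 1)) L}
    {c' : (P ≃ₐ[k] P) → (P ≃ₐ[k] P) → P}
    (h' : IsForm act ρ' U' fun σ τ => algebraMap P L (c' σ τ))
    (hroot : ∀ f : K[X], Irreducible f → f.natDegree = m + 1 →
      (∃ x : K ⊗[k] D, aeval x f = 0) → ∃ x : A, aeval x f = 0) :
    ∃ r : ℕ, 1 ≤ r ∧ ∃ κ : (P ≃ₐ[k] P) → P, (∀ σ, κ σ ≠ 0) ∧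
      ∀ σ τ, c' σ τ * κ (σ * τ) = κ σ * σ (κ τ) * c σ τ ^ r := by
  have := Fintype.ofFinite (P ≃ₐ[k] P)
  have hPinf : Infinite P := Infinite.of_injective _ (algebraMap k P).injective
  have hDdom : IsDomain D := {
    mul_left_cancel_of_ne_zero := fun {a} ha => (hD a ha).mul_right_injective
    mul_right_cancel_of_ne_zero := fun {a} ha => (hD a ha).mul_left_injective }
  have hdom : IsDomain (K ⊗[k] D) := isDomain_tensorProduct (Fin m)
  have hDfin := h.split.finite
  obtain ⟨a₀, ha₀⟩ := h.split.exists_eval_ne_zero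
    ((krylov (Matrix.mvPolynomialX (Fin (m + 1)) (Fin (m + 1)) P)).det *
      ∏ j : Fin m, MvPolynomial.X (j.castSucc, Fin.last m))
    (mul_ne_zero det_krylov_mvPolynomialX_ne_zero
      (Finset.prod_ne_zero_iff.mpr fun j _ => MvPolynomial.X_ne_zero _))
  rw [map_mul, eval_det_krylov, map_prod] at ha₀
  have hkry := left_ne_zero_of_mul ha₀
  have hM : ∀ j : Fin m, ρ a₀ j.castSucc (Fin.last m) ≠ 0 := fun j => by
    have := Finset.prod_ne_zero_iff.mp (right_ne_zero_of_mul ha₀) j (Finset.mem_univ j)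
    rwa [MvPolynomial.eval_X] at this
  obtain ⟨a, ha⟩ : ∃ a : K ⊗[k] D, a = 1 ⊗ₜ a₀ + ∑ i : Fin m,
    algebraMap (MvPolynomial (Fin m) k) K (MvPolynomial.X i) ⊗ₜ (b ^ ((i : ℕ) + 1)) := ⟨_, rfl⟩
  have hρa : baseChangeRep K (L := L) ρ a = (ρ a₀).map (algebraMap P L) + ∑ i : Fin m,
      algebraMap (MvPolynomial (Fin m) P) L (MvPolynomial.X i) •
        (Matrix.diagonal fun j => θ j ^ ((i : ℕ) + 1)).map (algebraMap P L) := by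
    rw [ha, map_add, map_sum, baseChangeRep_tmul, one_smul]
    refine congrArg₂ (· + ·) rfl (Finset.sum_congr rfl fun i _ => ?_)
    rw [baseChangeRep_tmul, map_pow, hb, Matrix.diagonal_pow, ← algebraMap_smul L, hKL,
      MvPolynomial.map_X]
    rfl
  have hbase := h.baseChange (K := K) (L := L) (act := act) (fun s x => by
    rw [IsScalarTower.algebraMap_apply P (MvPolynomial (Fin m) P) L, hact,
      MvPolynomial.algebraMap_eq, MvPolynomial.map_C,
      IsScalarTower.algebraMap_apply P (MvPolynomial (Fin m) P) L, MvPolynomial.algebraMap_eq]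
    rfl)
  have hkry' : (krylov (baseChangeRep K (L := L) ρ a)).det ≠ 0 := by
    obtain ⟨Q, hQ⟩ : ∃ Q : Matrix (Fin (m + 1)) (Fin (m + 1)) (MvPolynomial (Fin m) P),
      Q = (ρ a₀).map MvPolynomial.C + ∑ i : Fin m, (MvPolynomial.X i : MvPolynomial (Fin m) P) •
        (Matrix.diagonal fun j => θ j ^ ((i : ℕ) + 1)).map MvPolynomial.C := ⟨_, rfl⟩
    have h1 : Q.map (algebraMap (MvPolynomial (Fin m) P) L) = baseChangeRep K (L := L) ρ a := by
      rw [hρa, hQ]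
      refine Matrix.ext fun i j => ?_
      simp only [Matrix.map_apply, Matrix.add_apply, Matrix.sum_apply, Matrix.smul_apply,
        smul_eq_mul, map_add, map_sum, map_mul, ← MvPolynomial.algebraMap_eq,
        ← IsScalarTower.algebraMap_apply]
    have h2 : Q.map (MvPolynomial.eval 0) = ρ a₀ := by
      rw [hQ]
      refine Matrix.ext fun i j => ?_
      simp [Matrix.sum_apply]
    rw [← h1, krylov_map, ← RingHom.mapMatrix_apply, ← RingHom.map_det]
    intro h0
    rw [FaithfulSMul.algebraMap_eq_zero_iff] at h0
    apply hkry
    rw [← h2, krylov_map, ← RingHom.mapMatrix_apply, ← RingHom.map_det, h0, map_zero]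
  have hadeg : (minpoly K a).natDegree = m + 1 :=
    natDegree_minpoly_of_linearIndependent hbase.split m.succ_pos
      (linearIndependent_pow_of_det_krylov hkry')
  have hInt : IsIntegral K a := Algebra.IsIntegral.isIntegral a
  have hirr := minpoly.irreducible hInt
  obtain ⟨x, hx⟩ := hroot _ hirr hadeg ⟨a, minpoly.aeval K a⟩
  have hxmin : minpoly K x = minpoly K a :=
    (minpoly.eq_of_irreducible_of_monic hirr hx (minpoly.monic hInt)).symm
  have hch1 := hbase.map_minpoly hfix (a := a) (by rw [hadeg, Fintype.card_fin])
  have hch2 := h'.map_minpoly hfix (a := x) (by rw [hxmin, hadeg, Fintype.card_fin])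
  rw [hxmin] at hch2
  have hsep : (minpoly K a).Separable := separable_of_natDegree hirr (by
    rw [hadeg, ← map_natCast (algebraMap k K)]
    exact (_root_.map_ne_zero _).mpr hchar)
  obtain ⟨κ, d, e, hκ0, hκ⟩ := exists_cohomologous_of_generic hθ (ρ a₀) hM
    (MonoidHom.id (P ≃ₐ[k] P)) U h.isUnit c h.coc_ne_zero h.coc (fun σ => h.comm σ a₀)
    (fun σ => by have := h.comm σ b; rwa [hb] at this) (L := L) (fun σ => (act σ : L →+* L)) hact
    U' h'.isUnit c' h'.coc (ρ' x) (fun σ => h'.comm σ x)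
    (by rw [← hch2]; exact hsep.map) (by rw [← hch2, hch1, hρa])
  refine ⟨e + m * d + (m + 1), by omega, fun σ => κ σ / (U σ).det ^ (d + 1),
    fun σ => div_ne_zero (hκ0 σ) (pow_ne_zero _ (h.det_ne_zero σ)), fun σ τ => ?_⟩
  have h1 := h.det_coc σ τ
  rw [Fintype.card_fin, MonoidHom.id_apply] at h1
  have h2 := hκ σ τ
  rw [MonoidHom.id_apply] at h2
  have h3 := h.det_ne_zero σ
  have h4 := h.det_ne_zero (σ * τ)
  have h5 : σ (U τ).det ≠ 0 := (_root_.map_ne_zero _).mpr (h.det_ne_zero τ)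
  rw [map_div₀, map_pow, div_mul_div_comm, ← mul_pow, h1, mul_pow, ← pow_mul]
  have h6 := h.coc_ne_zero σ τ
  field_simp
  have h7 : (m + 1) * (d + 1) = m * d + (m + 1) + d := by ring
  rw [h7]
  linear_combination (c σ τ ^ (m * d + (m + 1))) * h2

end Generic

section Valuation

universe u

variable {L : Type u} [Field L]

/-- An integer valued valuation on a field; its value at `0` is irrelevant. -/
structure IsIntVal (v : L → ℤ) : Prop where
  map_mul : ∀ x y, x ≠ 0 → y ≠ 0 → v (x * y) = v x + v y
  map_add : ∀ x y, x ≠ 0 → y ≠ 0 → x + y ≠ 0 → min (v x) (v y) ≤ v (x + y)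

/-- `x` has valuation at least `i`. -/
def ValGE (v : L → ℤ) (i : ℤ) (x : L) : Prop := x ≠ 0 → i ≤ v x

variable {v : L → ℤ}

theorem ValGE.zero (i : ℤ) : ValGE v i (0 : L) := fun h => absurd rfl h

theorem ValGE.mono {i j : ℤ} {x : L} (h : ValGE v i x) (hij : j ≤ i) : ValGE v j x :=
  fun hx => hij.trans (h hx)

namespace IsIntVal

variable (hv : IsIntVal v)
include hv

theorem map_one : v 1 = 0 := by
  have := hv.map_mul 1 1 one_ne_zero one_ne_zero
  rw [mul_one] at this
  omega

theorem map_neg (x : L) : v (-x) = v x := by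
  rcases eq_or_ne x 0 with rfl | hx
  · rw [neg_zero]
  have h1 := hv.map_mul (-1) (-1) (neg_ne_zero.mpr one_ne_zero) (neg_ne_zero.mpr one_ne_zero)
  rw [neg_mul_neg, mul_one, hv.map_one] at h1
  have h2 := hv.map_mul (-1) x (neg_ne_zero.mpr one_ne_zero) hx
  rw [neg_one_mul] at h2
  omega

theorem map_inv {x : L} (hx : x ≠ 0) : v x⁻¹ = -v x := by
  have := hv.map_mul x x⁻¹ hx (inv_ne_zero hx)
  rw [mul_inv_cancel₀ hx, hv.map_one] at this
  omega

theorem map_pow {x : L} (hx : x ≠ 0) (k : ℕ) : v (x ^ k) = k * v x := by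
  induction k with
  | zero => rw [pow_zero, hv.map_one, Nat.cast_zero, zero_mul]
  | succ k ih =>
    rw [pow_succ, hv.map_mul _ _ (pow_ne_zero _ hx) hx, ih]
    push_cast
    ring

theorem map_zpow {x : L} (hx : x ≠ 0) (k : ℤ) : v (x ^ k) = k * v x := by
  obtain ⟨j, rfl | rfl⟩ := k.eq_nat_or_neg
  · rw [zpow_natCast, hv.map_pow hx]
  · rw [zpow_neg, zpow_natCast, hv.map_inv (pow_ne_zero _ hx), hv.map_pow hx, neg_mul]

theorem map_prod {ι : Type*} (s : Finset ι) (f : ι → L) (hf : ∀ i ∈ s, f i ≠ 0) :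
    v (∏ i ∈ s, f i) = ∑ i ∈ s, v (f i) := by
  classical
  induction s using Finset.induction_on with
  | empty => rw [Finset.prod_empty, Finset.sum_empty, hv.map_one]
  | insert a s ha ih =>
    rw [Finset.prod_insert ha, Finset.sum_insert ha,
      hv.map_mul _ _ (hf a (Finset.mem_insert_self a s))
      (Finset.prod_ne_zero_iff.mpr fun i hi => hf i (Finset.mem_insert_of_mem hi)),
      ih fun i hi => hf i (Finset.mem_insert_of_mem hi)]

theorem nsmul (n : ℕ) : IsIntVal fun x => n * v x where
  map_mul x y hx hy := by rw [hv.map_mul x y hx hy]; ring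
  map_add x y hx hy hxy := by
    have h := hv.map_add x y hx hy hxy
    rw [← mul_min_of_nonneg _ _ (Nat.cast_nonneg n)]
    exact mul_le_mul_of_nonneg_left h (Nat.cast_nonneg n)

theorem ge_one : ValGE v 0 (1 : L) := fun _ => hv.map_one.ge

theorem ge_add {i : ℤ} {x y : L} (hx : ValGE v i x) (hy : ValGE v i y) : ValGE v i (x + y) := by
  intro hxy
  rcases eq_or_ne x 0 with rfl | hx0
  · rw [zero_add] at hxy ⊢
    exact hy hxy
  rcases eq_or_ne y 0 with rfl | hy0
  · rw [add_zero]
    exact hx hx0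
  exact (le_min (hx hx0) (hy hy0)).trans (hv.map_add x y hx0 hy0 hxy)

theorem ge_neg {i : ℤ} {x : L} (hx : ValGE v i x) : ValGE v i (-x) := by
  intro h
  rw [hv.map_neg]
  exact hx (neg_ne_zero.mp h)

theorem ge_sub {i : ℤ} {x y : L} (hx : ValGE v i x) (hy : ValGE v i y) : ValGE v i (x - y) := by
  rw [sub_eq_add_neg]
  exact hv.ge_add hx (hv.ge_neg hy)

theorem ge_mul {i j : ℤ} {x y : L} (hx : ValGE v i x) (hy : ValGE v j y) :
    ValGE v (i + j) (x * y) := by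
  intro h
  rw [hv.map_mul x y (left_ne_zero_of_mul h) (right_ne_zero_of_mul h)]
  exact add_le_add (hx (left_ne_zero_of_mul h)) (hy (right_ne_zero_of_mul h))

theorem ge_sum {ι : Type*} {i : ℤ} (s : Finset ι) (f : ι → L) (hf : ∀ j ∈ s, ValGE v i (f j)) :
    ValGE v i (∑ j ∈ s, f j) := by
  classical
  induction s using Finset.induction_on with
  | empty => rw [Finset.sum_empty]; exact ValGE.zero i
  | insert a s ha ih =>
    rw [Finset.sum_insert ha]
    exact hv.ge_add (hf a (Finset.mem_insert_self a s))
      (ih fun i hi => hf i (Finset.mem_insert_of_mem hi))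

theorem ge_prod {ι : Type*} (s : Finset ι) (k : ι → ℤ) (f : ι → L)
    (hf : ∀ j ∈ s, ValGE v (k j) (f j)) : ValGE v (∑ j ∈ s, k j) (∏ j ∈ s, f j) := by
  classical
  induction s using Finset.induction_on with
  | empty => rw [Finset.sum_empty, Finset.prod_empty]; exact hv.ge_one
  | insert a s ha ih =>
    rw [Finset.sum_insert ha, Finset.prod_insert ha]
    exact hv.ge_mul (hf a (Finset.mem_insert_self a s))
      (ih fun i hi => hf i (Finset.mem_insert_of_mem hi))

theorem ge_pow {x : L} (hx : ValGE v 0 x) (k : ℕ) : ValGE v 0 (x ^ k) := by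
  intro h
  rcases k.eq_zero_or_pos with rfl | hk
  · rw [pow_zero, hv.map_one]
  have hx0 : x ≠ 0 := fun h0 => h (by rw [h0, zero_pow hk.ne'])
  rw [hv.map_pow hx0]
  exact mul_nonneg (Nat.cast_nonneg k) (hx hx0)

/-- The valuation ring. -/
def integers : Subring L where
  carrier := {x | ValGE v 0 x}
  mul_mem' hx hy := by simpa using hv.ge_mul hx hy
  one_mem' := hv.ge_one
  add_mem' hx hy := hv.ge_add hx hy
  zero_mem' := ValGE.zero 0
  neg_mem' hx := hv.ge_neg hx

theorem mem_integers {x : L} : x ∈ hv.integers ↔ ValGE v 0 x := Iff.rfl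

/-- The residue field of an integer valued valuation. -/
theorem exists_residue : ∃ (F : Type u) (_ : Field F) (π : hv.integers →+* F),
    Function.Surjective π ∧ ∀ x, π x = 0 ↔ ValGE v 1 (x : L) := by
  let I : Ideal hv.integers :=
    { carrier := {x | ValGE v 1 (x : L)}
      add_mem' := fun hx hy => hv.ge_add hx hy
      zero_mem' := ValGE.zero 1
      smul_mem' := fun c x hx => by simpa using hv.ge_mul c.2 hx }
  have hI : I.IsMaximal := by
    rw [Ideal.isMaximal_iff]
    refine ⟨fun h => ?_, fun J x hIJ hxI hxJ => ?_⟩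
    · have h1 : (1 : ℤ) ≤ v 1 := h one_ne_zero
      rw [hv.map_one] at h1
      omega
    · have h1 : ¬ ValGE v 1 (x : L) := hxI
      rw [ValGE] at h1
      push Not at h1
      have h2 : ValGE v 0 (x : L) := x.2
      have h3 : ValGE v 0 (x : L)⁻¹ := by
        intro _
        rw [hv.map_inv h1.1]
        omega
      have h4 : (⟨(x : L)⁻¹, h3⟩ : hv.integers) * x = 1 :=
        Subtype.ext (inv_mul_cancel₀ h1.1)
      rw [← h4]
      exact J.mul_mem_left _ hxJ
  exact ⟨hv.integers ⧸ I, Ideal.Quotient.field I, Ideal.Quotient.mk I,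
    Ideal.Quotient.mk_surjective, fun x => Ideal.Quotient.eq_zero_iff_mem⟩

theorem ge_det {ι : Type*} [Fintype ι] [DecidableEq ι] {M : Matrix ι ι L} (k : ι → ℤ)
    (hM : ∀ i j, ValGE v (k j) (M i j)) : ValGE v (∑ j, k j) M.det := by
  rw [Matrix.det_apply']
  refine hv.ge_sum _ _ fun σ _ => ?_
  have h1 : ValGE v 0 ((Equiv.Perm.sign σ : ℤ) : L) := by
    rcases Int.units_eq_one_or (Equiv.Perm.sign σ) with h | h <;> rw [h]
    · simpa using hv.ge_one
    · simpa using hv.ge_neg hv.ge_one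
  have h2 := hv.ge_mul h1 (hv.ge_prod Finset.univ k (fun j => M (σ j) j) fun j _ => hM _ _)
  rwa [zero_add] at h2

theorem ge_det_zero {ι : Type*} [Fintype ι] [DecidableEq ι] {M : Matrix ι ι L}
    (hM : ∀ i j, ValGE v 0 (M i j)) : ValGE v 0 M.det := by
  simpa using hv.ge_det (fun _ => 0) hM

section Residue

variable {F : Type*} [Field F] {π : hv.integers →+* F} (hπ : ∀ x, π x = 0 ↔ ValGE v 1 (x : L))
include hπ

theorem map_eq_zero_iff {x : L} (hx : x ∈ hv.integers) : (x ≠ 0 ∧ v x = 0) ↔ π ⟨x, hx⟩ ≠ 0 := by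
  rw [Ne, Ne, hπ, ValGE]
  push Not
  refine and_congr_right fun h => ?_
  have := hx h
  show _ ↔ v x < 1
  omega

end Residue

omit hv in
theorem exists_matrix_integers (hv : IsIntVal v) {ι : Type*} [Fintype ι] [DecidableEq ι]
    {M : Matrix ι ι L} (hM : ∀ i j, ValGE v 0 (M i j)) :
    ∃ M' : Matrix ι ι hv.integers, M'.map hv.integers.subtype = M :=
  ⟨fun i j => ⟨M i j, hM i j⟩, rfl⟩

theorem det_residue {F : Type*} [Field F] {π : hv.integers →+* F}
    (hπ : ∀ x, π x = 0 ↔ ValGE v 1 (x : L)) {ι : Type*} [Fintype ι] [DecidableEq ι]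
    (M : Matrix ι ι hv.integers) : (M.map π).det ≠ 0 ↔
      (M.map hv.integers.subtype).det ≠ 0 ∧ v (M.map hv.integers.subtype).det = 0 := by
  have h1 : (M.map hv.integers.subtype).det = (M.det : L) := by
    rw [← RingHom.mapMatrix_apply, ← RingHom.map_det]
    rfl
  have h2 : (M.map π).det = π M.det := by
    rw [← RingHom.mapMatrix_apply, ← RingHom.map_det]
  rw [h1, h2, hv.map_eq_zero_iff hπ M.det.2]

/-- A matrix congruent to `1` has unit determinant. -/
theorem det_one_add {ι : Type*} [Fintype ι] [DecidableEq ι] {X : Matrix ι ι L}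
    (hX : ∀ i j, ValGE v 1 (X i j)) : (1 + X).det ≠ 0 ∧ v (1 + X).det = 0 := by
  obtain ⟨F, _, π, -, hπ⟩ := hv.exists_residue
  obtain ⟨Y, hY⟩ := hv.exists_matrix_integers fun i j => (hX i j).mono zero_le_one
  have h1 := (hv.det_residue hπ (1 + Y)).mp (by
    have : (1 + Y).map π = 1 := by
      refine Matrix.ext fun i j => ?_
      have h2 : π (Y i j) = 0 := (hπ _).mpr (by
        rw [← hY] at hX
        exact hX i j)
      rw [Matrix.map_apply, Matrix.add_apply, RingHom.map_add, h2, add_zero, Matrix.one_apply,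
        Matrix.one_apply]
      split_ifs
      · exact RingHom.map_one π
      · exact RingHom.map_zero π
    rw [this, Matrix.det_one]
    exact one_ne_zero)
  have h3 : (1 + Y).map hv.integers.subtype = 1 + X := by
    rw [← hY]
    refine Matrix.ext fun i j => ?_
    rw [Matrix.map_apply, Matrix.add_apply, RingHom.map_add, Matrix.add_apply, Matrix.one_apply,
      Matrix.one_apply]
    split_ifs <;> simp
  rwa [h3] at h1

end IsIntVal

end Valuation

section Filtration

universe u

variable {L : Type u} [Field L] {v : L → ℤ} {ι : Type*} [Fintype ι]

/-- A decreasing filtration of a coordinate space by lattices over a valuation ring. -/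
structure IsLatticeFiltration (v : L → ℤ) (N : ℤ → Set (ι → L)) : Prop where
  mono : ∀ {i j x}, x ∈ N i → j ≤ i → x ∈ N j
  add : ∀ {i x y}, x ∈ N i → y ∈ N i → x + y ∈ N i
  smul : ∀ {i j x l}, x ∈ N i → ValGE v j l → l • x ∈ N (i + j)
  exhaustive : ∀ x, ∃ i, x ∈ N i
  separated : ∀ {i x}, x ∈ N i → ∀ l, ValGE v i (x l)

namespace IsLatticeFiltration

variable (hv : IsIntVal v) {N : ℤ → Set (ι → L)} (hN : IsLatticeFiltration v N)
include hv hN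

omit [Fintype ι] in
theorem neg {i : ℤ} {x : ι → L} (hx : x ∈ N i) : -x ∈ N i := by
  have := hN.smul hx (hv.ge_neg hv.ge_one)
  rwa [neg_one_smul, add_zero] at this

omit [Fintype ι] in
theorem sub {i : ℤ} {x y : ι → L} (hx : x ∈ N i) (hy : y ∈ N i) : x - y ∈ N i := by
  rw [sub_eq_add_neg]
  exact hN.add hx (hN.neg hv hy)

theorem exists_level_le (W : Submodule L (ι → L)) {x : ι → L} (hx : x ∉ W) :
    ∃ C : ℤ, ∀ i, ∀ u ∈ W, x + u ∈ N i → i ≤ C := by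
  classical
  obtain ⟨φ, hφx, hφW⟩ := Submodule.exists_le_ker_of_notMem hx
  obtain ⟨c, hc⟩ := (Set.finite_range fun l => v (φ (Pi.single l 1))).bddBelow
  refine ⟨v (φ x) - c, fun i u hu hxu => ?_⟩
  have h1 : φ x = ∑ l, (x + u) l * φ (Pi.single l 1) := by
    have h2 : φ u = 0 := hφW hu
    rw [← add_zero (φ x), ← h2, ← map_add, LinearMap.pi_apply_eq_sum_univ φ (x + u)]
    refine Finset.sum_congr rfl fun l _ => ?_
    rw [smul_eq_mul]
    congr 2
    funext j
    rw [Pi.single_apply]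
    simp only [eq_comm]
  have h2 : ValGE v (i + c) (φ x) := by
    rw [h1]
    exact hv.ge_sum _ _ fun l _ => hv.ge_mul (hN.separated hxu l) fun _ => hc ⟨l, rfl⟩
  have := h2 hφx
  omega

/-- A maximal approximation of a vector by a subspace. -/
theorem exists_max_level (W : Submodule L (ι → L)) {x : ι → L} (hx : x ∉ W) :
    ∃ i, ∃ u ∈ W, x + u ∈ N i ∧ ∀ w ∈ W, x + w ∉ N (i + 1) := by
  obtain ⟨C, hC⟩ := hN.exists_level_le hv W hx
  obtain ⟨i₀, hi₀⟩ := hN.exhaustive x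
  obtain ⟨i, ⟨u, hu, hi⟩, hmax⟩ := Int.exists_greatest_of_bdd
    (P := fun i => ∃ u ∈ W, x + u ∈ N i) ⟨C, fun i ⟨u, hu, h⟩ => hC i u hu h⟩
    ⟨i₀, 0, W.zero_mem, by rwa [add_zero]⟩
  refine ⟨i, u, hu, hi, fun w hw h => ?_⟩
  have := hmax (i + 1) ⟨w, hw, h⟩
  omega

/-- Partial orthogonal bases adapted to an approximate idempotent. -/
theorem exists_adapted {A : Matrix ι ι L} {m : ℤ}
    (hA : ∀ i, ∀ x ∈ N i, A.mulVec x ∈ N i)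
    (hA2 : ∀ i, ∀ x ∈ N i, (A * A - A).mulVec x ∈ N (i + m)) (d : ℕ) (hd : d ≤ Fintype.card ι) :
    ∃ (e : Fin d → ι → L) (ν : Fin d → ℤ) (b : Fin d → L), (∀ j, b j = 0 ∨ b j = 1) ∧
      (∀ j, e j ∈ N (ν j)) ∧ (∀ j, A.mulVec (e j) - b j • e j ∈ N (ν j + m)) ∧
      ∀ i (l : Fin d → L), ∑ j, l j • e j ∈ N i → ∀ j, ValGE v (i - ν j) (l j) := by
  induction d with
  | zero => exact ⟨Fin.elim0, Fin.elim0, Fin.elim0, fun j => j.elim0, fun j => j.elim0,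
      fun j => j.elim0, fun _ _ _ j => j.elim0⟩
  | succ d ih =>
    obtain ⟨e, ν, b, hb, he, hAe, horth⟩ := ih (by omega)
    obtain ⟨x, hx⟩ : ∃ x, x ∉ Submodule.span L (Set.range e) := by
      by_contra! h
      have h1 : Submodule.span L (Set.range e) = ⊤ := eq_top_iff.mpr fun x _ => h x
      have h2 := finrank_range_le_card (R := L) e
      rw [Set.finrank, h1, finrank_top, finrank_fintype_fun_eq_card, Fintype.card_fin] at h2
      omega
    obtain ⟨i₀, u, hu, hxu, hmax⟩ := hN.exists_max_level hv _ hx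
    obtain ⟨y, c, hc, hy, hAy, hymax⟩ : ∃ (y : ι → L) (c : L), (c = 0 ∨ c = 1) ∧ y ∈ N i₀ ∧
        A.mulVec y - c • y ∈ N (i₀ + m) ∧
        ∀ w ∈ Submodule.span L (Set.range e), y + w ∉ N (i₀ + 1) := by
      have h1 : (A * A - A).mulVec (x + u) ∈ N (i₀ + m) := hA2 _ _ hxu
      rw [Matrix.sub_mulVec, ← Matrix.mulVec_mulVec] at h1
      by_cases hcase : ∃ w ∈ Submodule.span L (Set.range e), A.mulVec (x + u) + w ∈ N (i₀ + 1)
      · obtain ⟨w, hw, hw'⟩ := hcase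
        refine ⟨x + u - A.mulVec (x + u), 0, Or.inl rfl, hN.sub hv hxu (hA _ _ hxu), ?_,
          fun w' hw'' h => ?_⟩
        · rw [zero_smul, sub_zero, Matrix.mulVec_sub, ← neg_sub]
          exact hN.neg hv h1
        · refine hmax (u + (w + w')) (add_mem hu (add_mem hw hw'')) ?_
          have := hN.add hw' h
          convert this using 1
          abel
      · push Not at hcase
        refine ⟨A.mulVec (x + u), 1, Or.inr rfl, hA _ _ hxu, ?_, hcase⟩
        rwa [one_smul]
    refine ⟨Fin.snoc e y, Fin.snoc ν i₀, Fin.snoc b c, ?_, ?_, ?_, ?_⟩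
    · intro j
      refine Fin.lastCases ?_ (fun j => ?_) j
      · rwa [Fin.snoc_last]
      · rw [Fin.snoc_castSucc]
        exact hb j
    · intro j
      refine Fin.lastCases ?_ (fun j => ?_) j
      · rwa [Fin.snoc_last, Fin.snoc_last]
      · rw [Fin.snoc_castSucc, Fin.snoc_castSucc]
        exact he j
    · intro j
      refine Fin.lastCases ?_ (fun j => ?_) j
      · rwa [Fin.snoc_last, Fin.snoc_last, Fin.snoc_last]
      · rw [Fin.snoc_castSucc, Fin.snoc_castSucc, Fin.snoc_castSucc]
        exact hAe j
    · intro i l hl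
      rw [Fin.sum_univ_castSucc, Fin.snoc_last] at hl
      simp only [Fin.snoc_castSucc] at hl
      have hlast : ValGE v (i - i₀) (l (Fin.last d)) := by
        intro h0
        by_contra! hlt
        have h1 := hN.smul hl (l := (l (Fin.last d))⁻¹) (j := -v (l (Fin.last d)))
          fun _ => (hv.map_inv h0).ge
        rw [smul_add, inv_smul_smul₀ h0, add_comm _ y] at h1
        have h2 := hN.mono h1 (show i₀ + 1 ≤ _ by omega)
        refine hymax _ ?_ h2
        exact Submodule.smul_mem _ _ (Submodule.sum_mem _ fun j _ =>
          Submodule.smul_mem _ _ (Submodule.subset_span ⟨j, rfl⟩))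
      intro j
      refine Fin.lastCases ?_ (fun j => ?_) j
      · rwa [Fin.snoc_last]
      · rw [Fin.snoc_castSucc]
        refine horth i (fun j => l j.castSucc) ?_ j
        have := hN.sub hv hl (hN.mono (hN.smul hy hlast) (by omega))
        rwa [add_sub_cancel_right] at this

omit hN [Fintype ι] in
/-- Orthogonal bases adapted to an approximate idempotent. -/
theorem exists_basis {n : ℕ} {N : ℤ → Set (Fin n → L)} (hN : IsLatticeFiltration v N)
    {A : Matrix (Fin n) (Fin n) L} {m : ℤ} (hm : 0 < m) {p : L} (hp : p ≠ 0) (hpm : v p = m)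
    (hA : ∀ i, ∀ x ∈ N i, A.mulVec x ∈ N i)
    (hA2 : ∀ i, ∀ x ∈ N i, (A * A - A).mulVec x ∈ N (i + m)) :
    ∃ (B : Matrix (Fin n) (Fin n) L) (ν : Fin n → ℤ) (b : Fin n → L), IsUnit B ∧
      (∀ j, b j = 0 ∨ b j = 1) ∧ (∀ j, 0 ≤ ν j ∧ ν j < m) ∧
      (∀ j, (fun i => B i j) ∈ N (ν j)) ∧
      (∀ j, (fun i => (A * B - B * Matrix.diagonal b) i j) ∈ N (ν j + m)) ∧
      ∀ i (l : Fin n → L), B.mulVec l ∈ N i → ∀ j, ValGE v (i - ν j) (l j) := by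
  obtain ⟨e, ν, b, hb, he, hAe, horth⟩ := hN.exists_adapted hv hA hA2 n (by simp)
  have hpz : ∀ j, p ^ (-(ν j / m)) ≠ 0 := fun j => zpow_ne_zero _ hp
  have hvp : ∀ j, v (p ^ (-(ν j / m))) = ν j % m - ν j := fun j => by
    rw [hv.map_zpow hp, hpm, Int.emod_def]
    ring
  have hl : ∀ i (l : Fin n → L),
      Matrix.mulVec (Matrix.of fun i j => p ^ (-(ν j / m)) * e j i) l ∈ N i →
      ∀ j, ValGE v (i - ν j % m) (l j) := by
    intro i l h j hj
    have h1 : Matrix.mulVec (Matrix.of fun i j => p ^ (-(ν j / m)) * e j i) l =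
        ∑ j, (l j * p ^ (-(ν j / m))) • e j := by
      funext i
      rw [Matrix.mulVec, dotProduct, Finset.sum_apply]
      refine Finset.sum_congr rfl fun j _ => ?_
      rw [Matrix.of_apply, Pi.smul_apply, smul_eq_mul]
      ring
    rw [h1] at h
    have h2 := horth i _ h j (mul_ne_zero hj (hpz j))
    rw [hv.map_mul _ _ hj (hpz j), hvp] at h2
    omega
  refine ⟨Matrix.of fun i j => p ^ (-(ν j / m)) * e j i, fun j => ν j % m, b, ?_, hb,
    fun j => ⟨Int.emod_nonneg _ hm.ne', Int.emod_lt_of_pos _ hm⟩, fun j => ?_, fun j => ?_, hl⟩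
  · rw [← Matrix.mulVec_injective_iff_isUnit]
    refine (injective_iff_map_eq_zero (Matrix.mulVecLin _)).mpr fun l h0 => ?_
    funext j
    by_contra hj
    obtain ⟨i₁, hi₁⟩ := hN.exhaustive 0
    have h2 : ∀ i, (0 : Fin n → L) ∈ N i := fun i => by
      have := hN.smul hi₁ (ValGE.zero (v := v) (i - i₁))
      rwa [smul_zero, add_sub_cancel] at this
    have h3 := hl (v (l j) + ν j % m + 1) l (by
      rw [← Matrix.mulVecLin_apply, h0]
      exact h2 _) j hj
    omega
  · have := hN.smul (he j) (l := p ^ (-(ν j / m))) (j := ν j % m - ν j) fun _ => (hvp j).ge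
    rwa [add_sub_cancel] at this
  · have := hN.smul (hAe j) (l := p ^ (-(ν j / m))) (j := ν j % m - ν j) fun _ => (hvp j).ge
    refine hN.mono (x := _) ?_ (show ν j % m + m ≤ ν j + m + (ν j % m - ν j) by omega)
    convert this using 1
    funext i
    rw [Matrix.sub_apply, Matrix.mul_diagonal, Matrix.mul_apply, Pi.smul_apply, Pi.sub_apply,
      Matrix.mulVec, dotProduct, smul_eq_mul, mul_sub, Finset.mul_sum, Pi.smul_apply, smul_eq_mul]
    congr 1
    · refine Finset.sum_congr rfl fun l _ => ?_
      rw [Matrix.of_apply]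
      ring
    · rw [Matrix.of_apply]
      ring

end IsLatticeFiltration

end Filtration

section Conj

variable {K L A G ι : Type*} [Field K] [Field L] [Algebra K L] [Ring A] [Algebra K A]
  [Group G] [Fintype ι] [DecidableEq ι] {act : G →* (L ≃ₐ[K] L)} {ρ : A →ₐ[K] Matrix ι ι L}
  {U : G → Matrix ι ι L} {c : G → G → L}

/-- Changing the basis of a form. -/
theorem IsForm.exists_conj (h : IsForm act ρ U c) (V : (Matrix ι ι L)ˣ) :
    ∃ ρ' : A →ₐ[K] Matrix ι ι L,
      (∀ a, ρ' a = (↑V⁻¹ : Matrix ι ι L) * ρ a * (V : Matrix ι ι L)) ∧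
      IsForm act ρ' (fun σ => (↑V⁻¹ : Matrix ι ι L) * U σ *
        (act σ).mapMatrix (V : Matrix ι ι L)) c := by
  obtain ⟨ρ', hρ', h2⟩ := h.split.exists_conj_unit V
  have hact : ∀ σ, (act σ).mapMatrix (V : Matrix ι ι L) *
      (act σ).mapMatrix (↑V⁻¹ : Matrix ι ι L) = 1 := fun σ => by
    rw [← map_mul, Units.mul_inv, map_one]
  refine ⟨ρ', h2, hρ', fun σ => ?_, fun σ a => ?_, fun σ τ => ?_⟩
  · exact ((V⁻¹).isUnit.mul (h.isUnit σ)).mul (V.isUnit.map ((act σ).mapMatrix (m := ι)))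
  · rw [h2, map_mul, map_mul]
    calc _ = (↑V⁻¹ : Matrix ι ι L) * U σ * ((act σ).mapMatrix (V : Matrix ι ι L) *
          (act σ).mapMatrix (↑V⁻¹ : Matrix ι ι L)) * (act σ).mapMatrix (ρ a) *
          (act σ).mapMatrix (V : Matrix ι ι L) := by simp only [mul_assoc]
      _ = (↑V⁻¹ : Matrix ι ι L) * (U σ * (act σ).mapMatrix (ρ a)) *
          (act σ).mapMatrix (V : Matrix ι ι L) := by
        rw [hact, mul_one]
        simp only [mul_assoc]
      _ = (↑V⁻¹ : Matrix ι ι L) * ρ a * ((V : Matrix ι ι L) * (↑V⁻¹ : Matrix ι ι L)) * U σ *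
          (act σ).mapMatrix (V : Matrix ι ι L) := by
        rw [h.comm, Units.mul_inv, mul_one]
        simp only [mul_assoc]
      _ = _ := by simp only [mul_assoc]
  · rw [map_mul, map_mul]
    have h3 : (act σ).mapMatrix ((act τ).mapMatrix (V : Matrix ι ι L)) =
        (act (σ * τ)).mapMatrix (V : Matrix ι ι L) := by
      rw [map_mul]
      rfl
    calc _ = (↑V⁻¹ : Matrix ι ι L) * U σ * ((act σ).mapMatrix (V : Matrix ι ι L) *
          (act σ).mapMatrix (↑V⁻¹ : Matrix ι ι L)) * (act σ).mapMatrix (U τ) *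
          (act σ).mapMatrix ((act τ).mapMatrix (V : Matrix ι ι L)) := by simp only [mul_assoc]
      _ = (↑V⁻¹ : Matrix ι ι L) * (U σ * (act σ).mapMatrix (U τ)) *
          (act (σ * τ)).mapMatrix (V : Matrix ι ι L) := by
        rw [hact, mul_one, h3]
        simp only [mul_assoc]
      _ = _ := by rw [h.coc, mul_smul_comm, smul_mul_assoc]

theorem IsForm.one_eq (h : IsForm act ρ U c) : U 1 = c 1 1 • 1 := by
  have h1 := h.coc 1 1
  have h2 : (act 1).mapMatrix (U 1) = U 1 := by
    rw [map_one]
    exact Matrix.ext fun i j => rfl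
  rw [h2, mul_one] at h1
  refine (h.isUnit 1).mul_right_cancel ?_
  rw [h1, smul_mul_assoc, one_mul]

end Conj

section Lattice

universe u

variable {L : Type u} [Field L] {w : L → ℤ}

theorem pow_entries_bounded (hw : IsIntVal w) {ι : Type*} [Fintype ι] [DecidableEq ι]
    (Z : Matrix ι ι L) (F : hw.integers[X]) (hF : F.Monic) (hZ : aeval Z F = 0) :
    ∃ M : ℤ, ∀ j l l', ValGE w M ((Z ^ j) l l') := by
  obtain ⟨M, hM⟩ := (Set.finite_range fun t : Fin (F.natDegree + 1) × ι × ι =>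
    w ((Z ^ (t.1 : ℕ)) t.2.1 t.2.2)).bddBelow
  refine ⟨M, fun j l l' => ?_⟩
  have h1 : Z ^ j = ∑ t ∈ Finset.range (F.natDegree + 1), ((X ^ j %ₘ F).coeff t) • Z ^ t := by
    rw [← aeval_eq_sum_range' (Nat.lt_succ_of_le (natDegree_modByMonic_le _ hF)),
      aeval_modByMonic_eq_self_of_root hZ, map_pow, aeval_X]
  rw [h1, Matrix.sum_apply]
  refine hw.ge_sum _ _ fun t ht => ?_
  have h2 := hw.ge_mul ((X ^ j %ₘ F).coeff t).2 (y := (Z ^ t) l l') (j := M)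
    fun _ => hM ⟨(⟨t, Finset.mem_range.mp ht⟩, l, l'), rfl⟩
  rw [zero_add] at h2
  exact h2

/-- Lattices cut out by a family of linear conditions. -/
theorem isLatticeFiltration_of_bounded {v : L → ℤ} (hv : IsIntVal v) {ι κ : Type*} [Fintype ι]
    [DecidableEq ι] (M : κ → Matrix ι ι L) (s : κ → ℤ) {C : ℤ}
    (hC : ∀ t l l', ValGE v (C - s t) (M t l l')) {t₀ : κ} {r : L} (hr : r ≠ 0)
    (ht₀ : M t₀ = r • 1) (hs : v r = - s t₀) :
    IsLatticeFiltration v fun i => {x | ∀ t l, ValGE v (i - s t) ((M t).mulVec x l)} where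
  mono h hij t l := (h t l).mono (by omega)
  add hx hy t l := by
    rw [Matrix.mulVec_add]
    exact hv.ge_add (hx t l) (hy t l)
  smul {i j x a} hx ha t l := by
    rw [Matrix.mulVec_smul]
    exact (hv.ge_mul ha (hx t l)).mono (by omega)
  exhaustive x := by
    obtain ⟨c, hc⟩ := (Set.finite_range fun l => v (x l)).bddBelow
    refine ⟨C + c, fun t l => ?_⟩
    refine hv.ge_sum _ _ fun l' _ => ?_
    exact (hv.ge_mul (hC t l l') (y := x l') (j := c) fun _ => hc ⟨l', rfl⟩).mono (by omega)
  separated {i x} hx l hl := by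
    have := hx t₀ l
    rw [ht₀, Matrix.smul_mulVec, Matrix.one_mulVec, Pi.smul_apply, smul_eq_mul] at this
    have := this (mul_ne_zero hr hl)
    rw [hv.map_mul _ _ hr hl] at this
    omega

end Lattice

section Shift

universe u

variable {L : Type u} [Field L] {v : L → ℤ} {ι : Type*} [Fintype ι] [DecidableEq ι] {ν : ι → ℤ}

/-- Matrices raising by `s` the level of a lattice chain with jumps `ν`. -/
def Shift (v : L → ℤ) (ν : ι → ℤ) (s : ℤ) (X : Matrix ι ι L) : Prop :=
  ∀ i j, ValGE v (ν j + s - ν i) (X i j)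

namespace Shift

omit [Fintype ι] [DecidableEq ι] in
theorem mono {s t : ℤ} {X : Matrix ι ι L} (h : Shift v ν s X) (hst : t ≤ s) : Shift v ν t X :=
  fun i j => (h i j).mono (by omega)

omit [Fintype ι] in
theorem diagonal {b : ι → L} {s : ℤ} (hb : ∀ i, ValGE v s (b i)) :
    Shift v ν s (Matrix.diagonal b) := by
  intro i j
  rcases eq_or_ne i j with rfl | hij
  · rw [Matrix.diagonal_apply_eq]
    exact (hb i).mono (by omega)
  · rw [Matrix.diagonal_apply_ne _ hij]
    exact ValGE.zero _

omit [Fintype ι] [DecidableEq ι] in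
theorem map {s : ℤ} {X : Matrix ι ι L} (h : Shift v ν s X) {f : L → L} (hf : ∀ x, v (f x) = v x)
    (hf0 : f 0 = 0) : Shift v ν s (X.map f) := by
  intro i j hne
  rw [Matrix.map_apply, hf]
  refine h i j fun h0 => hne ?_
  rw [Matrix.map_apply, h0, hf0]

variable (hv : IsIntVal v)
include hv

omit [Fintype ι] in
theorem one : Shift v ν 0 (1 : Matrix ι ι L) := by
  rw [← Matrix.diagonal_one]
  exact diagonal fun _ => hv.ge_one

omit [DecidableEq ι] in
theorem mul {s t : ℤ} {X Y : Matrix ι ι L} (hX : Shift v ν s X) (hY : Shift v ν t Y) :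
    Shift v ν (s + t) (X * Y) := by
  intro i j
  rw [Matrix.mul_apply]
  exact hv.ge_sum _ _ fun l _ => (hv.ge_mul (hX i l) (hY l j)).mono (by omega)

omit [Fintype ι] [DecidableEq ι] in
theorem add {s : ℤ} {X Y : Matrix ι ι L} (hX : Shift v ν s X) (hY : Shift v ν s Y) :
    Shift v ν s (X + Y) := fun i j => hv.ge_add (hX i j) (hY i j)

omit [Fintype ι] [DecidableEq ι] in
theorem sub {s : ℤ} {X Y : Matrix ι ι L} (hX : Shift v ν s X) (hY : Shift v ν s Y) :
    Shift v ν s (X - Y) := fun i j => hv.ge_sub (hX i j) (hY i j)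

omit [Fintype ι] [DecidableEq ι] in
theorem smul {s t : ℤ} {X : Matrix ι ι L} {l : L} (hX : Shift v ν s X) (hl : ValGE v t l) :
    Shift v ν (s + t) (l • X) := fun i j => by
  rw [Matrix.smul_apply, smul_eq_mul]
  exact (hv.ge_mul hl (hX i j)).mono (by omega)

theorem pow {s : ℤ} {X : Matrix ι ι L} (hX : Shift v ν s X) (k : ℕ) :
    Shift v ν (k * s) (X ^ k) := by
  induction k with
  | zero => simpa using one hv
  | succ k ih =>
    rw [pow_succ]
    exact (mul hv ih hX).mono (by push_cast; linarith)

/-- Inverses of matrices congruent to `1`. -/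
theorem of_one_add_mul {m : ℤ} (hm : 0 < m) {X Q : Matrix ι ι L} (hX : Shift v ν m X)
    (hQ : (1 + X) * Q = 1) : Shift v ν 0 Q := by
  have key : ∀ k : ℕ, ∀ j : ℤ, -(k : ℤ) ≤ j → Shift v ν j Q → Shift v ν 0 Q := by
    intro k
    induction k with
    | zero => exact fun j hj h => h.mono (by simpa using hj)
    | succ k ih =>
      intro j hj h
      rcases le_or_gt 0 j with h0 | h0
      · exact h.mono h0
      refine ih (j + 1) (by push_cast at hj; omega) ?_
      have h1 : Q = 1 - X * Q := by rw [eq_sub_iff_add_eq, ← hQ, add_mul, one_mul]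
      rw [h1]
      exact sub hv ((one hv).mono (by omega)) ((mul hv hX h).mono (by omega))
  obtain ⟨c, hc⟩ := (Set.finite_range fun l : ι × ι => v (Q l.1 l.2) - ν l.2 + ν l.1).bddBelow
  refine key c.natAbs c (by omega) fun i j _ => ?_
  have : c ≤ _ := hc ⟨(i, j), rfl⟩
  dsimp only at this
  omega

end Shift

end Shift

section Adapted

universe u

variable {K A G : Type*} {L : Type u} [Field K] [Field L] [Algebra K L] [Ring A] [Algebra K A]
  [Group G] [Finite G] {n : ℕ} [NeZero n] {act : G →* (L ≃ₐ[K] L)}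
  {ρ : A →ₐ[K] Matrix (Fin n) (Fin n) L} {U : G → Matrix (Fin n) (Fin n) L} {c : G → G → L}
  {w : L → ℤ}

/-- A basis adapted to a decomposition group and an approximate idempotent. -/
theorem IsForm.exists_adapted (h : IsForm act ρ U c) (hw : IsIntVal w) (H : Subgroup G)
    (hH : ∀ g ∈ H, ∀ l, w (act g l) = w l) {p : K} (hp : w (algebraMap K L p) = 1) (hp0 : p ≠ 0)
    {a z : A} (hz : a * a - a = p ^ 2 • z)
    {Fa Fz : hw.integers[X]} (hFa : Fa.Monic) (hFa' : aeval (ρ a) Fa = 0)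
    (hFz : Fz.Monic) (hFz' : aeval (ρ z) Fz = 0) :
    ∃ (ρ' : A →ₐ[K] Matrix (Fin n) (Fin n) L) (U' : G → Matrix (Fin n) (Fin n) L)
      (ν : Fin n → ℤ) (b : Fin n → L), IsForm act ρ' U' c ∧ (∀ x, (ρ' x).det = (ρ x).det) ∧
      (∀ g ∈ H, w (U' g).det = w (U g).det) ∧ (∀ j, b j = 0 ∨ b j = 1) ∧
      (∀ j, 0 ≤ ν j ∧ ν j < n) ∧
      (∀ g ∈ H, Shift (fun x => n * w x) ν (w (U g).det) (U' g)) ∧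
      Shift (fun x => n * w x) ν n (ρ' a - Matrix.diagonal b) ∧
      Shift (fun x => n * w x) ν 0 (ρ' z) := by
  have hv := hw.nsmul n
  obtain ⟨v, hvdef⟩ : ∃ v : L → ℤ, v = fun x => n * w x := ⟨_, rfl⟩
  rw [← hvdef] at hv ⊢
  have hvw : ∀ x, v x = n * w x := fun x => by rw [hvdef]
  have hpL : algebraMap K L p ≠ 0 := (_root_.map_ne_zero _).mpr hp0
  have hn : 0 < n := Nat.pos_of_ne_zero (NeZero.ne n)
  have hcomm : Commute a z := by
    have h1 : Commute a (p ^ 2 • z) := by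
      rw [← hz]
      exact ((Commute.refl a).mul_right (Commute.refl a)).sub_right (Commute.refl a)
    have h2 := h1.smul_right (p ^ 2)⁻¹
    rwa [inv_smul_smul₀ (pow_ne_zero 2 hp0)] at h2
  have hUdet : ∀ g, IsUnit (U g).det := fun g => (h.det_ne_zero g).isUnit
  have hdet : ∀ g ∈ H, ∀ g' : G, v (c g g') = w (U g).det + w (U g').det - w (U (g * g')).det := by
    intro g hg g'
    have h1 := congrArg w (h.det_coc g g')
    rw [hw.map_mul _ _ (h.det_ne_zero g) ((_root_.map_ne_zero _).mpr (h.det_ne_zero g')), hH g hg,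
      hw.map_mul _ _ (pow_ne_zero _ (h.coc_ne_zero g g')) (h.det_ne_zero _),
      hw.map_pow (h.coc_ne_zero g g'), Fintype.card_fin] at h1
    rw [hvw]
    omega
  obtain ⟨Ma, hMa⟩ := pow_entries_bounded hw (ρ a) Fa hFa hFa'
  obtain ⟨Mz, hMz⟩ := pow_entries_bounded hw (ρ z) Fz hFz hFz'
  have hge : ∀ {i : ℤ} {x : L}, ValGE w i x → ValGE v (n * i) x := fun hx h0 => by
    rw [hvw]
    exact mul_le_mul_of_nonneg_left (hx h0) (Nat.cast_nonneg n)
  obtain ⟨Cu, hCu⟩ := (Set.finite_range fun t : H × Fin n × Fin n =>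
    v ((U t.1)⁻¹ t.2.1 t.2.2) + w (U t.1).det).bddBelow
  obtain ⟨T, hT⟩ : ∃ T : H × ℕ × ℕ → Matrix (Fin n) (Fin n) L,
      ∀ t, T t = (U t.1)⁻¹ * ρ (a ^ t.2.1 * z ^ t.2.2) := ⟨_, fun _ => rfl⟩
  have hN := isLatticeFiltration_of_bounded hv T (fun t => w (U t.1).det)
    (C := Cu + n * Ma + n * Mz) (fun t l l' => by
      rw [hT, map_mul, map_pow, map_pow, Matrix.mul_apply]
      refine hv.ge_sum _ _ fun l₁ _ => ?_
      rw [Matrix.mul_apply, Finset.mul_sum]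
      refine hv.ge_sum _ _ fun l₂ _ => ?_
      have h1 : ValGE v (Cu - w (U t.1).det) ((U t.1)⁻¹ l l₁) := fun _ => by
        have : Cu ≤ _ := hCu ⟨(t.1, l, l₁), rfl⟩
        dsimp only at this
        omega
      exact (hv.ge_mul h1 (hv.ge_mul (hge (hMa t.2.1 l₁ l₂)) (hge (hMz t.2.2 l₂ l')))).mono
        (by omega))
    (t₀ := (1, 0, 0)) (r := (c 1 1)⁻¹) (inv_ne_zero (h.coc_ne_zero 1 1)) (by
      rw [hT, pow_zero, pow_zero, mul_one, map_one, mul_one]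
      refine Matrix.inv_eq_left_inv ?_
      show _ * U 1 = 1
      rw [h.one_eq, smul_mul_smul_comm, one_mul, inv_mul_cancel₀ (h.coc_ne_zero 1 1), one_smul])
    (by
      rw [hv.map_inv (h.coc_ne_zero 1 1), hdet 1 H.one_mem 1, mul_one]
      show _ = - w (U 1).det
      ring)
  obtain ⟨N, hNdef⟩ : ∃ N : ℤ → Set (Fin n → L),
    N = fun i => {x | ∀ t l, ValGE v (i - w (U t.1).det) ((T t).mulVec x l)} := ⟨_, rfl⟩
  rw [← hNdef] at hN
  have hmem : ∀ i x, x ∈ N i ↔ ∀ t l, ValGE v (i - w (U t.1).det) ((T t).mulVec x l) := by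
    intro i x
    rw [hNdef]
    rfl
  have hNa : ∀ i, ∀ x ∈ N i, (ρ a).mulVec x ∈ N i := by
    intro i x hx
    rw [hmem] at hx ⊢
    intro t l
    have h1 : T t * ρ a = T (t.1, t.2.1 + 1, t.2.2) := by
      rw [hT, hT, mul_assoc, ← map_mul, mul_assoc, ← (hcomm.pow_right t.2.2).eq, ← mul_assoc,
        ← pow_succ]
    rw [Matrix.mulVec_mulVec, h1]
    exact hx _ l
  have hNz : ∀ i, ∀ x ∈ N i, (ρ z).mulVec x ∈ N i := by
    intro i x hx
    rw [hmem] at hx ⊢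
    intro t l
    have h1 : T t * ρ z = T (t.1, t.2.1, t.2.2 + 1) := by
      rw [hT, hT, mul_assoc, ← map_mul, mul_assoc, ← pow_succ]
    rw [Matrix.mulVec_mulVec, h1]
    exact hx _ l
  have hNU : ∀ g ∈ H, ∀ i, ∀ x ∈ N i, (U g).mulVec (act g ∘ x) ∈ N (i + w (U g).det) := by
    intro g hg i x hx
    rw [hmem] at hx ⊢
    intro t l
    have h1 : T t * U g = c g (g⁻¹ * t.1) •
        (act g).mapMatrix (T (⟨g, hg⟩⁻¹ * t.1, t.2.1, t.2.2)) := by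
      have h2 := h.coc g (g⁻¹ * t.1)
      rw [mul_inv_cancel_left] at h2
      have h3 : (act g).mapMatrix (U (g⁻¹ * t.1)) * (act g).mapMatrix (U (g⁻¹ * t.1))⁻¹ = 1 := by
        rw [← map_mul, Matrix.mul_nonsing_inv _ (hUdet _), map_one]
      have h4 : (U t.1)⁻¹ * U g = c g (g⁻¹ * t.1) • (act g).mapMatrix (U (g⁻¹ * t.1))⁻¹ := by
        calc _ = (U t.1)⁻¹ * (U g * ((act g).mapMatrix (U (g⁻¹ * t.1)) *
              (act g).mapMatrix (U (g⁻¹ * t.1))⁻¹)) := by rw [h3, mul_one]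
          _ = _ := by
            rw [← mul_assoc (U g), h2, smul_mul_assoc, mul_smul_comm,
              Matrix.nonsing_inv_mul_cancel_left _ _ (hUdet _)]
      rw [hT, hT, mul_assoc, ← h.comm, ← mul_assoc, h4, smul_mul_assoc,
        map_mul ((act g).mapMatrix (m := Fin n))]
      rfl
    have h2 : (T t).mulVec ((U g).mulVec (act g ∘ x)) l = c g (g⁻¹ * t.1) *
        act g ((T (⟨g, hg⟩⁻¹ * t.1, t.2.1, t.2.2)).mulVec x l) := by
      rw [Matrix.mulVec_mulVec, h1, Matrix.smul_mulVec, Pi.smul_apply, smul_eq_mul]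
      congr 1
      rw [Matrix.mulVec, Matrix.mulVec, dotProduct, dotProduct, map_sum]
      refine Finset.sum_congr rfl fun l' _ => ?_
      rw [map_mul]
      rfl
    have h3 := hx (⟨g, hg⟩⁻¹ * t.1, t.2.1, t.2.2) l
    have h4 := hdet g hg (g⁻¹ * t.1)
    rw [mul_inv_cancel_left] at h4
    rw [h2]
    have h5 : ValGE v (i - w (U (g⁻¹ * t.1)).det)
        (act g ((T (⟨g, hg⟩⁻¹ * t.1, t.2.1, t.2.2)).mulVec x l)) := by
      intro h0
      rw [hvw, hH g hg, ← hvw]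
      exact h3 ((_root_.map_ne_zero _).mp h0)
    exact (hv.ge_mul (i := v (c g (g⁻¹ * t.1))) (fun _ => le_rfl) h5).mono (by omega)
  obtain ⟨B, ν, b, hB, hb, hν, hBN, hABN, hsep⟩ := hN.exists_basis hv (A := ρ a) (m := n)
    (by exact_mod_cast hn) hpL (by rw [hvw, hp, mul_one]) hNa (by
      intro i x hx
      have h1 : ρ a * ρ a - ρ a = (algebraMap K L p) ^ 2 • ρ z := by
        rw [← map_mul, ← map_sub, hz, map_smul, ← algebraMap_smul L, map_pow]
      rw [h1, Matrix.smul_mulVec]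
      refine hN.smul (hNz i x hx) fun _ => ?_
      rw [hv.map_pow hpL, hvw, hp]
      push_cast
      omega)
  obtain ⟨V, rfl⟩ := hB
  have hcol : ∀ s (M : Matrix (Fin n) (Fin n) L), (∀ j, (fun i => M i j) ∈ N (ν j + s)) →
      Shift v ν s ((↑V⁻¹ : Matrix (Fin n) (Fin n) L) * M) := by
    intro s M hM i j
    refine hsep _ (fun i => ((↑V⁻¹ : Matrix (Fin n) (Fin n) L) * M) i j) ?_ i
    have h1 : (V : Matrix (Fin n) (Fin n) L).mulVec
        (fun i => ((↑V⁻¹ : Matrix (Fin n) (Fin n) L) * M) i j) = fun i => M i j := by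
      funext i
      show ((V : Matrix (Fin n) (Fin n) L) * ((↑V⁻¹ : Matrix (Fin n) (Fin n) L) * M)) i j = _
      rw [← mul_assoc, Units.mul_inv, one_mul]
    rw [h1]
    exact hM j
  obtain ⟨ρ', hρ', hform⟩ := h.exists_conj V
  refine ⟨ρ', _, ν, b, hform, fun x => ?_, fun g hg => ?_, hb, hν, fun g hg => ?_, ?_, ?_⟩
  · rw [hρ', mul_assoc, Matrix.det_mul_comm, mul_assoc, Units.mul_inv, mul_one]
  · have hV0 : (V : Matrix (Fin n) (Fin n) L).det ≠ 0 :=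
      ((Matrix.isUnit_iff_isUnit_det _).mp V.isUnit).ne_zero
    have hV1 : (↑V⁻¹ : Matrix (Fin n) (Fin n) L).det ≠ 0 :=
      ((Matrix.isUnit_iff_isUnit_det _).mp V⁻¹.isUnit).ne_zero
    have h2 : w (V : Matrix (Fin n) (Fin n) L).det +
        w (↑V⁻¹ : Matrix (Fin n) (Fin n) L).det = 0 := by
      rw [← hw.map_mul _ _ hV0 hV1, ← Matrix.det_mul, Units.mul_inv, Matrix.det_one, hw.map_one]
    rw [Matrix.det_mul, Matrix.det_mul, mapMatrix_det, hw.map_mul _ _ (mul_ne_zero hV1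
      (h.det_ne_zero g)) ((_root_.map_ne_zero _).mpr hV0), hw.map_mul _ _ hV1 (h.det_ne_zero g),
      hH g hg]
    omega
  · rw [mul_assoc]
    exact hcol _ _ fun j => hNU g hg _ _ (hBN j)
  · have h1 : ρ' a - Matrix.diagonal b = (↑V⁻¹ : Matrix (Fin n) (Fin n) L) *
        (ρ a * V - V * Matrix.diagonal b) := by
      rw [hρ', mul_sub, ← mul_assoc, ← mul_assoc, Units.inv_mul, one_mul]
    rw [h1]
    exact hcol _ _ hABN
  · rw [hρ', mul_assoc]
    refine hcol _ _ fun j => ?_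
    rw [add_zero]
    exact hNz _ _ (hBN j)

end Adapted

section Truncation

universe u

variable {L : Type u} [Field L] {w : L → ℤ} {n : ℕ}

theorem Shift.entry_ge_one {ν : Fin n → ℤ} (hν : ∀ j, 0 ≤ ν j ∧ ν j < n)
    {X : Matrix (Fin n) (Fin n) L} (hX : Shift (fun x => n * w x) ν n X) (i j : Fin n) :
    ValGE w 1 (X i j) := by
  intro h
  have h1 : ν j + n - ν i ≤ n * w (X i j) := hX i j h
  have h2 := hν i
  have h3 := hν j
  by_contra! h4
  nlinarith

theorem Shift.entry_ge_zero {ν : Fin n → ℤ} (hν : ∀ j, 0 ≤ ν j ∧ ν j < n)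
    {X : Matrix (Fin n) (Fin n) L} (hX : Shift (fun x => n * w x) ν 0 X) (i j : Fin n) :
    ValGE w 0 (X i j) := by
  intro h
  have h1 : ν j + 0 - ν i ≤ n * w (X i j) := hX i j h
  have h2 := hν i
  have h3 := hν j
  by_contra! h4
  nlinarith

variable (hw : IsIntVal w) {p : L} (hp0 : p ≠ 0) (hp : w p = 1)
include hw hp0 hp

/-- The two determinants attached to an approximate idempotent. -/
theorem det_approx_idempotent {A Z : Matrix (Fin n) (Fin n) L} (hAZ : A * A - A = p ^ 2 • Z)
    (hZ : ∀ i j, ValGE w 0 (Z i j)) :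
    (A + p • (1 - A)).det ≠ 0 ∧ (p • A + (1 - A)).det ≠ 0 ∧
      w (A + p • (1 - A)).det + w (p • A + (1 - A)).det = n := by
  have hgp : ValGE w 1 p := fun _ => hp.ge
  have h1 : (A + p • (1 - A)) * (p • A + (1 - A)) = p • (1 + (-((1 - p) ^ 2 * p)) • Z) := by
    have h2 : A * A = A + p ^ 2 • Z := by rw [← hAZ, add_sub_cancel]
    simp only [add_mul, mul_add, mul_sub, sub_mul, mul_one, one_mul, smul_mul_assoc,
      mul_smul_comm, h2, smul_add, smul_sub, smul_smul]
    module
  have h3 := hw.det_one_add (X := (-((1 - p) ^ 2 * p)) • Z) fun i j => by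
    have h4 := hw.ge_mul (hw.ge_pow (hw.ge_sub hw.ge_one (hgp.mono zero_le_one)) 2) hgp
    rw [zero_add] at h4
    have h5 := hw.ge_mul (hw.ge_neg h4) (hZ i j)
    rwa [add_zero] at h5
  have h4 := congrArg Matrix.det h1
  rw [Matrix.det_mul, Matrix.det_smul, Fintype.card_fin] at h4
  have h5 : (A + p • (1 - A)).det * (p • A + (1 - A)).det ≠ 0 := by
    rw [h4]
    exact mul_ne_zero (pow_ne_zero _ hp0) h3.1
  refine ⟨left_ne_zero_of_mul h5, right_ne_zero_of_mul h5, ?_⟩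
  rw [← hw.map_mul _ _ (left_ne_zero_of_mul h5) (right_ne_zero_of_mul h5), h4,
    hw.map_mul _ _ (pow_ne_zero _ hp0) h3.1, hw.map_pow hp0, h3.2, hp]
  ring

/-- The determinant computes the rank of the reduction of an approximate idempotent. -/
theorem det_eq_card {A Z : Matrix (Fin n) (Fin n) L} (hAZ : A * A - A = p ^ 2 • Z)
    (hZ : ∀ i j, ValGE w 0 (Z i j)) {b : Fin n → L} (r : Fin n → ℕ)
    (hb : ∀ j, (b j = 0 ∧ r j = 0) ∨ (b j = 1 ∧ r j = 1))
    (hX : ∀ i j, ValGE w 1 ((A - Matrix.diagonal b) i j)) :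
    w (A + p • (1 - A)).det = n - ∑ j, (r j : ℤ) := by
  obtain ⟨h1, h2, h3⟩ := det_approx_idempotent hw hp0 hp hAZ hZ
  obtain ⟨X, hXdef⟩ : ∃ X, X = A - Matrix.diagonal b := ⟨_, rfl⟩
  rw [← hXdef] at hX
  have hA : A = Matrix.diagonal b + X := by rw [hXdef, add_sub_cancel]
  have hgp : ValGE w 1 p := fun _ => hp.ge
  have hq : ValGE w 0 (1 - p) := hw.ge_sub hw.ge_one (hgp.mono zero_le_one)
  have hqX : ∀ i j, ValGE w 1 ((1 - p) * X i j) := fun i j => by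
    simpa using hw.ge_mul hq (hX i j)
  have e1 : ∀ i j, (A + p • (1 - A)) i j =
      Matrix.diagonal (fun j => b j + p * (1 - b j)) i j + (1 - p) * X i j := by
    intro i j
    rw [hA]
    simp only [Matrix.add_apply, Matrix.smul_apply, Matrix.sub_apply, Matrix.one_apply,
      Matrix.diagonal_apply, smul_eq_mul]
    split_ifs <;> ring
  have e2 : ∀ i j, (p • A + (1 - A)) i j =
      Matrix.diagonal (fun j => p * b j + (1 - b j)) i j - (1 - p) * X i j := by
    intro i j
    rw [hA]
    simp only [Matrix.add_apply, Matrix.smul_apply, Matrix.sub_apply, Matrix.one_apply,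
      Matrix.diagonal_apply, smul_eq_mul]
    split_ifs <;> ring
  have hr1 : ∀ j, r j ≤ 1 := fun j => by rcases hb j with h | h <;> omega
  have h4 := hw.ge_det (M := A + p • (1 - A)) (fun j => 1 - (r j : ℤ)) (fun i j => by
    rw [e1]
    have := hr1 j
    refine hw.ge_add ?_ ((hqX i j).mono (by omega))
    rw [Matrix.diagonal_apply]
    split_ifs with hij
    · subst hij
      rcases hb i with ⟨h, h'⟩ | ⟨h, h'⟩ <;> rw [h, h']
      · simpa using hgp
      · simpa using hw.ge_one
    · exact ValGE.zero _) h1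
  have h5 := hw.ge_det (M := p • A + (1 - A)) (fun j => (r j : ℤ)) (fun i j => by
    rw [e2]
    have := hr1 j
    refine hw.ge_sub ?_ ((hqX i j).mono (by omega))
    rw [Matrix.diagonal_apply]
    split_ifs with hij
    · subst hij
      rcases hb i with ⟨h, h'⟩ | ⟨h, h'⟩ <;> rw [h, h']
      · simpa using hw.ge_one
      · simpa using hgp
    · exact ValGE.zero _) h2
  rw [Finset.sum_sub_distrib, Finset.sum_const, Finset.card_univ, Fintype.card_fin, nsmul_one] at h4
  omega

omit hw hp0 hp in
theorem corner_pow {M E : Matrix (Fin n) (Fin n) L} (hE : E * E = E) (hM : E * M = M)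
    (hM' : M * E = M) (k : ℕ) (hk : 0 < k) (x : L) :
    (M + (1 - E)) ^ k * (x • E + (1 - E)) = x • M ^ k + (1 - E) := by
  have h1 : M * (1 - E) = 0 := by rw [mul_sub, mul_one, hM', sub_self]
  have h2 : (1 - E) * M = 0 := by rw [sub_mul, one_mul, hM, sub_self]
  have h3 : (1 - E) * (1 - E) = 1 - E := by
    rw [mul_sub, sub_mul, sub_mul, hE, mul_one, one_mul, mul_one, sub_self, sub_zero]
  have h4 : (M + (1 - E)) ^ k = M ^ k + (1 - E) := by
    induction k, hk using Nat.le_induction with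
    | base => rw [pow_one, pow_one]
    | succ k hk ih =>
      have h5 : M ^ k * (1 - E) = 0 := by
        obtain ⟨j, rfl⟩ : ∃ j, k = j + 1 := ⟨k - 1, by omega⟩
        rw [pow_succ, mul_assoc, h1, mul_zero]
      rw [pow_succ, ih, add_mul, mul_add, mul_add, h5, h2, h3, ← pow_succ, add_zero, zero_add]
  have h6 : M ^ k * E = M ^ k := by
    obtain ⟨j, rfl⟩ : ∃ j, k = j + 1 := ⟨k - 1, by omega⟩
    rw [pow_succ, mul_assoc, hM']
  have h7 : M ^ k * (1 - E) = 0 := by rw [mul_sub, h6, mul_one, sub_self]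
  have h8 : (1 - E) * E = 0 := by rw [sub_mul, one_mul, hE, sub_self]
  rw [h4, add_mul, mul_add, mul_add, h7, h3, mul_smul_comm, h6, mul_smul_comm, h8, smul_zero,
    add_zero, zero_add]

/-- The truncation of a shift by an idempotent. -/
theorem exists_truncation {ν : Fin n → ℤ} (hν : ∀ j, 0 ≤ ν j ∧ ν j < n) (hn : 0 < n)
    {b : Fin n → L} (r : Fin n → ℕ) (hb : ∀ j, (b j = 0 ∧ r j = 0) ∨ (b j = 1 ∧ r j = 1))
    {t : ℕ} {Ψ Ψ' : Matrix (Fin n) (Fin n) L} (hΨ : Ψ * Ψ' = 1)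
    (hΨt : Shift (fun x => n * w x) ν t Ψ) (hΨt' : Shift (fun x => n * w x) ν (-t) Ψ')
    (hEΨ : Shift (fun x => n * w x) ν (t + n)
      (Matrix.diagonal b * Ψ - Ψ * Matrix.diagonal b)) :
    ∃ Q : Matrix (Fin n) (Fin n) L, Shift (fun x => n * w x) ν 0 Q ∧
      Q * (Matrix.diagonal b * Ψ' * Matrix.diagonal b + (1 - Matrix.diagonal b)) *
        (Matrix.diagonal b * Ψ * Matrix.diagonal b + (1 - Matrix.diagonal b)) = 1 ∧
      n * w (Matrix.diagonal b * Ψ * Matrix.diagonal b + (1 - Matrix.diagonal b)).det =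
        t * ∑ j, (r j : ℤ) := by
  have hv := hw.nsmul n
  have hgp : ValGE w 1 p := fun _ => hp.ge
  obtain ⟨E, hE⟩ : ∃ E, E = Matrix.diagonal b := ⟨_, rfl⟩
  have hbb : ∀ j, b j * b j = b j := fun j => by rcases hb j with h | h <;> rw [h.1] <;> ring
  have hEE : E * E = E := by
    rw [hE, Matrix.diagonal_mul_diagonal]
    exact congrArg _ (funext hbb)
  have hES : Shift (fun x => n * w x) ν 0 E := by
    rw [hE]
    refine Shift.diagonal fun j => ?_
    rcases hb j with h | h <;> rw [h.1]
    · exact ValGE.zero _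
    · exact hv.ge_one
  rw [← hE] at hEΨ ⊢
  have hΨ' : Ψ' * Ψ = 1 := mul_eq_one_comm.mp hΨ
  obtain ⟨C, hC⟩ : ∃ C, C = E * Ψ - Ψ * E := ⟨_, rfl⟩
  rw [← hC] at hEΨ
  obtain ⟨Y, hY⟩ : ∃ Y, Y = E * Ψ * E + (1 - E) := ⟨_, rfl⟩
  obtain ⟨Y', hY'⟩ : ∃ Y', Y' = E * Ψ' * E + (1 - E) := ⟨_, rfl⟩
  rw [← hY, ← hY']
  have h1E : E * (1 - E) = 0 := by rw [mul_sub, mul_one, hEE, sub_self]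
  have h1E' : (1 - E) * E = 0 := by rw [sub_mul, one_mul, hEE, sub_self]
  have h1E1 : (1 - E) * (1 - E) = 1 - E := by rw [mul_sub, mul_one, h1E', sub_zero]
  have hY'Y : Y' * Y = 1 + (E * Ψ' * C) * E := by
    have h1 : E * Ψ' * C * E = E * Ψ' * E * Ψ * E - E := by
      rw [hC, mul_sub, sub_mul]
      congr 1
      · simp only [mul_assoc]
      · rw [mul_assoc E Ψ', ← mul_assoc Ψ', hΨ', one_mul, hEE, hEE]
    have h2 : E * Ψ' * E * (E * Ψ * E) = E * Ψ' * E * Ψ * E := by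
      rw [mul_assoc (E * Ψ'), ← mul_assoc E (E * Ψ), ← mul_assoc E E, hEE]
      simp only [mul_assoc]
    have h3 : E * Ψ' * E * (1 - E) = 0 := by rw [mul_assoc, h1E, mul_zero]
    have h4 : (1 - E) * (E * Ψ * E) = 0 := by
      rw [← mul_assoc, ← mul_assoc, h1E', zero_mul, zero_mul]
    rw [hY, hY', add_mul, mul_add, mul_add, h2, h3, h4, h1E1, h1]
    abel
  have hX : Shift (fun x => n * w x) ν n (E * Ψ' * C * E) :=
    (Shift.mul hv (Shift.mul hv (Shift.mul hv hES hΨt') hEΨ) hES).mono (by omega)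
  have hdet := hw.det_one_add (Shift.entry_ge_one hν hX)
  have hQ : (1 + E * Ψ' * C * E) * (1 + E * Ψ' * C * E)⁻¹ = 1 :=
    Matrix.mul_nonsing_inv _ hdet.1.isUnit
  rw [← hY'Y] at hdet hQ
  have hdet1 := hdet.1
  rw [Matrix.det_mul] at hdet1
  have hY0 := right_ne_zero_of_mul hdet1
  have hY0' := left_ne_zero_of_mul hdet1
  have hsum : w Y'.det + w Y.det = 0 := by rw [← hw.map_mul _ _ hY0' hY0, ← Matrix.det_mul, hdet.2]
  have hn0 : (0 : ℤ) < n := by exact_mod_cast hn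
  have hdetE : ∀ x : L, (x • E + (1 - E)).det = x ^ ∑ j, r j := by
    intro x
    have : x • E + (1 - E) = Matrix.diagonal fun j => x ^ r j := by
      rw [hE]
      refine Matrix.ext fun i j => ?_
      simp only [Matrix.add_apply, Matrix.smul_apply, Matrix.sub_apply, Matrix.one_apply,
        Matrix.diagonal_apply, smul_eq_mul]
      split_ifs with hij
      · rcases hb i with h | h <;> rw [h.1, h.2] <;> ring
      · ring
    rw [this, Matrix.det_diagonal, Finset.prod_pow_eq_pow_sum]
  have key : ∀ (M : Matrix (Fin n) (Fin n) L) (s : ℤ), Shift (fun x => n * w x) ν s M →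
      (E * M * E + (1 - E)).det ≠ 0 →
      s * ∑ j, (r j : ℤ) ≤ n * w (E * M * E + (1 - E)).det := by
    intro M s hM h0
    have h1 := corner_pow (M := E * M * E) hEE (by rw [← mul_assoc, ← mul_assoc, hEE])
      (by rw [mul_assoc, hEE]) n hn (p ^ (-s))
    have hps : p ^ (-s) ≠ 0 := zpow_ne_zero _ hp0
    have h2 : Shift (fun x => n * w x) ν 0
        ((E * M * E + (1 - E)) ^ n * (p ^ (-s) • E + (1 - E))) := by
      rw [h1]
      refine Shift.add hv ?_ (Shift.sub hv (Shift.one hv) hES)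
      refine (Shift.smul hv (Shift.pow hv (Shift.mul hv (Shift.mul hv hES hM) hES) n)
        (t := n * -s) fun _ => ?_).mono (by linarith)
      rw [hw.map_zpow hp0, hp, mul_one]
    have h3 := hw.ge_det_zero (Shift.entry_ge_zero hν h2)
    rw [Matrix.det_mul, Matrix.det_pow, hdetE] at h3
    have h4 := h3 (mul_ne_zero (pow_ne_zero _ h0) (pow_ne_zero _ hps))
    rw [hw.map_mul _ _ (pow_ne_zero _ h0) (pow_ne_zero _ hps), hw.map_pow h0, hw.map_pow hps,
      hw.map_zpow hp0, hp] at h4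
    push_cast at h4
    linarith
  refine ⟨(Y' * Y)⁻¹, ?_, ?_, ?_⟩
  · rw [hY'Y] at hQ ⊢
    exact Shift.of_one_add_mul hv hn0 hX hQ
  · rw [mul_assoc]
    exact mul_eq_one_comm.mp hQ
  · have h1 := key Ψ t hΨt (by rwa [← hY])
    have h2 := key Ψ' (-t) hΨt' (by rwa [← hY'])
    rw [← hY] at h1
    rw [← hY'] at h2
    have h3 : w Y'.det = - w Y.det := by omega
    rw [h3] at h2
    linarith

end Truncation

section FullIdempotent

/-- An invertible matrix over a division ring with a prescribed nonzero first column. -/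
theorem exists_isUnit_mul_single {𝒟 κ : Type*} [DivisionRing 𝒟] [Fintype κ] [DecidableEq κ]
    (i₀ : κ) (v : κ → 𝒟) (hv : v ≠ 0) : ∃ u : Matrix κ κ 𝒟, IsUnit u ∧
      u * Matrix.single i₀ i₀ 1 = Matrix.of fun i j => if j = i₀ then v i else 0 := by
  have key : ∀ v : κ → 𝒟, v i₀ ≠ 0 → ∃ u : Matrix κ κ 𝒟, IsUnit u ∧
      u * Matrix.single i₀ i₀ 1 = Matrix.of fun i j => if j = i₀ then v i else 0 := by
    intro v hv
    have hmul : ∀ a b : κ → 𝒟, (1 + Matrix.of fun i j => if j = i₀ then a i else 0) *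
        (1 + Matrix.of fun i j => if j = i₀ then b i else 0) =
        1 + Matrix.of fun i j => if j = i₀ then a i + b i + a i * b i₀ else 0 := by
      intro a b
      have h : (Matrix.of fun i j => if j = i₀ then a i else 0 : Matrix κ κ 𝒟) *
          (Matrix.of fun i j => if j = i₀ then b i else 0) =
          Matrix.of fun i j => if j = i₀ then a i * b i₀ else 0 := by
        refine Matrix.ext fun i j => ?_
        simp [Matrix.mul_apply]
      rw [add_mul, mul_add, mul_add, h, one_mul, mul_one, one_mul]
      refine Matrix.ext fun i j => ?_
      simp only [Matrix.add_apply, Matrix.of_apply]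
      split_ifs
      · abel
      · simp
    obtain ⟨a, ha⟩ : ∃ a : κ → 𝒟, a = v - Pi.single i₀ 1 := ⟨_, rfl⟩
    have ha0 : a i₀ = v i₀ - 1 := by rw [ha]; simp
    obtain ⟨b, hb⟩ : ∃ b : κ → 𝒟, b = fun i => - a i * (v i₀)⁻¹ := ⟨_, rfl⟩
    have hone : (1 : Matrix κ κ 𝒟) + Matrix.of (fun i j => if j = i₀ then (0 : 𝒟) else 0) = 1 := by
      refine Matrix.ext fun i j => ?_
      simp
    refine ⟨1 + Matrix.of fun i j => if j = i₀ then a i else 0,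
      ⟨⟨_, 1 + Matrix.of fun i j => if j = i₀ then b i else 0, ?_, ?_⟩, rfl⟩, ?_⟩
    · rw [hmul]
      refine Eq.trans (congrArg (1 + ·)
        (congrArg Matrix.of (funext fun i => funext fun j => ?_))) hone
      split_ifs
      · rw [hb]
        simp only [ha0]
        have : (v i₀ - 1) * (v i₀)⁻¹ = 1 - (v i₀)⁻¹ := by rw [sub_mul, mul_inv_cancel₀ hv, one_mul]
        rw [neg_mul, neg_mul, this, mul_neg, mul_sub, mul_one]
        abel
      · rfl
    · rw [hmul]
      refine Eq.trans (congrArg (1 + ·)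
        (congrArg Matrix.of (funext fun i => funext fun j => ?_))) hone
      split_ifs
      · rw [hb]
        simp only [ha0]
        rw [mul_assoc, mul_sub, inv_mul_cancel₀ hv, mul_one, mul_sub, mul_one]
        simp
      · rfl
    · refine Matrix.ext fun i j => ?_
      rw [add_mul, one_mul, Matrix.add_apply, Matrix.mul_apply, ha]
      by_cases hj : j = i₀
      · subst hj
        by_cases hi : i = j
        · subst hi; simp [Matrix.single_apply]
        · simp [Matrix.single_apply, hi, Ne.symm hi]
      · simp [hj, Ne.symm hj]
  by_cases h0 : v i₀ = 0
  · obtain ⟨i, hi⟩ := Function.ne_iff.mp hv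
    have hii : i ≠ i₀ := by rintro rfl; exact hi h0
    have hs : (Matrix.single i₀ i 1 : Matrix κ κ 𝒟) * Matrix.single i₀ i 1 = 0 :=
      Matrix.single_mul_single_of_ne _ _ _ _ hii _
    obtain ⟨u, hu, hu'⟩ := key (fun j => v j + if j = i₀ then v i else 0) (by simpa [h0] using hi)
    refine ⟨(1 - Matrix.single i₀ i 1) * u, IsUnit.mul
      ⟨⟨_, 1 + Matrix.single i₀ i 1, ?_, ?_⟩, rfl⟩ hu, ?_⟩
    · rw [mul_add, sub_mul, sub_mul, hs]; simp
    · rw [mul_sub, add_mul, add_mul, hs]; simp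
    · rw [mul_assoc, hu', sub_mul, one_mul]
      refine Matrix.ext fun j l => ?_
      rw [Matrix.sub_apply, Matrix.mul_apply]
      by_cases hl : l = i₀
      · by_cases hj : j = i₀
        · subst hj; simp [hl, Matrix.single_apply, hii]
        · simp [hl, hj, Ne.symm hj]
      · simp [hl]
  · exact key v h0

/-- A simple finite-dimensional algebra contains a full idempotent that every nonunit kills up to
a unit. -/
theorem exists_full_idempotent (F B : Type*) [Field F] [Ring B] [Algebra F B] [Module.Finite F B]
    [IsSimpleRing B] : ∃ e : B, e * e = e ∧ (∃ (l : ℕ) (x y : Fin l → B), ∑ i, x i * e * y i = 1) ∧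
      ∀ y : B, ¬ IsUnit y → ∃ u : B, IsUnit u ∧ y * u * e = 0 := by
  have := IsArtinianRing.of_finite F B
  obtain ⟨l, hl, 𝒟, _, _, _, ⟨Φ⟩⟩ := IsSimpleRing.exists_algEquiv_matrix_divisionRing_finite F B
  have i₀ : Fin l := ⟨0, Nat.pos_of_ne_zero hl.out⟩
  refine ⟨Φ.symm (Matrix.single i₀ i₀ 1), ?_, ⟨l, fun i => Φ.symm (Matrix.single i i₀ 1),
    fun i => Φ.symm (Matrix.single i₀ i 1), ?_⟩, fun y hy => ?_⟩
  · rw [← map_mul, Matrix.single_mul_single_same, mul_one]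
  · simp only [← map_mul, Matrix.single_mul_single_same, mul_one]
    rw [← map_sum, Matrix.sum_single_one, map_one]
  · have h1 : ∃ x : B, y * x = 0 ∧ x ≠ 0 := by
      by_contra! h
      have hinj : Function.Injective (LinearMap.mulLeft F y) :=
        (injective_iff_map_eq_zero _).mpr fun x hx => h x hx
      obtain ⟨x, hx⟩ := (LinearMap.injective_iff_surjective.mp hinj) 1
      have : IsNoetherianRing B := IsNoetherianRing.of_finite F B
      exact hy (IsUnit.of_mul_eq_one x hx)
    obtain ⟨x, hyx, hx⟩ := h1
    have hx' : Φ x ≠ 0 := by simpa using hx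
    obtain ⟨j, hj⟩ : ∃ j, (fun i => Φ x i j) ≠ 0 := by
      by_contra! h
      exact hx' (Matrix.ext fun i j => congrFun (h j) i)
    obtain ⟨u, hu, hu'⟩ := exists_isUnit_mul_single i₀ _ hj
    refine ⟨Φ.symm u, hu.map Φ.symm, ?_⟩
    have h2 : u * Matrix.single i₀ i₀ 1 = Φ x * Matrix.single j i₀ 1 := by
      rw [hu']
      refine Matrix.ext fun a c => ?_
      rw [Matrix.mul_apply]
      by_cases hc : c = i₀
      · simp [hc, Matrix.single_apply]
      · simp [hc, Ne.symm hc]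
    rw [mul_assoc, ← map_mul, h2, map_mul, AlgEquiv.symm_apply_apply, ← mul_assoc, hyx, zero_mul]

end FullIdempotent

section Reduction

universe u

variable {L : Type u} [Field L] {w : L → ℤ} {n : ℕ}

/-- For an order with simple reduction, all determinants have valuations divisible by the defect
of a full approximate idempotent. -/
theorem exists_approx_idempotent_dvd (hw : IsIntVal w) (hn : 0 < n) {p : L} (hp0 : p ≠ 0)
    (hp : w p = 1) {S : Type*} [Ring S] (R : S →+* Matrix (Fin n) (Fin n) L)
    (hR : ∀ y i j, ValGE w 0 (R y i j)) (pS : S) (hpS : R pS = p • 1)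
    (hcomm : ∀ y, pS * y = y * pS) (F : Type*) {B : Type*} [Field F] [Ring B] [Algebra F B]
    [Module.Finite F B] [IsSimpleRing B] (red : S →+* B) (hred : Function.Surjective red)
    (hred0 : red pS = 0) (hker : ∀ y, red y = 0 → ∃ z, y = pS * z) :
    ∃ (d : ℤ) (a z : S), 1 ≤ d ∧ a * a - a = pS ^ 2 * z ∧
      w (R a + p • (1 - R a)).det = n - d ∧ ∀ y, (R y).det ≠ 0 → d ∣ w (R y).det := by
  obtain ⟨e, hee, ⟨l, x, y, hxy⟩, hdiv⟩ := exists_full_idempotent F B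
  have hgp : ValGE w 1 p := fun _ => hp.ge
  have hRp : ∀ z, R (pS * z) = p • R z := fun z => by
    rw [map_mul, hpS, smul_mul_assoc, one_mul]
  have hRp1 : ∀ z i j, ValGE w 1 (R (pS * z) i j) := fun z i j => by
    rw [hRp, Matrix.smul_apply, smul_eq_mul]
    simpa using hw.ge_mul hgp (hR z i j)
  obtain ⟨a₁, ha₁⟩ := hred e
  obtain ⟨z₁, hz₁⟩ := hker (a₁ * a₁ - a₁) (by rw [map_sub, map_mul, ha₁, hee, sub_self])
  obtain ⟨a, ha⟩ : ∃ a, a = 3 * (a₁ * a₁) - 2 * (a₁ * a₁ * a₁) := ⟨_, rfl⟩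
  have hred_a : red a = e := by
    have h3 : red 3 = 3 := map_ofNat red 3
    have h2 : red 2 = 2 := map_ofNat red 2
    rw [ha, map_sub, map_mul, map_mul, map_mul, map_mul, map_mul, ha₁, hee, hee, h3, h2, ← sub_mul]
    norm_num
  have haz : a * a - a = pS ^ 2 * (z₁ * z₁ * (4 * (a₁ * a₁) - 4 * a₁ - 3)) := by
    have h1 : a * a - a = (a₁ * a₁ - a₁) * (a₁ * a₁ - a₁) * (4 * (a₁ * a₁) - 4 * a₁ - 3) := by
      rw [ha]
      noncomm_ring
    rw [h1, hz₁, pow_two]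
    have h2 : pS * z₁ * (pS * z₁) = pS * pS * (z₁ * z₁) := by
      rw [mul_assoc, ← mul_assoc z₁, ← hcomm z₁]
      simp only [mul_assoc]
    rw [h2]
    simp only [mul_assoc]
  obtain ⟨z, hz⟩ : ∃ z, z = z₁ * z₁ * (4 * (a₁ * a₁) - 4 * a₁ - 3) := ⟨_, rfl⟩
  rw [← hz] at haz
  have hAZ : R a * R a - R a = p ^ 2 • R z := by
    rw [← map_mul, ← map_sub, haz, pow_two, mul_assoc, hRp, hRp, smul_smul, pow_two]
  obtain ⟨hd1, hd2, hd3⟩ := det_approx_idempotent hw hp0 hp hAZ (hR z)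
  have hG : R (a + pS * (1 - a)) = R a + p • (1 - R a) := by
    rw [map_add, hRp, map_sub, map_one]
  have hunit : ∀ y, IsUnit (red y) → (R y).det ≠ 0 ∧ w (R y).det = 0 := by
    intro y hy
    obtain ⟨v, hv⟩ := hy.exists_right_inv
    obtain ⟨y', rfl⟩ := hred v
    obtain ⟨q, hq⟩ := hker (y * y' - 1) (by rw [map_sub, map_mul, hv, map_one, sub_self])
    have h1 : y * y' = 1 + pS * q := by rw [← hq, add_sub_cancel]
    have h2 := hw.det_one_add (hRp1 q)
    rw [← map_one R, ← map_add, ← h1, map_mul, Matrix.det_mul] at h2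
    have h3 := left_ne_zero_of_mul h2.1
    have h4 := right_ne_zero_of_mul h2.1
    have h5 := h2.2
    rw [hw.map_mul _ _ h3 h4] at h5
    have h6 := hw.ge_det_zero (hR y) h3
    have h7 := hw.ge_det_zero (hR y') h4
    exact ⟨h3, by omega⟩
  obtain ⟨d, hd⟩ : ∃ d : ℤ, d = w (p • R a + (1 - R a)).det := ⟨_, rfl⟩
  rw [← hd] at hd3
  have hdge : 0 ≤ d := by
    rw [hd]
    refine hw.ge_det_zero (fun i j => ?_) hd2
    rw [Matrix.add_apply, Matrix.smul_apply, Matrix.sub_apply, smul_eq_mul]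
    have h1 := hw.ge_mul hgp (hR a i j)
    refine hw.ge_add (h1.mono (by omega)) (hw.ge_sub ?_ (hR a i j))
    simpa using hR 1 i j
  have hd1' : d ≠ 0 := by
    intro h0
    have h1 : R (pS * a + (1 - a)) = p • R a + (1 - R a) := by
      rw [map_add, hRp, map_sub, map_one]
    have hRa : ∀ i j, ValGE w 1 (R a i j) := by
      obtain ⟨q, hq⟩ := hker ((pS * a + (1 - a)) * a) (by
        rw [map_mul, map_add, map_mul, map_sub, map_one, hred0, hred_a, zero_mul, zero_add, sub_mul,
          one_mul, hee, sub_self])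
      have h2 := congrArg R hq
      rw [map_mul, h1] at h2
      obtain ⟨M, hM⟩ := hw.exists_matrix_integers (M := p • R a + (1 - R a)) (fun i j => by
        rw [← h1]; exact hR _ i j)
      have h3 : (p • R a + (1 - R a)).adjugate = M.adjugate.map hw.integers.subtype := by
        rw [← hM]
        exact (RingHom.map_adjugate hw.integers.subtype M).symm
      have h4 : (p • R a + (1 - R a)).det • R a = (p • R a + (1 - R a)).adjugate * R (pS * q) := by
        rw [← h2, ← mul_assoc, Matrix.adjugate_mul, smul_mul_assoc, one_mul]
      intro i j hij
      have h5 : ValGE w 1 ((p • R a + (1 - R a)).det * R a i j) := by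
        have h6 := congrFun (congrFun h4 i) j
        rw [Matrix.smul_apply, smul_eq_mul] at h6
        rw [h6, Matrix.mul_apply]
        refine hw.ge_sum _ _ fun s _ => ?_
        rw [h3]
        simpa using hw.ge_mul ((hw.mem_integers).mp (M.adjugate i s).2) (hRp1 q s j)
      have h6 := h5 (mul_ne_zero hd2 hij)
      rw [hw.map_mul _ _ hd2 hij, ← hd, h0, zero_add] at h6
      exact h6
    choose x' hx' using fun i => hred (x i)
    choose y' hy' using fun i => hred (y i)
    obtain ⟨q, hq⟩ := hker (1 - ∑ i, x' i * a * y' i) (by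
      rw [map_sub, map_one, map_sum]
      simp only [map_mul, hx', hy', hred_a, hxy, sub_self])
    have h2 : (1 : S) = pS * q + ∑ i, x' i * a * y' i := by rw [← hq, sub_add_cancel]
    have h3 : ValGE w 1 ((1 : Matrix (Fin n) (Fin n) L) ⟨0, hn⟩ ⟨0, hn⟩) := by
      rw [← map_one R, h2, map_add, Matrix.add_apply, map_sum, Matrix.sum_apply]
      refine hw.ge_add (hRp1 _ _ _) (hw.ge_sum _ _ fun i _ => ?_)
      rw [map_mul, map_mul, Matrix.mul_apply]
      refine hw.ge_sum _ _ fun s _ => ?_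
      have h4 : ValGE w 1 ((R (x' i) * R a) ⟨0, hn⟩ s) := by
        rw [Matrix.mul_apply]
        refine hw.ge_sum _ _ fun s' _ => ?_
        simpa using hw.ge_mul (hR (x' i) ⟨0, hn⟩ s') (hRa s' s)
      simpa using hw.ge_mul h4 (hR (y' i) s ⟨0, hn⟩)
    rw [Matrix.one_apply_eq] at h3
    have h4 := h3 one_ne_zero
    rw [hw.map_one] at h4
    omega
  refine ⟨d, a, z, by omega, haz, by omega, ?_⟩
  have main : ∀ (N : ℕ) (y : S), (R y).det ≠ 0 → w (R y).det ≤ N → d ∣ w (R y).det := by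
    intro N
    induction N with
    | zero =>
      intro y hy hN
      have h1 := hw.ge_det_zero (hR y) hy
      have h2 : w (R y).det = 0 := by push_cast at hN; omega
      rw [h2]
      exact dvd_zero _
    | succ N ih =>
      intro y hy hN
      by_cases hu : IsUnit (red y)
      · rw [(hunit y hu).2]
        exact dvd_zero _
      · obtain ⟨v, hv, hv'⟩ := hdiv _ hu
        obtain ⟨s, rfl⟩ := hred v
        obtain ⟨q, hq⟩ := hker (y * s * (a + pS * (1 - a))) (by
          rw [map_mul, map_mul, map_add, map_mul, hred0, hred_a, zero_mul, add_zero, hv'])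
        have h1 := congrArg (fun t => (R t).det) hq
        rw [map_mul, map_mul, hG, hRp, Matrix.det_mul, Matrix.det_mul, Matrix.det_smul,
          Fintype.card_fin] at h1
        have h2 := hunit s hv
        have h3 : (R q).det ≠ 0 := by
          intro h0
          rw [h0, mul_zero] at h1
          exact mul_ne_zero (mul_ne_zero hy h2.1) hd1 h1
        have h4 := congrArg w h1
        rw [hw.map_mul _ _ (mul_ne_zero hy h2.1) hd1, hw.map_mul _ _ hy h2.1, h2.2,
          hw.map_mul _ _ (pow_ne_zero _ hp0) h3, hw.map_pow hp0, hp] at h4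
        have h5 : w (R y).det = w (R q).det + d := by omega
        push_cast at hN
        have h6 := ih q h3 (by omega)
        rw [h5]
        exact dvd_add h6 dvd_rfl
  intro y hy
  exact main (w (R y).det).toNat y hy (Int.self_le_toNat _)

end Reduction

section Perturbation

universe u

variable {L : Type u} [Field L] {w : L → ℤ} {n : ℕ}

theorem IsIntVal.exists_pow_mul_ge (hw : IsIntVal w) {p : L} (hp0 : p ≠ 0) (hp : w p = 1)
    {ι : Type*} [Finite ι] (f : ι → L) (c : ℤ) :
    ∃ M : ℕ, ∀ j ≥ M, ∀ i, ValGE w c (p ^ j * f i) := by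
  cases nonempty_fintype ι
  refine ⟨∑ i, (c - w (f i)).toNat, fun j hj i h => ?_⟩
  have h1 := Finset.single_le_sum (f := fun i => (c - w (f i)).toNat) (fun i _ => Nat.zero_le _)
    (Finset.mem_univ i)
  rw [hw.map_mul _ _ (pow_ne_zero _ hp0) (right_ne_zero_of_mul h), hw.map_pow hp0, hp]
  have h2 := Int.self_le_toNat (c - w (f i))
  omega

/-- Small perturbations do not change the valuation of the determinant. -/
theorem IsIntVal.exists_det_add (hw : IsIntVal w) {p : L} (hp0 : p ≠ 0) (hp : w p = 1)
    {ι : Type*} [Fintype ι] [DecidableEq ι] (G B : Matrix ι ι L) (hG : G.det ≠ 0) :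
    ∃ M : ℕ, ∀ j ≥ M, (G + p ^ j • B).det ≠ 0 ∧ w (G + p ^ j • B).det = w G.det := by
  obtain ⟨M, hM⟩ := hw.exists_pow_mul_ge hp0 hp (fun i : ι × ι => (G⁻¹ * B) i.1 i.2) 1
  refine ⟨M, fun j hj => ?_⟩
  have h1 := hw.det_one_add (X := p ^ j • (G⁻¹ * B)) fun i i' => hM j hj (i, i')
  have h2 : G + p ^ j • B = G * (1 + p ^ j • (G⁻¹ * B)) := by
    rw [mul_add, mul_one, mul_smul_comm, ← mul_assoc, Matrix.mul_nonsing_inv _ hG.isUnit, one_mul]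
  rw [h2, Matrix.det_mul, hw.map_mul _ _ hG h1.1, h1.2, add_zero]
  exact ⟨mul_ne_zero hG h1.1, rfl⟩

theorem IsIntVal.infinite_pow (hw : IsIntVal w) {K : Type*} [Field K] [Algebra K L] {p : K}
    (hp0 : p ≠ 0) (hp : w (algebraMap K L p) = 1) (M : ℕ) :
    {s : K | ∃ j ≥ M, s = p ^ j}.Infinite := by
  refine Set.infinite_of_injective_forall_mem (f := fun i : ℕ => p ^ (M + i)) (fun i j hij => ?_)
    fun i => ⟨M + i, by omega, rfl⟩
  have hp0' : algebraMap K L p ≠ 0 := by simpa using hp0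
  have h1 := congrArg (fun x => w (algebraMap K L x)) hij
  dsimp only at h1
  rw [_root_.map_pow, _root_.map_pow, hw.map_pow hp0', hw.map_pow hp0', hp] at h1
  push_cast at h1
  omega

/-- An approximate idempotent can be perturbed to one of maximal degree. -/
theorem IsSplit.exists_approx_idempotent {K A : Type*} [Field K] [Infinite K] [Ring A]
    [Nontrivial A]
    [Algebra K A] [Algebra K L] {ρ : A →ₐ[K] Matrix (Fin n) (Fin n) L} (h : IsSplit ρ) (hn : 0 < n)
    (hw : IsIntVal w) {p : K} (hp0 : p ≠ 0) (hp : w (algebraMap K L p) = 1) {a z : A}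
    (haz : a * a - a = p ^ 2 • z) (ha : ∀ i j, ValGE w 0 (ρ a i j))
    (hz : ∀ i j, ValGE w 0 (ρ z i j)) (hdet : (ρ (a + p • (1 - a))).det ≠ 0) :
    ∃ a' z' : A, a' * a' - a' = p ^ 2 • z' ∧ (∀ i j, ValGE w 0 (ρ a' i j)) ∧
      (∀ i j, ValGE w 0 (ρ z' i j)) ∧ (minpoly K a').natDegree = n ∧
      (ρ (a' + p • (1 - a'))).det ≠ 0 ∧
      w (ρ (a' + p • (1 - a'))).det = w (ρ (a + p • (1 - a))).det := by
  obtain ⟨b, hb⟩ := h.exists_natDegree_minpoly_add hn a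
  have hp0' : algebraMap K L p ≠ 0 := by simpa using hp0
  have hsm : ∀ (x : K) (y : A), ρ (x • y) = algebraMap K L x • ρ y := fun x y => by
    rw [map_smul, algebraMap_smul]
  obtain ⟨M₁, hM₁⟩ := hw.exists_pow_mul_ge hp0' hp (fun i : Fin n × Fin n => ρ b i.1 i.2) 0
  obtain ⟨M₂, hM₂⟩ := hw.exists_pow_mul_ge hp0' hp
    (fun i : Fin n × Fin n => ρ (a * b + b * a - b) i.1 i.2) 0
  obtain ⟨M₃, hM₃⟩ := hw.exists_pow_mul_ge hp0' hp (fun i : Fin n × Fin n => ρ (b * b) i.1 i.2) 0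
  obtain ⟨M₄, hM₄⟩ := hw.exists_det_add hp0' hp (ρ (a + p • (1 - a))) (ρ ((1 - p) • b)) hdet
  obtain ⟨_, ⟨j, hj, rfl⟩, hdeg⟩ := hb _ (hw.infinite_pow hp0 hp (M₁ + M₂ + M₃ + M₄ + 2))
  obtain ⟨l, rfl⟩ : ∃ l, j = l + 2 := ⟨j - 2, by omega⟩
  have hdet' : ρ (a + p ^ (l + 2) • b + p • (1 - (a + p ^ (l + 2) • b))) =
      ρ (a + p • (1 - a)) + algebraMap K L p ^ (l + 2) • ρ ((1 - p) • b) := by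
    rw [← _root_.map_pow, ← hsm, ← _root_.map_add]
    congr 1
    module
  refine ⟨a + p ^ (l + 2) • b, z + p ^ l • (a * b + b * a - b) + p ^ (2 * l + 2) • (b * b), ?_,
    fun i i' => ?_, fun i i' => ?_, hdeg, ?_⟩
  · have h1 : a * a = a + p ^ 2 • z := by rw [← haz, add_sub_cancel]
    simp only [add_mul, mul_add, smul_mul_assoc, mul_smul_comm, h1, smul_add, smul_sub, smul_smul,
      ← pow_add]
    module
  · rw [_root_.map_add, hsm, Matrix.add_apply, Matrix.smul_apply, smul_eq_mul, _root_.map_pow]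
    exact hw.ge_add (ha i i') (hM₁ _ (by omega) (i, i'))
  · rw [_root_.map_add, _root_.map_add, hsm, hsm, Matrix.add_apply, Matrix.add_apply,
      Matrix.smul_apply, Matrix.smul_apply, smul_eq_mul, smul_eq_mul, _root_.map_pow,
      _root_.map_pow]
    exact hw.ge_add (hw.ge_add (hz i i') (hM₂ _ (by omega) (i, i'))) (hM₃ _ (by omega) (i, i'))
  · rw [hdet']
    exact hM₄ _ (by omega)

end Perturbation

section ConstantReduction

universe u

variable {k D K L : Type u} [Field k] [Ring D] [Nontrivial D] [Algebra k D] [Module.Finite k D]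
  [Field K] [Algebra k K] [Field L] [Algebra K L] {w : L → ℤ} {n : ℕ}

/-- The determinants of a constant algebra at a valuation. -/
theorem exists_approx_idempotent_tensorProduct (hw : IsIntVal w) (hn : 0 < n)
    (hD : ∀ x : D, x ≠ 0 → IsUnit x) (hcenter : Subalgebra.center k D = ⊥) {p : K} (hp0 : p ≠ 0)
    (hp : w (algebraMap K L p) = 1) (hk : ∀ x : k, ValGE w 0 (algebraMap K L (algebraMap k K x)))
    (ρ : K ⊗[k] D →ₐ[K] Matrix (Fin n) (Fin n) L) (hρ : ∀ d i j, ValGE w 0 (ρ (1 ⊗ₜ d) i j)) :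
    ∃ (d : ℤ) (a z : K ⊗[k] D), 1 ≤ d ∧ a * a - a = p ^ 2 • z ∧ (∀ i j, ValGE w 0 (ρ a i j)) ∧
      (∀ i j, ValGE w 0 (ρ z i j)) ∧ (ρ (a + p • (1 - a))).det ≠ 0 ∧
      w (ρ (a + p • (1 - a))).det = n - d ∧
      ∀ y, (ρ y).det ≠ 0 → d ∣ w (ρ y).det := by
  have hinj : Function.Injective (algebraMap K L) := (algebraMap K L).injective
  have hp0' : algebraMap K L p ≠ 0 := by simpa using hp0
  have hv : IsIntVal fun x : K => w (algebraMap K L x) :=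
    ⟨fun x y hx hy => by
      rw [_root_.map_mul, hw.map_mul _ _ (by simpa using hx) (by simpa using hy)],
     fun x y hx hy hxy => by
      rw [_root_.map_add]
      exact hw.map_add _ _ (by simpa using hx) (by simpa using hy)
        (by rwa [← _root_.map_add, _root_.map_ne_zero])⟩
  have hge : ∀ (c : ℤ) (x : K), ValGE (fun x : K => w (algebraMap K L x)) c x →
      ValGE w c (algebraMap K L x) := fun c x hx h0 => hx (by rintro rfl; simp at h0)
  obtain ⟨F, _, π, hπs, hπ⟩ := hv.exists_residue
  let φ : k →+* hv.integers := (algebraMap k K).codRestrict hv.integers fun x hx =>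
    hk x (by simpa using hx)
  let _ : Algebra k hv.integers := φ.toAlgebra
  let _ : Algebra k F := (π.comp φ).toAlgebra
  let πA : hv.integers →ₐ[k] F := { π with commutes' := fun x => rfl }
  let ιA : hv.integers →ₐ[k] K := { hv.integers.subtype with commutes' := fun x => rfl }
  have hsimple' : IsSimpleRing (D ⊗[k] F) := isSimpleRing_tensorProduct hD hcenter F
  have hsimple : IsSimpleRing (F ⊗[k] D) :=
    IsSimpleRing.of_ringEquiv (Algebra.TensorProduct.comm k D F).toRingEquiv hsimple'
  let red : hv.integers ⊗[k] D →ₐ[k] F ⊗[k] D := Algebra.TensorProduct.map πA (AlgHom.id k D)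
  let ι : hv.integers ⊗[k] D →ₐ[k] K ⊗[k] D := Algebra.TensorProduct.map ιA (AlgHom.id k D)
  have hι : ∀ (x : hv.integers) (d : D), ι (x ⊗ₜ d) = (x : K) ⊗ₜ d := fun x d => rfl
  have hredt : ∀ (x : hv.integers) (d : D), red (x ⊗ₜ d) = π x ⊗ₜ d := fun x d => rfl
  have hR : ∀ y i j, ValGE w 0 (ρ (ι y) i j) := by
    intro y
    induction y using TensorProduct.induction_on with
    | zero => intro i j; rw [_root_.map_zero, _root_.map_zero]; exact ValGE.zero _
    | add x y hx hy =>
      intro i j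
      rw [_root_.map_add, _root_.map_add, Matrix.add_apply]
      exact hw.ge_add (hx i j) (hy i j)
    | tmul x d =>
      intro i j
      have h1 : ρ (ι (x ⊗ₜ d)) = algebraMap K L x • ρ (1 ⊗ₜ d) := by
        rw [hι, algebraMap_smul, ← _root_.map_smul, TensorProduct.smul_tmul', smul_eq_mul, mul_one]
      rw [h1, Matrix.smul_apply, smul_eq_mul]
      exact hw.ge_mul (hge 0 _ x.2) (hρ d i j)
  let pO : hv.integers := ⟨p, fun _ => le_of_le_of_eq zero_le_one hp.symm⟩
  have hπp : π pO = 0 := (hπ pO).mpr fun _ => hp.ge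
  have hιp : ι (pO ⊗ₜ 1) = p • 1 := by
    rw [hι, Algebra.TensorProduct.one_def, TensorProduct.smul_tmul', smul_eq_mul, mul_one]
  have β := Module.finBasis k D
  obtain ⟨d, a, z, hd, haz, hdet, hdvd⟩ := exists_approx_idempotent_dvd hw hn hp0' hp
    (ρ.toRingHom.comp ι.toRingHom) hR (pO ⊗ₜ 1) (by
      change ρ (ι (pO ⊗ₜ 1)) = _
      rw [hιp, _root_.map_smul, _root_.map_one, algebraMap_smul]) (fun y => by
      induction y using TensorProduct.induction_on with
      | zero => rw [mul_zero, zero_mul]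
      | add x y hx hy => rw [mul_add, add_mul, hx, hy]
      | tmul x d =>
        rw [Algebra.TensorProduct.tmul_mul_tmul, Algebra.TensorProduct.tmul_mul_tmul, mul_one,
          one_mul, mul_comm]) F red.toRingHom
    (TensorProduct.map_surjective hπs Function.surjective_id) (by
      change red (pO ⊗ₜ 1) = 0
      rw [hredt, hπp, TensorProduct.zero_tmul]) (fun y hy => by
      obtain ⟨b, rfl⟩ := TensorProduct.eq_repr_basis_right β y
      have h1 : (b.mapRange π (_root_.map_zero π)).sum (fun i n => n ⊗ₜ[k] β i) = 0 := by
        rw [Finsupp.sum_mapRange_index (h := fun i n => n ⊗ₜ[k] β i)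
          fun i => TensorProduct.zero_tmul _ _]
        refine Eq.trans ?_ hy
        change _ = red _
        rw [Finsupp.sum, Finsupp.sum, _root_.map_sum]
        rfl
      have h2 := TensorProduct.sum_tmul_basis_right_eq_zero β _ h1
      have h3 : ∀ i, ∃ c : hv.integers, b i = pO * c := fun i => by
        have h4 : π (b i) = 0 := by
          have := DFunLike.congr_fun h2 i
          simpa using this
        have h5 := (hπ _).mp h4
        refine ⟨⟨p⁻¹ * b i, ?_⟩, Subtype.ext ?_⟩
        · have h6 := hv.ge_mul (x := p⁻¹) (y := (b i : K)) (i := -1) (j := 1)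
            (fun _ => (((hv.map_inv hp0).trans (congrArg Neg.neg hp)).ge)) h5
          rw [neg_add_cancel] at h6
          exact h6
        · exact (mul_inv_cancel_left₀ hp0 _).symm
      choose c hc using h3
      refine ⟨∑ i ∈ b.support, c i ⊗ₜ β i, ?_⟩
      rw [Finset.mul_sum, Finsupp.sum]
      refine Finset.sum_congr rfl fun i _ => ?_
      rw [Algebra.TensorProduct.tmul_mul_tmul, one_mul, ← hc])
  have hρp : ∀ y, ρ (p • y) = algebraMap K L p • ρ y := fun y => by
    rw [_root_.map_smul, algebraMap_smul]
  have hRa : ∀ y, (ρ.toRingHom.comp ι.toRingHom) y = ρ (ι y) := fun y => rfl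
  have hexh : ∀ y : K ⊗[k] D, ∃ (N : ℕ) (s : hv.integers ⊗[k] D), p ^ N • y = ι s := by
    intro y
    obtain ⟨b, rfl⟩ := TensorProduct.eq_repr_basis_right β y
    obtain ⟨N, hN⟩ := hw.exists_pow_mul_ge hp0' hp (fun i => algebraMap K L (b i)) 0
    refine ⟨N, ∑ i ∈ b.support, (⟨p ^ N * b i, fun _ => ?_⟩ : hv.integers) ⊗ₜ β i, ?_⟩
    · have h1 := hN N le_rfl i
      rw [← _root_.map_pow, ← _root_.map_mul] at h1
      exact h1 (by simpa using ‹p ^ N * b i ≠ 0›)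
    · rw [Finsupp.sum, Finset.smul_sum, _root_.map_sum]
      refine Finset.sum_congr rfl fun i _ => ?_
      rw [hι, TensorProduct.smul_tmul', smul_eq_mul]
  have hdetp : ∀ (N : ℕ) (y : K ⊗[k] D), (ρ y).det ≠ 0 → (ρ (p ^ N • y)).det ≠ 0 ∧
      w (ρ (p ^ N • y)).det = n * N + w (ρ y).det := by
    intro N y hy
    have h1 : (ρ (p ^ N • y)).det = (algebraMap K L p ^ N) ^ n * (ρ y).det := by
      rw [_root_.map_smul, ← algebraMap_smul L, Matrix.det_smul, Fintype.card_fin, _root_.map_pow]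
    have h2 := pow_ne_zero n (pow_ne_zero N hp0')
    rw [h1, hw.map_mul _ _ h2 hy, hw.map_pow (pow_ne_zero N hp0'), hw.map_pow hp0', hp, mul_one]
    exact ⟨mul_ne_zero h2 hy, rfl⟩
  have hdn : d ∣ n := by
    have h1 := hdvd (pO ⊗ₜ 1)
    rw [hRa, hιp] at h1
    have h2 := hdetp 1 1 (by rw [_root_.map_one, Matrix.det_one]; exact one_ne_zero)
    rw [pow_one] at h2
    have h3 := h1 h2.1
    rw [h2.2, _root_.map_one, Matrix.det_one, hw.map_one] at h3
    simpa using h3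
  have hG : ρ (ι a + p • (1 - ι a)) = ρ (ι a) + algebraMap K L p • (1 - ρ (ι a)) := by
    rw [_root_.map_add, hρp, _root_.map_sub, _root_.map_one]
  have hιaz : ι a * ι a - ι a = p ^ 2 • ι z := by
    rw [← _root_.map_mul, ← _root_.map_sub, haz, _root_.map_mul, _root_.map_pow, hιp,
      _root_.smul_pow,
      one_pow, smul_mul_assoc, one_mul]
  refine ⟨d, ι a, ι z, hd, hιaz, hR a, hR z, ?_, ?_, fun y hy => ?_⟩
  · rw [hG]
    refine (det_approx_idempotent hw hp0' hp (Z := ρ (ι z)) ?_ (hR z)).1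
    rw [← _root_.map_mul, ← _root_.map_sub, hιaz, _root_.map_smul, ← algebraMap_smul L,
      _root_.map_pow]
  · rw [hG]
    exact hdet
  · obtain ⟨N, s, hs⟩ := hexh y
    have h1 := hdetp N y hy
    have h2 := hdvd s
    rw [hRa, ← hs] at h2
    have h3 := h2 h1.1
    rw [h1.2] at h3
    exact (dvd_add_right (hdn.mul_right _)).mp h3

end ConstantReduction

section Transfer

universe u

variable {L : Type u} [Field L] {w : L → ℤ} {n : ℕ} {K : Type*} [Field K] [Algebra K L]
  {A A' : Type*} [Ring A] [Algebra K A] [Ring A'] [Algebra K A'] {G : Type*} [Group G]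
  {act : G →* (L ≃ₐ[K] L)} {ρ : A →ₐ[K] Matrix (Fin n) (Fin n) L}
  {U : G → Matrix (Fin n) (Fin n) L} {c : G → G → L}
  {ρ' : A' →ₐ[K] Matrix (Fin n) (Fin n) L} {U' : G → Matrix (Fin n) (Fin n) L} {c' : G → G → L}

theorem det_affine {M N : Matrix (Fin n) (Fin n) L} (hMN : M.charpoly = N.charpoly) {x y : L}
    (hy : y ≠ 0) : (x • 1 + y • M).det = (x • 1 + y • N).det := by
  have key : ∀ M : Matrix (Fin n) (Fin n) L,
      (x • 1 + y • M).det = (-y) ^ n * M.charpoly.eval (-y⁻¹ * x) := by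
    intro M
    have h1 : Matrix.scalar (Fin n) (-y⁻¹ * x) - M = (-y)⁻¹ • (x • 1 + y • M) := by
      rw [Matrix.scalar_apply, ← Matrix.smul_one_eq_diagonal, smul_add, smul_smul, smul_smul,
        inv_neg, neg_mul, neg_mul, inv_mul_cancel₀ hy, neg_smul, neg_smul, one_smul, sub_eq_add_neg]
    rw [Matrix.eval_charpoly, h1, Matrix.det_smul, Fintype.card_fin, ← mul_assoc, ← mul_pow,
      mul_inv_cancel₀ (neg_ne_zero.mpr hy), one_pow, one_mul]
  rw [key, key, hMN]

theorem exists_integral_poly (hw : IsIntVal w) {M : Matrix (Fin n) (Fin n) L}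
    (hM : ∀ i j, ValGE w 0 (M i j)) :
    ∃ F : hw.integers[X], F.Monic ∧ F.map (algebraMap hw.integers L) = M.charpoly := by
  obtain ⟨M', rfl⟩ := hw.exists_matrix_integers hM
  exact ⟨M'.charpoly, M'.charpoly_monic, (Matrix.charpoly_map M' hw.integers.subtype).symm⟩

theorem map_affine (x : A) (p : K) : ρ (x + p • (1 - x)) =
    algebraMap K L p • 1 + (1 - algebraMap K L p) • ρ x := by
  rw [map_add, _root_.map_smul, map_sub, _root_.map_one, sub_smul, one_smul, smul_sub,
    algebraMap_smul, algebraMap_smul]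
  abel

theorem aeval_quadratic (x : A) (p : K) :
    aeval x (C p * (X * X - X)) = p • (x * x - x) := by
  rw [_root_.map_mul, aeval_C, map_sub, _root_.map_mul, aeval_X, Algebra.smul_def]

/-- An approximate idempotent transfers along equality of minimal polynomials. -/
theorem IsForm.exists_transfer (h : IsForm act ρ U c) (h' : IsForm act ρ' U' c')
    [NeZero n]
    (hfix : ∀ l : L, (∀ σ, act σ l = l) → ∃ x : K, algebraMap K L x = l)
    (hw : IsIntVal w) {p : K} (hp0 : p ≠ 0) (hp : w (algebraMap K L p) = 1) {a z : A}
    (haz : a * a - a = p ^ 2 • z) (ha : ∀ i j, ValGE w 0 (ρ a i j))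
    (hz : ∀ i j, ValGE w 0 (ρ z i j)) (hdeg : (minpoly K a).natDegree = n) {a' : A'}
    (ha' : minpoly K a' = minpoly K a) :
    ∃ (z' : A') (Fa Fz : hw.integers[X]), a' * a' - a' = p ^ 2 • z' ∧ Fa.Monic ∧
      aeval (ρ' a') Fa = 0 ∧ Fz.Monic ∧ aeval (ρ' z') Fz = 0 ∧
      (ρ' (a' + p • (1 - a'))).det = (ρ (a + p • (1 - a))).det := by
  have hp2 : p ^ 2 ≠ 0 := pow_ne_zero _ hp0
  have hchar : (ρ' a').charpoly = (ρ a).charpoly := by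
    rw [← h.map_minpoly hfix (by rwa [Fintype.card_fin]),
      ← h'.map_minpoly hfix (by rwa [Fintype.card_fin, ha']), ha']
  obtain ⟨Fa, hFa, hFa'⟩ := exists_integral_poly hw ha
  obtain ⟨Fz, hFz, hFz'⟩ := exists_integral_poly hw hz
  obtain ⟨g, hg⟩ := h.exists_charpoly hfix z
  refine ⟨(p ^ 2)⁻¹ • (a' * a' - a'), Fa, Fz, (smul_inv_smul₀ hp2 _).symm, hFa, ?_, hFz, ?_, ?_⟩
  · rw [← aeval_map_algebraMap L, hFa', ← hchar, Matrix.aeval_self_charpoly]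
  · have h1 : aeval a (g.comp (C (p ^ 2)⁻¹ * (X * X - X))) = 0 := by
      rw [aeval_comp, aeval_quadratic, haz, inv_smul_smul₀ hp2]
      apply h.split.injective
      rw [← aeval_algHom_apply, ← aeval_map_algebraMap L, hg, Matrix.aeval_self_charpoly,
        _root_.map_zero]
    have h2 : aeval a' (g.comp (C (p ^ 2)⁻¹ * (X * X - X))) = 0 := by
      rw [← minpoly.dvd_iff, ha']
      exact minpoly.dvd K a h1
    rw [aeval_comp, aeval_quadratic] at h2
    rw [← aeval_map_algebraMap L, hFz', ← hg, aeval_map_algebraMap, aeval_algHom_apply, h2,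
      _root_.map_zero]
  · rw [map_affine, map_affine]
    refine det_affine hchar fun h0 => ?_
    rw [sub_eq_zero] at h0
    rw [← h0, hw.map_one] at hp
    omega

end Transfer

section FormTruncation

universe u

variable {K A G : Type*} {L : Type u} [Field K] [Field L] [Algebra K L] [Ring A] [Algebra K A]
  [Group G] {n : ℕ} [NeZero n] {act : G →* (L ≃ₐ[K] L)}
  {ρ : A →ₐ[K] Matrix (Fin n) (Fin n) L} {U : G → Matrix (Fin n) (Fin n) L} {c : G → G → L}
  {w : L → ℤ} {ν : Fin n → ℤ}

theorem IsForm.shift_inv (h : IsForm act ρ U c) (hw : IsIntVal w) {H : Subgroup G}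
    (hH : ∀ g ∈ H, ∀ l, w (act g l) = w l)
    (hU : ∀ g ∈ H, Shift (fun x => n * w x) ν (w (U g).det) (U g)) {g : G} (hg : g ∈ H) :
    Shift (fun x => n * w x) ν (-w (U g).det) (U g)⁻¹ := by
  have hv := hw.nsmul n
  obtain ⟨e, he⟩ : ∃ e, e = c g g⁻¹ * c 1 1 := ⟨_, rfl⟩
  have he0 : e ≠ 0 := he ▸ mul_ne_zero (h.coc_ne_zero _ _) (h.coc_ne_zero _ _)
  have h1 : U g * (act g).mapMatrix (U g⁻¹) = e • 1 := by
    rw [h.coc, mul_inv_cancel, h.one_eq, smul_smul, he]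
  have h2 : (U g)⁻¹ = e⁻¹ • (act g).mapMatrix (U g⁻¹) := by
    refine Matrix.inv_eq_right_inv ?_
    rw [mul_smul_comm, h1, inv_smul_smul₀ he0]
  have h3 : w (U g).det + w (U g⁻¹).det = n * w e := by
    have h4 := congrArg (fun M => w M.det) h1
    rw [Matrix.det_mul, mapMatrix_det, Matrix.det_smul, Matrix.det_one, mul_one, Fintype.card_fin,
      hw.map_mul _ _ (h.det_ne_zero g) (by simpa using h.det_ne_zero g⁻¹), hH g hg,
      hw.map_pow he0] at h4
    exact h4
  rw [h2]
  have h4 : Shift (fun x => n * w x) ν (w (U g⁻¹).det) ((act g).mapMatrix (U g⁻¹)) :=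
    (hU _ (H.inv_mem hg)).map (f := act g) (fun x => by rw [hH g hg]) (_root_.map_zero _)
  refine (Shift.smul hv h4 (t := -(n * w e)) fun _ => ?_).mono (by omega)
  rw [hv.map_inv he0]

/-- A form with a twist of fractional valuation can be truncated along an adapted idempotent. -/
theorem IsForm.exists_truncation (h : IsForm act ρ U c) (hw : IsIntVal w) {H : Subgroup G}
    (hH : ∀ g ∈ H, ∀ l, w (act g l) = w l) (hν : ∀ j, 0 ≤ ν j ∧ ν j < n)
    (hU : ∀ g ∈ H, Shift (fun x => n * w x) ν (w (U g).det) (U g)) {p : K} (hp0 : p ≠ 0)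
    (hp : w (algebraMap K L p) = 1) {a z : A} (haz : a * a - a = p ^ 2 • z) {b : Fin n → L}
    (hb : ∀ j, b j = 0 ∨ b j = 1)
    (hX : Shift (fun x => n * w x) ν n (ρ a - Matrix.diagonal b))
    (hZ : Shift (fun x => n * w x) ν 0 (ρ z)) {d : ℤ}
    (hd : w (ρ (a + p • (1 - a))).det = n - d) {g₀ : G} (hg₀ : g₀ ∈ H)
    (hdvd : ¬ (n : ℤ) ∣ w (U g₀).det) :
    ∃ (t : ℕ) (Y : Matrix (Fin n) (Fin n) L), 0 < t ∧ t < n ∧ Y.det ≠ 0 ∧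
      n * w Y.det = t * d ∧
      ∀ g ∈ H, ∀ i j, ValGE w 0 ((Y⁻¹ * (U g * (act g).mapMatrix Y * (U g)⁻¹)) i j) := by
  have hv := hw.nsmul n
  have hn : 0 < n := Nat.pos_of_ne_zero (NeZero.ne n)
  have hnz : (0 : ℤ) < n := by exact_mod_cast hn
  have hp0' : algebraMap K L p ≠ 0 := by simpa using hp0
  obtain ⟨E, hE⟩ : ∃ E, E = Matrix.diagonal b := ⟨_, rfl⟩
  have hr : ∀ j, ∃ r : ℕ, (b j = 0 ∧ r = 0) ∨ (b j = 1 ∧ r = 1) := fun j => by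
    rcases hb j with h | h
    · exact ⟨0, .inl ⟨h, rfl⟩⟩
    · exact ⟨1, .inr ⟨h, rfl⟩⟩
  choose r hr using hr
  have hdr : d = ∑ j, (r j : ℤ) := by
    have h1 := det_eq_card hw hp0' hp (A := ρ a) (Z := ρ z) (by
      rw [← _root_.map_mul, ← map_sub, haz, _root_.map_smul, ← algebraMap_smul L, _root_.map_pow])
      (Shift.entry_ge_zero hν hZ) r hr (Shift.entry_ge_one hν hX)
    have h2 : ρ (a + p • (1 - a)) = ρ a + algebraMap K L p • (1 - ρ a) := by
      rw [map_add, _root_.map_smul, map_sub, _root_.map_one, algebraMap_smul]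
    rw [h2, h1] at hd
    omega
  have hES : Shift (fun x => n * w x) ν 0 E := by
    rw [hE]
    refine Shift.diagonal fun j => ?_
    rcases hb j with h | h <;> rw [h]
    · exact ValGE.zero _
    · exact hv.ge_one
  have hgE : ∀ g, (act g).mapMatrix E = E := fun g => by
    rw [hE]
    refine Matrix.ext fun i j => ?_
    rw [AlgEquiv.mapMatrix_apply, Matrix.map_apply, Matrix.diagonal_apply]
    split_ifs
    · rcases hb i with h | h <;> rw [h] <;> simp
    · simp
  have hE1 : Shift (fun x => n * w x) ν 0 (1 - E) := Shift.sub hv (Shift.one hv) hES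
  have hUinv : ∀ g, U g * (U g)⁻¹ = 1 := fun g =>
    Matrix.mul_nonsing_inv _ (h.det_ne_zero g).isUnit
  have hUinv' : ∀ g, (U g)⁻¹ * U g = 1 := fun g =>
    Matrix.nonsing_inv_mul _ (h.det_ne_zero g).isUnit
  have hmap : ∀ g ∈ H, ∀ s M, Shift (fun x => n * w x) ν s M →
      Shift (fun x => n * w x) ν s ((act g).mapMatrix M) := fun g hg s M hM =>
    hM.map (f := act g) (fun x => by rw [hH g hg]) (_root_.map_zero _)
  have hcomm : ∀ g ∈ H, Shift (fun x => n * w x) ν (w (U g).det + n) (E * U g - U g * E) := by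
    intro g hg
    obtain ⟨X, hXd⟩ : ∃ X, X = ρ a - E := ⟨_, rfl⟩
    have h1 : E = ρ a - X := by rw [hXd, sub_sub_cancel]
    have h2 : E * U g - U g * E = U g * (act g).mapMatrix X - X * U g := by
      have h3 : (act g).mapMatrix (ρ a) = E + (act g).mapMatrix X := by
        rw [hXd, map_sub, hgE, add_sub_cancel]
      have h4 := h.comm g a
      rw [h3, mul_add] at h4
      have h5 : ρ a = E + X := by rw [hXd, add_sub_cancel]
      rw [h5, add_mul] at h4
      rw [sub_eq_sub_iff_add_eq_add, ← h4, add_comm]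
    rw [h2]
    rw [← hE, ← hXd] at hX
    exact Shift.sub hv (Shift.mul hv (hU g hg) (hmap g hg _ _ hX))
      ((Shift.mul hv hX (hU g hg)).mono (by omega))
  obtain ⟨s, hs⟩ : ∃ s, s = w (U g₀).det := ⟨_, rfl⟩
  obtain ⟨t, ht⟩ : ∃ t : ℕ, (t : ℤ) = s % n := ⟨(s % n).toNat, Int.toNat_of_nonneg
    (Int.emod_nonneg _ hnz.ne')⟩
  have hst : s = n * (s / n) + t := by rw [ht, Int.mul_ediv_add_emod]
  obtain ⟨q, hq⟩ : ∃ q, q = s / n := ⟨_, rfl⟩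
  rw [← hq] at hst
  have htn : t < n := by
    have := Int.emod_lt_of_pos s hnz
    omega
  have ht0 : 0 < t := by
    rw [← hs, hst] at hdvd
    by_contra h0
    have : t = 0 := by omega
    rw [this] at hdvd
    simp at hdvd
  have hpq : ∀ q : ℤ, ValGE (fun x => n * w x) (n * q) (algebraMap K L p ^ q) := fun q _ => by
    show (n : ℤ) * q ≤ n * w _
    rw [hw.map_zpow hp0', hp, mul_one]
  obtain ⟨Ψ, hΨ⟩ : ∃ Ψ, Ψ = algebraMap K L p ^ (-q) • U g₀ := ⟨_, rfl⟩
  obtain ⟨Ψ', hΨ'⟩ : ∃ Ψ', Ψ' = algebraMap K L p ^ q • (U g₀)⁻¹ := ⟨_, rfl⟩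
  have hΨt : Shift (fun x => n * w x) ν t Ψ := by
    rw [hΨ]
    exact (Shift.smul hv (hU g₀ hg₀) (hpq (-q))).mono (by rw [← hs, hst, mul_neg]; omega)
  have hΨt' : Shift (fun x => n * w x) ν (-t) Ψ' := by
    rw [hΨ']
    exact (Shift.smul hv (h.shift_inv hw hH hU hg₀) (hpq q)).mono (by rw [← hs, hst]; omega)
  have hEΨ : Shift (fun x => n * w x) ν (t + n) (E * Ψ - Ψ * E) := by
    have h1 : E * Ψ - Ψ * E = algebraMap K L p ^ (-q) • (E * U g₀ - U g₀ * E) := by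
      rw [hΨ, mul_smul_comm, smul_mul_assoc, smul_sub]
    rw [h1]
    exact (Shift.smul hv (hcomm g₀ hg₀) (hpq (-q))).mono (by rw [← hs, hst, mul_neg]; omega)
  obtain ⟨Q, hQ, hQY, hdet⟩ := GenusTranscendental.exists_truncation hw hp0' hp hν hn r hr
    (Ψ := Ψ) (Ψ' := Ψ') (by
      rw [hΨ, hΨ', smul_mul_smul_comm, hUinv, zpow_neg, inv_mul_cancel₀ (zpow_ne_zero _ hp0'),
        one_smul]) hΨt hΨt' (by rwa [← hE])
  rw [← hE] at hQY hdet
  obtain ⟨Y, hY⟩ : ∃ Y, Y = E * Ψ * E + (1 - E) := ⟨_, rfl⟩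
  rw [← hY] at hQY hdet
  have hYinv : Y⁻¹ = Q * (E * Ψ' * E + (1 - E)) := Matrix.inv_eq_left_inv hQY
  have hY0 : Y.det ≠ 0 := fun h0 => by
    have h1 := congrArg Matrix.det hQY
    rw [Matrix.det_mul, h0, mul_zero, Matrix.det_one] at h1
    exact zero_ne_one h1
  refine ⟨t, Y, ht0, htn, hY0, by rw [hdet, hdr], fun g hg => Shift.entry_ge_zero hν ?_⟩
  rw [hYinv, mul_assoc]
  refine (Shift.mul hv (t := 0) hQ ?_).mono (by omega)
  obtain ⟨Eg, hEg⟩ : ∃ Eg, Eg = U g * E * (U g)⁻¹ := ⟨_, rfl⟩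
  obtain ⟨Φ, hΦ⟩ : ∃ Φ, Φ = U g * (act g).mapMatrix Ψ * (U g)⁻¹ := ⟨_, rfl⟩
  obtain ⟨R, hR⟩ : ∃ R, R = Eg - E := ⟨_, rfl⟩
  have hconj : ∀ M N : Matrix (Fin n) (Fin n) L, U g * (M * N) * (U g)⁻¹ =
      (U g * M * (U g)⁻¹) * (U g * N * (U g)⁻¹) := fun M N => by
    rw [mul_assoc (U g * M), ← mul_assoc (U g)⁻¹, ← mul_assoc (U g)⁻¹, hUinv', one_mul]
    simp only [mul_assoc]
  have hW : U g * (act g).mapMatrix Y * (U g)⁻¹ = Eg * Φ * Eg + (1 - Eg) := by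
    rw [hY, map_add ((act g).mapMatrix (m := Fin n)), map_sub ((act g).mapMatrix (m := Fin n)),
      _root_.map_mul ((act g).mapMatrix (m := Fin n)),
      _root_.map_mul ((act g).mapMatrix (m := Fin n)), hgE,
      _root_.map_one ((act g).mapMatrix (m := Fin n)), mul_add, add_mul, hconj, hconj, mul_sub,
      mul_one, sub_mul, hUinv, hEg, hΦ]
  have hRS : Shift (fun x => n * w x) ν n R := by
    have h1 : R = (U g * E - E * U g) * (U g)⁻¹ := by
      rw [hR, hEg, sub_mul, mul_assoc E, hUinv, mul_one]
    rw [h1]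
    have h2 : Shift (fun x => n * w x) ν (w (U g).det + n) (U g * E - E * U g) := by
      intro i j
      have := hv.ge_neg (hcomm g hg i j)
      rwa [← Matrix.neg_apply, neg_sub] at this
    exact (Shift.mul hv h2 (h.shift_inv hw hH hU hg)).mono (by omega)
  have hEgS : Shift (fun x => n * w x) ν 0 Eg := by
    have h1 : Eg = E + R := by rw [hR, add_sub_cancel]
    rw [h1]
    exact Shift.add hv hES (hRS.mono (by omega))
  have hΦS : Shift (fun x => n * w x) ν t Φ := by
    rw [hΦ]
    exact (Shift.mul hv (Shift.mul hv (hU g hg) (hmap g hg _ _ hΨt))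
      (h.shift_inv hw hH hU hg)).mono (by omega)
  have hEE : E * E = E := by
    rw [hE, Matrix.diagonal_mul_diagonal]
    exact congrArg _ (funext fun j => by rcases hb j with h | h <;> rw [h] <;> ring)
  have hEEg : E * (1 - Eg) = (E - E) - E * R := by
    rw [hR, mul_sub, mul_sub, mul_one, hEE]
    abel
  rw [hW, add_mul, mul_add, mul_add, mul_assoc (E * Ψ') E (1 - Eg), hEEg, sub_self]
  have hEΨ'E : Shift (fun x => n * w x) ν (-t) (E * Ψ' * E) :=
    (Shift.mul hv (Shift.mul hv hES hΨt') hES).mono (by omega)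
  have hEΦE : Shift (fun x => n * w x) ν t (Eg * Φ * Eg) :=
    (Shift.mul hv (Shift.mul hv hEgS hΦS) hEgS).mono (by omega)
  have h0S : Shift (fun x => n * w x) ν n (0 : Matrix (Fin n) (Fin n) L) :=
    fun i j => ValGE.zero _
  refine Shift.add hv (Shift.add hv ?_ ?_) (Shift.add hv ?_ ?_)
  · exact (Shift.mul hv hEΨ'E hEΦE).mono (by omega)
  · exact (Shift.mul hv (Shift.mul hv hES hΨt')
      (Shift.sub hv h0S ((Shift.mul hv hES hRS).mono (by omega)))).mono (by omega)
  · exact (Shift.mul hv hE1 hEΦE).mono (by omega)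
  · exact (Shift.mul hv hE1 (Shift.sub hv (Shift.one hv) hEgS)).mono (by omega)

end FormTruncation

section GaloisAverage

universe u

variable {k P K : Type*} {L : Type u} [Field k] [Field P] [Field K] [Field L] [Algebra k P]
  [Algebra K L] [Algebra P L] {A A' : Type*} [Ring A] [Algebra K A] [Ring A'] [Algebra K A']
  {n : ℕ} [NeZero n] {act : (P ≃ₐ[k] P) →* (L ≃ₐ[K] L)}
  {ρ : A →ₐ[K] Matrix (Fin n) (Fin n) L} {U : (P ≃ₐ[k] P) → Matrix (Fin n) (Fin n) L}
  {c : (P ≃ₐ[k] P) → (P ≃ₐ[k] P) → L}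
  {ρ' : A' →ₐ[K] Matrix (Fin n) (Fin n) L} {U' : (P ≃ₐ[k] P) → Matrix (Fin n) (Fin n) L}
  {c' : (P ≃ₐ[k] P) → (P ≃ₐ[k] P) → L} {w : L → ℤ}

theorem IsForm.twist_comp {G ι : Type*} [Group G] [Fintype ι] [DecidableEq ι]
    {act : G →* (L ≃ₐ[K] L)} {ρ : A →ₐ[K] Matrix ι ι L} {U : G → Matrix ι ι L} {c : G → G → L}
    (h : IsForm act ρ U c) (τ σ : G) (M : Matrix ι ι L) :
    U τ * (act τ).mapMatrix (U σ * (act σ).mapMatrix M * (U σ)⁻¹) =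
      U (τ * σ) * (act (τ * σ)).mapMatrix M * (U (τ * σ))⁻¹ * U τ := by
  have hdet : ∀ s, IsUnit (U s).det := fun s => (h.det_ne_zero s).isUnit
  obtain ⟨X, hX⟩ : ∃ X, X = U σ * (act σ).mapMatrix M * (U σ)⁻¹ := ⟨_, rfl⟩
  have h1 : X * U σ = U σ * (act σ).mapMatrix M := by
    rw [hX, Matrix.nonsing_inv_mul_cancel_right _ _ (hdet σ)]
  have h2 : (act τ).mapMatrix ((act σ).mapMatrix M) = (act (τ * σ)).mapMatrix M := by
    rw [_root_.map_mul]
    rfl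
  have h3 := congrArg (fun N => U τ * (act τ).mapMatrix N) h1
  rw [map_mul ((act τ).mapMatrix (m := ι)), map_mul ((act τ).mapMatrix (m := ι)), ← mul_assoc,
    ← mul_assoc, h.coc, h2] at h3
  have hτ : IsUnit ((act τ).mapMatrix (U σ)) := (h.isUnit σ).map _
  rw [← hX]
  refine hτ.mul_right_cancel ?_
  rw [h3, mul_assoc _ (U τ), h.coc, mul_smul_comm,
    Matrix.nonsing_inv_mul_cancel_right _ _ (hdet (τ * σ)), smul_mul_assoc]

/-- An integrally twisted matrix can be averaged into the form without changing the valuation of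
its determinant. -/
theorem IsForm.exists_average [Infinite k] [FiniteDimensional k P] (h : IsForm act ρ U c)
    (hact : ∀ s x, act s (algebraMap P L x) = algebraMap P L (s x))
    (hfix : ∀ l : L, (∀ s, act s l = l) → ∃ x : K, algebraMap K L x = l) (hw : IsIntVal w)
    (hP : ∀ x : P, ValGE w 0 (algebraMap P L x)) {H : Subgroup (P ≃ₐ[k] P)}
    (hH : ∀ g ∈ H, ∀ l, w (act g l) = w l)
    (hsep : ∀ C : ℤ, ∃ S : L, S ≠ 0 ∧ w S = 0 ∧ ∀ g ∉ H, C ≤ w (act g S))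
    {Y : Matrix (Fin n) (Fin n) L} (hY : Y.det ≠ 0)
    (hInt : ∀ g ∈ H, ∀ i j, ValGE w 0 ((Y⁻¹ * (U g * (act g).mapMatrix Y * (U g)⁻¹)) i j)) :
    ∃ y : A, (ρ y).det ≠ 0 ∧ w (ρ y).det = w Y.det := by
  classical
  cases nonempty_fintype (P ≃ₐ[k] P)
  obtain ⟨Z, hZ⟩ : ∃ Z : (P ≃ₐ[k] P) → Matrix (Fin n) (Fin n) L,
    Z = fun g => Y⁻¹ * (U g * (act g).mapMatrix Y * (U g)⁻¹) := ⟨_, rfl⟩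
  obtain ⟨C, hC⟩ := Finite.exists_le
    (fun q : (P ≃ₐ[k] P) × Fin n × Fin n => -w (Z q.1 q.2.1 q.2.2))
  obtain ⟨S, hS0, hS, hSC⟩ := hsep C
  have hz : ∀ g i j, ValGE w 0 ((act g S • Z g) i j) := fun g i j => by
    by_cases hg : g ∈ H
    · have h1 : ValGE w 0 (act g S) := fun _ => by rw [hH g hg, hS]
      have h2 : ValGE w 0 (Z g i j) := by
        rw [hZ]
        exact hInt g hg i j
      exact hw.ge_mul h1 h2
    · intro h0
      rw [Matrix.smul_apply, smul_eq_mul] at h0 ⊢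
      rw [hw.map_mul _ _ (left_ne_zero_of_mul h0) (right_ne_zero_of_mul h0)]
      have h1 := hC (g, i, j)
      have h2 := hSC g hg
      dsimp only at h1
      omega
  choose z' hz' using fun g => IsIntVal.exists_matrix_integers hw (hz g)
  obtain ⟨F, _, π, -, hπ⟩ := hw.exists_residue
  let φ : P →+* hw.integers := (algebraMap P L).codRestrict hw.integers hP
  let _ : Algebra P F := (π.comp φ).toAlgebra
  have hZ1 : Z 1 = 1 := by
    have h1 : (act 1).mapMatrix Y = Y := by
      rw [_root_.map_one]
      rfl
    have hc : c 1 1 ≠ 0 := h.coc_ne_zero 1 1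
    have h2 : (c 1 1 • (1 : Matrix (Fin n) (Fin n) L))⁻¹ = (c 1 1)⁻¹ • 1 := by
      refine Matrix.inv_eq_right_inv ?_
      rw [smul_mul_smul_comm, mul_inv_cancel₀ hc, mul_one, one_smul]
    rw [hZ]
    dsimp only
    rw [h1, h.one_eq, h2, smul_mul_assoc, one_mul, smul_mul_smul_comm, mul_inv_cancel₀ hc,
      mul_one, one_smul, Matrix.nonsing_inv_mul _ hY.isUnit]
  have hz1 : ((z' 1).map π).det ≠ 0 := by
    rw [IsIntVal.det_residue hw hπ, hz', hZ1, Matrix.det_smul, Matrix.det_one, mul_one,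
      _root_.map_one]
    exact ⟨pow_ne_zero _ hS0, by
      show w (S ^ _) = 0
      rw [hw.map_pow hS0, hS, mul_zero]⟩
  obtain ⟨l, hl⟩ := exists_det_sum_galois_ne_zero (fun g => (z' g).map π) hz1
  obtain ⟨N, hN⟩ : ∃ N, N = ∑ g, algebraMap P L (g l) • act g S • Z g := ⟨_, rfl⟩
  have hNdet : N.det ≠ 0 ∧ w N.det = 0 := by
    have h1 : (∑ g, φ (g l) • z' g).map hw.integers.subtype = N := by
      refine Matrix.ext fun i j => ?_
      rw [hN, Matrix.map_apply, Matrix.sum_apply, Matrix.sum_apply, map_sum]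
      refine Finset.sum_congr rfl fun g _ => ?_
      rw [← hz', Matrix.smul_apply, Matrix.smul_apply, smul_eq_mul, smul_eq_mul,
        Matrix.map_apply, _root_.map_mul]
      rfl
    rw [← h1, ← IsIntVal.det_residue hw hπ]
    convert hl using 2
    refine Matrix.ext fun i j => ?_
    rw [Matrix.map_apply, Matrix.sum_apply, Matrix.sum_apply, map_sum]
    refine Finset.sum_congr rfl fun g _ => ?_
    rw [Matrix.smul_apply, Matrix.smul_apply, smul_eq_mul, smul_eq_mul, Matrix.map_apply,
      _root_.map_mul]
    rfl
  have hYN : Y * N = ∑ g, U g * (act g).mapMatrix ((algebraMap P L l * S) • Y) * (U g)⁻¹ := by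
    rw [hN, Finset.mul_sum]
    refine Finset.sum_congr rfl fun g _ => ?_
    rw [hZ, mapMatrix_smul', _root_.map_mul, hact, smul_smul, mul_smul_comm, mul_smul_comm,
      smul_mul_assoc]
    dsimp only
    rw [Matrix.mul_nonsing_inv_cancel_left _ _ hY.isUnit]
  obtain ⟨y, hy⟩ := h.mem_range hfix (M := Y * N) fun τ => by
    rw [hYN, map_sum, Finset.mul_sum, Finset.sum_mul]
    simp only [h.twist_comp]
    exact Fintype.sum_equiv (Equiv.mulLeft τ) _ _ fun _ => rfl
  refine ⟨y, ?_⟩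
  rw [hy, Matrix.det_mul]
  refine ⟨mul_ne_zero hY hNdet.1, ?_⟩
  rw [hw.map_mul _ _ hY hNdet.1, hNdet.2, add_zero]

/-- If the form `A` contains an approximate idempotent realizing the least valuation `d` of reduced
norms, then forms with the same subfields as `A` are unramified on the decomposition group. -/
theorem IsForm.dvd_det_of_approx_idempotent [Infinite k] [FiniteDimensional k P] [Infinite K]
    [IsDomain A] [IsDomain A']
    (hact : ∀ s x, act s (algebraMap P L x) = algebraMap P L (s x))
    (hfix : ∀ l : L, (∀ s, act s l = l) → ∃ x : K, algebraMap K L x = l)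
    (h : IsForm act ρ U c) (h' : IsForm act ρ' U' c')
    (hroot : ∀ f : K[X], Irreducible f → f.natDegree = n →
      ((∃ x : A, aeval x f = 0) ↔ ∃ x : A', aeval x f = 0))
    (hw : IsIntVal w) (hP : ∀ x : P, ValGE w 0 (algebraMap P L x)) {H : Subgroup (P ≃ₐ[k] P)}
    (hH : ∀ g ∈ H, ∀ l, w (act g l) = w l)
    (hsep : ∀ C : ℤ, ∃ S : L, S ≠ 0 ∧ w S = 0 ∧ ∀ g ∉ H, C ≤ w (act g S))
    {p : K} (hp0 : p ≠ 0) (hp : w (algebraMap K L p) = 1) {d : ℤ} (hd0 : 1 ≤ d) {a z : A}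
    (haz : a * a - a = p ^ 2 • z) (ha : ∀ i j, ValGE w 0 (ρ a i j))
    (hz : ∀ i j, ValGE w 0 (ρ z i j)) (hdet : (ρ (a + p • (1 - a))).det ≠ 0)
    (hd : w (ρ (a + p • (1 - a))).det = n - d) (hdvd : ∀ y, (ρ y).det ≠ 0 → d ∣ w (ρ y).det)
    {g₀ : P ≃ₐ[k] P} (hg₀ : g₀ ∈ H) : (n : ℤ) ∣ w (U' g₀).det := by
  by_contra hnd
  have hn : 0 < n := NeZero.pos n
  have := h.split.finite
  have := h'.split.finite
  obtain ⟨a₁, z₁, haz₁, ha₁, hz₁, hdeg₁, hdet₁, hw₁⟩ :=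
    h.split.exists_approx_idempotent hn hw hp0 hp haz ha hz hdet
  have hirr : Irreducible (minpoly K a₁) := minpoly.irreducible (IsIntegral.of_finite K a₁)
  obtain ⟨a', ha'⟩ := (hroot _ hirr hdeg₁).1 ⟨a₁, minpoly.aeval K a₁⟩
  have hmin := (minpoly.eq_of_irreducible_of_monic hirr ha'
    (minpoly.monic (IsIntegral.of_finite K a₁))).symm
  obtain ⟨z', Fa, Fz, haz', hFa, hFa', hFz, hFz', hdet'⟩ :=
    h.exists_transfer h' hfix hw hp0 hp haz₁ ha₁ hz₁ hdeg₁ hmin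
  obtain ⟨ρ₂, U₂, ν, b, h₂, hρ₂, hU₂, hb, hν, hshift, hX, hZ⟩ :=
    h'.exists_adapted hw H hH hp hp0 haz' hFa hFa' hFz hFz'
  obtain ⟨t, Y, ht0, htn, hY, hYd, hInt⟩ := h₂.exists_truncation hw hH hν
    (fun g hg => by rw [hU₂ g hg]; exact hshift g hg) hp0 hp haz' hb hX hZ (d := d)
    (by rw [hρ₂, hdet', hw₁, hd]) hg₀ (by rwa [hU₂ g₀ hg₀])
  obtain ⟨y, hy0, hy⟩ := h₂.exists_average hact hfix hw hP hH hsep hY hInt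
  have hpL : algebraMap K L p ≠ 0 := by rwa [_root_.map_ne_zero]
  obtain ⟨B, hB⟩ := h₂.split.exists_natDegree_minpoly_add hn y
  obtain ⟨M, hM⟩ := hw.exists_det_add hpL hp (ρ₂ y) (ρ₂ B) hy0
  obtain ⟨s, ⟨j, hj, rfl⟩, hs⟩ := hB _ (hw.infinite_pow hp0 hp M)
  have hyB : ρ₂ (y + p ^ j • B) = ρ₂ y + algebraMap K L p ^ j • ρ₂ B := by
    rw [_root_.map_add, _root_.map_smul, ← algebraMap_smul L, _root_.map_pow]
  obtain ⟨hy1, hy2⟩ := hM j hj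
  rw [← hyB] at hy1 hy2
  have hirr' : Irreducible (minpoly K (y + p ^ j • B)) :=
    minpoly.irreducible (IsIntegral.of_finite K _)
  obtain ⟨x, hx⟩ := (hroot _ hirr' hs).2 ⟨_, minpoly.aeval K _⟩
  have hmin' := (minpoly.eq_of_irreducible_of_monic hirr' hx
    (minpoly.monic (IsIntegral.of_finite K _))).symm
  have h1 := h.map_minpoly hfix (a := x) (by rw [hmin', hs, Fintype.card_fin])
  rw [hmin', h₂.map_minpoly hfix (by rw [hs, Fintype.card_fin])] at h1
  have h2 : (ρ x).det = (ρ₂ (y + p ^ j • B)).det := by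
    rw [Matrix.det_eq_sign_charpoly_coeff, Matrix.det_eq_sign_charpoly_coeff, h1]
  obtain ⟨e, he⟩ := hdvd x (by rwa [h2])
  rw [h2, hy2, hy] at he
  have h3 : (n : ℤ) * e = t := mul_right_cancel₀ (show d ≠ 0 by omega) (by rw [← hYd, he]; ring)
  have h4 : (n : ℤ) ∣ t := ⟨e, h3.symm⟩
  have h5 := Nat.le_of_dvd ht0 (Int.natCast_dvd_natCast.mp h4)
  omega

end GaloisAverage

section PrimeValuation

variable {R : Type*} {L : Type*} [CommRing R] [IsDomain R] [UniqueFactorizationMonoid R] [Field L]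
  [Algebra R L] [IsFractionRing R L]

open Classical in
/-- The valuation of the fraction field of a factorial ring attached to a prime element, with
value `0` at `0`. -/
noncomputable def primeVal (q : R) (x : L) : ℤ :=
  if x = 0 then 0 else (multiplicity q (IsLocalization.sec (nonZeroDivisors R) x).1 : ℤ) -
    multiplicity q ((IsLocalization.sec (nonZeroDivisors R) x).2 : R)

theorem multiplicity_mul_of_ne_zero {q : R} (hq : Prime q) {a b : R} (ha : a ≠ 0) (hb : b ≠ 0) :
    multiplicity q (a * b) = multiplicity q a + multiplicity q b :=
  multiplicity_mul hq (FiniteMultiplicity.of_prime_left hq (mul_ne_zero ha hb))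

theorem primeVal_div {q : R} (hq : Prime q) {a b : R} (ha : a ≠ 0) (hb : b ≠ 0) :
    primeVal q (algebraMap R L a / algebraMap R L b) =
      (multiplicity q a : ℤ) - multiplicity q b := by
  have hR := IsFractionRing.injective R L
  obtain ⟨x, hx⟩ : ∃ x, x = algebraMap R L a / algebraMap R L b := ⟨_, rfl⟩
  have hb' : algebraMap R L b ≠ 0 := by rwa [Ne, map_eq_zero_iff _ hR]
  have ha' : algebraMap R L a ≠ 0 := by rwa [Ne, map_eq_zero_iff _ hR]
  obtain ⟨s, hs⟩ : ∃ s, s = IsLocalization.sec (nonZeroDivisors R) x := ⟨_, rfl⟩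
  have h1 : x * algebraMap R L s.2 = algebraMap R L s.1 := by
    rw [hs]
    exact IsLocalization.sec_spec _ x
  have hs2 : (s.2 : R) ≠ 0 := nonZeroDivisors.ne_zero s.2.2
  have hs2' : algebraMap R L s.2 ≠ 0 := by rwa [Ne, map_eq_zero_iff _ hR]
  have h2 : a * s.2 = s.1 * b := by
    refine hR ?_
    rw [_root_.map_mul, _root_.map_mul, ← h1, hx]
    field_simp
  have hs1 : s.1 ≠ 0 := left_ne_zero_of_mul (h2 ▸ mul_ne_zero ha hs2)
  have h3 := congrArg (multiplicity q) h2
  rw [multiplicity_mul_of_ne_zero hq ha hs2, multiplicity_mul_of_ne_zero hq hs1 hb] at h3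
  rw [← hx, primeVal, if_neg (hx ▸ div_ne_zero ha' hb'), ← hs]
  omega

theorem primeVal_algebraMap {q : R} (hq : Prime q) {a : R} (ha : a ≠ 0) :
    primeVal q (algebraMap R L a) = (multiplicity q a : ℤ) := by
  have h := primeVal_div (L := L) hq ha one_ne_zero
  rw [_root_.map_one, div_one] at h
  rw [h, multiplicity_eq_zero.2 fun h => hq.not_isUnit (isUnit_of_dvd_one h), Nat.cast_zero,
    sub_zero]

omit [UniqueFactorizationMonoid R] in
theorem exists_div_ne_zero {x : L} (hx : x ≠ 0) :
    ∃ a b : R, a ≠ 0 ∧ b ≠ 0 ∧ algebraMap R L a / algebraMap R L b = x := by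
  obtain ⟨a, b, hb, rfl⟩ := IsFractionRing.div_surjective (A := R) x
  refine ⟨a, b, ?_, nonZeroDivisors.ne_zero hb, rfl⟩
  rintro rfl
  simp at hx

theorem isIntVal_primeVal {q : R} (hq : Prime q) : IsIntVal (primeVal q : L → ℤ) where
  map_mul x y hx hy := by
    obtain ⟨a, b, ha, hb, rfl⟩ := exists_div_ne_zero (R := R) hx
    obtain ⟨a', b', ha', hb', rfl⟩ := exists_div_ne_zero (R := R) hy
    rw [div_mul_div_comm, ← _root_.map_mul, ← _root_.map_mul,
      primeVal_div hq (mul_ne_zero ha ha') (mul_ne_zero hb hb'), primeVal_div hq ha hb,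
      primeVal_div hq ha' hb', multiplicity_mul_of_ne_zero hq ha ha',
      multiplicity_mul_of_ne_zero hq hb hb']
    omega
  map_add x y hx hy hxy := by
    obtain ⟨a, b, ha, hb, rfl⟩ := exists_div_ne_zero (R := R) hx
    obtain ⟨a', b', ha', hb', rfl⟩ := exists_div_ne_zero (R := R) hy
    have hR := IsFractionRing.injective R L
    have h0 : algebraMap R L b ≠ 0 := by rwa [Ne, map_eq_zero_iff _ hR]
    have h0' : algebraMap R L b' ≠ 0 := by rwa [Ne, map_eq_zero_iff _ hR]
    have h1 : algebraMap R L a / algebraMap R L b + algebraMap R L a' / algebraMap R L b' =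
        algebraMap R L (a * b' + b * a') / algebraMap R L (b * b') := by
      rw [div_add_div _ _ h0 h0']
      simp only [_root_.map_mul, _root_.map_add]
    rw [h1] at hxy ⊢
    have h2 : a * b' + b * a' ≠ 0 := by
      intro h
      simp [h] at hxy
    rw [primeVal_div hq ha hb, primeVal_div hq ha' hb', primeVal_div hq h2 (mul_ne_zero hb hb'),
      multiplicity_mul_of_ne_zero hq hb hb']
    obtain ⟨e, he⟩ : ∃ e, e = min (multiplicity q (a * b')) (multiplicity q (b * a')) := ⟨_, rfl⟩
    have h3 : q ^ e ∣ a * b' + b * a' := dvd_add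
      (pow_dvd_of_le_multiplicity (he ▸ min_le_left _ _))
      (pow_dvd_of_le_multiplicity (he ▸ min_le_right _ _))
    have h4 := (FiniteMultiplicity.of_prime_left hq h2).pow_dvd_iff_le_multiplicity.1 h3
    rw [multiplicity_mul_of_ne_zero hq ha hb', multiplicity_mul_of_ne_zero hq hb ha'] at he
    omega

omit [IsDomain R] [UniqueFactorizationMonoid R] in
theorem primeVal_congr {q q' : R} (h : Associated q q') :
    (primeVal q : L → ℤ) = primeVal q' := by
  funext x
  rw [primeVal, primeVal, multiplicity_eq_of_associated_left h,
    multiplicity_eq_of_associated_left h]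

theorem primeVal_self {q : R} (hq : Prime q) : primeVal q (algebraMap R L q) = 1 := by
  rw [primeVal_algebraMap hq hq.ne_zero, multiplicity_self, Nat.cast_one]

theorem primeVal_eq_zero {q a : R} (hq : Prime q) (ha : a ≠ 0) (h : ¬ q ∣ a) :
    primeVal q (algebraMap R L a) = 0 := by
  rw [primeVal_algebraMap hq ha, multiplicity_eq_zero.2 h, Nat.cast_zero]

theorem primeVal_prime_eq_zero {q q' : R} (hq : Prime q) (hq' : Prime q')
    (h : ¬ Associated q q') : primeVal q (algebraMap R L q') = 0 :=
  primeVal_eq_zero hq hq'.ne_zero fun h' => h (hq.associated_of_dvd hq' h')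

theorem primeVal_algebraMap_nonneg {q : R} (hq : Prime q) (a : R) :
    ValGE (primeVal q : L → ℤ) 0 (algebraMap R L a) := fun h => by
  rw [primeVal_algebraMap hq (by rintro rfl; simp at h)]
  exact Nat.cast_nonneg _

/-- An element without zeros and poles is a unit of the factorial ring. -/
theorem exists_isUnit_of_primeVal_eq_zero {x : L} (hx : x ≠ 0)
    (h : ∀ q : R, Prime q → primeVal q x = 0) : ∃ u : R, IsUnit u ∧ algebraMap R L u = x := by
  obtain ⟨a, b, hab, hb, rfl⟩ : ∃ a b : R, IsRelPrime a b ∧ b ≠ 0 ∧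
      algebraMap R L a / algebraMap R L b = x :=
    ⟨_, _, IsFractionRing.num_den_reduced R x, nonZeroDivisors.ne_zero (IsFractionRing.den R x).2,
      IsFractionRing.mk'_num_den' R x⟩
  have ha : a ≠ 0 := by
    rintro rfl
    simp at hx
  have key : ∀ q : R, Prime q → (q ∣ a ↔ q ∣ b) := fun q hq => by
    have h1 := h q hq
    rw [primeVal_div hq ha hb] at h1
    rw [← not_iff_not, ← multiplicity_eq_zero, ← multiplicity_eq_zero]
    omega
  have hua : IsUnit a := by
    by_contra hu
    obtain ⟨q, hq, hqa⟩ := WfDvdMonoid.exists_irreducible_factor hu ha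
    exact hq.not_isUnit (hab hqa ((key q hq.prime).1 hqa))
  have hub : IsUnit b := by
    by_contra hu
    obtain ⟨q, hq, hqb⟩ := WfDvdMonoid.exists_irreducible_factor hu hb
    exact hq.not_isUnit (hab ((key q hq.prime).2 hqb) hqb)
  obtain ⟨b, rfl⟩ := hub
  refine ⟨a * (b⁻¹ : Rˣ), hua.mul (b⁻¹ : Rˣ).isUnit, ?_⟩
  rw [eq_div_iff (by rwa [Ne, map_eq_zero_iff _ (IsFractionRing.injective R L)]),
    ← _root_.map_mul, mul_assoc, Units.inv_mul, mul_one]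

variable {K G : Type*} [Field K] [Algebra K L] [Group G] {act : G →* (L ≃ₐ[K] L)}
  {actR : G →* RingAut R}

theorem primeVal_act (hact : ∀ g p, act g (algebraMap R L p) = algebraMap R L (actR g p)) {q : R}
    (hq : Prime q) (g : G) (x : L) : primeVal q (act g x) = primeVal (actR g⁻¹ q) x := by
  by_cases hx : x = 0
  · rw [hx, _root_.map_zero, primeVal, primeVal, if_pos rfl, if_pos rfl]
  obtain ⟨a, b, ha, hb, rfl⟩ := exists_div_ne_zero (R := R) hx
  have h1 : ∀ a : R, multiplicity q (actR g a) = multiplicity (actR g⁻¹ q) a := fun a => by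
    rw [← multiplicity_map_eq (actR g⁻¹) (a := q), ← RingAut.mul_apply, ← _root_.map_mul,
      inv_mul_cancel, _root_.map_one, RingAut.one_apply]
  have hq' : Prime (actR g⁻¹ q) := (MulEquiv.prime_iff (actR g⁻¹)).2 hq
  have h0 : ∀ {a : R}, a ≠ 0 → actR g a ≠ 0 := fun ha => by
    rwa [Ne, EmbeddingLike.map_eq_zero_iff]
  rw [map_div₀, hact, hact, primeVal_div hq (h0 ha) (h0 hb), primeVal_div hq' ha hb, h1, h1]

end PrimeValuation

section Rescaling

variable {R : Type*} {L : Type*} [CommRing R] [IsDomain R] [UniqueFactorizationMonoid R] [Field L]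
  [Algebra R L] [IsFractionRing R L]
  {K G A : Type*} [Field K] [Algebra K L] [Group G] [Finite G] [Ring A] [Algebra K A]
  {act : G →* (L ≃ₐ[K] L)} {actR : G →* RingAut R}

/-- The decomposition group of an element: the stabilizer of the ideal it generates. -/
def stab (actR : G →* RingAut R) (q : R) : Subgroup G where
  carrier := {g | Associated (actR g q) q}
  one_mem' := by
    show Associated (actR 1 q) q
    rw [_root_.map_one]
    exact Associated.refl q
  mul_mem' {g h} hg hh := by
    show Associated (actR (g * h) q) q
    rw [_root_.map_mul]
    exact (hh.map (actR g)).trans hg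
  inv_mem' {g} hg := by
    have h := Associated.map (actR g⁻¹) hg
    rw [← RingAut.mul_apply, ← _root_.map_mul, inv_mul_cancel, _root_.map_one] at h
    exact h.symm

omit [IsDomain R] [UniqueFactorizationMonoid R] [Finite G] in
theorem mem_stab {q : R} {g : G} : g ∈ stab actR q ↔ Associated (actR g q) q := Iff.rfl

omit [IsDomain R] [UniqueFactorizationMonoid R] [Finite G] in
theorem associated_iff_mem_stab {q : R} {x y : G} :
    Associated (actR x q) (actR y q) ↔ x⁻¹ * y ∈ stab actR q := by
  have key : ∀ x g : G, actR (x * g) q = actR x (actR g q) := fun x g => by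
    rw [_root_.map_mul]
    rfl
  rw [mem_stab, key]
  refine ⟨fun h => ?_, fun h => ?_⟩
  · have := h.map (actR x⁻¹)
    rw [← key, inv_mul_cancel, _root_.map_one] at this
    exact this.symm
  · have := h.map (actR x)
    rw [← key, ← key, mul_inv_cancel_left] at this
    exact this.symm

omit [Finite G] [UniqueFactorizationMonoid R] [IsDomain R] in
theorem prime_act {q : R} (hq : Prime q) (g : G) : Prime (actR g q) :=
  (MulEquiv.prime_iff (actR g)).2 hq

omit [Finite G] [UniqueFactorizationMonoid R] [IsDomain R] in
theorem out_mul_mem_stab {q : R} (x : G) :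
    x⁻¹ * (QuotientGroup.mk x : G ⧸ stab actR q).out ∈ stab actR q := by
  obtain ⟨η, hη⟩ := QuotientGroup.mk_out_eq_mul (stab actR q) x
  rw [hη, inv_mul_cancel_left]
  exact η.2

/-- Existence of an element with prescribed valuations along the orbit of a prime. -/
theorem exists_orbit_element {q : R} (hq : Prime q) (f : G → ℤ)
    (hf : ∀ x η, η ∈ stab actR q → f (x * η) = f x) :
    ∃ r : L, r ≠ 0 ∧ (∀ x, primeVal (actR x q) r = f x) ∧
      ∀ q' : R, Prime q' → (∀ x, ¬ Associated q' (actR x q)) → primeVal q' r = 0 := by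
  classical
  cases nonempty_fintype (G ⧸ stab actR q)
  have hne : ∀ x : G, algebraMap R L (actR x q) ≠ 0 := fun x => by
    rw [Ne, map_eq_zero_iff _ (IsFractionRing.injective R L)]
    exact (prime_act hq x).ne_zero
  have hne' : ∀ X : G ⧸ stab actR q, algebraMap R L (actR X.out q) ^ f X.out ≠ 0 :=
    fun X => zpow_ne_zero _ (hne _)
  refine ⟨∏ X : G ⧸ stab actR q, algebraMap R L (actR X.out q) ^ f X.out,
    Finset.prod_ne_zero_iff.2 fun X _ => hne' X, fun x => ?_, fun q' hq' h => ?_⟩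
  · have hv := isIntVal_primeVal (L := L) (prime_act (actR := actR) hq x)
    rw [hv.map_prod _ _ fun X _ => hne' X, Finset.sum_eq_single (QuotientGroup.mk x)]
    · have h1 := out_mul_mem_stab (actR := actR) (q := q) x
      rw [hv.map_zpow (hne _), primeVal_congr (associated_iff_mem_stab.2 h1),
        primeVal_self (prime_act hq _), mul_one, ← hf x _ h1, mul_inv_cancel_left]
    · intro X _ hX
      rw [hv.map_zpow (hne _), primeVal_prime_eq_zero (prime_act hq x) (prime_act hq _), mul_zero]
      intro h
      have h1 := QuotientGroup.eq.2 (associated_iff_mem_stab.1 h)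
      rw [QuotientGroup.out_eq'] at h1
      exact hX h1.symm
    · exact fun h => absurd (Finset.mem_univ _) h
  · have hv := isIntVal_primeVal (L := L) hq'
    rw [hv.map_prod _ _ fun X _ => hne' X]
    refine Finset.sum_eq_zero fun X _ => ?_
    rw [hv.map_zpow (hne _), primeVal_prime_eq_zero hq' (prime_act hq _) (h _), mul_zero]

variable {n : ℕ} [NeZero n] {ρ : A →ₐ[K] Matrix (Fin n) (Fin n) L}
  {U : G → Matrix (Fin n) (Fin n) L} {c : G → G → L}

/-- A cocycle unramified on the decomposition group of a prime can be made integral along the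
whole orbit of the prime. -/
theorem IsForm.exists_rescale_orbit
    (hact : ∀ g p, act g (algebraMap R L p) = algebraMap R L (actR g p))
    (h : IsForm act ρ U c) {q : R} (hq : Prime q)
    (hloc : ∀ g ∈ stab actR q, (n : ℤ) ∣ primeVal q (U g).det) :
    ∃ U' c', IsForm act ρ U' c' ∧ (∀ x σ τ, primeVal (actR x q) (c' σ τ) = 0) ∧
      ∀ q' : R, Prime q' → (∀ x, ¬ Associated q' (actR x q)) →
        ∀ σ τ, primeVal q' (c' σ τ) = primeVal q' (c σ τ) := by
  have hn : (n : ℤ) ≠ 0 := Nat.cast_ne_zero.2 (NeZero.ne n)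
  have hv : ∀ x, IsIntVal (primeVal (actR x q) : L → ℤ) := fun x =>
    isIntVal_primeVal (prime_act hq x)
  have hcoc : ∀ {V : G → Matrix (Fin n) (Fin n) L} {e : G → G → L}, IsForm act ρ V e →
      ∀ x σ τ, primeVal (actR x q) (V σ).det + primeVal (actR (σ⁻¹ * x) q) (V τ).det =
        n * primeVal (actR x q) (e σ τ) + primeVal (actR x q) (V (σ * τ)).det := by
    intro V e hV x σ τ
    have h1 := congrArg (primeVal (actR x q)) (hV.det_coc σ τ)
    have h2 : act σ (V τ).det ≠ 0 := by
      rw [_root_.map_ne_zero]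
      exact hV.det_ne_zero τ
    rw [(hv x).map_mul _ _ (hV.det_ne_zero σ) h2,
      (hv x).map_mul _ _ (pow_ne_zero _ (hV.coc_ne_zero σ τ)) (hV.det_ne_zero _),
      (hv x).map_pow (hV.coc_ne_zero σ τ), Fintype.card_fin,
      primeVal_act hact (prime_act hq x)] at h1
    rw [_root_.map_mul]
    exact h1
  have hst : ∀ x η, η ∈ stab actR q → (primeVal (actR (x * η) q) : L → ℤ) = primeVal (actR x q) :=
    fun x η hη => primeVal_congr (associated_iff_mem_stab.2 (by
      rw [mul_inv_rev, mul_assoc, inv_mul_cancel, mul_one]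
      exact inv_mem hη))
  obtain ⟨β, hβ⟩ : ∃ β : G → ℤ, β = fun x => primeVal (actR x q) (U x).det % n := ⟨_, rfl⟩
  have hβ' : ∀ x, (n : ℤ) ∣ primeVal (actR x q) (U x).det - β x := fun x => by
    rw [hβ]
    exact Int.dvd_self_sub_emod
  have hβst : ∀ x η, η ∈ stab actR q → β (x * η) = β x := fun x η hη => by
    rw [hβ]
    dsimp only
    rw [hst x η hη]
    have h1 := hcoc h x x η
    rw [inv_mul_cancel, _root_.map_one, RingAut.one_apply] at h1
    obtain ⟨e, he⟩ := hloc η hη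
    refine Int.emod_eq_emod_iff_emod_sub_eq_zero.2 ?_
    refine Int.emod_eq_zero_of_dvd ⟨e - primeVal (actR x q) (c x η), ?_⟩
    linear_combination he - h1
  have hα : ∀ σ x, ∃ e : ℤ, primeVal (actR x q) (U σ).det + β (σ⁻¹ * x) - β x = n * e := by
    intro σ x
    obtain ⟨e₁, h₁⟩ := hβ' x
    obtain ⟨e₂, h₂⟩ := hβ' (σ⁻¹ * x)
    have h3 := hcoc h x σ (σ⁻¹ * x)
    rw [mul_inv_cancel_left] at h3
    exact ⟨e₁ - e₂ + primeVal (actR x q) (c σ (σ⁻¹ * x)), by linear_combination h₁ - h₂ + h3⟩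
  choose α hα using hα
  have hαst : ∀ σ x η, η ∈ stab actR q → -α σ (x * η) = -α σ x := fun σ x η hη => by
    have h1 := hα σ (x * η)
    rw [hst x η hη, hβst x η hη, ← mul_assoc, hβst _ η hη, hα] at h1
    rw [mul_left_cancel₀ hn h1]
  choose r hr0 hr hr' using fun σ => exists_orbit_element (L := L) hq (fun x => -α σ x) (hαst σ)
  refine ⟨_, _, h.rescale r hr0, fun x σ τ => ?_, fun q' hq' hq'' σ τ => ?_⟩
  · have key : ∀ x σ, primeVal (actR x q) (r σ • U σ).det = β x - β (σ⁻¹ * x) := fun x σ => by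
      rw [Matrix.det_smul, (hv x).map_mul _ _ (pow_ne_zero _ (hr0 σ)) (h.det_ne_zero σ),
        (hv x).map_pow (hr0 σ), Fintype.card_fin, hr]
      linear_combination hα σ x
    have h1 := hcoc (h.rescale r hr0) x σ τ
    rw [key, key, key, mul_inv_rev, mul_assoc τ⁻¹, add_comm] at h1
    refine (mul_eq_zero.1 (?_ : (n : ℤ) * _ = 0)).resolve_left hn
    linear_combination -h1
  · have hv' := isIntVal_primeVal (L := L) hq'
    have h1 : primeVal q' (act σ (r τ)) = 0 := by
      rw [primeVal_act hact hq']
      refine hr' τ _ (prime_act hq' _) fun x hx => hq'' (σ * x) ?_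
      have h2 := hx.map (actR σ)
      rw [← RingAut.mul_apply, ← RingAut.mul_apply, ← _root_.map_mul, ← _root_.map_mul,
        mul_inv_cancel, _root_.map_one] at h2
      exact h2
    have h0 : act σ (r τ) ≠ 0 := by
      rw [_root_.map_ne_zero]
      exact hr0 τ
    have hc := h.coc_ne_zero σ τ
    rw [hv'.map_mul _ _ (mul_ne_zero (mul_ne_zero (hr0 σ) h0) (inv_ne_zero (hr0 _))) hc,
      hv'.map_mul _ _ (mul_ne_zero (hr0 σ) h0) (inv_ne_zero (hr0 _)),
      hv'.map_mul _ _ (hr0 σ) h0, h1, hv'.map_inv (hr0 _), hr' σ _ hq' hq'', hr' _ _ hq' hq'']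
    omega

/-- A cocycle unramified at all primes is cohomologous to one with unit values. -/
theorem IsForm.exists_unit_cocycle
    (hact : ∀ g p, act g (algebraMap R L p) = algebraMap R L (actR g p))
    (h : IsForm act ρ U c)
    (hloc : ∀ (U : G → Matrix (Fin n) (Fin n) L) (c : G → G → L), IsForm act ρ U c →
      ∀ q : R, Prime q → ∀ g ∈ stab actR q, (n : ℤ) ∣ primeVal q (U g).det) :
    ∃ (U' : G → Matrix (Fin n) (Fin n) L) (c' : G → G → R), (∀ σ τ, IsUnit (c' σ τ)) ∧
      IsForm act ρ U' fun σ τ => algebraMap R L (c' σ τ) := by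
  classical
  cases nonempty_fintype G
  have key : ∀ F : R, F ≠ 0 → ∀ (U : G → Matrix (Fin n) (Fin n) L) (c : G → G → L),
      IsForm act ρ U c →
      (∀ q : R, Prime q → (∃ σ τ, primeVal q (c σ τ) ≠ 0) → q ∣ F) →
      ∃ U' c', IsForm act ρ U' c' ∧ ∀ q : R, Prime q → ∀ σ τ, primeVal q (c' σ τ) = 0 := by
    intro F
    induction F using UniqueFactorizationMonoid.induction_on_prime with
    | h₁ => exact fun h => absurd rfl h
    | h₂ u hu =>
      intro _ U c h hF
      refine ⟨U, c, h, fun q hq σ τ => ?_⟩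
      by_contra h0
      exact hq.not_isUnit (isUnit_of_dvd_unit (hF q hq ⟨σ, τ, h0⟩) hu)
    | h₃ F p hF0 hp ih =>
      intro _ U c h hF
      obtain ⟨U', c', h', hc', hc''⟩ := h.exists_rescale_orbit hact hp (hloc U c h p hp)
      refine ih hF0 U' c' h' fun q hq ⟨σ, τ, h0⟩ => ?_
      have h1 : ∀ x, ¬ Associated q (actR x p) := fun x hx => h0 (by rw [primeVal_congr hx, hc'])
      rw [hc'' q hq h1] at h0
      refine (hq.dvd_or_dvd (hF q hq ⟨σ, τ, h0⟩)).resolve_left fun h2 => h1 1 ?_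
      rw [_root_.map_one]
      exact hq.associated_of_dvd hp h2
  choose a b ha hb hab using fun s : G × G =>
    exists_div_ne_zero (R := R) (h.coc_ne_zero s.1 s.2)
  obtain ⟨U', c', h', hc'⟩ := key (∏ s, a s * b s)
    (Finset.prod_ne_zero_iff.2 fun s _ => mul_ne_zero (ha s) (hb s)) U c h
    fun q hq ⟨σ, τ, h0⟩ => by
      refine dvd_trans ?_ (Finset.dvd_prod_of_mem _ (Finset.mem_univ (σ, τ)))
      by_contra hd
      have h1 : ¬ q ∣ a (σ, τ) := fun h => hd (h.mul_right _)
      have h2 : ¬ q ∣ b (σ, τ) := fun h => hd (h.mul_left _)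
      refine h0 ?_
      rw [← hab (σ, τ), primeVal_div hq (ha _) (hb _), multiplicity_eq_zero.2 h1,
        multiplicity_eq_zero.2 h2, sub_self]
  choose u hu hu' using fun σ τ =>
    exists_isUnit_of_primeVal_eq_zero (h'.coc_ne_zero σ τ) fun q hq => hc' q hq σ τ
  refine ⟨U', u, hu, ?_⟩
  simp only [hu']
  exact h'

end Rescaling

section ConstantCocycle

universe u

/-- The Galois action on polynomials through the coefficients. -/
noncomputable def galMv (k P : Type*) [Field k] [Field P] [Algebra k P] (m : ℕ) :
    (P ≃ₐ[k] P) →* RingAut (MvPolynomial (Fin m) P) where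
  toFun g := MvPolynomial.mapEquiv (Fin m) (g : P ≃+* P)
  map_one' := RingEquiv.ext fun p => MvPolynomial.map_id p
  map_mul' g h := RingEquiv.ext fun p => (MvPolynomial.map_map (h : P →+* P) (g : P →+* P) p).symm

variable {k P K L : Type u} [Field k] [Field P] [Algebra k P] [FiniteDimensional k P] {m : ℕ}
  [Field K] [Field L] [Algebra (MvPolynomial (Fin m) P) L]
  [IsFractionRing (MvPolynomial (Fin m) P) L] [Algebra P L]
  [IsScalarTower P (MvPolynomial (Fin m) P) L] [Algebra K L] {act : (P ≃ₐ[k] P) →* (L ≃ₐ[K] L)}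

omit [IsFractionRing (MvPolynomial (Fin m) P) L] in
theorem exists_algebraMap_eq_of_isUnit {u : MvPolynomial (Fin m) P} (hu : IsUnit u) :
    ∃ y : P, y ≠ 0 ∧ algebraMap P L y = algebraMap _ L u := by
  obtain ⟨y, hy, rfl⟩ := (MvPolynomial.isUnit_iff_eq_C_of_isReduced).1 hu
  exact ⟨y, hy.ne_zero, IsScalarTower.algebraMap_apply P (MvPolynomial (Fin m) P) L y⟩

theorem primeVal_const {q : MvPolynomial (Fin m) P} (hq : Prime q) (x : P) :
    ValGE (primeVal q : L → ℤ) 0 (algebraMap P L x) := by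
  rw [IsScalarTower.algebraMap_apply P (MvPolynomial (Fin m) P) L]
  exact primeVal_algebraMap_nonneg hq _

theorem primeVal_const_eq {q : MvPolynomial (Fin m) P} (hq : Prime q) {x : P} (hx : x ≠ 0) :
    primeVal q (algebraMap P L x) = 0 := by
  have h1 := primeVal_const (L := L) hq x (by rwa [_root_.map_ne_zero])
  have h2 := primeVal_const (L := L) hq x⁻¹ (by rw [_root_.map_ne_zero]; exact inv_ne_zero hx)
  rw [map_inv₀, (isIntVal_primeVal hq).map_inv (by rwa [_root_.map_ne_zero])] at h2
  omega

/-- The valuations attached to primes of the constant extension are unramified. -/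
theorem exists_uniformizer
    (hact : ∀ g p, act g (algebraMap _ L p) = algebraMap _ L (galMv k P m g p))
    (hactP : ∀ g x, act g (algebraMap P L x) = algebraMap P L (g x))
    (hfix : ∀ l : L, (∀ s, act s l = l) → ∃ x : K, algebraMap K L x = l)
    {q : MvPolynomial (Fin m) P} (hq : Prime q) :
    ∃ p : K, p ≠ 0 ∧ primeVal q (algebraMap K L p) = 1 := by
  obtain ⟨r, hr0, hr, hr'⟩ := exists_orbit_element (L := L) (actR := galMv k P m) hq (fun _ => 1)
    fun _ _ _ => rfl
  have hu : ∀ g, ∃ y : P, y ≠ 0 ∧ algebraMap P L y = act g r / r := fun g => by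
    have hg0 : act g r ≠ 0 := by rwa [_root_.map_ne_zero]
    obtain ⟨u, hu, hu'⟩ := exists_isUnit_of_primeVal_eq_zero (R := MvPolynomial (Fin m) P)
      (div_ne_zero hg0 hr0) fun q' hq' => by
        have hv := isIntVal_primeVal (L := L) hq'
        have hkey : primeVal (galMv k P m g⁻¹ q') r = primeVal q' r := by
          by_cases hx : ∃ x, Associated q' (galMv k P m x q)
          · obtain ⟨x, hx⟩ := hx
            have h1 := hx.map (galMv k P m g⁻¹)
            rw [← RingAut.mul_apply, ← _root_.map_mul] at h1
            rw [primeVal_congr hx, hr, primeVal_congr h1, hr]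
          · push Not at hx
            rw [hr' q' hq' hx, hr' _ (prime_act hq' _)]
            intro x h1
            have h2 := h1.map (galMv k P m g)
            rw [← RingAut.mul_apply, ← RingAut.mul_apply, ← _root_.map_mul, ← _root_.map_mul,
              mul_inv_cancel, _root_.map_one] at h2
            exact hx _ h2
        rw [div_eq_mul_inv, hv.map_mul _ _ hg0 (inv_ne_zero hr0), hv.map_inv hr0,
          primeVal_act hact hq', hkey, add_neg_cancel]
    rw [← hu']
    exact exists_algebraMap_eq_of_isUnit hu
  choose y hy0 hy using hu
  obtain ⟨β, hβ⟩ := groupCohomology.isMulCoboundary₁_of_isMulCocycle₁_of_aut_to_units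
    (K := k) (L := P) (fun g => Units.mk0 (y g) (hy0 g)) fun g h => by
      refine Units.ext ((algebraMap P L).injective ?_)
      show algebraMap P L (y (g * h)) = algebraMap P L (g (y h) * y g)
      have hg0 : act g r ≠ 0 := by rwa [_root_.map_ne_zero]
      rw [_root_.map_mul, ← hactP, hy, hy, hy, map_div₀, _root_.map_mul, AlgEquiv.mul_apply]
      field_simp
  have hβ' : ∀ g, g (β : P) = y g * β := fun g => by
    have h1 := congrArg (fun u : Pˣ => (u : P)) (hβ g)
    rw [Units.val_div_eq_div_val, div_eq_iff β.ne_zero] at h1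
    exact h1
  have hβ0 : algebraMap P L β ≠ 0 := by
    rw [_root_.map_ne_zero]
    exact β.ne_zero
  obtain ⟨p, hp⟩ := hfix (r / algebraMap P L β) fun g => by
    have hy' : algebraMap P L (y g) ≠ 0 := by
      rw [_root_.map_ne_zero]
      exact hy0 g
    have h1 : act g r = algebraMap P L (y g) * r := by
      rw [hy, div_mul_cancel₀ _ hr0]
    rw [map_div₀, hactP, hβ', _root_.map_mul, h1, mul_div_mul_left _ _ hy']
  have hv := isIntVal_primeVal (L := L) hq
  refine ⟨p, ?_, ?_⟩
  · rintro rfl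
    rw [_root_.map_zero] at hp
    exact div_ne_zero hr0 hβ0 hp.symm
  · have h1 := hr 1
    rw [_root_.map_one, RingAut.one_apply] at h1
    rw [hp, div_eq_mul_inv, hv.map_mul _ _ hr0 (inv_ne_zero hβ0), hv.map_inv hβ0,
      primeVal_const_eq hq β.ne_zero, h1, neg_zero, add_zero]

omit [FiniteDimensional k P] [Algebra P L] [IsScalarTower P (MvPolynomial (Fin m) P) L] in
/-- The conjugates of a prime valuation outside the decomposition group can be separated from it. -/
theorem exists_separating [Finite (P ≃ₐ[k] P)]
    (hact : ∀ g p, act g (algebraMap _ L p) = algebraMap _ L (galMv k P m g p))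
    {q : MvPolynomial (Fin m) P} (hq : Prime q) (C : ℤ) :
    ∃ S : L, S ≠ 0 ∧ primeVal q S = 0 ∧ ∀ g ∉ stab (galMv k P m) q, C ≤ primeVal q (act g S) := by
  classical
  obtain ⟨r, hr0, hr, -⟩ := exists_orbit_element (L := L) (actR := galMv k P m) hq
    (fun x => if x ∈ stab (galMv k P m) q then 0 else C) fun x η hη => by
      rw [Subgroup.mul_mem_cancel_right _ hη]
  refine ⟨r, hr0, ?_, fun g hg => ?_⟩
  · have h1 := hr 1
    rw [_root_.map_one, RingAut.one_apply, if_pos (one_mem _)] at h1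
    exact h1
  · rw [primeVal_act hact hq, hr, if_neg (by rwa [inv_mem_iff])]

variable {D A : Type u} [Ring D] [Algebra k D] [Ring A] [Algebra K A]
  [Algebra (MvPolynomial (Fin m) k) K] [IsFractionRing (MvPolynomial (Fin m) k) K]
  [Algebra k K] [IsScalarTower k (MvPolynomial (Fin m) k) K]
  [Algebra k L] [IsScalarTower k K L] [IsScalarTower k P L]

/-- A form with the same subfields as a constant division algebra has a constant cocycle. -/
theorem exists_constant_cocycle [Infinite k] [IsDomain D] [Module.Finite k D] [IsDomain A]
    (hD : ∀ x : D, x ≠ 0 → IsUnit x) (hcenter : Subalgebra.center k D = ⊥)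
    (hact : ∀ g p, act g (algebraMap _ L p) = algebraMap _ L (galMv k P m g p))
    (hfix : ∀ l : L, (∀ s, act s l = l) → ∃ x : K, algebraMap K L x = l) {n : ℕ} [NeZero n]
    {ρ : D →ₐ[k] Matrix (Fin n) (Fin n) P} {U : (P ≃ₐ[k] P) → Matrix (Fin n) (Fin n) P}
    {c : (P ≃ₐ[k] P) → (P ≃ₐ[k] P) → P} (h : IsForm (MonoidHom.id (P ≃ₐ[k] P)) ρ U c)
    {ρ' : A →ₐ[K] Matrix (Fin n) (Fin n) L} {U' : (P ≃ₐ[k] P) → Matrix (Fin n) (Fin n) L}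
    {c' : (P ≃ₐ[k] P) → (P ≃ₐ[k] P) → L} (h' : IsForm act ρ' U' c')
    (hroot : ∀ f : K[X], Irreducible f → f.natDegree = n →
      ((∃ x : K ⊗[k] D, aeval x f = 0) ↔ ∃ x : A, aeval x f = 0)) :
    ∃ (U'' : (P ≃ₐ[k] P) → Matrix (Fin n) (Fin n) L) (c'' : (P ≃ₐ[k] P) → (P ≃ₐ[k] P) → P),
      IsForm act ρ' U'' fun σ τ => algebraMap P L (c'' σ τ) := by
  have hactP : ∀ g x, act g (algebraMap P L x) = algebraMap P L (g x) := fun g x => by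
    rw [IsScalarTower.algebraMap_apply P (MvPolynomial (Fin m) P) L, hact,
      IsScalarTower.algebraMap_apply P (MvPolynomial (Fin m) P) L]
    exact congrArg _ (MvPolynomial.map_C _ x)
  have : Infinite K := Infinite.of_injective _ (algebraMap k K).injective
  have : IsDomain (K ⊗[k] D) := isDomain_tensorProduct (Fin m)
  have h₁ := h.baseChange (K := K) (L := L) (act := act) hactP
  obtain ⟨V, u, hu, hV⟩ := h'.exists_unit_cocycle hact fun V e hV q hq g hg => by
    have hw := isIntVal_primeVal (L := L) hq
    obtain ⟨p, hp0, hp⟩ := exists_uniformizer hact hactP hfix hq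
    obtain ⟨d, a, z, hd0, haz, ha, hz, hdet, hd, hdvd⟩ :=
      exists_approx_idempotent_tensorProduct hw (NeZero.pos n) hD hcenter hp0 hp (fun x => by
        rw [← IsScalarTower.algebraMap_apply, IsScalarTower.algebraMap_apply k P L]
        exact primeVal_const hq _) (baseChangeRep K (L := L) ρ) fun d i j => by
          rw [baseChangeRep_tmul, one_smul]
          exact primeVal_const hq _
    refine h₁.dvd_det_of_approx_idempotent hactP hfix hV hroot hw (primeVal_const hq)
      (H := stab (galMv k P m) q) (fun g hg l => ?_) (exists_separating hact hq) hp0 hp hd0 haz ha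
      hz hdet hd hdvd hg
    rw [primeVal_act hact hq, primeVal_congr (mem_stab.1 (inv_mem hg))]
  choose y _ hy using fun σ τ => exists_algebraMap_eq_of_isUnit (L := L) (hu σ τ)
  refine ⟨V, y, ?_⟩
  simp only [hy]
  exact hV

end ConstantCocycle

section ConstantExtension

theorem exists_map_eq_of_galMv_eq {k P : Type*} [Field k] [Field P] [Algebra k P]
    [FiniteDimensional k P] [IsGalois k P] {m : ℕ} {p : MvPolynomial (Fin m) P}
    (hp : ∀ g, galMv k P m g p = p) :
    ∃ q : MvPolynomial (Fin m) k, MvPolynomial.map (algebraMap k P) q = p := by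
  refine MvPolynomial.mem_range_map_iff_coeffs_subset.2 fun x hx => ?_
  obtain ⟨d, -, rfl⟩ := MvPolynomial.mem_coeffs_iff.1 hx
  refine (IsGalois.mem_range_algebraMap_iff_fixed _).2 fun g => ?_
  have h1 := congrArg (MvPolynomial.coeff d) (hp g)
  rwa [show galMv k P m g p = MvPolynomial.map (g : P →+* P) p from rfl,
    MvPolynomial.coeff_map] at h1

variable {k P K : Type} [Field k] [Field P] [Algebra k P] [FiniteDimensional k P] [IsGalois k P]
  {m : ℕ} [Field K] [Algebra (MvPolynomial (Fin m) k) K]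
  [IsFractionRing (MvPolynomial (Fin m) k) K] [Algebra k K]
  [IsScalarTower k (MvPolynomial (Fin m) k) K]

/-- An element of the rational function field over `P` that is fixed by the Galois group of `P/k`
is a quotient of polynomials over `k`. -/
theorem exists_eq_div_of_galois_fixed {L : Type*} [Field L] [Algebra (MvPolynomial (Fin m) P) L]
    [IsFractionRing (MvPolynomial (Fin m) P) L] {act : (P ≃ₐ[k] P) → L →+* L}
    (hact : ∀ g p, act g (algebraMap _ L p) = algebraMap _ L (galMv k P m g p)) {l : L}
    (hl : ∀ g, act g l = l) : ∃ p q : MvPolynomial (Fin m) k,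
      l = algebraMap _ L (MvPolynomial.map (algebraMap k P) p) /
        algebraMap _ L (MvPolynomial.map (algebraMap k P) q) := by
  classical
  obtain ⟨a, b, hb, rfl⟩ := IsFractionRing.div_surjective (A := MvPolynomial (Fin m) P) l
  have hb0 : b ≠ 0 := nonZeroDivisors.ne_zero hb
  obtain ⟨N, hN⟩ : ∃ N, N = ∏ g, galMv k P m g b := ⟨_, rfl⟩
  have hN0 : N ≠ 0 := by
    rw [hN, Finset.prod_ne_zero_iff]
    exact fun g _ => by rwa [_root_.map_ne_zero_iff _ (galMv k P m g).injective]
  have hNinv : ∀ g, galMv k P m g N = N := fun g => by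
    rw [hN, map_prod]
    refine Fintype.prod_equiv (Equiv.mulLeft g) _ _ fun x => ?_
    rw [Equiv.coe_mulLeft, _root_.map_mul, RingAut.mul_apply]
  obtain ⟨b', hb'⟩ : b ∣ N := by
    have h1 := Finset.dvd_prod_of_mem (fun g => galMv k P m g b) (Finset.mem_univ 1)
    rwa [← hN, _root_.map_one] at h1
  have hinj : Function.Injective (algebraMap (MvPolynomial (Fin m) P) L) :=
    IsFractionRing.injective _ _
  have hbL : algebraMap _ L b ≠ 0 := by rwa [_root_.map_ne_zero_iff _ hinj]
  have hNL : algebraMap _ L N ≠ 0 := by rwa [_root_.map_ne_zero_iff _ hinj]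
  have hlN : algebraMap _ L a / algebraMap _ L b = algebraMap _ L (a * b') / algebraMap _ L N := by
    rw [div_eq_div_iff hbL hNL, hb', _root_.map_mul, _root_.map_mul]
    ring
  obtain ⟨q, hq⟩ := exists_map_eq_of_galMv_eq hNinv
  obtain ⟨p, hp⟩ := exists_map_eq_of_galMv_eq (p := a * b') fun g => by
    have h1 := hl g
    rw [hlN, map_div₀, hact, hact, hNinv, div_left_inj' hNL] at h1
    exact hinj h1
  exact ⟨p, q, by rw [hlN, hp, hq]⟩

variable (k P m K) in
/-- The rational function field over a finite Galois extension `P` of `k`, as an extension of the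
rational function field over `k`, with its Galois action. -/
theorem exists_constant_extension :
    ∃ (L : Type) (_ : Field L) (_ : Algebra (MvPolynomial (Fin m) P) L)
      (_ : IsFractionRing (MvPolynomial (Fin m) P) L) (_ : Algebra P L)
      (_ : IsScalarTower P (MvPolynomial (Fin m) P) L) (_ : Algebra K L) (_ : Algebra k L)
      (_ : IsScalarTower k K L) (_ : IsScalarTower k P L) (act : (P ≃ₐ[k] P) →* (L ≃ₐ[K] L)),
      (∀ p : MvPolynomial (Fin m) k,
        algebraMap K L (algebraMap (MvPolynomial (Fin m) k) K p) =
          algebraMap (MvPolynomial (Fin m) P) L (MvPolynomial.map (algebraMap k P) p)) ∧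
      (∀ g p, act g (algebraMap _ L p) = algebraMap _ L (galMv k P m g p)) ∧
      (∀ l : L, (∀ g, act g l = l) → ∃ x : K, algebraMap K L x = l) := by
  have hinj : Function.Injective ((algebraMap (MvPolynomial (Fin m) P)
      (FractionRing (MvPolynomial (Fin m) P))).comp
        (MvPolynomial.map (σ := Fin m) (algebraMap k P))) :=
    (IsFractionRing.injective _ _).comp (MvPolynomial.map_injective _ (algebraMap k P).injective)
  let _ : Algebra K (FractionRing (MvPolynomial (Fin m) P)) := (IsFractionRing.lift hinj).toAlgebra
  have hKL : ∀ p : MvPolynomial (Fin m) k,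
      algebraMap K (FractionRing (MvPolynomial (Fin m) P))
          (algebraMap (MvPolynomial (Fin m) k) K p) =
        algebraMap (MvPolynomial (Fin m) P) _ (MvPolynomial.map (algebraMap k P) p) :=
    fun p => IsFractionRing.lift_algebraMap hinj p
  obtain ⟨Φ, hact⟩ : ∃ Φ : (P ≃ₐ[k] P) →* RingAut (FractionRing (MvPolynomial (Fin m) P)),
      ∀ g p, Φ g (algebraMap _ _ p) = algebraMap _ _ (galMv k P m g p) :=
    ⟨(IsFractionRing.ringEquivOfRingEquivHom _ _).comp (galMv k P m),
      fun g p => IsFractionRing.ringEquivOfRingEquiv_algebraMap _ _⟩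
  have hmap : ∀ (g : P ≃ₐ[k] P) (p : MvPolynomial (Fin m) k),
      galMv k P m g (MvPolynomial.map (algebraMap k P) p) =
        MvPolynomial.map (algebraMap k P) p := fun g p => by
    refine (MvPolynomial.map_map _ _ p).trans (congrArg (fun f => MvPolynomial.map f p) ?_)
    exact RingHom.ext fun x => g.commutes x
  have hcomm : ∀ g x, Φ g (algebraMap K _ x) = algebraMap K _ x := fun g x => by
    obtain ⟨p, q, -, rfl⟩ := IsFractionRing.div_surjective (A := MvPolynomial (Fin m) k) x
    rw [map_div₀, map_div₀, hKL, hKL, hact, hact, hmap, hmap]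
  refine ⟨FractionRing (MvPolynomial (Fin m) P), inferInstance, inferInstance, inferInstance,
    inferInstance, inferInstance, inferInstance, inferInstance,
    IsScalarTower.of_algebraMap_eq fun x => ?_, IsScalarTower.of_algebraMap_eq fun x => ?_,
    { toFun g := AlgEquiv.ofRingEquiv (f := Φ g) (hcomm g)
      map_one' := AlgEquiv.ext fun x => RingEquiv.congr_fun (_root_.map_one Φ) x
      map_mul' g h := AlgEquiv.ext fun x => RingEquiv.congr_fun (_root_.map_mul Φ g h) x },
    hKL, hact, fun l hl => ?_⟩
  · rw [IsScalarTower.algebraMap_apply k (MvPolynomial (Fin m) k) K, hKL,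
      MvPolynomial.algebraMap_eq, MvPolynomial.map_C, ← MvPolynomial.algebraMap_eq,
      ← IsScalarTower.algebraMap_apply, ← IsScalarTower.algebraMap_apply]
  · rw [← IsScalarTower.algebraMap_apply]
  · obtain ⟨p, q, rfl⟩ := exists_eq_div_of_galois_fixed (act := fun g =>
      (Φ g : FractionRing (MvPolynomial (Fin m) P) →+* _)) hact hl
    exact ⟨algebraMap _ K p / algebraMap _ K q, by rw [map_div₀, hKL, hKL]⟩

end ConstantExtension

section BrauerClass

/-- Base change commutes with the formation of matrix algebras. -/
theorem nonempty_tensorProduct_matrix_algEquiv {k K D ι : Type*} [Field k] [Field K] [Algebra k K]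
    [Ring D] [Algebra k D] [Fintype ι] [DecidableEq ι] :
    Nonempty (K ⊗[k] Matrix ι ι D ≃ₐ[K] Matrix (Unit × ι) (Unit × ι) (K ⊗[k] D)) :=
  ⟨(Algebra.TensorProduct.congr (Matrix.uniqueAlgEquiv (m := Unit) (R := K) (A := K)).symm
    (AlgEquiv.refl (R := k))).trans (Matrix.kroneckerTMulAlgEquiv Unit ι k K K D)⟩

theorem center_eq_bot_of_matrix {k D ι : Type*} [Field k] [Ring D] [Algebra k D] [Fintype ι]
    [DecidableEq ι] [Nonempty ι] (h : Subalgebra.center k (Matrix ι ι D) = ⊥) :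
    Subalgebra.center k D = ⊥ := by
  refine eq_bot_iff.2 fun x hx => ?_
  have hx' := Subalgebra.mem_center_iff.1 hx
  have h1 : Matrix.diagonal (fun _ : ι => x) ∈ Subalgebra.center k (Matrix ι ι D) := by
    refine Subalgebra.mem_center_iff.2 fun M => Matrix.ext fun i j => ?_
    rw [Matrix.mul_diagonal, Matrix.diagonal_mul, hx']
  rw [h, Algebra.mem_bot] at h1
  obtain ⟨y, hy⟩ := h1
  obtain ⟨i⟩ := ‹Nonempty ι›
  have h2 := congrFun (congrFun hy i) i
  rw [Matrix.algebraMap_matrix_apply, if_pos rfl, Matrix.diagonal_apply_eq] at h2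
  exact h2 ▸ Subalgebra.algebraMap_mem _ y

theorem center_eq_bot_of_algEquiv {k A B : Type*} [Field k] [Ring A] [Algebra k A] [Ring B]
    [Algebra k B] (e : A ≃ₐ[k] B) (h : Subalgebra.center k A = ⊥) :
    Subalgebra.center k B = ⊥ := by
  refine eq_bot_iff.2 fun x hx => ?_
  have h1 : e.symm x ∈ Subalgebra.center k A := by
    refine Subalgebra.mem_center_iff.2 fun a => e.injective ?_
    rw [_root_.map_mul, _root_.map_mul, e.apply_symm_apply]
    exact Subalgebra.mem_center_iff.1 hx _
  rw [h, Algebra.mem_bot] at h1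
  obtain ⟨y, hy⟩ := h1
  rw [Algebra.mem_bot]
  exact ⟨y, by rw [← e.commutes, hy, e.apply_symm_apply]⟩

variable {k P K L ι κ : Type*} [Field k] [Infinite k] [Field P] [Field K] [Field L] [Algebra k P]
  [FiniteDimensional k P] [Algebra K L] [Algebra P L] [Fintype ι] [DecidableEq ι] [Nonempty ι]
  [Fintype κ] [DecidableEq κ] [Nonempty κ] {act : (P ≃ₐ[k] P) →* (L ≃ₐ[K] L)}

/-- Forms with cohomologous cocycles are Brauer equivalent. -/
theorem IsForm.nonempty_matrix_algEquiv
    (hact : ∀ s x, act s (algebraMap P L x) = algebraMap P L (s x))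
    (hfix : ∀ l : L, (∀ s, act s l = l) → ∃ x : K, algebraMap K L x = l)
    {A A' : Type*} [Ring A] [Algebra K A] [Ring A'] [Algebra K A']
    {ρ : A →ₐ[K] Matrix ι ι L} {ρ' : A' →ₐ[K] Matrix κ κ L}
    {U : (P ≃ₐ[k] P) → Matrix ι ι L} {U' : (P ≃ₐ[k] P) → Matrix κ κ L}
    {c c' : (P ≃ₐ[k] P) → (P ≃ₐ[k] P) → L}
    (h : IsForm act ρ U c) (h' : IsForm act ρ' U' c') (r : (P ≃ₐ[k] P) → L)
    (hr : ∀ s, r s ≠ 0) (hc : ∀ s t, c' s t * r (s * t) = r s * act s (r t) * c s t) :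
    Nonempty (Matrix κ κ A ≃ₐ[K] Matrix ι ι A') := by
  have h1 := h.rescale r hr
  rw [show (fun s t => r s * act s (r t) * (r (s * t))⁻¹ * c s t) = c' from
    funext fun s => funext fun t => by
      rw [mul_right_comm, ← hc, mul_assoc, mul_inv_cancel₀ (hr _), mul_one]] at h1
  exact (((h1.matrix κ).reindex (Equiv.prodComm κ ι)).nonempty_algEquiv hact hfix (h'.matrix ι))

end BrauerClass

section DivisionForm

variable {k : Type*} [Field k] {D : Type*} [Ring D] [Algebra k D] {n : ℕ}

theorem exists_galois_fixed {P : Type*} [Field P] [Algebra k P] [FiniteDimensional k P]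
    [IsGalois k P] (l : P) (hl : ∀ s, MonoidHom.id (P ≃ₐ[k] P) s l = l) :
    ∃ x : k, algebraMap k P x = l :=
  (IsGalois.mem_range_algebraMap_iff_fixed l).2 hl

variable [IsDomain D] [Module.Finite k D] [NeZero n]

theorem exists_diagonal_form (hcenter : Subalgebra.center k D = ⊥) (hdim : finrank k D = n ^ 2)
    {b : D} (hb : (minpoly k b).natDegree = n) (hchar : (n : k) ≠ 0)
    {P : Type*} [Field P] [Algebra k P] [FiniteDimensional k P]
    [IsGalois k P] (hs : ((minpoly k b).map (algebraMap k P)).Splits) :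
    ∃ (ρ : D →ₐ[k] Matrix (Fin n) (Fin n) P) (U : (P ≃ₐ[k] P) → Matrix (Fin n) (Fin n) P)
      (c : (P ≃ₐ[k] P) → (P ≃ₐ[k] P) → P) (θ : Fin n → P),
      IsForm (MonoidHom.id (P ≃ₐ[k] P)) ρ U c ∧ Function.Injective θ ∧
        ρ b = Matrix.diagonal θ ∧ (minpoly k b).map (algebraMap k P) = ∏ i, (X - C (θ i)) := by
  have hi : IsIntegral k b := IsIntegral.of_finite k b
  have hsep : (minpoly k b).Separable :=
    separable_of_natDegree (minpoly.irreducible hi) (by rwa [hb])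
  obtain ⟨θ, hθ, hroots⟩ := exists_roots_of_splits (n := n)
    ((minpoly.monic hi).map (algebraMap k P))
    (by rw [natDegree_map, hb]) (hsep.map (f := algebraMap k P)) hs
  obtain ⟨ρ, hρ⟩ := exists_isSplit (NeZero.pos n)
    (fun x hx => isUnit_of_isDomain_of_finite (K := k) hx) hcenter hdim b hb θ hθ hroots
  obtain ⟨ρ', hρ', hdiag⟩ := hρ.exists_diagonal exists_galois_fixed hb θ hθ hroots
  obtain ⟨U, c, h⟩ := hρ'.exists_isForm (MonoidHom.id (P ≃ₐ[k] P))
  exact ⟨ρ', U, c, θ, h, hθ, hdiag, hroots⟩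

theorem exists_natDegree_minpoly [Infinite k] (hcenter : Subalgebra.center k D = ⊥)
    (hdim : finrank k D = n ^ 2) : ∃ b : D, (minpoly k b).natDegree = n := by
  obtain ⟨ρ, hρ⟩ := exists_isSplit_algebraicClosure (NeZero.pos n)
    (fun (x : D) hx => isUnit_of_isDomain_of_finite (K := k) hx) hcenter hdim
  exact hρ.exists_natDegree_minpoly (NeZero.pos n)

end DivisionForm

section Minpoly

theorem minpoly_one_tmul {k K D : Type*} [Field k] [Field K] [Algebra k K] [Ring D]
    [Algebra k D] [Module.Finite k D] (b : D) :
    minpoly K ((1 : K) ⊗ₜ[k] b) = (minpoly k b).map (algebraMap k K) := by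
  have hi : IsIntegral k b := IsIntegral.of_finite k b
  have h0 : aeval ((1 : K) ⊗ₜ[k] b) ((minpoly k b).map (algebraMap k K)) = 0 := by
    rw [aeval_map_algebraMap, ← Algebra.TensorProduct.includeRight_apply, aeval_algHom_apply,
      minpoly.aeval, _root_.map_zero]
  have hi' : IsIntegral K ((1 : K) ⊗ₜ[k] b) := ⟨_, (minpoly.monic hi).map _, h0⟩
  refine (Polynomial.eq_of_monic_of_dvd_of_natDegree_le (minpoly.monic hi')
    ((minpoly.monic hi).map _) (minpoly.dvd _ _ h0) ?_).symm
  rw [natDegree_map]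
  by_contra! hlt
  exact aeval_one_tmul_ne_zero b _ (minpoly.ne_zero hi') hlt (minpoly.aeval _ _)

end Minpoly

section Main

variable {k K : Type} [Field k] [Infinite k] {m : ℕ} [Field K] [Algebra (MvPolynomial (Fin m) k) K]
  [IsFractionRing (MvPolynomial (Fin m) k) K] [Algebra k K]
  [IsScalarTower k (MvPolynomial (Fin m) k) K]
  {D : Type} [Ring D] [IsDomain D] [Algebra k D] [Module.Finite k D]

variable (K) in
/-- If every root of a polynomial of degree `m + 1` over the rational function field that lies in
the base change of `E` also lies in the base change of `D`, then `D` is Brauer equivalent to a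
tensor power of `E`. -/
theorem exists_matrix_algEquiv_tensorPow (hchar : ((m + 1 : ℕ) : k) ≠ 0)
    (hD : Subalgebra.center k D = ⊥) (hDdim : finrank k D = (m + 1) ^ 2)
    {E : Type} [Ring E] [IsDomain E] [Algebra k E] [Module.Finite k E]
    (hE : Subalgebra.center k E = ⊥) (hEdim : finrank k E = (m + 1) ^ 2)
    (hroot : ∀ f : K[X], Irreducible f → f.natDegree = m + 1 →
      (∃ x : K ⊗[k] E, aeval x f = 0) → ∃ x : K ⊗[k] D, aeval x f = 0) :
    ∃ s : ℕ, 1 ≤ s ∧ Nonempty (Matrix (Fin s → Fin (m + 1)) (Fin s → Fin (m + 1)) D ≃ₐ[k]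
      Matrix (Fin (m + 1)) (Fin (m + 1)) (⨂[k] (_ : Fin s), E)) := by
  obtain ⟨b, hb⟩ := exists_natDegree_minpoly hD hDdim
  obtain ⟨e, he⟩ := exists_natDegree_minpoly hE hEdim
  have hib := minpoly.irreducible (IsIntegral.of_finite k b)
  have hie := minpoly.irreducible (IsIntegral.of_finite k e)
  obtain ⟨P, _, _, _, _, hbs, hes⟩ := exists_isGalois_splits hib hie
    (separable_of_natDegree hib (by rwa [hb])) (separable_of_natDegree hie (by rwa [he]))
  obtain ⟨L, _, _, _, _, _, _, _, _, _, act, hKL, hact, hfix⟩ := exists_constant_extension k P K m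
  obtain ⟨ρ, U, c, -, h, -⟩ := exists_diagonal_form hD hDdim hb hchar hbs
  obtain ⟨ρ', U', c', θ, h', hθ, hdiag, -⟩ := exists_diagonal_form hE hEdim he hchar hes
  have hactP : ∀ s x, act s (algebraMap P L x) = algebraMap P L (s x) := fun s x => by
    rw [IsScalarTower.algebraMap_apply P (MvPolynomial (Fin m) P) L, hact,
      IsScalarTower.algebraMap_apply P (MvPolynomial (Fin m) P) L]
    exact congrArg _ (MvPolynomial.map_C _ x)
  have : IsDomain (K ⊗[k] D) := isDomain_tensorProduct (Fin m)
  obtain ⟨s, hs, r, hr, hc⟩ := exists_cohomologous_pow (A := K ⊗[k] D) hchar hKL hact hfix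
    (fun x hx => isUnit_of_isDomain_of_finite (K := k) hx) h' hθ hdiag
    (h.baseChange (K := K) (L := L) (act := act) hactP) hroot
  have hn : Nonempty (Fin s → Fin (m + 1)) := ⟨fun _ => 0⟩
  obtain ⟨e⟩ := IsForm.nonempty_matrix_algEquiv (fun _ _ => rfl) exists_galois_fixed
    (h'.tensorPow s) h r hr hc
  exact ⟨s, hs, ⟨e.symm⟩⟩

/-- A division algebra over the rational function field with the same roots of polynomials of
degree `m + 1` as the base change of `D` is Brauer equivalent to a tensor power of `D`. -/
theorem exists_matrix_algEquiv_baseChange_tensorPow (hchar : ((m + 1 : ℕ) : k) ≠ 0)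
    (hD : Subalgebra.center k D = ⊥) (hDdim : finrank k D = (m + 1) ^ 2)
    {A : Type} [Ring A] [IsDomain A] [Algebra K A] [Module.Finite K A]
    (hA : Subalgebra.center K A = ⊥) (hAdim : finrank K A = (m + 1) ^ 2)
    (hroot : ∀ f : K[X], Irreducible f → f.natDegree = m + 1 →
      ((∃ x : K ⊗[k] D, aeval x f = 0) ↔ ∃ x : A, aeval x f = 0)) :
    ∃ r : ℕ, 1 ≤ r ∧ IsSimpleRing (⨂[k] (_ : Fin r), D) ∧
      Module.Finite k (⨂[k] (_ : Fin r), D) ∧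
      Subalgebra.center k (⨂[k] (_ : Fin r), D) = ⊥ ∧
      Nonempty (Matrix (Fin r → Fin (m + 1)) (Fin r → Fin (m + 1)) A ≃ₐ[K]
        Matrix (Fin (m + 1)) (Fin (m + 1)) (K ⊗[k] (⨂[k] (_ : Fin r), D))) := by
  obtain ⟨b, hb⟩ := exists_natDegree_minpoly hD hDdim
  have hi : IsIntegral k b := IsIntegral.of_finite k b
  have hib := minpoly.irreducible hi
  have hsep := separable_of_natDegree hib (by rwa [hb])
  obtain ⟨P, _, _, _, _, hbs, -⟩ := exists_isGalois_splits hib hib hsep hsep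
  obtain ⟨L, _, _, _, _, _, _, _, _, _, act, hKL, hact, hfix⟩ := exists_constant_extension k P K m
  obtain ⟨ρ, U, c, θ, h, hθ, hdiag, hroots⟩ := exists_diagonal_form hD hDdim hb hchar hbs
  have hactP : ∀ s x, act s (algebraMap P L x) = algebraMap P L (s x) := fun s x => by
    rw [IsScalarTower.algebraMap_apply P (MvPolynomial (Fin m) P) L, hact,
      IsScalarTower.algebraMap_apply P (MvPolynomial (Fin m) P) L]
    exact congrArg _ (MvPolynomial.map_C _ x)
  have : IsDomain (K ⊗[k] D) := isDomain_tensorProduct (Fin m)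
  have hirr : Irreducible (minpoly K ((1 : K) ⊗ₜ[k] b)) :=
    minpoly.irreducible (IsIntegral.of_finite K _)
  have hdeg : (minpoly K ((1 : K) ⊗ₜ[k] b)).natDegree = m + 1 := by
    rw [minpoly_one_tmul, natDegree_map, hb]
  obtain ⟨x, hx⟩ := (hroot _ hirr hdeg).1 ⟨_, minpoly.aeval K _⟩
  have hmin : (minpoly k b).map (algebraMap k K) = minpoly K x := by
    rw [← minpoly_one_tmul]
    exact minpoly.eq_of_irreducible_of_monic hirr hx (minpoly.monic (IsIntegral.of_finite K _))
  obtain ⟨ρ', hρ'⟩ := exists_isSplit (L := L) m.succ_pos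
    (fun (x : A) hx => isUnit_of_isDomain_of_finite (K := K) hx) hA hAdim x
    (by rw [← hmin, natDegree_map, hb]) (fun i => algebraMap P L (θ i))
    ((algebraMap P L).injective.comp hθ) (by
      rw [← hmin, Polynomial.map_map, ← IsScalarTower.algebraMap_eq,
        IsScalarTower.algebraMap_eq k P L, ← Polynomial.map_map, hroots, Polynomial.map_prod]
      exact Finset.prod_congr rfl fun i _ => by rw [Polynomial.map_sub, map_X, map_C])
  obtain ⟨U₁, c₁, h₁⟩ := hρ'.exists_isForm act
  have hunit : ∀ x : D, x ≠ 0 → IsUnit x := fun x hx => isUnit_of_isDomain_of_finite (K := k) hx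
  obtain ⟨U', c', h'⟩ := exists_constant_cocycle hunit hD hact hfix h h₁ hroot
  obtain ⟨r, hr, κ, hκ, hc⟩ := exists_cohomologous_pow hchar hKL hact hfix hunit h hθ hdiag h'
    fun f hf hn => (hroot f hf hn).1
  have hn : Nonempty (Fin r → Fin (m + 1)) := ⟨fun _ => 0⟩
  have hT := h.tensorPow r
  have hTK := hT.baseChange (K := K) (L := L) (act := act) hactP
  refine ⟨r, hr, hT.split.isSimpleRing, hT.split.finite, hT.center_eq_bot exists_galois_fixed,
    (IsForm.nonempty_matrix_algEquiv hactP hfix hTK h' (fun s => algebraMap P L (κ s))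
      (fun s => ?_) fun s t => ?_).map AlgEquiv.symm⟩
  · rw [_root_.map_ne_zero]
    exact hκ s
  · rw [hactP, ← _root_.map_mul, ← _root_.map_mul, ← _root_.map_mul, hc]

end Main

theorem exists_aeval_eq_zero_iff {K : Type} [Field K] {n : ℕ} {A B : Type} [Ring A] [Algebra K A]
    [Ring B] [Algebra K B] (h : HaveSameMaximalSubfields K n A B) {f : K[X]} (hf : Irreducible f)
    (hn : f.natDegree = n) : (∃ x : A, aeval x f = 0) ↔ ∃ x : B, aeval x f = 0 := by
  have : Fact (Irreducible f) := ⟨hf⟩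
  rw [← nonempty_adjoinRoot_algHom_iff, ← nonempty_adjoinRoot_algHom_iff]
  exact h (AdjoinRoot f) (by rw [(AdjoinRoot.powerBasis hf.ne_zero).finrank,
    AdjoinRoot.powerBasis_dim, hn])

theorem _root_.BrauerEquivalent.of_matrix {k A B : Type} [Field k] [Ring A] [Algebra k A] [Ring B]
    [Algebra k B] {ι κ : Type*} [Fintype ι] [DecidableEq ι] [Nonempty ι] [Fintype κ]
    [DecidableEq κ] [Nonempty κ] (e : Matrix ι ι A ≃ₐ[k] Matrix κ κ B) :
    BrauerEquivalent k A B :=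
  ⟨Fintype.card ι, Fintype.card κ, Fintype.card_pos, Fintype.card_pos,
    ⟨((Matrix.reindexAlgEquiv k A (Fintype.equivFin ι)).symm.trans e).trans
      (Matrix.reindexAlgEquiv k B (Fintype.equivFin κ))⟩⟩

theorem _root_.BrauerEquivalent.of_algEquiv {k A B : Type} [Field k] [Ring A] [Algebra k A] [Ring B]
    [Algebra k B] (e : A ≃ₐ[k] B) : BrauerEquivalent k A B :=
  .of_matrix (e.mapMatrix (m := Unit))

section Degree

theorem nonempty_algEquiv_of_finrank_eq_one {k A : Type*} [Field k] [Ring A] [Algebra k A]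
    (h : finrank k A = 1) : Nonempty (k ≃ₐ[k] A) := by
  have : Nontrivial A := Module.nontrivial_of_finrank_pos (R := k) (by omega)
  refine ⟨AlgEquiv.ofBijective (Algebra.ofId k A)
    ⟨(algebraMap k A).injective, fun x => ?_⟩⟩
  obtain ⟨y, hy⟩ := (finrank_eq_one_iff_of_nonzero' (1 : A) one_ne_zero).1 h x
  exact ⟨y, by rw [← hy, Algebra.ofId_apply, Algebra.algebraMap_eq_smul_one]⟩

theorem eq_one_of_finite {k : Type} [Field k] [Finite k] {n : ℕ} {D : Type} [DivisionRing D]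
    [Algebra k D] (hn : 0 < n) (hD : IsCentralDivisionAlgebraOfDegree k n D) : n = 1 := by
  have : Module.Finite k D := Module.finite_of_finrank_pos (by rw [hD.2]; positivity)
  have : Finite D := Module.finite_of_finite k
  have h1 : (⊥ : Subalgebra k D) = ⊤ := by
    rw [← hD.1]
    refine eq_top_iff.2 fun x _ => Subalgebra.mem_center_iff.2 fun y => ?_
    let _ : Field D := littleWedderburn D
    exact mul_comm y x
  have h2 := Subalgebra.bot_eq_top_iff_finrank_eq_one.1 h1
  rw [hD.2] at h2
  exact (pow_eq_one_iff.1 h2).resolve_right two_ne_zero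

/-- The degree one case. -/
theorem exists_of_degree_one {k K : Type} [Field k] [Field K] [Algebra k K] {D Δ : Type}
    [DivisionRing D] [Algebra k D] [DivisionRing Δ] [Algebra K Δ]
    (hD : IsCentralDivisionAlgebraOfDegree k 1 D) (hΔ : IsCentralDivisionAlgebraOfDegree K 1 Δ) :
    ∃ (D' : Type) (_ : DivisionRing D') (_ : Algebra k D'),
      IsCentralDivisionAlgebraOfDegree k 1 D' ∧ Nonempty (Δ ≃ₐ[K] (K ⊗[k] D')) ∧
      ∃ r s : ℕ, 1 ≤ r ∧ 1 ≤ s ∧ BrauerEquivalent k D' (tensorPow k D r) ∧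
        BrauerEquivalent k D (tensorPow k D' s) := by
  obtain ⟨e⟩ := nonempty_algEquiv_of_finrank_eq_one hD.2
  obtain ⟨e₁⟩ := nonempty_algEquiv_of_finrank_eq_one (k := k) (A := tensorPow k D 1)
    ((PiTensorProduct.subsingletonEquiv (0 : Fin 1)).finrank_eq.trans hD.2)
  obtain ⟨e₂⟩ := nonempty_algEquiv_of_finrank_eq_one hΔ.2
  obtain ⟨e₃⟩ := nonempty_algEquiv_of_finrank_eq_one (k := K) (A := K ⊗[k] D)
    (Module.finrank_baseChange.trans hD.2)
  exact ⟨D, inferInstance, inferInstance, hD, ⟨e₂.symm.trans e₃⟩, 1, 1, le_rfl, le_rfl,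
    .of_algEquiv (e.symm.trans e₁), .of_algEquiv (e.symm.trans e₁)⟩

/-- The case of an infinite base field. -/
theorem exists_of_infinite {k K : Type} [Field k] [Infinite k] {n m : ℕ} (hnm : n = m + 1)
    (hchar : (n : k) ≠ 0) [Field K] [Algebra (MvPolynomial (Fin m) k) K]
    [IsFractionRing (MvPolynomial (Fin m) k) K] [Algebra k K]
    [IsScalarTower k (MvPolynomial (Fin m) k) K] {D Δ : Type} [DivisionRing D] [Algebra k D]
    [DivisionRing Δ] [Algebra K Δ] (hD : IsCentralDivisionAlgebraOfDegree k n D)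
    (hΔ : IsCentralDivisionAlgebraOfDegree K n Δ)
    (hsame : HaveSameMaximalSubfields K n Δ (K ⊗[k] D)) :
    ∃ (D' : Type) (_ : DivisionRing D') (_ : Algebra k D'),
      IsCentralDivisionAlgebraOfDegree k n D' ∧ Nonempty (Δ ≃ₐ[K] (K ⊗[k] D')) ∧
      ∃ r s : ℕ, 1 ≤ r ∧ 1 ≤ s ∧ BrauerEquivalent k D' (tensorPow k D r) ∧
        BrauerEquivalent k D (tensorPow k D' s) := by
  subst hnm
  obtain ⟨hDc, hDdim⟩ := hD
  obtain ⟨hΔc, hΔdim⟩ := hΔ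
  have : Module.Finite k D := Module.finite_of_finrank_pos (by rw [hDdim]; positivity)
  have : Module.Finite K Δ := Module.finite_of_finrank_pos (by rw [hΔdim]; positivity)
  obtain ⟨r, hr, hsimple, hfin, hc, ⟨Ψ⟩⟩ := exists_matrix_algEquiv_baseChange_tensorPow hchar
    hDc hDdim hΔc hΔdim fun f hf hn => (exists_aeval_eq_zero_iff hsame hf hn).symm
  have : IsArtinianRing (⨂[k] (_ : Fin r), D) := IsArtinianRing.of_finite k _
  obtain ⟨l, hl, D', _, _, hfin', ⟨Φ⟩⟩ :=
    IsSimpleRing.exists_algEquiv_matrix_divisionRing_finite k (⨂[k] (_ : Fin r), D)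
  have hl' : Nonempty (Fin l) := ⟨⟨0, Nat.pos_of_ne_zero hl.out⟩⟩
  have : Nonempty (Fin r → Fin (m + 1)) := ⟨fun _ => 0⟩
  have : IsDomain (K ⊗[k] D') := isDomain_tensorProduct (Fin m)
  obtain ⟨Ω⟩ := nonempty_tensorProduct_matrix_algEquiv (k := k) (K := K) (D := D') (ι := Fin l)
  obtain ⟨e⟩ := nonempty_algEquiv_of_matrix_algEquiv (K := K)
    (fun x hx => isUnit_of_isDomain_of_finite (K := K) hx)
    (fun x hx => isUnit_of_isDomain_of_finite (K := K) hx)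
    (Ψ.trans ((((Algebra.TensorProduct.congr AlgEquiv.refl Φ).trans Ω).mapMatrix
      (m := Fin (m + 1))).trans (Matrix.compAlgEquiv (Fin (m + 1)) (Unit × Fin l) (K ⊗[k] D') K)))
  have hD'c : Subalgebra.center k D' = ⊥ :=
    center_eq_bot_of_matrix (center_eq_bot_of_algEquiv Φ hc)
  have hD'dim : finrank k D' = (m + 1) ^ 2 := by
    rw [← hΔdim, e.toLinearEquiv.finrank_eq, Module.finrank_baseChange]
  obtain ⟨s, hs, ⟨Θ⟩⟩ := exists_matrix_algEquiv_tensorPow K hchar hDc hDdim hD'c hD'dim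
    fun f hf hn ⟨x, hx⟩ => (exists_aeval_eq_zero_iff hsame hf hn).1
      ⟨e.symm x, by
        rw [← AlgEquiv.coe_toAlgHom, aeval_algHom_apply, hx, _root_.map_zero]⟩
  have : Nonempty (Fin s → Fin (m + 1)) := ⟨fun _ => 0⟩
  exact ⟨D', inferInstance, inferInstance, ⟨hD'c, hD'dim⟩, ⟨e⟩, r, s, hr, hs,
    .of_matrix (Φ.symm.trans (Matrix.uniqueAlgEquiv (m := Unit)).symm), .of_matrix Θ⟩

end Degree

end GenusTranscendental

/-- Killing the genus by a purely transcendental extension: if `D` is a central division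
algebra of degree `n` (prime to `char k`) over `k` and `Δ` is a central division algebra of
degree `n` over `K = k(x₁, …, x_{n-1})` with the same maximal subfields as `D ⊗_k K`, then
`Δ ≃ D' ⊗_k K` where `D'` is a central division algebra of degree `n` over `k` whose Brauer
class generates the same subgroup of `Br(k)` as the class of `D`: there are `r, s ≥ 1` with
`D'` Brauer-equivalent to `D^{⊗ r}` and `D` Brauer-equivalent to `D'^{⊗ s}`. -/
theorem genus_killed_by_purely_transcendental_extension
    (k : Type) [Field k] (n : ℕ) (hn : 0 < n) (hchar : ¬ (ringChar k ∣ n))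
    (D : Type) [DivisionRing D] [Algebra k D]
    (hD : IsCentralDivisionAlgebraOfDegree k n D)
    (Δ : Type) [DivisionRing Δ]
    [Algebra (FractionRing (MvPolynomial (Fin (n - 1)) k)) Δ]
    (hΔ : IsCentralDivisionAlgebraOfDegree (FractionRing (MvPolynomial (Fin (n - 1)) k)) n Δ)
    (hsame : HaveSameMaximalSubfields (FractionRing (MvPolynomial (Fin (n - 1)) k)) n Δ
      (FractionRing (MvPolynomial (Fin (n - 1)) k) ⊗[k] D)) :
    ∃ (D' : Type) (_ : DivisionRing D') (_ : Algebra k D'),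
      IsCentralDivisionAlgebraOfDegree k n D' ∧
      Nonempty (Δ ≃ₐ[FractionRing (MvPolynomial (Fin (n - 1)) k)]
        (FractionRing (MvPolynomial (Fin (n - 1)) k) ⊗[k] D')) ∧
      ∃ r s : ℕ, 1 ≤ r ∧ 1 ≤ s ∧
        BrauerEquivalent k D' (tensorPow k D r) ∧
        BrauerEquivalent k D (tensorPow k D' s) := by
  rcases finite_or_infinite k with _ | _
  · obtain rfl := GenusTranscendental.eq_one_of_finite hn hD
    exact GenusTranscendental.exists_of_degree_one hD hΔ
  · exact GenusTranscendental.exists_of_infinite (m := n - 1) (by omega)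
      (fun h => hchar ((ringChar.spec k n).1 h)) hD hΔ hsame
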